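/- Let (X,x₀) be a well-pointed path-connected space and let S¹ be the unit circle in ℝ². Then there is a weak homotopy equivalence from the labelled configuration space C⁰(S¹;X) to the free loop space Map(S¹, ΣX) (the space of all continuous maps from S¹ to the reduced suspension ΣX, with the compact-open topology). -/

import Mathlib

open scoped unitInterval Topology
open Metric Set

noncomputable section

universe uWP

/-! ### Ordered configuration spaces -/

/-- The ordered configuration space `C⁰_k(M)`: `k`-tuples of pairwise distinct points of `M`,
topologized as a subspace of `M^k`. -/
def OrdConfig (M : Type*) [TopologicalSpace M] (k : ℕ) : Type _ :=
  {p : Fin k → M // Function.Injective p}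

instance (M : Type*) [TopologicalSpace M] (k : ℕ) : TopologicalSpace (OrdConfig M k) :=
  inferInstanceAs (TopologicalSpace {p : Fin k → M // Function.Injective p})

/-- The action of the symmetric group `Σ_k` on the ordered configuration space,
permuting the coordinates. -/
def OrdConfig.perm {M : Type*} [TopologicalSpace M] {k : ℕ} (e : Equiv.Perm (Fin k))
    (p : OrdConfig M k) : OrdConfig M k :=
  ⟨p.1 ∘ e, p.2.comp e.injective⟩

/-! ### Labelled configuration spaces -/

/-- The "pre-configuration space": disjoint union over `k` of `C⁰_k(M) × X^k`. -/
def LabelPre (M X : Type*) [TopologicalSpace M] [TopologicalSpace X] : Type _ :=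
  Σ k : ℕ, OrdConfig M k × (Fin k → X)

instance (M X : Type*) [TopologicalSpace M] [TopologicalSpace X] :
    TopologicalSpace (LabelPre M X) :=
  inferInstanceAs (TopologicalSpace (Σ k : ℕ, OrdConfig M k × (Fin k → X)))

/-- The relation generating the equivalence defining `C⁰(M;X)`: permuting points together
with their labels, and deleting points labelled by the base point `x₀`. -/
inductive LabelRel (M X : Type*) [TopologicalSpace M] [TopologicalSpace X] (x₀ : X) :
    LabelPre M X → LabelPre M X → Prop
  | perm {k : ℕ} (c : OrdConfig M k) (l : Fin k → X) (e : Equiv.Perm (Fin k)) :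
      LabelRel M X x₀ ⟨k, c, l⟩ ⟨k, OrdConfig.perm e c, l ∘ e⟩
  | delete {k : ℕ} (c : OrdConfig M (k + 1)) (l : Fin (k + 1) → X) (i : Fin (k + 1))
      (h : l i = x₀) :
      LabelRel M X x₀ ⟨k + 1, c, l⟩
        ⟨k, ⟨c.1 ∘ i.succAbove, c.2.comp Fin.succAbove_right_injective⟩, l ∘ i.succAbove⟩

/-- The labelled configuration space `C⁰(M;X)`, with the quotient topology. -/
def LabeledConfig (M X : Type*) [TopologicalSpace M] [TopologicalSpace X] (x₀ : X) :=
  Quot (LabelRel M X x₀)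

instance (M X : Type*) [TopologicalSpace M] [TopologicalSpace X] (x₀ : X) :
    TopologicalSpace (LabeledConfig M X x₀) :=
  inferInstanceAs (TopologicalSpace (Quot (LabelRel M X x₀)))

/-- The empty configuration. -/
def LabelPre.empty (M X : Type*) [TopologicalSpace M] [TopologicalSpace X] : LabelPre M X :=
  ⟨0, ⟨Fin.elim0, fun i => i.elim0⟩, Fin.elim0⟩

/-- The class of the empty configuration; the base point of `C⁰(M;X)`. -/
def LabeledConfig.empty (M X : Type*) [TopologicalSpace M] [TopologicalSpace X] (x₀ : X) :
    LabeledConfig M X x₀ :=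
  Quot.mk _ (LabelPre.empty M X)

/-- The label of a pre-configuration `a` at a point `m` of `M`: the label of the point of the
configuration located at `m`, if there is one, and the base point `x₀` otherwise. -/
noncomputable def labelAt {M X : Type*} [TopologicalSpace M] [TopologicalSpace X] (x₀ : X)
    (a : LabelPre M X) (m : M) : X :=
  haveI := Classical.propDecidable (∃ i, a.2.1.1 i = m)
  if h : ∃ i, a.2.1.1 i = m then a.2.2 h.choose else x₀

/-- Two labelled configurations agree off `N` if they have representatives whose labelled points
outside of `N` coincide. -/
def AgreeOff {M X : Type*} [TopologicalSpace M] [TopologicalSpace X] (x₀ : X) (N : Set M)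
    (a b : LabeledConfig M X x₀) : Prop :=
  ∃ a' b' : LabelPre M X, a = Quot.mk _ a' ∧ b = Quot.mk _ b' ∧
    ∀ m ∉ N, labelAt x₀ a' m = labelAt x₀ b' m

/-- The relative labelled configuration space `C⁰(M,N;X)`: the quotient of `C⁰(M;X)`
identifying two labelled configurations whenever they agree on `M ∖ N`. -/
def RelConfig (M : Type*) [TopologicalSpace M] (N : Set M) (X : Type*) [TopologicalSpace X]
    (x₀ : X) : Type _ :=
  Quot (AgreeOff (M := M) (X := X) x₀ N)

instance (M : Type*) [TopologicalSpace M] (N : Set M) (X : Type*) [TopologicalSpace X] (x₀ : X) :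
    TopologicalSpace (RelConfig M N X x₀) :=
  inferInstanceAs (TopologicalSpace (Quot _))

/-- The base point of `C⁰(M,N;X)`: the class of the empty configuration. -/
def RelConfig.base (M : Type*) [TopologicalSpace M] (N : Set M) (X : Type*) [TopologicalSpace X]
    (x₀ : X) : RelConfig M N X x₀ :=
  Quot.mk _ (LabeledConfig.empty M X x₀)

/-! ### Well-pointedness -/

/-- `(X, x₀)` is well-pointed if the inclusion `{x₀} ↪ X` is a cofibration, i.e. satisfies the
homotopy extension property. -/
def IsWellPointed (X : Type uWP) [TopologicalSpace X] (x₀ : X) : Prop :=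
  ∀ (Y : Type uWP) (_ : TopologicalSpace Y) (f : C(X, Y)) (p : C(I, Y)),
    p 0 = f x₀ → ∃ G : C(I × X, Y), (∀ x, G (0, x) = f x) ∧ ∀ t, G (t, x₀) = p t

/-! ### Cubes, suspensions and loop spaces -/

/-- The `n`-cube `I^n`. -/
def NCube (n : ℕ) : Type :=
  Fin n → I

instance (n : ℕ) : TopologicalSpace (NCube n) :=
  inferInstanceAs (TopologicalSpace (Fin n → I))

/-- The boundary `∂I^n` of the `n`-cube. -/
def NCube.boundary (n : ℕ) : Set (NCube n) :=
  {t | ∃ i, t i = 0 ∨ t i = 1}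

/-- The subset of `I^n × X` collapsed in the definition of the reduced suspension:
`(∂I^n × X) ∪ (I^n × {x₀})`. -/
def SuspCollapse (n : ℕ) (X : Type*) [TopologicalSpace X] (x₀ : X) : Set (NCube n × X) :=
  (NCube.boundary n ×ˢ (univ : Set X)) ∪ ((univ : Set (NCube n)) ×ˢ ({x₀} : Set X))

/-- The `n`-fold reduced suspension `Σⁿ X = (I^n × X)/((∂I^n × X) ∪ (I^n × {x₀}))`. -/
def Susp (n : ℕ) (X : Type*) [TopologicalSpace X] (x₀ : X) :=
  Quot (fun a b : NCube n × X => a ∈ SuspCollapse n X x₀ ∧ b ∈ SuspCollapse n X x₀)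

instance (n : ℕ) (X : Type*) [TopologicalSpace X] (x₀ : X) : TopologicalSpace (Susp n X x₀) :=
  inferInstanceAs (TopologicalSpace (Quot _))

/-- The base point of the reduced suspension: the class of the collapsed subset. -/
def Susp.base (n : ℕ) (X : Type*) [TopologicalSpace X] (x₀ : X) : Susp n X x₀ :=
  Quot.mk _ (fun _ => 0, x₀)

/-- The `n`-fold based loop space `Ωⁿ(Y,y₀)`, modelled as the space of continuous maps
`I^n → Y` sending `∂I^n` to the base point, with the compact-open topology. -/
def NLoop (n : ℕ) (Y : Type*) [TopologicalSpace Y] (y₀ : Y) :=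
  {f : C(NCube n, Y) // ∀ t ∈ NCube.boundary n, f t = y₀}

instance (n : ℕ) (Y : Type*) [TopologicalSpace Y] (y₀ : Y) : TopologicalSpace (NLoop n Y y₀) :=
  inferInstanceAs (TopologicalSpace {f : C(NCube n, Y) // ∀ t ∈ NCube.boundary n, f t = y₀})

/-! ### Weak homotopy equivalences -/

/-- The map induced on path components by a continuous map. -/
def ZerothHomotopy.inducedMap {X Y : Type*} [TopologicalSpace X] [TopologicalSpace Y]
    (f : C(X, Y)) : ZerothHomotopy X → ZerothHomotopy Y :=
  @Quotient.map _ _ (pathSetoid X) (pathSetoid Y) f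
    (fun _ _ h => Nonempty.map (fun p => p.map f.continuous) h)

/-- The map induced by a continuous map on generalized loops. -/
def GenLoop.inducedMap {N X Y : Type*} [TopologicalSpace X] [TopologicalSpace Y] {x : X}
    (f : C(X, Y)) (p : GenLoop N X x) : GenLoop N Y (f x) :=
  ⟨f.comp p.1, fun y hy => by
    simp only [ContinuousMap.comp_apply]
    rw [p.2 y hy]⟩

/-- The map induced by a continuous map on homotopy groups. -/
def HomotopyGroup.inducedMap (N : Type*) {X Y : Type*} [TopologicalSpace X] [TopologicalSpace Y]
    (x : X) (f : C(X, Y)) : HomotopyGroup N X x → HomotopyGroup N Y (f x) :=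
  Quotient.map (GenLoop.inducedMap f)
    (fun _ _ h => Nonempty.map (fun H => H.compContinuousMap f) h)

/-- A continuous map is a weak homotopy equivalence if it induces a bijection on path
components and isomorphisms on all homotopy groups at every base point. -/
def IsWeakHomotopyEquiv {X Y : Type*} [TopologicalSpace X] [TopologicalSpace Y]
    (f : C(X, Y)) : Prop :=
  Function.Bijective (ZerothHomotopy.inducedMap f) ∧
    ∀ (n : ℕ) (x : X), Function.Bijective (HomotopyGroup.inducedMap (Fin n) x f)


set_option linter.unusedSectionVars false
set_option linter.unusedSimpArgs false

namespace LoopModel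

/-- The cylinder bottom together with the cylinder over `A`. -/
def Cyl {K : Type*} (A : Set K) : Set (I × K) := {z | z.1 = 0 ∨ z.2 ∈ A}

/-- A pair for which the cylinder deformation retracts onto `Cyl A` in a parametrized way. -/
def GoodPair (K : Type*) [TopologicalSpace K] (A : Set K) : Prop :=
  ∃ (D : I × (I × K) → I × K) (ψ : I × K → I), Continuous D ∧ Continuous ψ ∧
    (∀ z, D (0, z) ∈ Cyl A) ∧ (∀ z, D (ψ z, z) = z) ∧ ∀ z ∈ Cyl A, ψ z = 0

/-- The homotopy lifting property for all small spaces. -/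
def Fib {E B : Type*} [TopologicalSpace E] [TopologicalSpace B] (q : E → B) : Prop :=
  ∀ (Z : Type) [TopologicalSpace Z] (h : I × Z → B) (d : Z → E), Continuous h → Continuous d →
    (∀ z, q (d z) = h (0, z)) →
    ∃ H : I × Z → E, Continuous H ∧ (∀ z, H (0, z) = d z) ∧ ∀ y, q (H y) = h y

theorem GoodPair.relLift {K : Type} [TopologicalSpace K] {A : Set K} (hK : GoodPair K A)
    {E B : Type*} [TopologicalSpace E] [TopologicalSpace B] {q : E → B} (hq : Fib q)
    {h : I × K → B} {d : I × K → E} (hh : Continuous h) (hd : ContinuousOn d (Cyl A))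
    (hqd : ∀ z ∈ Cyl A, q (d z) = h z) :
    ∃ H : I × K → E, Continuous H ∧ (∀ z ∈ Cyl A, H z = d z) ∧ ∀ z, q (H z) = h z := by
  obtain ⟨D, ψ, hD, hψ, h0, h1, h2⟩ := hK
  have hR : Continuous fun z => D (0, z) := by fun_prop
  obtain ⟨H, hH, hH0, hHq⟩ := hq (I × K) (fun y => h (D y)) (fun z => d (D (0, z)))
    (hh.comp hD) (hd.comp_continuous hR h0) (fun z => hqd _ (h0 z))
  refine ⟨fun z => H (ψ z, z), by fun_prop, fun z hz => ?_, fun z => ?_⟩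
  · show H (ψ z, z) = d z
    rw [h2 z hz, hH0]; congr 1; rw [← h2 z hz, h1]
  · rw [hHq, h1]

theorem GoodPair.extend {K : Type*} [TopologicalSpace K] {A : Set K} (hK : GoodPair K A)
    {B : Type*} [TopologicalSpace B] {d : I × K → B} (hd : ContinuousOn d (Cyl A)) :
    ∃ H : I × K → B, Continuous H ∧ ∀ z ∈ Cyl A, H z = d z := by
  obtain ⟨D, ψ, hD, hψ, h0, h1, h2⟩ := hK
  have hR : Continuous fun z => D (0, z) := by fun_prop
  refine ⟨fun z => d (D (0, z)), hd.comp_continuous hR h0, fun z hz => ?_⟩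
  show d _ = d z
  congr 1; rw [← h2 z hz, h1]

theorem GoodPair.homeo {K L : Type*} [TopologicalSpace K] [TopologicalSpace L] {A : Set K}
    (hK : GoodPair K A) (e : L ≃ₜ K) : GoodPair L (e ⁻¹' A) := by
  obtain ⟨D, ψ, hD, hψ, h0, h1, h2⟩ := hK
  refine ⟨fun y => ((D (y.1, (y.2.1, e y.2.2))).1, e.symm (D (y.1, (y.2.1, e y.2.2))).2),
    fun z => ψ (z.1, e z.2), by fun_prop, by fun_prop, fun z => ?_, fun z => ?_, fun z hz => ?_⟩
  · simpa [Cyl] using h0 (z.1, e z.2)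
  · simp [h1]
  · exact h2 _ (by simpa [Cyl] using hz)

/-- The standard cube. -/
abbrev Cb (n : ℕ) : Type := Fin n → I

/-- The boundary of the standard cube. -/
def bd (n : ℕ) : Set (Cb n) := {y | ∃ i, y i = 0 ∨ y i = 1}

theorem isClosed_bd (n : ℕ) : IsClosed (bd n) := by
  have : bd n = ⋃ i, ((fun y : Cb n => y i) ⁻¹' {0} ∪ (fun y : Cb n => y i) ⁻¹' {1}) := by
    ext y; simp [bd]
  rw [this]
  exact isClosed_iUnion_of_finite fun i =>
    (isClosed_singleton.preimage (continuous_apply i)).union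
      (isClosed_singleton.preimage (continuous_apply i))

/-- Centered coordinates on the cube. -/
def ctr {n : ℕ} (y : Cb n) : Fin n → ℝ := fun i => 2 * (y i : ℝ) - 1

theorem continuous_ctr (n : ℕ) : Continuous (ctr : Cb n → _) := by unfold ctr; fun_prop

theorem norm_ctr_le {n : ℕ} (y : Cb n) : ‖ctr y‖ ≤ 1 := by
  rw [pi_norm_le_iff_of_nonneg zero_le_one]
  intro i
  rw [Real.norm_eq_abs, abs_le]
  have := (y i).2.1; have := (y i).2.2
  constructor <;> simp only [ctr] <;> linarith

theorem mem_bd_of_norm {n : ℕ} {y : Cb n} (h : ‖ctr y‖ = 1) : y ∈ bd n := by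
  have hne : Nonempty (Fin n) := by
    by_contra hn
    rw [not_nonempty_iff] at hn
    rw [Subsingleton.elim (ctr y) 0, norm_zero] at h
    norm_num at h
  obtain ⟨i, hi⟩ := Finite.exists_max (fun i => ‖ctr y i‖)
  have h1 : ‖ctr y‖ ≤ ‖ctr y i‖ := (pi_norm_le_iff_of_nonneg (norm_nonneg _)).2 hi
  have h2 : ‖ctr y i‖ = 1 := le_antisymm (h ▸ norm_le_pi_norm _ i) (h ▸ h1)
  refine ⟨i, ?_⟩
  rw [Real.norm_eq_abs, abs_eq zero_le_one] at h2
  simp only [ctr] at h2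
  rcases h2 with h2 | h2
  · right; apply Subtype.ext; show (y i : ℝ) = 1; linarith
  · left; apply Subtype.ext; show (y i : ℝ) = 0; linarith

theorem norm_of_mem_bd {n : ℕ} {y : Cb n} (h : y ∈ bd n) : ‖ctr y‖ = 1 := by
  refine le_antisymm (norm_ctr_le y) ?_
  obtain ⟨i, hi⟩ := h
  refine le_trans ?_ (norm_le_pi_norm (ctr y) i)
  rcases hi with hi | hi <;> simp [ctr, hi]
  norm_num

theorem goodPair_bd (n : ℕ) : GoodPair (Cb n) (bd n) := by
  let M : I × Cb n → ℝ := fun z => max ‖ctr z.2‖ (1 - (z.1 : ℝ) / 2)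
  have hM : Continuous M := by
    have := continuous_ctr n
    fun_prop
  have hMpos : ∀ z, 0 < M z := fun z => lt_max_of_lt_right (by have := z.1.2.2; linarith)
  have hM1 : ∀ z, M z ≤ 1 := fun z => max_le (norm_ctr_le _) (by have := z.1.2.1; linarith)
  have hMs : ∀ z, 2 - (z.1 : ℝ) ≤ 2 * M z := fun z => by
    have : 1 - (z.1 : ℝ) / 2 ≤ M z := le_max_right _ _
    linarith
  let R1 : I × Cb n → ℝ := fun z => 2 - (2 - (z.1 : ℝ)) / M z
  let R2 : I × Cb n → Fin n → ℝ := fun z i => ((ctr z.2 i) / M z + 1) / 2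
  have hR1 : Continuous R1 := by
    have h0 := fun z => (hMpos z).ne'
    fun_prop (disch := assumption)
  have hR2 : Continuous R2 := by
    have h0 := fun z => (hMpos z).ne'
    have := continuous_ctr n
    fun_prop (disch := assumption)
  have hR1m : ∀ z, R1 z ∈ I := fun z => by
    have hp := hMpos z
    have hs := hMs z
    constructor
    · have : (2 - (z.1 : ℝ)) / M z ≤ 2 := by rw [div_le_iff₀ hp]; linarith
      simp only [R1]; linarith
    · have : 1 ≤ (2 - (z.1 : ℝ)) / M z := by
        rw [le_div_iff₀ hp]; have := z.1.2.2; have := hM1 z; linarith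
      simp only [R1]; linarith
  have hR2m : ∀ z i, R2 z i ∈ I := fun z i => by
    have hp := hMpos z
    have h1 : |ctr z.2 i / M z| ≤ 1 := by
      rw [abs_div, abs_of_pos hp, div_le_one hp]
      exact le_trans (norm_le_pi_norm (ctr z.2) i) (le_max_left _ _)
    rw [abs_le] at h1
    constructor <;> simp only [R2] <;> linarith [h1.1, h1.2]
  have hRid : ∀ z ∈ Cyl (bd n), R1 z = z.1 ∧ ∀ i, R2 z i = z.2 i := fun z hz => by
    have : M z = 1 := by
      refine le_antisymm (hM1 z) ?_
      rcases hz with hz | hz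
      · refine le_trans ?_ (le_max_right _ _); simp [hz]
      · exact le_trans (norm_of_mem_bd hz).ge (le_max_left _ _)
    simp [R1, R2, this, ctr]
  have hRmem : ∀ z, R1 z = 0 ∨ ∃ i, R2 z i = 0 ∨ R2 z i = 1 := fun z => by
    rcases le_total ‖ctr z.2‖ (1 - (z.1 : ℝ) / 2) with h | h
    · left
      have h1 : M z = 1 - (z.1 : ℝ) / 2 := max_eq_right h
      have := hMpos z
      simp only [R1, sub_eq_zero]
      rw [eq_div_iff this.ne', h1]; ring
    · right
      have h1 : M z = ‖ctr z.2‖ := max_eq_left h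
      have hp := hMpos z
      let y : Cb n := fun i => ⟨R2 z i, hR2m z i⟩
      have hy : ctr y = (M z)⁻¹ • ctr z.2 := by
        ext i; simp only [ctr, y, R2, Pi.smul_apply, smul_eq_mul]; ring
      have : ‖ctr y‖ = 1 := by
        rw [hy, norm_smul, ← h1, Real.norm_eq_abs, abs_of_pos (inv_pos.2 hp),
          inv_mul_cancel₀ hp.ne']
      obtain ⟨i, hi⟩ := mem_bd_of_norm this
      refine ⟨i, ?_⟩
      rcases hi with hi | hi
      · left; exact congrArg Subtype.val hi
      · right; exact congrArg Subtype.val hi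
  -- clamped segments
  let c : ℝ → ℝ → ℝ → ℝ := fun τ r w => r + max (-τ) (min τ (w - r))
  have hcm : ∀ τ ∈ I, ∀ r ∈ I, ∀ w ∈ I, c τ r w ∈ I := by
    intro τ hτ r hr w hw
    have h0 := hτ.1
    rcases le_total w r with h | h
    · have h1 : min τ (w - r) = w - r := min_eq_right (by linarith)
      constructor
      · have : w - r ≤ max (-τ) (min τ (w - r)) := by rw [h1]; exact le_max_right _ _
        have := hw.1
        simp only [c]; linarith
      · have : max (-τ) (min τ (w - r)) ≤ 0 := by rw [h1]; exact max_le (by linarith) (by linarith)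
        have := hr.2
        simp only [c]; linarith
    · have h1 : max (-τ) (min τ (w - r)) = min τ (w - r) :=
        max_eq_right (le_trans (by linarith) (le_min h0 (by linarith)))
      constructor
      · have : 0 ≤ min τ (w - r) := le_min h0 (by linarith)
        have := hr.1
        simp only [c, h1]; linarith
      · have : min τ (w - r) ≤ w - r := min_le_right _ _
        have := hw.2
        simp only [c, h1]; linarith
  have hc1 : ∀ τ r w, |w - r| ≤ τ → c τ r w = w := by
    intro τ r w h
    rw [abs_le] at h
    simp only [c, min_eq_right h.2, max_eq_right h.1]; ring
  have hc0 : ∀ r w, c 0 r w = r := by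
    intro r w
    have : max (-0) (min 0 (w - r)) = 0 := by rw [neg_zero]; exact max_eq_left (min_le_left _ _)
    simp only [c, this, add_zero]
  let ψ0 : I × Cb n → ℝ := fun z => max |(z.1 : ℝ) - R1 z| ‖fun i => (z.2 i : ℝ) - R2 z i‖
  have hψ0 : Continuous ψ0 := by fun_prop
  have hψm : ∀ z, ψ0 z ∈ I := fun z => by
    refine ⟨le_trans (abs_nonneg _) (le_max_left _ _), max_le ?_ ?_⟩
    · rw [abs_le]
      have := z.1.2
      have := hR1m z
      constructor <;> linarith [this.1, this.2, z.1.2.1, z.1.2.2]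
    · rw [pi_norm_le_iff_of_nonneg zero_le_one]
      intro i
      rw [Real.norm_eq_abs, abs_le]; have := hR2m z i
      constructor <;> linarith [this.1, this.2, (z.2 i).2.1, (z.2 i).2.2]
  refine ⟨fun y => (⟨c y.1 (R1 y.2) y.2.1, hcm _ y.1.2 _ (hR1m _) _ y.2.1.2⟩,
      fun i => ⟨c y.1 (R2 y.2 i) (y.2.2 i), hcm _ y.1.2 _ (hR2m _ i) _ (y.2.2 i).2⟩),
    fun z => ⟨ψ0 z, hψm z⟩, ?_, by fun_prop, fun z => ?_, fun z => ?_, fun z hz => ?_⟩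
  · refine Continuous.prodMk ?_ ?_
    · refine Continuous.subtype_mk ?_ _
      simp only [c]; fun_prop
    · refine continuous_pi fun i => Continuous.subtype_mk ?_ _
      simp only [c]; fun_prop
  · rcases hRmem z with h | ⟨i, h⟩
    · left; apply Subtype.ext; simp [hc0, h]
    · right; refine ⟨i, ?_⟩
      rcases h with h | h
      · left; apply Subtype.ext; simp [hc0, h]
      · right; apply Subtype.ext; simp [hc0, h]
  · refine Prod.ext (Subtype.ext ?_) (funext fun i => Subtype.ext ?_)
    · exact hc1 _ _ _ (le_max_left _ _)
    · refine hc1 _ _ _ (le_trans ?_ (le_max_right _ _))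
      exact norm_le_pi_norm (fun i => (z.2 i : ℝ) - R2 z i) i
  · apply Subtype.ext
    obtain ⟨h1, h2⟩ := hRid z hz
    have h3 : (fun i => (z.2 i : ℝ) - R2 z i) = 0 := by ext i; simp [h2]
    show max _ _ = (0 : ℝ)
    rw [h1, h3]; simp

/-- The boundary of `I × K`. -/
def dbl {K : Type*} (A : Set K) : Set (I × K) := {z | z.1 = 0 ∨ z.1 = 1 ∨ z.2 ∈ A}

/-- The prism `I × I^n` is a cube. -/
def prism (n : ℕ) : I × Cb n ≃ₜ Cb (n + 1) where
  toFun z := Fin.cons z.1 z.2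
  invFun y := (y 0, fun i => y i.succ)
  left_inv z := by ext <;> simp
  right_inv y := by
    funext i
    refine Fin.cases ?_ (fun j => ?_) i <;> simp
  continuous_toFun := by
    refine continuous_pi fun i => ?_
    refine Fin.cases ?_ (fun j => ?_) i <;> simp <;> fun_prop
  continuous_invFun := by fun_prop

theorem prism_mem (n : ℕ) (z : I × Cb n) : prism n z ∈ bd (n + 1) ↔ z ∈ dbl (bd n) := by
  simp only [bd, dbl, mem_ofPred_eq, Fin.exists_fin_succ]
  simp [prism, or_assoc]

theorem goodPair_prism (n : ℕ) : GoodPair (I × Cb n) (dbl (bd n)) := by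
  have h := (goodPair_bd (n + 1)).homeo (prism n)
  have : prism n ⁻¹' bd (n + 1) = dbl (bd n) := by ext z; exact prism_mem n z
  rwa [this] at h

end LoopModel

namespace LoopModel

section
variable {A B C D K : Type*} [TopologicalSpace A] [TopologicalSpace B] [TopologicalSpace C]
  [TopologicalSpace D] [TopologicalSpace K]

/-- Homotopy relative to a subset, for unbundled maps. -/
def HRel (b b' : K → B) (S : Set K) : Prop :=
  ∃ H : I × K → B, Continuous H ∧ (∀ k, H (0, k) = b k) ∧ (∀ k, H (1, k) = b' k) ∧
    ∀ k ∈ S, ∀ t, H (t, k) = b k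

theorem HRel.refl {b : K → B} (hb : Continuous b) (S : Set K) : HRel b b S :=
  ⟨fun z => b z.2, by fun_prop, fun _ => rfl, fun _ => rfl, fun _ _ _ => rfl⟩

theorem HRel.symm {b b' : K → B} {S : Set K} (h : HRel b b' S) : HRel b' b S := by
  obtain ⟨H, hH, h0, h1, hS⟩ := h
  refine ⟨fun z => H (σ z.1, z.2), by fun_prop, by simp [h1], by simp [h0], fun k hk t => ?_⟩
  show H (σ t, k) = b' k
  rw [hS k hk, ← h1, hS k hk]

theorem HRel.trans {b b' b'' : K → B} {S : Set K} (h : HRel b b' S) (h' : HRel b' b'' S) :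
    HRel b b'' S := by
  obtain ⟨H, hH, h0, h1, hS⟩ := h
  obtain ⟨H', hH', h0', h1', hS'⟩ := h'
  have hb : Continuous b := by
    have : b = fun k => H (0, k) := funext fun k => (h0 k).symm
    rw [this]; fun_prop
  have hb' : Continuous b' := by
    have : b' = fun k => H (1, k) := funext fun k => (h1 k).symm
    rw [this]; fun_prop
  have hb'' : Continuous b'' := by
    have : b'' = fun k => H' (1, k) := funext fun k => (h1' k).symm
    rw [this]; fun_prop
  let F : ContinuousMap.HomotopyRel ⟨b, hb⟩ ⟨b', hb'⟩ S :=
    ⟨⟨⟨H, hH⟩, h0, h1⟩, fun t k hk => hS k hk t⟩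
  let F' : ContinuousMap.HomotopyRel ⟨b', hb'⟩ ⟨b'', hb''⟩ S :=
    ⟨⟨⟨H', hH'⟩, h0', h1'⟩, fun t k hk => hS' k hk t⟩
  let G := F.trans F'
  exact ⟨G, G.continuous, fun k => G.apply_zero k, fun k => G.apply_one k, fun k hk t =>
    G.eq_fst t hk⟩

theorem HRel.comp {b b' : K → B} {S : Set K} (h : HRel b b' S) {g : B → C} (hg : Continuous g) :
    HRel (g ∘ b) (g ∘ b') S := by
  obtain ⟨H, hH, h0, h1, hS⟩ := h
  exact ⟨g ∘ H, hg.comp hH, by simp [h0], by simp [h1], fun k hk t => by simp [hS k hk]⟩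

theorem HRel.straighten {S : Set K} (hS : IsClosed S) (hK : GoodPair (I × K) (dbl S))
    {H H' G : I × K → B} (hH : Continuous H) (hH' : Continuous H') (hG : Continuous G)
    (h0 : ∀ k, G (0, k) = H (1, k)) (h1 : ∀ k, G (1, k) = H' (1, k))
    (hGS : ∀ k ∈ S, ∀ t, G (t, k) = H (1, k)) (hHH : ∀ k ∈ S, ∀ t, H (t, k) = H' (t, k)) :
    HRel (fun k => H (0, k)) (fun k => H' (0, k)) S := by
  classical
  let d : I × (I × K) → B := fun z =>
    if z.1 = 0 then G z.2 else if z.2.1 = 1 then H' (σ z.1, z.2.2) else H (σ z.1, z.2.2)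
  have e0 : ∀ z ∈ {z : I × (I × K) | z.1 = 0}, d z = G z.2 := fun z hz => if_pos hz
  have e1 : ∀ z ∈ {z : I × (I × K) | z.2.1 = 1}, d z = H' (σ z.1, z.2.2) := fun z hz => by
    obtain ⟨s, t, k⟩ := z
    obtain rfl : t = 1 := hz
    by_cases h : s = 0
    · subst h; simp [d, h1]
    · simp [d, h]
  have e2 : ∀ z ∈ {z : I × (I × K) | z.2.1 = 0 ∨ z.2.2 ∈ S}, d z = H (σ z.1, z.2.2) := by
    rintro ⟨s, t, k⟩ hz
    by_cases h : s = 0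
    · subst h
      rcases hz with hz | hz
      · obtain rfl : t = 0 := hz
        simp [d, h0]
      · simp [d, hGS k hz]
    · by_cases ht : t = 1
      · subst ht
        rcases hz with hz | hz
        · exact absurd hz (by simp)
        · simp [d, h, hHH k hz]
      · simp [d, h, ht]
  have c0 : IsClosed {z : I × (I × K) | z.1 = 0} := isClosed_eq (by fun_prop) (by fun_prop)
  have c1 : IsClosed {z : I × (I × K) | z.2.1 = 1} := isClosed_eq (by fun_prop) (by fun_prop)
  have c2 : IsClosed {z : I × (I × K) | z.2.1 = 0 ∨ z.2.2 ∈ S} :=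
    (isClosed_eq (f := fun z : I × (I × K) => z.2.1) (by fun_prop) continuous_const).union
      (hS.preimage (by fun_prop : Continuous fun z : I × (I × K) => z.2.2))
  have hd : ContinuousOn d (Cyl (dbl S)) := by
    have h0 : ContinuousOn d {z : I × (I × K) | z.1 = 0} :=
      ContinuousOn.congr (by fun_prop) e0
    have h1 : ContinuousOn d {z : I × (I × K) | z.2.1 = 1} :=
      ContinuousOn.congr (by fun_prop) e1
    have h2 : ContinuousOn d {z : I × (I × K) | z.2.1 = 0 ∨ z.2.2 ∈ S} :=
      ContinuousOn.congr (by fun_prop) e2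
    refine ((h0.union_of_isClosed h1 c0 c1).union_of_isClosed h2 (c0.union c1) c2).mono ?_
    rintro ⟨s, t, k⟩ (hz | hz | hz | hz)
    · exact Or.inl (Or.inl hz)
    · exact Or.inr (Or.inl hz)
    · exact Or.inl (Or.inr hz)
    · exact Or.inr (Or.inr hz)
  obtain ⟨F, hF, hFd⟩ := hK.extend hd
  refine ⟨fun z => F (1, z), by fun_prop, fun k => ?_, fun k => ?_, fun k hk t => ?_⟩
  · exact (hFd _ (Or.inr (Or.inl rfl))).trans ((e2 _ (Or.inl rfl)).trans (by simp))
  · exact (hFd _ (Or.inr (Or.inr (Or.inl rfl)))).trans ((e1 _ rfl).trans (by simp))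
  · exact (hFd _ (Or.inr (Or.inr (Or.inr hk)))).trans ((e2 _ (Or.inr hk)).trans (by simp))

/-- The compression criterion for weak equivalences. -/
def WE (f : A → B) : Prop :=
  (Nonempty B → Nonempty A) ∧
  ∀ (n : ℕ) (b : Cb n → B) (a : Cb n → A), Continuous b → ContinuousOn a (bd n) →
    (∀ x ∈ bd n, f (a x) = b x) →
    ∃ a' : Cb n → A, Continuous a' ∧ (∀ x ∈ bd n, a' x = a x) ∧ HRel (f ∘ a') b (bd n)

/-- The strict relative lifting property for cubes. -/
def TF (f : A → B) : Prop :=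
  (Nonempty B → Nonempty A) ∧
  ∀ (n : ℕ) (b : Cb n → B) (a : Cb n → A), Continuous b → ContinuousOn a (bd n) →
    (∀ x ∈ bd n, f (a x) = b x) →
    ∃ a' : Cb n → A, Continuous a' ∧ (∀ x ∈ bd n, a' x = a x) ∧ ∀ x, f (a' x) = b x

theorem TF.we {f : A → B} (h : TF f) : WE f := by
  refine ⟨h.1, fun n b a hb ha hab => ?_⟩
  obtain ⟨a', h1, h2, h3⟩ := h.2 n b a hb ha hab
  refine ⟨a', h1, h2, ?_⟩
  have : f ∘ a' = b := funext h3
  rw [this]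
  exact HRel.refl hb _

theorem WE.tf {f : A → B} (h : WE f) (hf : Fib f) : TF f := by
  classical
  refine ⟨h.1, fun n b a hb ha hab => ?_⟩
  obtain ⟨a', h1, h2, H, hH, hH0, hH1, hHS⟩ := h.2 n b a hb ha hab
  let d : I × Cb n → A := fun z => a' z.2
  have hd : ∀ z ∈ Cyl (bd n), f (d z) = H z := by
    rintro ⟨t, k⟩ (hz | hz)
    · obtain rfl : t = 0 := hz
      exact (hH0 k).symm
    · exact (hHS k hz t).symm
  obtain ⟨L, hL, hLd, hLf⟩ := (goodPair_bd n).relLift hf hH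
    (h1.comp continuous_snd).continuousOn hd
  refine ⟨fun x => L (1, x), by fun_prop, fun x hx => ?_, fun x => ?_⟩
  · exact (hLd _ (Or.inr hx)).trans (h2 x hx)
  · exact (hLf _).trans (hH1 x)

theorem WE.id : WE (id : A → A) :=
  ⟨fun h => h, fun _ b _ hb _ hab => ⟨b, hb, fun x hx => (hab x hx).symm, HRel.refl hb _⟩⟩

theorem WE.comp {g : B → C} {f : A → B} (hg : WE g) (hf : WE f) (hgc : Continuous g)
    (hfc : Continuous f) : WE (g ∘ f) := by
  refine ⟨fun h => hf.1 (hg.1 h), fun n c a hc ha hac => ?_⟩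
  obtain ⟨b', h1, h2, h3⟩ := hg.2 n c (f ∘ a) hc (hfc.comp_continuousOn ha) hac
  obtain ⟨a', h4, h5, h6⟩ := hf.2 n b' a h1 ha (fun x hx => (h2 x hx).symm)
  exact ⟨a', h4, h5, (h6.comp hgc).trans h3⟩

theorem WE.inj {q : A → B} (hq : WE q) {n : ℕ} {a a' : Cb n → A} (ha : Continuous a)
    (ha' : Continuous a') (haa : ∀ x ∈ bd n, a x = a' x) (h : HRel (q ∘ a) (q ∘ a') (bd n)) :
    HRel a a' (bd n) := by
  classical
  obtain ⟨H, hH, h0, h1, hS⟩ := h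
  let d : I × Cb n → A := fun z => if z.1 = 1 then a' z.2 else a z.2
  have e1 : ∀ z ∈ {z : I × Cb n | z.1 = 1}, d z = a' z.2 := fun z hz => if_pos hz
  have e2 : ∀ z ∈ {z : I × Cb n | z.1 = 0 ∨ z.2 ∈ bd n}, d z = a z.2 := by
    rintro ⟨t, k⟩ hz
    by_cases h : t = 1
    · subst h
      rcases hz with hz | hz
      · exact absurd hz (by simp)
      · simp [d, haa k hz]
    · simp [d, h]
  have c1 : IsClosed {z : I × Cb n | z.1 = 1} := isClosed_eq (by fun_prop) (by fun_prop)
  have c2 : IsClosed {z : I × Cb n | z.1 = 0 ∨ z.2 ∈ bd n} :=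
    (isClosed_eq (f := fun z : I × Cb n => z.1) (by fun_prop) continuous_const).union
      ((isClosed_bd n).preimage (by fun_prop : Continuous fun z : I × Cb n => z.2))
  have hd : ContinuousOn d (dbl (bd n)) := by
    have h1 : ContinuousOn d {z : I × Cb n | z.1 = 1} := ContinuousOn.congr (by fun_prop) e1
    have h2 : ContinuousOn d {z : I × Cb n | z.1 = 0 ∨ z.2 ∈ bd n} :=
      ContinuousOn.congr (by fun_prop) e2
    refine (h1.union_of_isClosed h2 c1 c2).mono ?_
    rintro ⟨t, k⟩ (hz | hz | hz)
    · exact Or.inr (Or.inl hz)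
    · exact Or.inl hz
    · exact Or.inr (Or.inr hz)
  have hqd : ∀ z ∈ dbl (bd n), q (d z) = H z := by
    rintro ⟨t, k⟩ (hz | hz | hz)
    · obtain rfl : t = 0 := hz
      rw [e2 _ (Or.inl rfl), h0]; rfl
    · obtain rfl : t = 1 := hz
      rw [e1 _ rfl, h1]; rfl
    · rw [e2 _ (Or.inr hz), hS k hz]; rfl
  obtain ⟨F, hF, hFd, -⟩ := hq.2 (n + 1) (H ∘ (prism n).symm) (d ∘ (prism n).symm) (by fun_prop)
    (hd.comp (prism n).symm.continuous.continuousOn fun y hy => by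
      rw [← prism_mem]; simpa using hy)
    (fun y hy => hqd _ (by rw [← prism_mem]; simpa using hy))
  have hFd' : ∀ z ∈ dbl (bd n), F (prism n z) = d z := fun z hz => by
    rw [hFd _ ((prism_mem n z).2 hz)]; simp
  refine ⟨F ∘ prism n, by fun_prop, fun k => ?_, fun k => ?_, fun k hk t => ?_⟩
  · exact (hFd' _ (Or.inl rfl)).trans (e2 _ (Or.inl rfl))
  · exact (hFd' _ (Or.inr (Or.inl rfl))).trans (e1 _ rfl)
  · exact (hFd' _ (Or.inr (Or.inr hk))).trans (e2 _ (Or.inr hk))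

/-- Two-out-of-six. -/
theorem WE.of_two {f : A → B} {g : B → C} {h : C → D} (hf : Continuous f) (hg : Continuous g)
    (hh : Continuous h) (h1 : WE (g ∘ f)) (h2 : WE (h ∘ g)) : WE f := by
  refine ⟨fun ⟨b⟩ => h1.1 ⟨g b⟩, fun n b a hb ha hab => ?_⟩
  obtain ⟨a', ha', haa, hr⟩ := h1.2 n (g ∘ b) a (hg.comp hb) ha
    (fun x hx => congrArg g (hab x hx))
  exact ⟨a', ha', haa, h2.inj (hf.comp ha') hb (fun x hx => by simp [haa x hx, hab x hx])
    (hr.comp hh)⟩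

theorem WE.of_comp_left {f : A → B} {g : B → C} (hf : Continuous f) (hg : Continuous g)
    (h : WE (g ∘ f)) (hgw : WE g) : WE f :=
  WE.of_two (h := fun c => c) hf hg continuous_id h hgw

/-- Free homotopy for unbundled maps. -/
def Htpy (f g : A → B) : Prop :=
  ∃ F : I × A → B, Continuous F ∧ (∀ a, F (0, a) = f a) ∧ ∀ a, F (1, a) = g a

theorem Htpy.symm {f g : A → B} (h : Htpy f g) : Htpy g f := by
  obtain ⟨F, hF, h0, h1⟩ := h
  exact ⟨fun z => F (σ z.1, z.2), by fun_prop, by simp [h1], by simp [h0]⟩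

theorem Htpy.trans {f g h : A → B} (h1 : Htpy f g) (h2 : Htpy g h) : Htpy f h := by
  obtain ⟨F, hF, h0, h1⟩ := h1
  obtain ⟨F', hF', h0', h1'⟩ := h2
  obtain ⟨G, hG, g0, g1, -⟩ := HRel.trans (S := ∅) ⟨F, hF, h0, h1, by simp⟩
    ⟨F', hF', h0', h1', by simp⟩
  exact ⟨G, hG, g0, g1⟩

theorem Htpy.refl {f : A → B} (hf : Continuous f) : Htpy f f :=
  ⟨fun z => f z.2, by fun_prop, fun _ => rfl, fun _ => rfl⟩

theorem Htpy.comp_left {f g : A → B} (h : Htpy f g) {k : B → C} (hk : Continuous k) :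
    Htpy (k ∘ f) (k ∘ g) := by
  obtain ⟨F, hF, h0, h1⟩ := h
  exact ⟨k ∘ F, hk.comp hF, by simp [h0], by simp [h1]⟩

theorem Htpy.comp_right {f g : A → B} (h : Htpy f g) {k : C → A} (hk : Continuous k) :
    Htpy (f ∘ k) (g ∘ k) := by
  obtain ⟨F, hF, h0, h1⟩ := h
  exact ⟨fun z => F (z.1, k z.2), by fun_prop, by simp [h0], by simp [h1]⟩

theorem WE.congr {f g : A → B} (h : Htpy f g) (hg : WE g) : WE f := by
  obtain ⟨F, hF, h0, h1⟩ := h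
  refine ⟨hg.1, fun n b a hb ha hab => ?_⟩
  classical
  let d : I × Cb n → B := fun z => if z.1 = 0 then b z.2 else F (z.1, a z.2)
  have e1 : ∀ z ∈ {z : I × Cb n | z.1 = 0}, d z = b z.2 := fun z hz => if_pos hz
  have e2 : ∀ z ∈ {z : I × Cb n | z.2 ∈ bd n}, d z = F (z.1, a z.2) := by
    rintro ⟨t, k⟩ hz
    by_cases h : t = 0
    · subst h; simp [d, h0, hab k hz]
    · simp [d, h]
  have c1 : IsClosed {z : I × Cb n | z.1 = 0} := isClosed_eq (by fun_prop) (by fun_prop)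
  have c2 : IsClosed {z : I × Cb n | z.2 ∈ bd n} :=
    (isClosed_bd n).preimage (by fun_prop : Continuous fun z : I × Cb n => z.2)
  have hd : ContinuousOn d (Cyl (bd n)) := by
    have h1 : ContinuousOn d {z : I × Cb n | z.1 = 0} := ContinuousOn.congr (by fun_prop) e1
    have h2 : ContinuousOn d {z : I × Cb n | z.2 ∈ bd n} := by
      refine ContinuousOn.congr ?_ e2
      refine hF.comp_continuousOn (continuousOn_fst.prodMk ?_)
      exact ha.comp continuousOn_snd fun z hz => hz
    exact h1.union_of_isClosed h2 c1 c2
  obtain ⟨H, hH, hHd⟩ := (goodPair_bd n).extend hd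
  have hH0 : ∀ k, H (0, k) = b k := fun k => (hHd _ (Or.inl rfl)).trans (e1 _ rfl)
  have hHS : ∀ k ∈ bd n, ∀ t, H (t, k) = F (t, a k) := fun k hk t =>
    (hHd _ (Or.inr hk)).trans (e2 _ hk)
  obtain ⟨a', ha', haa, G, hG, hG0, hG1, hGS⟩ := hg.2 n (fun k => H (1, k)) a (by fun_prop) ha
    (fun x hx => by rw [hHS x hx, h1])
  refine ⟨a', ha', haa, ?_⟩
  have := HRel.straighten (isClosed_bd n) (goodPair_prism n) (H := fun z => F (z.1, a' z.2))
    (H' := H) (G := G) (by fun_prop) hH hG (fun k => by simp [hG0, h1]) hG1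
    (fun k hk t => by simp [hGS k hk, h1]) (fun k hk t => by simp [hHS k hk, haa k hk])
  convert this using 1
  · ext k; simp [h0]
  · ext k; simp [hH0]

/-- Homotopy equivalences. -/
def HE (r : A → B) : Prop :=
  Continuous r ∧ ∃ s : B → A, Continuous s ∧ Htpy (s ∘ r) id ∧ Htpy (r ∘ s) id

theorem HE.we {r : A → B} (h : HE r) : WE r := by
  obtain ⟨hr, s, hs, h1, h2⟩ := h
  exact WE.of_two hr hs hr (WE.congr h1 WE.id) (WE.congr h2 WE.id)

theorem HE.symm' {r : A → B} (h : HE r) :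
    ∃ s : B → A, HE s ∧ Htpy (r ∘ s) id ∧ Htpy (s ∘ r) id := by
  obtain ⟨hr, s, hs, h1, h2⟩ := h
  exact ⟨s, ⟨hs, r, hr, h2, h1⟩, h2, h1⟩

theorem HE.homeo (e : A ≃ₜ B) : HE e :=
  ⟨e.continuous, e.symm, e.symm.continuous, by
    have : e.symm ∘ e = id := funext fun x => e.symm_apply_apply x
    rw [this]; exact Htpy.refl continuous_id, by
    have : e ∘ e.symm = id := funext fun x => e.apply_symm_apply x
    rw [this]; exact Htpy.refl continuous_id⟩

theorem HE.comp {g : B → C} {f : A → B} (hg : HE g) (hf : HE f) : HE (g ∘ f) := by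
  obtain ⟨hgc, s, hs, h1, h2⟩ := hg
  obtain ⟨hfc, r, hr, h3, h4⟩ := hf
  refine ⟨hgc.comp hfc, r ∘ s, hr.comp hs, ?_, ?_⟩
  · exact ((h1.comp_right hfc).comp_left hr).trans h3
  · exact ((h4.comp_right hs).comp_left hgc).trans h2

theorem WE.of_comp_right {f : B → C} {r : A → B} (hf : Continuous f) (hr : HE r)
    (h : WE (f ∘ r)) : WE f := by
  obtain ⟨s, hs, h1, -⟩ := hr.symm'
  refine WE.congr (g := f ∘ r ∘ s) ?_ (WE.comp (g := f ∘ r) h hs.we (hf.comp hr.1) hs.1)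
  exact (h1.comp_left hf).symm

theorem WE.prod {f : A → B} (h : WE f) : WE (fun z : A × C => (f z.1, z.2)) := by
  refine ⟨fun ⟨z⟩ => ?_, fun n b a hb ha hab => ?_⟩
  · obtain ⟨x⟩ := h.1 ⟨z.1⟩
    exact ⟨(x, z.2)⟩
  · obtain ⟨a', ha', haa, G, hG, h0, h1, hS⟩ := h.2 n (fun x => (b x).1) (fun x => (a x).1)
      (by fun_prop) (by fun_prop) (fun x hx => congrArg Prod.fst (hab x hx))
    refine ⟨fun x => (a' x, (b x).2), by fun_prop, fun x hx => ?_,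
      fun z => (G z, (b z.2).2), by fun_prop, ?_, ?_, ?_⟩
    · exact Prod.ext (haa x hx) (congrArg Prod.snd (hab x hx)).symm
    · intro k; simp [h0]
    · intro k; simp [h1]
    · intro k hk t; simp [hS k hk]

end

end LoopModel

namespace LoopModel

/-- Clamping a real number to the unit interval. -/
def cl (r : ℝ) : I := projIcc 0 1 zero_le_one r

@[fun_prop] theorem continuous_cl : Continuous cl := continuous_projIcc (h := zero_le_one)

theorem cl_of_mem {r : ℝ} (h : r ∈ I) : cl r = ⟨r, h⟩ := projIcc_of_mem zero_le_one h

theorem coe_cl {r : ℝ} (h0 : 0 ≤ r) (h1 : r ≤ 1) : (cl r : ℝ) = r := by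
  rw [cl_of_mem ⟨h0, h1⟩]

theorem cl_of_le {r : ℝ} (h : r ≤ 0) : cl r = 0 := projIcc_of_le_left zero_le_one h

theorem cl_of_ge {r : ℝ} (h : 1 ≤ r) : cl r = 1 := projIcc_of_right_le zero_le_one h

@[simp] theorem cl_coe (t : I) : cl t = t := projIcc_val zero_le_one t

@[simp] theorem cl_zero : cl 0 = 0 := cl_of_le le_rfl

@[simp] theorem cl_one : cl 1 = 1 := cl_of_ge le_rfl

section
variable {A B E Z : Type*} [TopologicalSpace A] [TopologicalSpace B] [TopologicalSpace E]
  [TopologicalSpace Z]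

/-- The family of paths given by a map defined on `Z × I`. -/
def mkP (g : Z × I → B) (hg : Continuous g) : C(Z, C(I, B)) := ContinuousMap.curry ⟨g, hg⟩

@[simp] theorem mkP_apply (g : Z × I → B) (hg : Continuous g) (z : Z) (t : I) :
    mkP g hg z t = g (z, t) := rfl

/-- The two endpoints form a fibration. -/
theorem fib_ends : Fib (fun γ : C(I, B) => (γ 0, γ 1)) := by
  intro Z _ h d hh hd hhd
  have e0 : ∀ z, d z 0 = (h (0, z)).1 := fun z => congrArg Prod.fst (hhd z)
  have e1 : ∀ z, d z 1 = (h (0, z)).2 := fun z => congrArg Prod.snd (hhd z)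
  let u : (I × Z) × I → ℝ := fun y => y.2 * (1 + 2 * y.1.1) - y.1.1
  let g : (I × Z) × I → B := fun y =>
    if u y ≤ 0 then (h (cl (-u y), y.1.2)).1 else
      if u y ≤ 1 then d y.1.2 (cl (u y)) else (h (cl (u y - 1), y.1.2)).2
  have hu : Continuous u := by fun_prop
  have hg : Continuous g := by
    refine Continuous.if_le (by fun_prop) ?_ hu continuous_const ?_
    · refine Continuous.if_le (by fun_prop) (by fun_prop) hu continuous_const ?_
      intro y hy
      simp [hy, e1]
    · intro y hy
      simp [hy, e0]
  refine ⟨mkP g hg, (mkP g hg).continuous, fun z => ?_, fun y => ?_⟩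
  · ext t
    rw [mkP_apply]
    have hut : u ((0, z), t) = t := by simp [u]
    simp only [g, hut]
    rcases eq_or_lt_of_le t.2.1 with ht | ht
    · have : t = 0 := Subtype.ext ht.symm
      subst this; simp [e0]
    · rw [if_neg (not_le.2 ht), if_pos t.2.2, cl_coe]
  · have hu0 : u (y, 0) = - y.1 := by simp [u]
    have hu1 : u (y, 1) = 1 + y.1 := by simp [u]; ring
    have h0 := y.1.2.1
    refine Prod.ext ?_ ?_
    · show g (y, 0) = _
      simp [g, hu0, h0]
    · show g (y, 1) = _
      simp only [g, hu1]
      rw [if_neg (by linarith)]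
      split_ifs with h
      · have : y.1 = 0 := Subtype.ext (le_antisymm (by simpa using h) h0)
        obtain ⟨s, z⟩ := y
        simp only at this; subst this
        simp [e1]
      · simp

/-- The mapping path space of `f` over the subset `S`. -/
def NS (f : A → B) (S : Set B) : Type _ :=
  {z : A × C(I, B) // z.2 0 = f z.1 ∧ ∀ t, z.2 t ∈ S}

instance (f : A → B) (S : Set B) : TopologicalSpace (NS f S) :=
  inferInstanceAs (TopologicalSpace {z : A × C(I, B) // z.2 0 = f z.1 ∧ ∀ t, z.2 t ∈ S})

/-- Evaluation at the endpoint. -/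
def NS.ev {f : A → B} {S : Set B} (z : NS f S) : S := ⟨z.1.2 1, z.2.2 1⟩

@[fun_prop] theorem NS.continuous_val {f : A → B} {S : Set B} :
    Continuous (fun z : NS f S => z.1) := continuous_subtype_val

theorem NS.continuous_ev {f : A → B} {S : Set B} : Continuous (NS.ev : NS f S → S) := by
  unfold NS.ev
  refine Continuous.subtype_mk ?_ _
  exact (continuous_eval_const (1 : I)).comp (continuous_snd.comp NS.continuous_val)

theorem NS.fib_ev {f : A → B} {S : Set B} : Fib (NS.ev : NS f S → S) := by
  intro Z _ h d hh hd hhd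
  obtain ⟨H, hH, H0, H1⟩ := fib_ends (B := S) Z (fun y => (⟨(d y.2).1.2 0, (d y.2).2.2 0⟩, h y))
    (fun z => ⟨fun t => ⟨(d z).1.2 t, (d z).2.2 t⟩, by fun_prop⟩)
    (by
      refine Continuous.prodMk (Continuous.subtype_mk ?_ _) hh
      exact (continuous_eval_const (0 : I)).comp
        (continuous_snd.comp (NS.continuous_val.comp (hd.comp continuous_snd))))
    (by
      refine ContinuousMap.continuous_of_continuous_uncurry _ ?_
      refine Continuous.subtype_mk (f := fun y : Z × I => (d y.1).1.2 y.2) ?_ _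
      have : Continuous fun z => (d z).1.2 := continuous_snd.comp (NS.continuous_val.comp hd)
      fun_prop)
    (fun z => Prod.ext rfl (hhd z))
  refine ⟨fun y => ⟨((d y.2).1.1, ⟨fun t => H y t, by fun_prop⟩), ?_, fun t => (H y t).2⟩,
    ?_, fun z => ?_, fun y => ?_⟩
  · have := congrArg (fun z => z.1.1) (H1 y)
    exact this.trans (d y.2).2.1
  · refine Continuous.subtype_mk (Continuous.prodMk ?_ ?_) _
    · exact continuous_fst.comp (NS.continuous_val.comp (hd.comp continuous_snd))
    · refine ContinuousMap.continuous_of_continuous_uncurry _ ?_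
      show Continuous fun y : (I × Z) × I => (H y.1 y.2 : B)
      fun_prop
  · refine Subtype.ext (Prod.ext rfl ?_)
    ext t
    simp [H0]
  · exact congrArg (fun z => z.2) (H1 y)

/-- Constant paths. -/
def NS.const (f : A → B) (S : Set B) (a : f ⁻¹' S) : NS f S :=
  ⟨(a, .const I (f a)), rfl, fun _ => a.2⟩

theorem NS.he_const {f : A → B} (hf : Continuous f) {S : Set B} : HE (NS.const f S) := by
  have hc : Continuous (NS.const f S) := by
    refine Continuous.subtype_mk (Continuous.prodMk (by fun_prop) ?_) _
    refine ContinuousMap.continuous_of_continuous_uncurry _ ?_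
    show Continuous fun y : (f ⁻¹' S) × I => f y.1
    fun_prop
  refine ⟨hc, fun z => ⟨z.1.1, by show f z.1.1 ∈ S; rw [← z.2.1]; exact z.2.2 0⟩, ?_, ?_, ?_⟩
  · exact Continuous.subtype_mk (by fun_prop) _
  · exact Htpy.refl continuous_id
  · refine ⟨fun y => ⟨(y.2.1.1, ⟨fun t => y.2.1.2 (y.1 * t), by fun_prop⟩), ?_, fun t => y.2.2.2 _⟩,
      ?_, fun z => ?_, fun z => ?_⟩
    · show y.2.1.2 (y.1 * 0) = _
      rw [mul_zero, y.2.2.1]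
    · refine Continuous.subtype_mk (Continuous.prodMk (by fun_prop) ?_) _
      refine ContinuousMap.continuous_of_continuous_uncurry _ ?_
      show Continuous fun y : (I × NS f S) × I => y.1.2.1.2 (y.1.1 * y.2)
      fun_prop
    · refine Subtype.ext (Prod.ext rfl ?_)
      ext t
      simp [NS.const, z.2.1]
    · refine Subtype.ext (Prod.ext rfl ?_)
      ext t
      simp

theorem NS.tf_ev {f : A → B} (hf : Continuous f) {S : Set B} (h : WE (S.restrictPreimage f)) :
    TF (NS.ev : NS f S → S) := by
  refine WE.tf ?_ NS.fib_ev
  refine WE.of_comp_right NS.continuous_ev (NS.he_const hf) ?_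
  exact h

/-- Vertical compression into a fibration weakly equivalent to the ambient one. -/
theorem vertical_compress {D M Y : Type*} [TopologicalSpace D] [TopologicalSpace M]
    [TopologicalSpace Y] {i : D → M} {q : M → Y} (hi : Continuous i) (hqc : Continuous q)
    (hiw : WE i) (hq : Fib q) (hqi : Fib (q ∘ i)) {n : ℕ} {w : Cb n → M} {a : Cb n → D}
    (hw : Continuous w) (ha : ContinuousOn a (bd n)) (haw : ∀ x ∈ bd n, i (a x) = w x) :
    ∃ (a' : Cb n → D) (v : I × Cb n → M), Continuous a' ∧ (∀ x ∈ bd n, a' x = a x) ∧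
      Continuous v ∧ (∀ x, v (0, x) = i (a' x)) ∧ (∀ x, v (1, x) = w x) ∧
      (∀ t x, q (v (t, x)) = q (w x)) ∧ ∀ x ∈ bd n, ∀ t, v (t, x) = w x := by
  classical
  obtain ⟨a₁, ha₁, haa, G, hG, G0, G1, GS⟩ := hiw.2 n w a hw ha haw
  have GS' : ∀ x ∈ bd n, ∀ t, G (t, x) = w x := fun x hx t => by
    rw [GS x hx, ← G1, GS x hx]
  obtain ⟨F, hF, hFd, hFq⟩ := (goodPair_bd n).relLift hqi (h := q ∘ G) (d := fun z => a₁ z.2)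
    (hqc.comp hG) (by fun_prop) (by
      rintro ⟨t, x⟩ (hz | hz)
      · obtain rfl : t = 0 := hz
        simp [G0]
      · simp [GS x hz])
  -- fill the square whose edges are the two lifts
  let d : I × (I × Cb n) → M := fun z => if z.2.1 = 1 then G (z.1, z.2.2) else i (F (z.1, z.2.2))
  have F0 : ∀ x, F (0, x) = a₁ x := fun x => hFd _ (Or.inl rfl)
  have FS : ∀ x ∈ bd n, ∀ t, F (t, x) = a₁ x := fun x hx t => hFd _ (Or.inr hx)
  have e1 : ∀ z ∈ {z : I × (I × Cb n) | z.2.1 = 1}, d z = G (z.1, z.2.2) := fun z hz => if_pos hz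
  have e2 : ∀ z ∈ {z : I × (I × Cb n) | z.1 = 0 ∨ z.2.1 = 0 ∨ z.2.2 ∈ bd n},
      d z = i (F (z.1, z.2.2)) := by
    rintro ⟨s, t, x⟩ hz
    by_cases h : t = 1
    · subst h
      rcases hz with hz | hz | hz
      · obtain rfl : s = 0 := hz
        simp [d, G0, F0]
      · exact absurd hz (by simp)
      · simp [d, GS x hz, FS x hz]
    · simp [d, h]
  have c1 : IsClosed {z : I × (I × Cb n) | z.2.1 = 1} := isClosed_eq (by fun_prop) (by fun_prop)
  have c2 : IsClosed {z : I × (I × Cb n) | z.1 = 0 ∨ z.2.1 = 0 ∨ z.2.2 ∈ bd n} := by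
    refine IsClosed.union (isClosed_eq (f := fun z : I × (I × Cb n) => z.1) (by fun_prop)
      continuous_const) (IsClosed.union (isClosed_eq (f := fun z : I × (I × Cb n) => z.2.1)
      (by fun_prop) continuous_const) ?_)
    exact (isClosed_bd n).preimage (by fun_prop : Continuous fun z : I × (I × Cb n) => z.2.2)
  have hd : ContinuousOn d (Cyl (dbl (bd n))) := by
    have h1 : ContinuousOn d {z : I × (I × Cb n) | z.2.1 = 1} :=
      ContinuousOn.congr (by fun_prop) e1
    have h2 : ContinuousOn d {z : I × (I × Cb n) | z.1 = 0 ∨ z.2.1 = 0 ∨ z.2.2 ∈ bd n} :=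
      ContinuousOn.congr (by fun_prop) e2
    refine (h1.union_of_isClosed h2 c1 c2).mono ?_
    rintro ⟨s, t, k⟩ (hz | hz | hz | hz)
    · exact Or.inr (Or.inl hz)
    · exact Or.inr (Or.inr (Or.inl hz))
    · exact Or.inl hz
    · exact Or.inr (Or.inr (Or.inr hz))
  obtain ⟨H, hH, hHd, hHq⟩ := (goodPair_prism n).relLift hq (h := fun z => q (G (z.1, z.2.2)))
    (d := d) (by fun_prop) hd (by
      rintro ⟨s, t, x⟩ -
      by_cases h : t = 1
      · simp [d, h]
      · have := hFq (s, x)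
        simp only [Function.comp] at this
        simp [d, h, this])
  refine ⟨fun x => F (1, x), fun z => H (1, z), by fun_prop, fun x hx => ?_, by fun_prop,
    fun x => ?_, fun x => ?_, fun t x => ?_, fun x hx t => ?_⟩
  · exact (FS x hx 1).trans (haa x hx)
  · exact (hHd _ (Or.inr (Or.inl rfl))).trans (e2 _ (Or.inr (Or.inl rfl)))
  · exact (hHd _ (Or.inr (Or.inr (Or.inl rfl)))).trans ((e1 _ rfl).trans (G1 x))
  · exact (hHq _).trans (by rw [G1])
  · refine (hHd _ (Or.inr (Or.inr (Or.inr hx)))).trans ((e2 _ (Or.inr (Or.inr hx))).trans ?_)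
    rw [FS x hx, ← haw x hx, haa x hx]

end

end LoopModel

namespace LoopModel

section
variable {W : Type*} [TopologicalSpace W] {n : ℕ}

/-- Grid boxes in the cube. -/
def box (N : ℕ) (a b : Fin n → ℕ) : Set (Cb n) :=
  {x | ∀ i, (a i : ℝ) ≤ N * x i ∧ (N * x i : ℝ) ≤ b i}

/-- The relative boundary of a (possibly degenerate) grid box. -/
def bbd (N : ℕ) (a b : Fin n → ℕ) : Set (Cb n) :=
  {x | x ∈ box N a b ∧ ∃ i, a i < b i ∧ ((N * x i : ℝ) = a i ∨ (N * x i : ℝ) = b i)}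

theorem isClosed_box (N : ℕ) (a b : Fin n → ℕ) : IsClosed (box N a b) := by
  have : box N a b =
    ⋂ i, ({x : Cb n | (a i : ℝ) ≤ N * x i} ∩ {x : Cb n | (N * x i : ℝ) ≤ b i}) := by
    ext x; simp [box]
  rw [this]
  exact isClosed_iInter fun i => (isClosed_le (by fun_prop) (by fun_prop)).inter
    (isClosed_le (by fun_prop) (by fun_prop))

theorem isClosed_bbd (N : ℕ) (a b : Fin n → ℕ) : IsClosed (bbd N a b) := by
  have : bbd N a b = ⋃ i, (box N a b ∩ ({x : Cb n | a i < b i} ∩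
      ({x : Cb n | (N * x i : ℝ) = a i} ∪ {x : Cb n | (N * x i : ℝ) = b i}))) := by
    ext x; simp [bbd]
  rw [this]
  exact isClosed_iUnion_of_finite fun i => (isClosed_box N a b).inter (isClosed_const.inter
    ((isClosed_eq (by fun_prop) (by fun_prop)).union (isClosed_eq (by fun_prop) (by fun_prop))))

/-- The extension problem with pointwise constraints is solvable on a box. -/
def Solv (P : Cb n → W → Prop) (N : ℕ) (a b : Fin n → ℕ) : Prop :=
  ∀ g : Cb n → W, ContinuousOn g (bbd N a b) → (∀ x ∈ bbd N a b, P x (g x)) →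
    ∃ g' : Cb n → W, ContinuousOn g' (box N a b) ∧ (∀ x ∈ bbd N a b, g' x = g x) ∧
      ∀ x ∈ box N a b, P x (g' x)

theorem solv_of_cells {P : Cb n → W → Prop} {N : ℕ}
    (h : ∀ a b : Fin n → ℕ, (∀ i, a i ≤ b i) → (∀ i, b i ≤ N) → (∀ i, b i ≤ a i + 1) →
      Solv P N a b) (a b : Fin n → ℕ) (hab : ∀ i, a i ≤ b i) (hb : ∀ i, b i ≤ N) :
    Solv P N a b := by
  classical
  induction hs : ∑ i, (b i - a i) using Nat.strong_induction_on generalizing a b with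
  | _ s ih =>
    by_cases hcell : ∀ i, b i ≤ a i + 1
    · exact h a b hab hb hcell
    push Not at hcell
    obtain ⟨i, hi⟩ := hcell
    set c := a i + 1 with hc
    let aR := Function.update a i c
    let bL := Function.update b i c
    have sum_lt : ∀ a' b' : Fin n → ℕ, (∀ j, b' j - a' j ≤ b j - a j) →
        b' i - a' i < b i - a i → ∑ j, (b' j - a' j) < s := by
      intro a' b' h1 h2
      rw [← hs]
      exact Finset.sum_lt_sum (fun j _ => h1 j) ⟨i, Finset.mem_univ _, h2⟩
    have haR : ∀ j, a j ≤ aR j ∧ aR j ≤ b j := fun j => by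
      by_cases hj : j = i
      · subst hj; simp only [aR, Function.update_self]; omega
      · simp only [aR, Function.update_of_ne hj]; exact ⟨le_rfl, hab j⟩
    have hbL : ∀ j, a j ≤ bL j ∧ bL j ≤ b j ∧ aR j ≤ bL j := fun j => by
      by_cases hj : j = i
      · subst hj; simp only [aR, bL, Function.update_self]; omega
      · simp only [aR, bL, Function.update_of_ne hj]; exact ⟨hab j, le_rfl, hab j⟩
    have haRi : aR i = c := Function.update_self _ _ _
    have hbLi : bL i = c := Function.update_self _ _ _
    have key : ∀ a' b' : Fin n → ℕ, (∀ j, a j ≤ a' j) → (∀ j, b' j ≤ b j) → (∀ j, a' j ≤ b' j) →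
        b' i - a' i < b i - a i → Solv P N a' b' := fun a' b' h1 h2 h3 h4 =>
      ih _ (sum_lt a' b' (fun j => by have := h1 j; have := h2 j; omega) h4) a' b' h3
        (fun j => (h2 j).trans (hb j)) rfl
    have castc : (c : ℝ) = a i + 1 := by simp [hc]
    have hac : (a i : ℝ) < c := by rw [castc]; linarith
    have hcb : (c : ℝ) < b i := by exact_mod_cast hi
    have upd : ∀ (f : Fin n → ℕ) (j : Fin n), j ≠ i → Function.update f i c j = f j :=
      fun f j hj => Function.update_of_ne hj _ _
    have updi : ∀ (f : Fin n → ℕ), Function.update f i c i = c :=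
      fun f => Function.update_self _ _ _
    have boxL : ∀ x, x ∈ box N a bL ↔ x ∈ box N a b ∧ (N * x i : ℝ) ≤ c := by
      intro x
      constructor
      · intro hx
        refine ⟨fun j => ?_, by simpa [bL] using (hx i).2⟩
        by_cases hj : j = i
        · subst hj
          exact ⟨(hx j).1, by have := (hx j).2; simp only [bL, updi] at this; linarith⟩
        · have := hx j
          simp only [bL, upd b j hj] at this
          exact this
      · rintro ⟨hx, hxc⟩ j
        by_cases hj : j = i
        · subst hj; simp only [bL, updi]; exact ⟨(hx j).1, hxc⟩
        · simp only [bL, upd b j hj]; exact hx j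
    have boxR : ∀ x, x ∈ box N aR b ↔ x ∈ box N a b ∧ (c : ℝ) ≤ N * x i := by
      intro x
      constructor
      · intro hx
        refine ⟨fun j => ?_, by simpa [aR] using (hx i).1⟩
        by_cases hj : j = i
        · subst hj
          exact ⟨by have := (hx j).1; simp only [aR, updi] at this; linarith, (hx j).2⟩
        · have := hx j
          simp only [aR, upd a j hj] at this
          exact this
      · rintro ⟨hx, hxc⟩ j
        by_cases hj : j = i
        · subst hj; simp only [aR, updi]; exact ⟨hxc, (hx j).2⟩
        · simp only [aR, upd a j hj]; exact hx j
    have boxW : ∀ x, x ∈ box N aR bL ↔ x ∈ box N a b ∧ (N * x i : ℝ) = c := by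
      intro x
      constructor
      · intro hx
        have hxi := hx i
        simp only [aR, bL, updi] at hxi
        refine ⟨fun j => ?_, le_antisymm hxi.2 hxi.1⟩
        by_cases hj : j = i
        · subst hj
          exact ⟨by linarith, by linarith⟩
        · have := hx j
          simp only [aR, bL, upd _ j hj] at this
          exact this
      · rintro ⟨hx, hxc⟩ j
        by_cases hj : j = i
        · subst hj; simp only [aR, bL, updi]; exact ⟨hxc.ge, hxc.le⟩
        · simp only [aR, bL, upd _ j hj]; exact hx j
    have bbdW : ∀ x, x ∈ bbd N aR bL ↔ x ∈ bbd N a b ∧ (N * x i : ℝ) = c := by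
      intro x
      constructor
      · rintro ⟨hx, j, hj, hxj⟩
        have hji : j ≠ i := by rintro rfl; simp [aR, bL] at hj
        simp only [aR, bL, upd _ j hji] at hj hxj
        exact ⟨⟨((boxW x).1 hx).1, j, hj, hxj⟩, ((boxW x).1 hx).2⟩
      · rintro ⟨⟨hx, j, hj, hxj⟩, hxc⟩
        have hji : j ≠ i := by
          rintro rfl
          rcases hxj with h | h <;> linarith
        exact ⟨(boxW x).2 ⟨hx, hxc⟩, j, by simpa only [aR, bL, upd _ j hji] using hj,
          by simpa only [aR, bL, upd _ j hji] using hxj⟩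
    have bbdL : ∀ x, x ∈ bbd N a bL ↔ (x ∈ bbd N a b ∧ (N * x i : ℝ) ≤ c) ∨ x ∈ box N aR bL := by
      intro x
      constructor
      · rintro ⟨hx, j, hj, hxj⟩
        by_cases hji : j = i
        · subst hji
          rcases hxj with h | h
          · exact Or.inl ⟨⟨((boxL x).1 hx).1, j, by omega, Or.inl h⟩, ((boxL x).1 hx).2⟩
          · refine Or.inr ((boxW x).2 ⟨((boxL x).1 hx).1, by simpa [bL] using h⟩)
        · simp only [bL, upd _ j hji] at hj hxj
          exact Or.inl ⟨⟨((boxL x).1 hx).1, j, hj, hxj⟩, ((boxL x).1 hx).2⟩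
      · rintro (⟨⟨hx, j, hj, hxj⟩, hxc⟩ | hx)
        · refine ⟨(boxL x).2 ⟨hx, hxc⟩, j, ?_⟩
          by_cases hji : j = i
          · subst hji
            simp only [bL, updi]
            refine ⟨by omega, Or.inl ?_⟩
            rcases hxj with h | h
            · exact h
            · linarith
          · simp only [bL, upd _ j hji]
            exact ⟨hj, hxj⟩
        · have := (boxW x).1 hx
          exact ⟨(boxL x).2 ⟨this.1, this.2.le⟩, i, by simp only [bL, updi]; omega,
            Or.inr (by simp only [bL, updi]; exact this.2)⟩
    have bbdR : ∀ x, x ∈ bbd N aR b ↔ (x ∈ bbd N a b ∧ (c : ℝ) ≤ N * x i) ∨ x ∈ box N aR bL := by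
      intro x
      constructor
      · rintro ⟨hx, j, hj, hxj⟩
        by_cases hji : j = i
        · subst hji
          rcases hxj with h | h
          · refine Or.inr ((boxW x).2 ⟨((boxR x).1 hx).1, by simpa [aR] using h⟩)
          · exact Or.inl ⟨⟨((boxR x).1 hx).1, j, by omega, Or.inr h⟩, ((boxR x).1 hx).2⟩
        · simp only [aR, upd _ j hji] at hj hxj
          exact Or.inl ⟨⟨((boxR x).1 hx).1, j, hj, hxj⟩, ((boxR x).1 hx).2⟩
      · rintro (⟨⟨hx, j, hj, hxj⟩, hxc⟩ | hx)
        · refine ⟨(boxR x).2 ⟨hx, hxc⟩, j, ?_⟩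
          by_cases hji : j = i
          · subst hji
            simp only [aR, updi]
            refine ⟨by omega, Or.inr ?_⟩
            rcases hxj with h | h
            · linarith
            · exact h
          · simp only [aR, upd _ j hji]
            exact ⟨hj, hxj⟩
        · have := (boxW x).1 hx
          exact ⟨(boxR x).2 ⟨this.1, this.2.ge⟩, i, by simp only [aR, updi]; omega,
            Or.inl (by simp only [aR, updi]; exact this.2)⟩
    intro g hg hgP
    obtain ⟨g₁, hg₁, hgg₁, hP₁⟩ := key aR bL (fun j => (haR j).1) (fun j => (hbL j).2.1)
      (fun j => (hbL j).2.2) (by omega) g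
      (hg.mono fun x hx => ((bbdW x).1 hx).1) (fun x hx => hgP x ((bbdW x).1 hx).1)
    let g₂ : Cb n → W := fun x => if (N * x i : ℝ) = c then g₁ x else g x
    have e1 : ∀ x ∈ box N aR bL, g₂ x = g₁ x := fun x hx => if_pos ((boxW x).1 hx).2
    have e2 : ∀ x ∈ bbd N a b, g₂ x = g x := fun x hx => by
      by_cases hxc : (N * x i : ℝ) = c
      · simp only [g₂, if_pos hxc]
        exact hgg₁ x ((bbdW x).2 ⟨hx, hxc⟩)
      · simp only [g₂, if_neg hxc]
    have hg₂ : ContinuousOn g₂ (bbd N a b ∪ box N aR bL) :=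
      (hg.congr e2).union_of_isClosed (hg₁.congr e1) (isClosed_bbd _ _ _) (isClosed_box _ _ _)
    have hP₂ : ∀ x ∈ bbd N a b ∪ box N aR bL, P x (g₂ x) := by
      rintro x (hx | hx)
      · rw [e2 x hx]; exact hgP x hx
      · rw [e1 x hx]; exact hP₁ x hx
    have subL : ∀ x ∈ bbd N a bL, x ∈ bbd N a b ∪ box N aR bL := fun x hx =>
      ((bbdL x).1 hx).imp (fun h => h.1) (fun h => h)
    have subR : ∀ x ∈ bbd N aR b, x ∈ bbd N a b ∪ box N aR bL := fun x hx =>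
      ((bbdR x).1 hx).imp (fun h => h.1) (fun h => h)
    obtain ⟨g₃, hg₃, hgg₃, hP₃⟩ := key a bL (fun j => le_rfl) (fun j => (hbL j).2.1)
      (fun j => (hbL j).1) (by omega) g₂
      (hg₂.mono subL) (fun x hx => hP₂ x (subL x hx))
    obtain ⟨g₄, hg₄, hgg₄, hP₄⟩ := key aR b (fun j => (haR j).1) (fun j => le_rfl)
      (fun j => (haR j).2) (by omega) g₂
      (hg₂.mono subR) (fun x hx => hP₂ x (subR x hx))
    let g₅ : Cb n → W := fun x => if (N * x i : ℝ) ≤ c then g₃ x else g₄ x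
    have e3 : ∀ x ∈ box N a bL, g₅ x = g₃ x := fun x hx => if_pos ((boxL x).1 hx).2
    have e4 : ∀ x ∈ box N aR b, g₅ x = g₄ x := fun x hx => by
      by_cases hxc : (N * x i : ℝ) ≤ c
      · simp only [g₅, if_pos hxc]
        have hw : x ∈ box N aR bL :=
          (boxW x).2 ⟨((boxR x).1 hx).1, le_antisymm hxc ((boxR x).1 hx).2⟩
        rw [hgg₃ x ((bbdL x).2 (Or.inr hw)), hgg₄ x ((bbdR x).2 (Or.inr hw))]
      · simp only [g₅, if_neg hxc]
    have cov : ∀ x ∈ box N a b, x ∈ box N a bL ∪ box N aR b := fun x hx => by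
      rcases le_total (N * x i : ℝ) c with h | h
      · exact Or.inl ((boxL x).2 ⟨hx, h⟩)
      · exact Or.inr ((boxR x).2 ⟨hx, h⟩)
    refine ⟨g₅, ((hg₃.congr e3).union_of_isClosed (hg₄.congr e4) (isClosed_box _ _ _)
      (isClosed_box _ _ _)).mono cov, fun x hx => ?_, fun x hx => ?_⟩
    · rcases le_total (N * x i : ℝ) c with h | h
      · have hx' : x ∈ bbd N a bL := (bbdL x).2 (Or.inl ⟨hx, h⟩)
        rw [e3 x hx'.1, hgg₃ x hx', e2 x hx]
      · have hx' : x ∈ bbd N aR b := (bbdR x).2 (Or.inl ⟨hx, h⟩)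
        rw [e4 x hx'.1, hgg₄ x hx', e2 x hx]
    · rcases cov x hx with hx | hx
      · rw [e3 x hx]; exact hP₃ x hx
      · rw [e4 x hx]; exact hP₄ x hx

theorem box_full {N : ℕ} : box N (0 : Fin n → ℕ) (fun _ => N) = univ := by
  refine eq_univ_of_forall fun x i => ?_
  have h0 := (x i).2.1
  have h1 := (x i).2.2
  have hN : (0 : ℝ) ≤ N := Nat.cast_nonneg N
  exact ⟨by simp; positivity, by nlinarith⟩

theorem bbd_full {N : ℕ} (hN : 0 < N) : bbd N (0 : Fin n → ℕ) (fun _ => N) = bd n := by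
  have hN' : (N : ℝ) ≠ 0 := by exact_mod_cast hN.ne'
  ext x
  constructor
  · rintro ⟨-, i, -, h | h⟩
    · exact ⟨i, Or.inl (Subtype.ext (by simpa [hN'] using h))⟩
    · exact ⟨i, Or.inr (Subtype.ext (by simpa [hN'] using h))⟩
  · rintro ⟨i, h⟩
    refine ⟨by rw [box_full]; trivial, i, hN, ?_⟩
    rcases h with h | h
    · left; simp [h]
    · right; simp [h]

theorem cell_param {N : ℕ} (hN : 0 < N) {a b : Fin n → ℕ} (hab : ∀ i, a i ≤ b i)
    (hb : ∀ i, b i ≤ N) (hba : ∀ i, b i ≤ a i + 1) :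
    ∃ (m : ℕ) (c : Cb m → Cb n) (r : Cb n → Cb m), Continuous c ∧ Continuous r ∧
      (∀ y, c y ∈ box N a b) ∧ (∀ y, r (c y) = y) ∧ (∀ x ∈ box N a b, c (r x) = x) ∧
      ∀ y, c y ∈ bbd N a b ↔ y ∈ bd m := by
  classical
  have hN' : (0 : ℝ) < N := by exact_mod_cast hN
  let J := {i : Fin n // a i < b i}
  let e : Fin (Fintype.card J) ≃ J := (Fintype.equivFin J).symm
  let y0 : Cb (Fintype.card J) → Fin n → ℝ := fun y i =>
    if h : a i < b i then (y (e.symm ⟨i, h⟩) : ℝ) else 0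
  have y01 : ∀ y i, y0 y i ∈ I := fun y i => by
    by_cases h : a i < b i
    · simp only [y0, dif_pos h]; exact (y _).2
    · simp only [y0, dif_neg h]; exact ⟨le_rfl, zero_le_one⟩
  have y0b : ∀ y i, (a i : ℝ) + y0 y i ≤ b i := fun y i => by
    by_cases h : a i < b i
    · have : b i = a i + 1 := le_antisymm (hba i) h
      rw [this]; push_cast; have := (y01 y i).2; linarith
    · simp only [y0, dif_neg h, add_zero]; exact_mod_cast hab i
  let c : Cb (Fintype.card J) → Cb n := fun y i => cl ((a i + y0 y i) / N)
  have hc : ∀ y i, (N * c y i : ℝ) = a i + y0 y i := fun y i => by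
    have h0 := (y01 y i).1
    have : ((c y i : I) : ℝ) = (a i + y0 y i) / N := by
      refine coe_cl (by positivity) ?_
      rw [div_le_one hN']
      exact (y0b y i).trans (by exact_mod_cast hb i)
    rw [this]; field_simp
  have hce : ∀ y (j : J), y0 y j.1 = y (e.symm j) := fun y j => dif_pos j.2
  refine ⟨Fintype.card J, c, fun x j => cl (N * x (e j).1 - a (e j).1), ?_, by fun_prop,
    fun y i => ?_, fun y => ?_, fun x hx => ?_, fun y => ?_⟩
  · refine continuous_pi fun i => continuous_cl.comp ?_
    refine (continuous_const.add ?_).div_const _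
    by_cases h : a i < b i
    · simp only [y0, dif_pos h]; fun_prop
    · simp only [y0, dif_neg h]; fun_prop
  · rw [hc]
    exact ⟨by linarith [(y01 y i).1], y0b y i⟩
  · funext j
    simp only [hc, hce, add_sub_cancel_left, Equiv.symm_apply_apply, cl_coe]
  · funext i
    have hxi := hx i
    have : (a i : ℝ) + y0 (fun j => cl (N * x (e j).1 - a (e j).1)) i = N * x i := by
      by_cases h : a i < b i
      · have hb1 : (b i : ℝ) = a i + 1 := by exact_mod_cast le_antisymm (hba i) h
        have h1 := hce (fun j => cl (N * x (e j).1 - a (e j).1)) ⟨i, h⟩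
        simp only [Equiv.apply_symm_apply] at h1
        rw [h1]
        rw [coe_cl (by linarith) (by linarith)]
        ring
      · have hb1 : (b i : ℝ) = a i := by exact_mod_cast le_antisymm (not_lt.1 h) (hab i)
        simp only [y0, dif_neg h]; linarith
    simp only [c, this]
    rw [mul_div_cancel_left₀ _ hN'.ne', cl_coe]
  · have hbox : c y ∈ box N a b := fun i => by
      rw [hc]; exact ⟨by linarith [(y01 y i).1], y0b y i⟩
    constructor
    · rintro ⟨-, i, h, hx⟩
      have hb1 : (b i : ℝ) = a i + 1 := by exact_mod_cast le_antisymm (hba i) h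
      rw [hc, show y0 _ i = _ from hce _ ⟨i, h⟩, hb1] at hx
      refine ⟨e.symm ⟨i, h⟩, hx.imp (fun h => Subtype.ext ?_) (fun h => Subtype.ext ?_)⟩
      · simpa using h
      · simpa using h
    · rintro ⟨j, hj⟩
      have hb1 : (b (e j).1 : ℝ) = a (e j).1 + 1 := by
        exact_mod_cast le_antisymm (hba _) (e j).2
      refine ⟨hbox, (e j).1, (e j).2, ?_⟩
      rw [hc, hce, hb1, Equiv.symm_apply_apply]
      exact hj.imp (fun h => by simp [h]) (fun h => by simp [h])

/-- Small cubes of the grid. -/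
def small (N : ℕ) (Q : Fin n → ℕ) : Set (Cb n) := box N Q (fun i => Q i + 1)

theorem box_principle {N : ℕ} (hN : 0 < N) (R : Cb n → W → Prop) (C : (Fin n → ℕ) → W → Prop)
    (cell : ∀ T : Set (Fin n → ℕ), T.Nonempty → (∀ Q ∈ T, ∀ i, Q i < N) →
      ∀ (m : ℕ) (c : Cb m → Cb n), Continuous c → (∀ Q ∈ T, ∀ y, c y ∈ small N Q) →
      ∀ g : Cb m → W, ContinuousOn g (bd m) →
        (∀ y ∈ bd m, R (c y) (g y) ∧ ∀ Q ∈ T, C Q (g y)) →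
        ∃ g' : Cb m → W, Continuous g' ∧ (∀ y ∈ bd m, g' y = g y) ∧
          ∀ y, R (c y) (g' y) ∧ ∀ Q ∈ T, C Q (g' y))
    (g : Cb n → W) (hg : ContinuousOn g (bd n))
    (hP : ∀ x ∈ bd n, R x (g x) ∧ ∀ Q, (∀ i, Q i < N) → x ∈ small N Q → C Q (g x)) :
    ∃ g' : Cb n → W, Continuous g' ∧ (∀ x ∈ bd n, g' x = g x) ∧
      ∀ x, R x (g' x) ∧ ∀ Q, (∀ i, Q i < N) → x ∈ small N Q → C Q (g' x) := by
  let P : Cb n → W → Prop := fun x w =>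
    R x w ∧ ∀ Q, (∀ i, Q i < N) → x ∈ small N Q → C Q w
  have main : Solv P N (0 : Fin n → ℕ) (fun _ => N) := by
    refine solv_of_cells (fun a b hab hb hba => ?_) _ _ (fun i => Nat.zero_le _) (fun i => le_rfl)
    obtain ⟨m, c, r, hc, hr, hcb, hrc, hcr, hbd⟩ := cell_param hN hab hb hba
    intro g hg hgP
    let T : Set (Fin n → ℕ) := {Q | (∀ i, Q i < N) ∧ ∀ i, Q i ≤ a i ∧ b i ≤ Q i + 1}
    have hT : T.Nonempty := by
      refine ⟨fun i => min (a i) (N - 1), fun i => ?_, fun i => ?_⟩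
      · have := min_le_right (a i) (N - 1); show min _ _ < _; omega
      · refine ⟨min_le_left _ _, ?_⟩
        have h1 := hb i
        have h2 := hba i
        show b i ≤ min (a i) (N - 1) + 1
        rcases le_total (a i) (N - 1) with h | h
        · rw [min_eq_left h]; exact h2
        · rw [min_eq_right h]; omega
    have hTs : ∀ Q ∈ T, ∀ x ∈ box N a b, x ∈ small N Q := by
      intro Q hQ x hx i
      have h1 : (Q i : ℝ) ≤ a i := by exact_mod_cast (hQ.2 i).1
      have h2 : (b i : ℝ) ≤ (Q i + 1 : ℕ) := by exact_mod_cast (hQ.2 i).2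
      exact ⟨h1.trans (hx i).1, (hx i).2.trans h2⟩
    obtain ⟨g', hg', hgg, hgP'⟩ := cell T hT (fun Q hQ => hQ.1) m c hc
      (fun Q hQ y => hTs Q hQ _ (hcb y)) (g ∘ c)
      (hg.comp hc.continuousOn fun y hy => (hbd y).2 hy)
      (fun y hy => by
        have := hgP _ ((hbd y).2 hy)
        exact ⟨this.1, fun Q hQ => this.2 Q hQ.1 (hTs Q hQ _ (hcb y))⟩)
    have hbb : ∀ x ∈ bbd N a b, g' (r x) = g x := fun x hx => by
      have : r x ∈ bd m := (hbd _).1 (by rw [hcr x hx.1]; exact hx)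
      rw [hgg _ this]; simp only [Function.comp, hcr x hx.1]
    refine ⟨g' ∘ r, (hg'.comp hr).continuousOn, hbb, fun x hx => ?_⟩
    by_cases hxb : x ∈ bbd N a b
    · simp only [Function.comp, hbb x hxb]; exact hgP x hxb
    · have := hgP' (r x)
      rw [hcr x hx] at this
      refine ⟨this.1, fun Q hQ hxQ => this.2 Q ⟨hQ, fun i => ?_⟩⟩
      have hxi := hx i
      have hxQi := hxQ i
      by_cases h : a i < b i
      · have hb1 : b i = a i + 1 := le_antisymm (hba i) h
        have hne : ¬ ((N * x i : ℝ) = a i ∨ (N * x i : ℝ) = b i) := fun h' => hxb ⟨hx, i, h, h'⟩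
        push Not at hne
        have h1 : (a i : ℝ) < N * x i := lt_of_le_of_ne hxi.1 (Ne.symm hne.1)
        have h2 : (N * x i : ℝ) < b i := lt_of_le_of_ne hxi.2 hne.2
        have h3 : a i < Q i + 1 := by exact_mod_cast h1.trans_le hxQi.2
        have h4 : Q i < b i := by exact_mod_cast hxQi.1.trans_lt h2
        omega
      · have hb1 : b i = a i := le_antisymm (not_lt.1 h) (hab i)
        rw [hb1] at hxi ⊢
        have h3 : Q i ≤ a i := by exact_mod_cast hxQi.1.trans hxi.2
        have h4 : a i ≤ Q i + 1 := by exact_mod_cast hxi.1.trans hxQi.2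
        exact ⟨h3, h4⟩
  obtain ⟨g', hg', hgg, hP'⟩ := main g (by rwa [bbd_full hN]) (by rwa [bbd_full hN])
  rw [bbd_full hN] at hgg
  rw [box_full] at hg' hP'
  exact ⟨g', continuousOn_univ.1 hg', hgg, fun x => hP' x trivial⟩

theorem exists_grid {ι : Type*} (β : ι → Set (Cb n)) (hβ : ∀ k, IsOpen (β k))
    (hc : ∀ x, ∃ k, x ∈ β k) :
    ∃ N : ℕ, 0 < N ∧ ∀ Q : Fin n → ℕ, (∀ i, Q i < N) → ∃ k, small N Q ⊆ β k := by
  obtain ⟨δ, hδ, hL⟩ := lebesgue_number_lemma_of_metric (isCompact_univ (X := Cb n)) hβ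
    (fun x _ => mem_iUnion.2 (hc x))
  obtain ⟨N, hN⟩ := exists_nat_gt (1 / δ)
  have hN0 : (0 : ℝ) < N := lt_trans (by positivity) hN
  refine ⟨N, by exact_mod_cast hN0, fun Q hQ => ?_⟩
  let x : Cb n := fun i => cl (Q i / N)
  have hx : ∀ i, (N * x i : ℝ) = Q i := fun i => by
    have h1 : (Q i : ℝ) ≤ N := by exact_mod_cast (hQ i).le
    have : ((x i : I) : ℝ) = Q i / N := coe_cl (by positivity) ((div_le_one hN0).2 h1)
    rw [this]; field_simp
  obtain ⟨k, hk⟩ := hL x trivial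
  refine ⟨k, fun y hy => hk ?_⟩
  rw [mem_ball, dist_pi_lt_iff hδ]
  intro i
  have hyi := hy i
  push_cast at hyi
  rw [← hx i] at hyi
  have h1 : 1 < N * δ := by rwa [div_lt_iff₀ hδ] at hN
  have h2 : 0 ≤ (y i : ℝ) - x i := by
    by_contra h
    push Not at h
    nlinarith
  show |(y i : ℝ) - x i| < δ
  rw [abs_of_nonneg h2]
  nlinarith

end

end LoopModel

namespace LoopModel

section
variable {A B E : Type*} [TopologicalSpace A] [TopologicalSpace B] [TopologicalSpace E]

theorem exists_factor {K D W : Type*} [TopologicalSpace K] [TopologicalSpace D]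
    [TopologicalSpace W] {j : D → W} (hj : Topology.IsInducing j) [Nonempty D] {g : K → W}
    {s : Set K} (hg : ContinuousOn g s) (h : ∀ x ∈ s, ∃ d, j d = g x) :
    ∃ a : K → D, ContinuousOn a s ∧ ∀ x ∈ s, j (a x) = g x := by
  classical
  let a : K → D := fun x => if h : ∃ d, j d = g x then h.choose else Classical.arbitrary D
  have ha : ∀ x ∈ s, j (a x) = g x := fun x hx => by
    simp only [a, dif_pos (h x hx)]; exact (h x hx).choose_spec
  exact ⟨a, hj.continuousOn_iff.2 (hg.congr ha), ha⟩

/-- Two sets indexed by a Boolean. -/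
def two (U V : Set B) (k : Bool) : Set B := if k then U else V

theorem inter_two {B : Type*} {U V : Set B} {ι : Type*} {T : Set ι} (hT : T.Nonempty)
    (k : ι → Bool) :
    (⋂ Q ∈ T, two U V (k Q)) = U ∨ (⋂ Q ∈ T, two U V (k Q)) = V ∨
      (⋂ Q ∈ T, two U V (k Q)) = U ∩ V := by
  obtain ⟨Q₀, hQ₀⟩ := hT
  by_cases h1 : ∀ Q ∈ T, k Q = true
  · left
    refine Subset.antisymm (fun x hx => ?_) (fun x hx => ?_)
    · have := mem_iInter₂.1 hx Q₀ hQ₀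
      rwa [h1 _ hQ₀] at this
    · refine mem_iInter₂.2 fun Q hQ => ?_
      rw [h1 _ hQ]; exact hx
  · by_cases h2 : ∀ Q ∈ T, k Q = false
    · right; left
      refine Subset.antisymm (fun x hx => ?_) (fun x hx => ?_)
      · have := mem_iInter₂.1 hx Q₀ hQ₀
        rwa [h2 _ hQ₀] at this
      · refine mem_iInter₂.2 fun Q hQ => ?_
        rw [h2 _ hQ]; exact hx
    · right; right
      push Not at h1 h2
      obtain ⟨Q₁, hQ₁, e1⟩ := h1
      obtain ⟨Q₂, hQ₂, e2⟩ := h2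
      simp only [ne_eq, Bool.not_eq_true, Bool.not_eq_false] at e1 e2
      refine Subset.antisymm (fun x hx => ?_) (fun x hx => ?_)
      · have h1 := mem_iInter₂.1 hx Q₁ hQ₁
        have h2 := mem_iInter₂.1 hx Q₂ hQ₂
        rw [e1] at h1; rw [e2] at h2
        exact ⟨h2, h1⟩
      · refine mem_iInter₂.2 fun Q hQ => ?_
        cases h : k Q
        · exact hx.2
        · exact hx.1

/-- Forgetting the subset containing the path. -/
def NS.incl (f : A → B) (S : Set B) (z : NS f S) : NS f (univ : Set B) :=
  ⟨z.1, z.2.1, fun _ => trivial⟩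

theorem NS.isInducing_incl {f : A → B} {S : Set B} : Topology.IsInducing (NS.incl f S) := by
  refine Topology.IsInducing.of_comp (g := fun z : NS f (univ : Set B) => z.1) ?_ ?_ ?_
  · exact Continuous.subtype_mk NS.continuous_val _
  · exact NS.continuous_val
  · exact Topology.IsInducing.subtypeVal

theorem WE.local {f : A → B} (hf : Continuous f) {U V : Set B} (hU : IsOpen U) (hV : IsOpen V)
    (hUV : ∀ b, b ∈ U ∨ b ∈ V) (h1 : WE (U.restrictPreimage f)) (h2 : WE (V.restrictPreimage f))
    (h3 : WE ((U ∩ V).restrictPreimage f)) : WE f := by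
  classical
  refine ⟨?_, fun n b a hb ha hab => ?_⟩
  · rintro ⟨b⟩
    rcases hUV b with h | h
    · obtain ⟨z⟩ := h1.1 ⟨⟨b, h⟩⟩; exact ⟨z.1⟩
    · obtain ⟨z⟩ := h2.1 ⟨⟨b, h⟩⟩; exact ⟨z.1⟩
  have hopen : ∀ k, IsOpen (two U V k) := by rintro (_ | _); exacts [hV, hU]
  obtain ⟨N, hN, hgrid⟩ := exists_grid (fun k => b ⁻¹' two U V k) (fun k => (hopen k).preimage hb)
    (fun x => (hUV (b x)).elim (fun h => ⟨true, h⟩) (fun h => ⟨false, h⟩))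
  choose! k hk using hgrid
  let g : Cb n → NS f (univ : Set B) := fun x => NS.const f univ ⟨a x, trivial⟩
  have hgc : ContinuousOn g (bd n) := by
    refine (NS.he_const hf).1.comp_continuousOn ?_
    exact Topology.IsInducing.subtypeVal.continuousOn_iff.2 ha
  have hbp := box_principle hN (fun x (w : NS f (univ : Set B)) => w.1.2 1 = b x)
    (fun Q w => ∀ t, w.1.2 t ∈ two U V (k Q)) ?_ g hgc ?_
  · obtain ⟨g', hg', hgg, hP⟩ := hbp
    refine ⟨fun x => (g' x).1.1, continuous_fst.comp (NS.continuous_val.comp hg'), fun x hx => ?_,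
      fun z => (g' z.2).1.2 z.1, ?_, fun x => ?_, fun x => ?_, fun x hx t => ?_⟩
    · show (g' x).1.1 = a x
      rw [hgg x hx]; rfl
    · have : Continuous fun x => (g' x).1.2 := continuous_snd.comp (NS.continuous_val.comp hg')
      fun_prop
    · exact (g' x).2.1
    · exact (hP x).1
    · show (g' x).1.2 t = f (g' x).1.1
      rw [hgg x hx]; rfl
  · intro T hT hTN m c hc hcT g hg hgP
    set O := ⋂ Q ∈ T, two U V (k Q) with hO
    have tf : TF (NS.ev : NS f O → O) := by
      rcases inter_two (U := U) (V := V) hT k with h | h | h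
      · rw [hO, h]; exact NS.tf_ev hf h1
      · rw [hO, h]; exact NS.tf_ev hf h2
      · rw [hO, h]; exact NS.tf_ev hf h3
    have hbO : ∀ y, b (c y) ∈ O := fun y => mem_iInter₂.2 fun Q hQ =>
      hk Q (hTN Q hQ) (hcT Q hQ y)
    have : Nonempty (NS f O) := tf.1 ⟨⟨_, hbO (fun _ => 0)⟩⟩
    obtain ⟨a₁, ha₁, haa⟩ := exists_factor (NS.isInducing_incl (f := f) (S := O)) hg
      (fun y hy => ⟨⟨(g y).1, (g y).2.1, fun t => mem_iInter₂.2 fun Q hQ => (hgP y hy).2 Q hQ t⟩,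
        rfl⟩)
    obtain ⟨a₂, ha₂, h4, h5⟩ := tf.2 m (fun y => ⟨b (c y), hbO y⟩) a₁
      (Continuous.subtype_mk (hb.comp hc) _) ha₁
      (fun y hy => Subtype.ext (by
        show (a₁ y).1.2 1 = b (c y)
        rw [← (hgP y hy).1, ← haa y hy]; rfl))
    refine ⟨fun y => NS.incl f O (a₂ y), NS.isInducing_incl.continuous.comp ha₂, fun y hy => ?_,
      fun y => ⟨congrArg Subtype.val (h5 y), fun Q hQ t => ?_⟩⟩
    · simp only [h4 y hy]; exact haa y hy
    · exact mem_iInter₂.1 ((a₂ y).2.2 t) Q hQ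
  · intro x hx
    refine ⟨hab x hx, fun Q hQ hxQ t => ?_⟩
    have := hk Q hQ hxQ
    rw [mem_preimage, ← hab x hx] at this
    exact this

end

end LoopModel

namespace LoopModel

section
variable {A B E : Type*} [TopologicalSpace A] [TopologicalSpace B] [TopologicalSpace E]

/-- Points with a path in `S` from their image to a point of `Y`. -/
abbrev MS (p : E → B) (S Y : Set B) : Type _ := {z : NS p S // (z.ev : B) ∈ Y}

/-- The endpoint of the path. -/
def MS.ev {p : E → B} {S Y : Set B} (z : MS p S Y) : Y := ⟨z.1.ev, z.2⟩

theorem MS.continuous_ev {p : E → B} {S Y : Set B} : Continuous (MS.ev : MS p S Y → Y) := by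
  refine Continuous.subtype_mk ?_ _
  exact continuous_subtype_val.comp (NS.continuous_ev.comp continuous_subtype_val)

theorem MS.fib_ev {p : E → B} {S Y : Set B} (hYS : Y ⊆ S) : Fib (MS.ev : MS p S Y → Y) := by
  intro Z _ h d hh hd hhd
  obtain ⟨H, hH, H0, H1⟩ := NS.fib_ev Z (fun y => inclusion hYS (h y)) (fun z => (d z).1)
    ((continuous_inclusion hYS).comp hh) (by fun_prop)
    (fun z => Subtype.ext (show (MS.ev (d z) : B) = h (0, z) from congrArg Subtype.val (hhd z)))
  have hv : ∀ y, ((H y).ev : B) = h y := fun y => congrArg Subtype.val (H1 y)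
  have hY : ∀ y, ((H y).ev : B) ∈ Y := fun y => by rw [hv]; exact (h y).2
  exact ⟨fun y => ⟨H y, hY y⟩, hH.subtype_mk hY,
    fun z => Subtype.ext (H0 z), fun y => Subtype.ext (hv y)⟩

/-- Enlarging the set containing the path. -/
def NS.mono (p : E → B) {Y S : Set B} (hYS : Y ⊆ S) (z : NS p Y) : NS p S :=
  ⟨z.1, z.2.1, fun t => hYS (z.2.2 t)⟩

theorem NS.continuous_mono {p : E → B} {Y S : Set B} (hYS : Y ⊆ S) :
    Continuous (NS.mono p hYS) := Continuous.subtype_mk NS.continuous_val _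

/-- The inclusion of `NS p Y` into `MS p S Y`. -/
def MS.incl (p : E → B) {Y S : Set B} (hYS : Y ⊆ S) (z : NS p Y) : MS p S Y :=
  ⟨z.mono p hYS, z.ev.2⟩

theorem MS.isInducing_incl {p : E → B} {Y S : Set B} (hYS : Y ⊆ S) :
    Topology.IsInducing (MS.incl p hYS) := by
  refine Topology.IsInducing.of_comp (g := fun z : MS p S Y => z.1.1) ?_ ?_ ?_
  · exact Continuous.subtype_mk (NS.continuous_mono hYS) _
  · exact NS.continuous_val.comp continuous_subtype_val
  · exact Topology.IsInducing.subtypeVal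

/-- Constant paths. -/
def MS.const (p : E → B) {Y S : Set B} (hYS : Y ⊆ S) (e : p ⁻¹' Y) : MS p S Y :=
  MS.incl p hYS (NS.const p Y e)

theorem MS.we_incl {p : E → B} (hp : Continuous p) {Y S : Set B} (hYS : Y ⊆ S)
    (h : WE (MS.const p hYS)) : WE (MS.incl p hYS) :=
  WE.of_comp_right (MS.isInducing_incl hYS).continuous (NS.he_const hp) h

theorem MS.extend {p : E → B} (hp : Continuous p) {Y S : Set B} (hYS : Y ⊆ S)
    (hw : WE (MS.const p hYS)) {n : ℕ} {h : I × Cb n → S} {d : I × Cb n → NS p S}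
    (hh : Continuous h) (hd : ContinuousOn d (Cyl (bd n))) (hdh : ∀ z ∈ Cyl (bd n), (d z).ev = h z)
    (h1 : ∀ x, (h (1, x) : B) ∈ Y) (hd1 : ∀ x ∈ bd n, ∀ t, (d (1, x)).1.2 t ∈ Y) :
    ∃ H : I × Cb n → NS p S, Continuous H ∧ (∀ z ∈ Cyl (bd n), H z = d z) ∧
      (∀ z, (H z).ev = h z) ∧ ∀ x t, (H (1, x)).1.2 t ∈ Y := by
  classical
  obtain ⟨ω, hω, ωd, ωh⟩ := (goodPair_bd n).relLift NS.fib_ev hh hd hdh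
  let w : Cb n → MS p S Y := fun x => ⟨ω (1, x), by rw [ωh]; exact h1 x⟩
  have hwc : Continuous w := Continuous.subtype_mk (by fun_prop) _
  have hwe := MS.we_incl hp hYS hw
  have : Nonempty (NS p Y) := hwe.1 ⟨w fun _ => 0⟩
  obtain ⟨a, ha, haw⟩ := exists_factor (MS.isInducing_incl (p := p) hYS)
    (hwc.continuousOn (s := bd n)) (fun x hx => by
      have e := ωd (1, x) (Or.inr hx)
      refine ⟨⟨(ω (1, x)).1, (ω (1, x)).2.1, fun t => ?_⟩, rfl⟩
      rw [e]; exact hd1 x hx t)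
  obtain ⟨a', v, ha', haa, hv, v0, v1, vq, vbd⟩ := vertical_compress
    (MS.isInducing_incl (p := p) hYS).continuous MS.continuous_ev hwe (MS.fib_ev hYS)
    (show Fib (MS.ev ∘ MS.incl p hYS) from NS.fib_ev) hwc ha haw
  let d' : I × (I × Cb n) → NS p S := fun z =>
    if z.2.1 = 1 then (v (σ z.1, z.2.2)).1 else ω z.2
  have e1 : ∀ z ∈ {z : I × (I × Cb n) | z.2.1 = 1}, d' z = (v (σ z.1, z.2.2)).1 :=
    fun z hz => if_pos hz
  have e2 : ∀ z ∈ {z : I × (I × Cb n) | z.1 = 0 ∨ z.2.1 = 0 ∨ z.2.2 ∈ bd n}, d' z = ω z.2 := by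
    rintro ⟨s, t, x⟩ hz
    by_cases ht : t = 1
    · subst ht
      refine (if_pos rfl).trans ?_
      show (v (σ s, x)).1 = (w x).1
      rcases hz with hz | hz | hz
      · obtain rfl : s = 0 := hz
        rw [unitInterval.symm_zero, v1]
      · exact absurd hz (by simp)
      · rw [vbd x hz]
    · exact if_neg ht
  have hd' : ContinuousOn d' (Cyl (dbl (bd n))) := by
    have : Cyl (dbl (bd n)) = {z : I × (I × Cb n) | z.2.1 = 1} ∪
        {z : I × (I × Cb n) | z.1 = 0 ∨ z.2.1 = 0 ∨ z.2.2 ∈ bd n} := by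
      ext z; simp only [Cyl, dbl, mem_ofPred_eq, mem_union]; tauto
    rw [this]
    have hbd := isClosed_bd n
    refine ContinuousOn.union_of_isClosed (ContinuousOn.congr (by fun_prop) e1)
      (ContinuousOn.congr (by fun_prop) e2) (isClosed_eq (by fun_prop) (by fun_prop)) ?_
    exact (isClosed_eq (by fun_prop) (by fun_prop)).union
      ((isClosed_eq (by fun_prop) (by fun_prop)).union (hbd.preimage (by fun_prop)))
  have hq : ∀ z ∈ Cyl (dbl (bd n)), (d' z).ev = h z.2 := by
    rintro ⟨s, t, x⟩ -
    by_cases ht : t = 1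
    · subst ht
      rw [e1 _ rfl]
      have := vq (σ s) x
      refine Subtype.ext ?_
      rw [show (v (σ s, x)).1.ev.1 = (v (σ s, x)).ev.1 from rfl, this]
      exact congrArg Subtype.val (ωh (1, x))
    · rw [show d' (s, t, x) = ω (t, x) from if_neg ht]
      exact ωh _
  obtain ⟨H, hH, Hd, Hh⟩ := (goodPair_prism n).relLift NS.fib_ev (h := fun z => h z.2)
    (by fun_prop) hd' hq
  refine ⟨fun z => H (1, z), by fun_prop, fun z hz => ?_, fun z => Hh _, fun x t => ?_⟩
  · show H (1, z) = d z
    rw [Hd _ (Or.inr (by rcases hz with hz | hz; exacts [Or.inl hz, Or.inr (Or.inr hz)])),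
      e2 _ (by rcases hz with hz | hz; exacts [Or.inr (Or.inl hz), Or.inr (Or.inr hz)])]
    exact ωd z hz
  · have e : H (1, (1, x)) = (v (σ 1, x)).1 :=
      (Hd (1, (1, x)) (Or.inr (Or.inr (Or.inl rfl)))).trans (e1 (1, (1, x)) rfl)
    show (H (1, (1, x))).1.2 t ∈ Y
    rw [e, unitInterval.symm_one, v0]
    exact (a' x).2.2 t

end

end LoopModel

namespace LoopModel

section
variable {A B E : Type*} [TopologicalSpace A] [TopologicalSpace B] [TopologicalSpace E]

theorem WE.const_self {p : E → B} (hp : Continuous p) {Y S : Set B} (hYS : Y ⊆ S) (h : Y = S) :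
    WE (MS.const p hYS) := by
  subst h
  refine (HE.comp (g := MS.incl p hYS) ⟨(MS.isInducing_incl hYS).continuous, fun z => z.1,
    continuous_subtype_val, ?_, ?_⟩ (NS.he_const hp)).we
  · exact Htpy.refl continuous_id
  · exact Htpy.refl continuous_id

/-- The hypothesis that the restriction to the intersection controls both pieces. -/
def Glue (p : E → B) (U V : Set B) : Prop :=
  WE (MS.const p (inter_subset_left : U ∩ V ⊆ U)) ∧
    WE (MS.const p (inter_subset_right : U ∩ V ⊆ V))

theorem Glue.we {p : E → B} (hp : Continuous p) {U V S S' Y : Set B} (hG : Glue p U V)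
    (hS : S = U ∨ S = V ∨ S = U ∩ V) (hS' : S' = U ∨ S' = V ∨ S' = U ∩ V) (hYS : Y ⊆ S)
    (hY : Y = S ∩ S') : WE (MS.const p hYS) := by
  have key : S ⊆ S' ∨ (S = U ∧ S ∩ S' = U ∩ V) ∨ (S = V ∧ S ∩ S' = U ∩ V) := by
    rcases hS with rfl | rfl | rfl <;> rcases hS' with rfl | rfl | rfl
    · exact Or.inl Subset.rfl
    · exact Or.inr (Or.inl ⟨rfl, rfl⟩)
    · exact Or.inr (Or.inl ⟨rfl, by rw [← inter_assoc, inter_self]⟩)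
    · exact Or.inr (Or.inr ⟨rfl, inter_comm _ _⟩)
    · exact Or.inl Subset.rfl
    · exact Or.inr (Or.inr ⟨rfl, by rw [inter_comm, inter_assoc, inter_self]⟩)
    · exact Or.inl inter_subset_left
    · exact Or.inl inter_subset_right
    · exact Or.inl Subset.rfl
  rcases key with h | ⟨rfl, h⟩ | ⟨rfl, h⟩
  · exact WE.const_self hp hYS (hY.trans (inter_eq_left.2 h))
  · rw [h] at hY; subst hY; exact hG.1
  · rw [h] at hY; subst hY; exact hG.2

/-- The path is contained in `S`. -/
def NS.In {p : E → B} (z : NS p (univ : Set B)) (S : Set B) : Prop := ∀ t, z.1.2 t ∈ S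

theorem Glue.slab {p : E → B} (hp : Continuous p) {U V : Set B} (hG : Glue p U V) {n N : ℕ}
    (hN : 0 < N) {κ κ' : (Fin n → ℕ) → Bool} {h : I × Cb n → B} (hh : Continuous h)
    (h1 : ∀ Q, (∀ i, Q i < N) → ∀ x ∈ small N Q, ∀ s, h (s, x) ∈ two U V (κ Q))
    (h2 : ∀ Q, (∀ i, Q i < N) → ∀ x ∈ small N Q, h (1, x) ∈ two U V (κ' Q))
    {start : Cb n → NS p (univ : Set B)} (hs : Continuous start)
    (hsh : ∀ x, ((start x).ev : B) = h (0, x))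
    (hsD : ∀ Q, (∀ i, Q i < N) → ∀ x ∈ small N Q, (start x).In (two U V (κ Q)))
    {d : I × Cb n → NS p (univ : Set B)} (hd : ContinuousOn d {z | z.2 ∈ bd n})
    (hdh : ∀ x ∈ bd n, ∀ s, ((d (s, x)).ev : B) = h (s, x))
    (hds : ∀ x ∈ bd n, d (0, x) = start x)
    (hdD : ∀ Q, (∀ i, Q i < N) → ∀ x ∈ small N Q, x ∈ bd n →
      (∀ s, (d (s, x)).In (two U V (κ Q))) ∧ (d (1, x)).In (two U V (κ' Q))) :
    ∃ H : I × Cb n → NS p (univ : Set B), Continuous H ∧ (∀ x, H (0, x) = start x) ∧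
      (∀ x ∈ bd n, ∀ s, H (s, x) = d (s, x)) ∧ (∀ z, ((H z).ev : B) = h z) ∧
      ∀ Q, (∀ i, Q i < N) → ∀ x ∈ small N Q,
        (∀ s, (H (s, x)).In (two U V (κ Q))) ∧ (H (1, x)).In (two U V (κ' Q)) := by
  classical
  have hdx : ∀ x ∈ bd n, Continuous fun s => d (s, x) := fun x hx =>
    hd.comp_continuous (by fun_prop) fun _ => hx
  let g : Cb n → C(I, NS p (univ : Set B)) := fun x =>
    if hx : x ∈ bd n then ⟨fun s => d (s, x), hdx x hx⟩ else .const I (start x)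
  have hgx : ∀ x ∈ bd n, ∀ s, g x s = d (s, x) := fun x hx s => by
    simp only [g, dif_pos hx]; rfl
  have hg : ContinuousOn g (bd n) := by
    rw [continuousOn_iff_continuous_domRestrict]
    refine ContinuousMap.continuous_of_continuous_uncurry _ ?_
    refine (hd.comp_continuous (f := fun y : bd n × I => (y.2, y.1.1)) (by fun_prop)
      (fun y => y.1.2)).congr fun y => ?_
    exact (hgx y.1.1 y.1.2 y.2).symm
  have hbp := box_principle hN
    (fun x (w : C(I, NS p (univ : Set B))) => w 0 = start x ∧ ∀ s, ((w s).ev : B) = h (s, x))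
    (fun Q w => (∀ s, (w s).In (two U V (κ Q))) ∧ (w 1).In (two U V (κ' Q))) ?_ g hg
    (fun x hx => ⟨⟨by rw [hgx x hx, hds x hx], fun s => by rw [hgx x hx, hdh x hx]⟩,
      fun Q hQ hxQ => by
        obtain ⟨h3, h4⟩ := hdD Q hQ x hxQ hx
        exact ⟨fun s => by rw [hgx x hx]; exact h3 s, by rw [hgx x hx]; exact h4⟩⟩)
  · obtain ⟨g', hg', hgg, hP⟩ := hbp
    refine ⟨fun z => g' z.2 z.1, by fun_prop, fun x => (hP x).1.1, fun x hx s => ?_,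
      fun z => (hP z.2).1.2 z.1, fun Q hQ x hx => (hP x).2 Q hQ hx⟩
    show g' x s = _
    rw [hgg x hx, hgx x hx]
  intro T hT hTN m c hc hcT g hg hgP
  let O := ⋂ Q ∈ T, two U V (κ Q)
  let O' := ⋂ Q ∈ T, two U V (κ' Q)
  have hO : ∀ z : I × Cb m, h (z.1, c z.2) ∈ O := fun z => mem_iInter₂.2 fun Q hQ =>
    h1 Q (hTN Q hQ) _ (hcT Q hQ _) _
  have hO' : ∀ y, h (1, c y) ∈ O ∩ O' := fun y => ⟨hO (1, y), mem_iInter₂.2 fun Q hQ =>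
    h2 Q (hTN Q hQ) _ (hcT Q hQ _)⟩
  let d' : I × Cb m → NS p (univ : Set B) := fun z => if z.1 = 0 then start (c z.2) else g z.2 z.1
  have e1 : ∀ z ∈ {z : I × Cb m | z.1 = 0}, d' z = start (c z.2) := fun z hz => if_pos hz
  have e2 : ∀ z ∈ {z : I × Cb m | z.2 ∈ bd m}, d' z = g z.2 z.1 := by
    rintro ⟨s, y⟩ hy
    by_cases hs : s = 0
    · subst hs
      exact (if_pos rfl).trans (hgP y hy).1.1.symm
    · exact if_neg hs
  have hd' : ContinuousOn d' (Cyl (bd m)) := by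
    refine ContinuousOn.union_of_isClosed (s := {z : I × Cb m | z.1 = 0})
      (t := {z : I × Cb m | z.2 ∈ bd m}) (ContinuousOn.congr (by fun_prop) e1)
      (ContinuousOn.congr ?_ e2) (isClosed_eq (by fun_prop) (by fun_prop))
      ((isClosed_bd m).preimage continuous_snd)
    have h3 : ContinuousOn (fun z : I × Cb m => g z.2) {z : I × Cb m | z.2 ∈ bd m} :=
      hg.comp continuousOn_snd (fun z hz => hz)
    exact ContinuousEval.continuous_eval.comp_continuousOn (h3.prodMk continuousOn_fst)
  have hdI : ∀ z ∈ Cyl (bd m), (d' z).In O ∧ ((d' z).ev : B) = h (z.1, c z.2) := by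
    rintro ⟨s, y⟩ (hz | hz)
    · obtain rfl : s = 0 := hz
      rw [e1 (0, y) rfl]
      exact ⟨fun t => mem_iInter₂.2 fun Q hQ => hsD Q (hTN Q hQ) _ (hcT Q hQ y) t, hsh _⟩
    · rw [e2 (s, y) hz]
      exact ⟨fun t => mem_iInter₂.2 fun Q hQ => ((hgP y hz).2 Q hQ).1 s t, (hgP y hz).1.2 s⟩
  have : Nonempty (NS p O) := by
    have := (hdI (0, fun _ => 0) (Or.inl rfl)).1
    exact ⟨⟨(d' (0, fun _ => 0)).1, (d' (0, fun _ => 0)).2.1, this⟩⟩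
  obtain ⟨a, ha, hai⟩ := exists_factor (NS.isInducing_incl (f := p) (S := O)) hd'
    (fun z hz => ⟨⟨(d' z).1, (d' z).2.1, (hdI z hz).1⟩, rfl⟩)
  have hv : ∀ z ∈ Cyl (bd m), (a z).1 = (d' z).1 := fun z hz => congrArg Subtype.val (hai z hz)
  obtain ⟨H, hH, Hd, Hh, H1⟩ := MS.extend hp (Y := O ∩ O') (S := O) inter_subset_left
    (hG.we hp (inter_two hT κ) (inter_two hT κ') inter_subset_left rfl)
    (h := fun z => ⟨h (z.1, c z.2), hO z⟩) (d := a) (Continuous.subtype_mk (by fun_prop) _) ha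
    (fun z hz => Subtype.ext (by
      show (a z).1.2 1 = _
      rw [hv z hz]; exact (hdI z hz).2)) hO'
    (fun y hy t => by
      have hz : ((1 : I), y) ∈ Cyl (bd m) := Or.inr hy
      rw [hv _ hz]
      refine ⟨(hdI _ hz).1 t, mem_iInter₂.2 fun Q hQ => ?_⟩
      rw [e2 _ hy]
      exact ((hgP y hy).2 Q hQ).2 t)
  have hHc := (NS.isInducing_incl (f := p) (S := O)).continuous.comp hH
  have hHz : ∀ z ∈ Cyl (bd m), NS.incl p O (H z) = d' z := fun z hz => by
    rw [Hd z hz, hai z hz]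
  refine ⟨fun y => ⟨fun s => NS.incl p O (H (s, y)),
    hHc.comp (by fun_prop : Continuous fun s : I => (s, y))⟩, ?_, fun y hy => ?_, fun y => ?_⟩
  · refine ContinuousMap.continuous_of_continuous_uncurry _ ?_
    show Continuous fun z : Cb m × I => NS.incl p O (H (z.2, z.1))
    exact hHc.comp (by fun_prop : Continuous fun z : Cb m × I => (z.2, z.1))
  · refine ContinuousMap.ext fun s => ?_
    exact (hHz (s, y) (Or.inr hy)).trans (e2 (s, y) hy)
  · refine ⟨⟨(hHz (0, y) (Or.inl rfl)).trans (e1 (0, y) rfl),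
      fun s => congrArg Subtype.val (Hh (s, y))⟩, fun Q hQ => ⟨fun s t => ?_, fun t => ?_⟩⟩
    · exact mem_iInter₂.1 ((H (s, y)).2.2 t) Q hQ
    · exact mem_iInter₂.1 (H1 y t).2 Q hQ

end

end LoopModel

namespace LoopModel

section
variable {A B E : Type*} [TopologicalSpace A] [TopologicalSpace B] [TopologicalSpace E]

/-- Paths from a point to a set. -/
abbrev PSp (N : Type*) [TopologicalSpace N] (n₀ : N) (S : Set N) : Type _ :=
  {ω : C(I, N) // ω 0 = n₀ ∧ ω 1 ∈ S}

/-- Functoriality of path spaces. -/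
def PSp.map {n₀ : A} {S : Set A} {b₀ : B} {S' : Set B} (f : A → B) (hf : Continuous f)
    (h₀ : f n₀ = b₀) (hS : ∀ z ∈ S, f z ∈ S') (ω : PSp A n₀ S) : PSp B b₀ S' :=
  ⟨(⟨f, hf⟩ : C(A, B)).comp ω.1, (congrArg f ω.2.1).trans h₀, hS _ ω.2.2⟩

theorem PSp.continuous_map {n₀ : A} {S : Set A} {b₀ : B} {S' : Set B} {f : A → B}
    (hf : Continuous f) (h₀ : f n₀ = b₀) (hS : ∀ z ∈ S, f z ∈ S') :
    Continuous (PSp.map f hf h₀ hS) :=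
  Continuous.subtype_mk ((ContinuousMap.continuous_postcomp _).comp continuous_subtype_val) _

/-- Points with a path in one of the two sets. -/
abbrev Sh (p : E → B) (U V : Set B) : Type _ := {z : NS p (univ : Set B) // z.In U ∨ z.In V}

/-- The endpoint. -/
def Sh.ev {p : E → B} {U V : Set B} (z : Sh p U V) : B := z.1.ev

theorem Sh.continuous_ev {p : E → B} {U V : Set B} : Continuous (Sh.ev : Sh p U V → B) :=
  continuous_subtype_val.comp (NS.continuous_ev.comp continuous_subtype_val)

theorem NS.In.two {E : Type*} {p : E → B} {U V : Set B} {z : NS p (univ : Set B)} {k : Bool}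
    (h : z.In (two U V k)) : z.In U ∨ z.In V := by
  cases k
  · exact Or.inr h
  · exact Or.inl h

theorem NS.isOpen_in {p : E → B} {U : Set B} (hU : IsOpen U) :
    IsOpen {z : NS p (univ : Set B) | z.In U} := by
  have h : Continuous fun z : NS p (univ : Set B) => z.1.2 :=
    continuous_snd.comp NS.continuous_val
  have := (ContinuousMap.isOpen_setOfPred_mapsTo (isCompact_univ (X := I)) hU).preimage h
  convert this using 1
  ext z; simp [NS.In, MapsTo]

theorem exists_small {n N : ℕ} (hN : 0 < N) (x : Cb n) :
    ∃ Q : Fin n → ℕ, (∀ i, Q i < N) ∧ x ∈ small N Q := by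
  refine ⟨fun i => min ⌊(N * x i : ℝ)⌋₊ (N - 1), fun i => by simp only; omega, fun i => ?_⟩
  have h0 : (0 : ℝ) ≤ N * x i := mul_nonneg (Nat.cast_nonneg _) (x i).2.1
  have h1 : (N * x i : ℝ) ≤ N := by
    have := (x i).2.2
    have h2 : (0 : ℝ) ≤ N := Nat.cast_nonneg _
    nlinarith
  refine ⟨le_trans (by exact_mod_cast min_le_left _ _) (Nat.floor_le h0), ?_⟩
  rcases le_total ⌊(N * x i : ℝ)⌋₊ (N - 1) with h | h
  · simp only [min_eq_left h]
    push_cast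
    exact (Nat.lt_floor_add_one _).le
  · simp only [min_eq_right h]
    rw [Nat.sub_add_cancel hN]
    exact h1

set_option maxHeartbeats 1000000 in
theorem Glue.tf {p : E → B} (hp : Continuous p) {U V : Set B} (hU : IsOpen U) (hV : IsOpen V)
    (hUV : ∀ b, b ∈ U ∨ b ∈ V) (hG : Glue p U V) {b₀ : B} (hb₀ : b₀ ∉ U) {n₀ : Sh p U V}
    (hn₀ : n₀.ev = b₀) :
    TF (PSp.map (Sh.ev : Sh p U V → B) Sh.continuous_ev hn₀
      (fun _ hz => hz.2 : ∀ z ∈ {z : Sh p U V | z.1.In V ∧ z.ev = b₀}, z.ev ∈ ({b₀} : Set B)) :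
      PSp (Sh p U V) n₀ {z | z.1.In V ∧ z.ev = b₀} → PSp B b₀ {b₀}) := by
  classical
  have hb₀V : b₀ ∈ V := (hUV b₀).resolve_left hb₀
  have notU : ∀ {z : NS p (univ : Set B)}, (z.ev : B) = b₀ → ¬ z.In U := fun {z} hz h => by
    have := h 1
    rw [show z.1.2 1 = b₀ from hz] at this
    exact hb₀ this
  have inV : ∀ {z : Sh p U V}, z.ev = b₀ → z.1.In V := fun {z} hz => z.2.resolve_left (notU hz)
  refine ⟨fun _ => ⟨.const I n₀, rfl, inV hn₀, hn₀⟩, fun n b a hb ha hab => ?_⟩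
  have hbc : Continuous fun x => (b x).1 := continuous_subtype_val.comp hb
  let h : I × Cb n → B := fun z => (b z.2).1 z.1
  have hh : Continuous h := by fun_prop
  let d : I × Cb n → Sh p U V := fun z => (a z.2).1 z.1
  have hd : ContinuousOn d {z | z.2 ∈ bd n} := by
    have h3 : ContinuousOn (fun z : I × Cb n => (a z.2).1) {z : I × Cb n | z.2 ∈ bd n} :=
      (continuous_subtype_val.comp_continuousOn ha).comp continuousOn_snd (fun z hz => hz)
    exact ContinuousEval.continuous_eval.comp_continuousOn (h3.prodMk continuousOn_fst)
  have hdh : ∀ x ∈ bd n, ∀ s, (d (s, x)).ev = h (s, x) := fun x hx s => by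
    have := congrArg (fun w : PSp B b₀ {b₀} => w.1 s) (hab x hx)
    exact this
  have hdv : ContinuousOn (fun z => (d z).1) {z : I × Cb n | z.2 ∈ bd n} :=
    continuous_subtype_val.comp_continuousOn hd
  let β : Bool → Set (I × Cb n) := fun k =>
    {z | h z ∈ two U V k ∧ (z.2 ∈ bd n → (d z).1.In (two U V k))}
  have hopen : ∀ k, IsOpen (two U V k) := by rintro (_ | _); exacts [hV, hU]
  have hβ : ∀ k, IsOpen (β k) := fun k => by
    have hcl : IsClosed {z : I × Cb n | z.2 ∈ bd n} := (isClosed_bd n).preimage continuous_snd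
    obtain ⟨O, hO, hOe⟩ := (continuousOn_iff'.1 hdv) _ (NS.isOpen_in (p := p) (hopen k))
    have : β k = h ⁻¹' two U V k ∩ ({z : I × Cb n | z.2 ∈ bd n}ᶜ ∪ O) := by
      ext z
      simp only [β, mem_ofPred_eq, mem_inter_iff, mem_preimage, mem_union, mem_compl_iff]
      have h4 := Set.ext_iff.1 hOe z
      simp only [mem_inter_iff, mem_preimage, mem_ofPred_eq] at h4
      tauto
    rw [this]
    exact ((hopen k).preimage hh).inter (hcl.isOpen_compl.union hO)
  have hβc : ∀ z, ∃ k, z ∈ β k := by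
    rintro ⟨s, x⟩
    by_cases hx : x ∈ bd n
    · have hk : ∃ k, (d (s, x)).1.In (two U V k) :=
        (d (s, x)).2.elim (fun h => ⟨true, h⟩) (fun h => ⟨false, h⟩)
      obtain ⟨k, hk⟩ := hk
      refine ⟨k, ?_, fun _ => hk⟩
      rw [← hdh x hx s]
      exact hk 1
    · obtain ⟨k, hk⟩ : ∃ k, h (s, x) ∈ two U V k :=
        (hUV (h (s, x))).elim (fun h => ⟨true, h⟩) (fun h => ⟨false, h⟩)
      exact ⟨k, hk, fun h => absurd h hx⟩
  obtain ⟨N, hN, hgrid⟩ := exists_grid (fun k => (prism n).symm ⁻¹' β k)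
    (fun k => (hβ k).preimage (prism n).symm.continuous) (fun x => hβc _)
  choose! k hk using hgrid
  have hNR : (0 : ℝ) < N := by exact_mod_cast hN
  let κ : ℕ → (Fin n → ℕ) → Bool := fun j Q => if j < N then k (Fin.cons j Q) else false
  have key : ∀ j < N, ∀ Q : Fin n → ℕ, (∀ i, Q i < N) → ∀ x ∈ small N Q, ∀ s : I,
      (j : ℝ) ≤ N * s → (N * s : ℝ) ≤ j + 1 → (s, x) ∈ β (κ j Q) := by
    intro j hj Q hQ x hx s h1 h2
    have hmem : prism n (s, x) ∈ small N (Fin.cons j Q : Fin (n + 1) → ℕ) := by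
      intro i
      refine Fin.cases ?_ (fun i => ?_) i
      · exact ⟨by simpa [prism] using h1, by simpa [prism] using h2⟩
      · simpa [prism] using hx i
    have := hk (Fin.cons j Q) (fun i => by
      refine Fin.cases ?_ (fun i => ?_) i
      · simpa using hj
      · simpa using hQ i) hmem
    simpa [κ, hj] using this
  let pt : ℕ → I := fun j => cl (j / N)
  have hpt : ∀ j ≤ N, (N * (pt j : ℝ)) = j := fun j hj => by
    have h1 : (j : ℝ) ≤ N := by exact_mod_cast hj
    rw [show ((pt j : I) : ℝ) = j / N from coe_cl (by positivity) ((div_le_one hNR).2 h1)]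
    field_simp
  have hend : ∀ x, h (1, x) = b₀ := fun x => (b x).2.2
  have key' : ∀ j ≤ N, ∀ Q : Fin n → ℕ, (∀ i, Q i < N) → ∀ x ∈ small N Q,
      (pt j, x) ∈ β (κ j Q) := by
    intro j hj Q hQ x hx
    rcases hj.lt_or_eq with hj' | rfl
    · exact key j hj' Q hQ x hx _ (hpt j hj).ge (by rw [hpt j hj]; linarith)
    · have e : pt j = 1 := cl_of_ge (by rw [div_self hNR.ne'])
      have e2 : κ j Q = false := if_neg (lt_irrefl _)
      rw [e, e2]
      refine ⟨?_, fun hx => ?_⟩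
      · show h (1, x) ∈ V
        rw [hend]; exact hb₀V
      · exact inV ((hdh x hx 1).trans (hend x))
  have ind : ∀ j ≤ N, ∃ H : I × Cb n → NS p (univ : Set B),
      ContinuousOn H {z | (N * z.1 : ℝ) ≤ j} ∧ (∀ x, H (0, x) = n₀.1) ∧
      (∀ z : I × Cb n, (N * z.1 : ℝ) ≤ j → ((H z).ev : B) = h z ∧ ((H z).In U ∨ (H z).In V)) ∧
      (∀ x ∈ bd n, ∀ s : I, (N * s : ℝ) ≤ j → H (s, x) = (d (s, x)).1) ∧
      ∀ Q : Fin n → ℕ, (∀ i, Q i < N) → ∀ x ∈ small N Q, (H (pt j, x)).In (two U V (κ j Q)) := by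
    intro j
    induction j with
    | zero =>
      intro _
      have hz0 : ∀ s : I, (N * s : ℝ) ≤ (0 : ℕ) → s = 0 := fun s hs => by
        have h5 := s.2.1
        have : (s : ℝ) ≤ 0 := by
          by_contra hc
          push Not at hc
          have := mul_pos hNR hc
          push_cast at hs
          linarith
        exact Subtype.ext (le_antisymm this h5)
      refine ⟨fun _ => n₀.1, continuousOn_const, fun _ => rfl, ?_, ?_, ?_⟩
      · rintro ⟨s, x⟩ hs
        obtain rfl := hz0 s hs
        exact ⟨hn₀.trans (b x).2.1.symm, n₀.2⟩
      · intro x hx s hs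
        obtain rfl := hz0 s hs
        exact congrArg Subtype.val (a x).2.1.symm
      · intro Q hQ x hx
        have := (key' 0 (Nat.zero_le _) Q hQ x hx).1
        have e : pt 0 = 0 := by simp [pt]
        rw [e, show h (0, x) = b₀ from (b x).2.1] at this
        cases h6 : κ 0 Q
        · exact inV hn₀
        · rw [h6] at this; exact absurd this hb₀
    | succ j ih =>
      intro hj
      have hjN : j < N := hj
      have hjR : (j : ℝ) + 1 ≤ N := by exact_mod_cast hj
      obtain ⟨H, hH, H0, Hh, Hd, HQ⟩ := ih hjN.le
      let θ : I → I := fun s => cl ((j + s) / N)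
      have hθ : ∀ s, (N * (θ s : ℝ)) = j + s := fun s => by
        rw [show ((θ s : I) : ℝ) = (j + s) / N from coe_cl
          (by have := s.2.1; positivity) ((div_le_one hNR).2 (by have := s.2.2; linarith))]
        field_simp
      have hθc : Continuous θ := by fun_prop
      have hθ0 : θ 0 = pt j := by simp [θ, pt]
      have hθ1 : θ 1 = pt (j + 1) := by simp [θ, pt]
      have hθs : ∀ s : I, (j : ℝ) ≤ N * s → (N * s : ℝ) ≤ j + 1 → θ (cl (N * s - j)) = s := by
        intro s h1 h2
        refine Subtype.ext ?_
        have := hθ (cl (N * s - j))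
        rw [coe_cl (r := N * s - j) (by linarith) (by linarith)] at this
        have h3 : (N : ℝ) * (θ (cl (N * s - j)) : ℝ) = N * s := by linarith
        exact mul_left_cancel₀ hNR.ne' h3
      have hkey : ∀ Q : Fin n → ℕ, (∀ i, Q i < N) → ∀ x ∈ small N Q, ∀ s : I,
          (θ s, x) ∈ β (κ j Q) := fun Q hQ x hx s =>
        key j hjN Q hQ x hx _ (by rw [hθ]; linarith [s.2.1]) (by rw [hθ]; linarith [s.2.2])
      have hdc : ContinuousOn (fun z : I × Cb n => (d (θ z.1, z.2)).1) {z | z.2 ∈ bd n} := by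
        have c : Continuous fun z : I × Cb n => (θ z.1, z.2) := by fun_prop
        have c' : MapsTo (fun z : I × Cb n => (θ z.1, z.2)) {z | z.2 ∈ bd n} {z | z.2 ∈ bd n} :=
          fun z hz => hz
        exact hdv.comp c.continuousOn c'
      obtain ⟨H', hH', H'0, H'd, H'h, H'Q⟩ := hG.slab hp hN (κ := κ j) (κ' := κ (j + 1))
        (h := fun z => h (θ z.1, z.2)) (by fun_prop)
        (fun Q hQ x hx s => (hkey Q hQ x hx s).1)
        (fun Q hQ x hx => by
          show h (θ 1, x) ∈ _
          rw [hθ1]; exact (key' (j + 1) hj Q hQ x hx).1)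
        (start := fun x => H (pt j, x))
        (hH.comp_continuous (f := fun x => (pt j, x)) (by fun_prop)
          (fun x => (hpt j hjN.le).le))
        (fun x => by
          show _ = h (θ 0, x)
          rw [hθ0]; exact (Hh (pt j, x) (hpt j hjN.le).le).1)
        HQ (d := fun z => (d (θ z.1, z.2)).1)
        hdc
        (fun x hx s => hdh x hx _)
        (fun x hx => by
          show (d (θ 0, x)).1 = _
          rw [hθ0]; exact (Hd x hx _ (hpt j hjN.le).le).symm)
        (fun Q hQ x hx hxb => ⟨fun s => (hkey Q hQ x hx s).2 hxb, by
          show (d (θ 1, x)).1.In _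
          rw [hθ1]; exact (key' (j + 1) hj Q hQ x hx).2 hxb⟩)
      let K : I × Cb n → NS p (univ : Set B) := fun z =>
        if (N * z.1 : ℝ) ≤ j then H z else H' (cl (N * z.1 - j), z.2)
      have e1 : ∀ z ∈ {z : I × Cb n | (N * z.1 : ℝ) ≤ j}, K z = H z := fun z hz => if_pos hz
      have e2 : ∀ z ∈ {z : I × Cb n | (j : ℝ) ≤ N * z.1 ∧ (N * z.1 : ℝ) ≤ j + 1},
          K z = H' (cl (N * z.1 - j), z.2) := by
        rintro ⟨s, x⟩ ⟨h1, h2⟩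
        simp only at h1 h2
        rcases h1.eq_or_lt with h3 | h3
        · refine (if_pos h3.ge).trans ?_
          have e : cl ((N : ℝ) * s - j) = 0 := by rw [← h3, sub_self, cl_zero]
          show H (s, x) = H' (cl (N * s - j), x)
          rw [e, H'0]
          have : s = pt j := Subtype.ext (mul_left_cancel₀ hNR.ne' (by rw [hpt j hjN.le, h3]))
          rw [this]
        · exact if_neg (not_le.2 h3)
      have esplit : ∀ z : I × Cb n, (N * z.1 : ℝ) ≤ ((j + 1 : ℕ) : ℝ) →
          (N * z.1 : ℝ) ≤ j ∨ ((j : ℝ) ≤ N * z.1 ∧ (N * z.1 : ℝ) ≤ j + 1) := fun z hz => by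
        push_cast at hz
        rcases le_total (N * z.1 : ℝ) j with h | h
        · exact Or.inl h
        · exact Or.inr ⟨h, hz⟩
      refine ⟨K, ?_, fun x => ?_, fun z hz => ?_, fun x hx s hs => ?_, fun Q hQ x hx => ?_⟩
      · refine ContinuousOn.mono (s := {z : I × Cb n | (N * z.1 : ℝ) ≤ j} ∪
          {z : I × Cb n | (j : ℝ) ≤ N * z.1 ∧ (N * z.1 : ℝ) ≤ j + 1}) ?_ esplit
        have c1 : ContinuousOn K {z | (N * z.1 : ℝ) ≤ j} := hH.congr e1
        have c2 : Continuous fun z : I × Cb n => H' (cl (N * z.1 - j), z.2) :=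
          hH'.comp (by fun_prop)
        have c3 : IsClosed {z : I × Cb n | (N * z.1 : ℝ) ≤ j} :=
          isClosed_le (by fun_prop) (by fun_prop)
        have c4 : IsClosed {z : I × Cb n | (j : ℝ) ≤ N * z.1 ∧ (N * z.1 : ℝ) ≤ j + 1} :=
          IsClosed.inter (s₁ := {z : I × Cb n | (j : ℝ) ≤ N * z.1})
            (s₂ := {z : I × Cb n | (N * z.1 : ℝ) ≤ j + 1})
            (isClosed_le (by fun_prop) (by fun_prop)) (isClosed_le (by fun_prop) (by fun_prop))
        exact c1.union_of_isClosed (c2.continuousOn.congr e2) c3 c4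
      · have h3 : (N * ((0 : I) : ℝ)) ≤ j := by simp
        exact (e1 (0, x) h3).trans (H0 x)
      · rcases esplit z hz with h3 | h3
        · rw [e1 z h3]; exact Hh z h3
        · rw [e2 z h3]
          refine ⟨?_, ?_⟩
          · rw [H'h]
            show h (θ (cl (N * z.1 - j)), z.2) = h z
            rw [hθs _ h3.1 h3.2]
          · have hx : ∃ Q : Fin n → ℕ, (∀ i, Q i < N) ∧ z.2 ∈ small N Q := exists_small hN z.2
            obtain ⟨Q, hQ, hx⟩ := hx
            exact ((H'Q Q hQ _ hx).1 _).two
      · rcases esplit (s, x) hs with h3 | h3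
        · rw [e1 _ h3]; exact Hd x hx s h3
        · rw [e2 _ h3]
          refine (H'd x hx _).trans ?_
          show (d (θ (cl (N * s - j)), x)).1 = _
          rw [hθs s h3.1 h3.2]
      · have h4 := hpt (j + 1) hj
        have h3 : (j : ℝ) ≤ N * (pt (j + 1) : ℝ) ∧ (N * (pt (j + 1) : ℝ)) ≤ j + 1 := by
          rw [h4]; push_cast; exact ⟨by linarith, le_rfl⟩
        rw [e2 (pt (j + 1), x) h3]
        have e : cl ((N : ℝ) * (pt (j + 1) : ℝ) - j) = 1 := by
          rw [h4]; push_cast; rw [add_sub_cancel_left, cl_one]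
        show (H' (cl (N * (pt (j + 1) : ℝ) - j), x)).In _
        rw [e]
        exact (H'Q Q hQ x hx).2
  obtain ⟨H, hH, H0, Hh, Hd, -⟩ := ind N le_rfl
  have hall : ∀ z : I × Cb n, (N * z.1 : ℝ) ≤ N := fun z => by
    have := z.1.2.2
    nlinarith
  have hHc : Continuous H := by
    rw [← continuousOn_univ]
    exact hH.mono fun z _ => hall z
  have hKc : Continuous fun z => (⟨H z, (Hh z (hall z)).2⟩ : Sh p U V) := hHc.subtype_mk _
  refine ⟨fun x => ⟨⟨fun s => ⟨H (s, x), (Hh _ (hall _)).2⟩, ?_⟩, Subtype.ext (H0 x), ?_⟩, ?_,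
    fun x hx => Subtype.ext (ContinuousMap.ext fun s => Subtype.ext (Hd x hx s (hall (s, x)))),
    fun x => Subtype.ext (ContinuousMap.ext fun s => (Hh (s, x) (hall _)).1)⟩
  · exact hKc.comp (by fun_prop : Continuous fun s : I => (s, x))
  · have e : ((H (1, x)).ev : B) = b₀ := (Hh (1, x) (hall _)).1.trans (hend x)
    exact ⟨(Hh (1, x) (hall _)).2.resolve_left (notU e), e⟩
  · refine Continuous.subtype_mk (ContinuousMap.continuous_of_continuous_uncurry _ ?_) _
    exact hKc.comp (by fun_prop : Continuous fun z : Cb n × I => (z.2, z.1))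

end

end LoopModel

namespace LoopModel

section
variable {A B E D Y : Type*} [TopologicalSpace A] [TopologicalSpace B] [TopologicalSpace E]
  [TopologicalSpace D] [TopologicalSpace Y]

theorem HRel.homotopicRel {K : Type*} [TopologicalSpace K] {S : Set K} {f g : C(K, B)}
    (h : HRel f g S) : f.HomotopicRel g S := by
  obtain ⟨H, hH, h0, h1, hS⟩ := h
  exact ⟨{ toFun := H, continuous_toFun := hH, map_zero_left := h0, map_one_left := h1,
           prop' := fun t x hx => hS x hx t }⟩

theorem HRel.of_homotopicRel {K : Type*} [TopologicalSpace K] {S : Set K} {f g : C(K, B)}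
    (h : f.HomotopicRel g S) : HRel f g S := by
  obtain ⟨H⟩ := h
  exact ⟨H, H.continuous, fun k => H.apply_zero k, fun k => H.apply_one k,
    fun k hk t => H.eq_fst t hk⟩

theorem bd_zero : bd 0 = ∅ := by
  ext x; simp [bd]

theorem joined_of_hrel {a a' : B} (h : HRel (fun _ : Cb 0 => a) (fun _ => a') (bd 0)) :
    Joined a a' := by
  obtain ⟨H, hH, h0, h1, -⟩ := h
  exact ⟨{ toFun := fun t => H (t, fun _ => 0), continuous_toFun := by fun_prop,
           source' := h0 _, target' := h1 _ }⟩

theorem hrel_of_joined {a a' : B} (h : Joined a a') :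
    HRel (fun _ : Cb 0 => a) (fun _ => a') (bd 0) := by
  obtain ⟨γ⟩ := h
  exact ⟨fun z => γ z.1, by fun_prop, fun _ => γ.source, fun _ => γ.target,
    fun k hk => by rw [bd_zero] at hk; exact hk.elim⟩

theorem WE.isWeakHomotopyEquiv {f : C(A, B)} (h : WE f) : IsWeakHomotopyEquiv f := by
  refine ⟨⟨?_, ?_⟩, fun n x => ⟨?_, ?_⟩⟩
  · rintro ⟨a⟩ ⟨a'⟩ haa
    have : Joined (f a) (f a') := Quotient.exact haa
    refine Quotient.sound (joined_of_hrel ?_)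
    exact h.inj continuous_const continuous_const
      (fun x hx => by rw [bd_zero] at hx; exact hx.elim) (hrel_of_joined this)
  · rintro ⟨b⟩
    obtain ⟨a₀⟩ := h.1 ⟨b⟩
    obtain ⟨a, ha, -, hr⟩ := h.2 0 (fun _ => b) (fun _ => a₀) continuous_const continuousOn_const
      (fun x hx => by rw [bd_zero] at hx; exact hx.elim)
    refine ⟨Quotient.mk _ (a fun _ => 0), Quotient.sound (joined_of_hrel ?_)⟩
    convert hr using 1
    funext y
    exact congrArg f (congrArg a (Subsingleton.elim _ _))
  · rintro ⟨p⟩ ⟨q⟩ hpq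
    have h1 : (f.comp p.1).HomotopicRel (f.comp q.1) (Cube.boundary (Fin n)) :=
      Quotient.exact hpq
    refine Quotient.sound (HRel.homotopicRel ?_)
    exact h.inj p.1.continuous q.1.continuous
      (fun y hy => (p.2 y hy).trans (q.2 y hy).symm) (HRel.of_homotopicRel h1)
  · rintro ⟨q⟩
    obtain ⟨a, ha, hab, hr⟩ := h.2 n q.1 (fun _ => x) q.1.continuous continuousOn_const
      (fun y hy => (q.2 y hy).symm)
    exact ⟨Quotient.mk _ ⟨⟨a, ha⟩, hab⟩, Quotient.sound (HRel.homotopicRel hr)⟩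

/-- The pullback of a map along a map. -/
abbrev PB (q : D → B) (y : Y → B) : Type _ := {z : Y × D // q z.2 = y z.1}

/-- The total space of a family of pullbacks. -/
abbrev PBI (q : D → B) (y : I × Y → B) : Type _ := {z : (I × Y) × D // q z.2 = y z.1}

/-- The inclusion of one of the pullbacks. -/
def PB.at (q : D → B) (y : I × Y → B) (s : I) (z : PB q fun x => y (s, x)) : PBI q y :=
  ⟨((s, z.1.1), z.1.2), z.2⟩

theorem PB.continuous_at (q : D → B) (y : I × Y → B) (s : I) : Continuous (PB.at q y s) :=
  Continuous.subtype_mk (by fun_prop) _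

theorem PB.we_at {q : D → B} (hq : Fib q) {y : I × Y → B} (hy : Continuous y) (s₀ : I) :
    WE (PB.at q y s₀) := by
  have key : ∀ (n : ℕ) (b : Cb n → PBI q y) (a : Cb n → PB q fun x => y (s₀, x)), Continuous b →
    ContinuousOn a (bd n) → (∀ x ∈ bd n, PB.at q y s₀ (a x) = b x) →
    ∃ a' : Cb n → PB q fun x => y (s₀, x), Continuous a' ∧ (∀ x ∈ bd n, a' x = a x) ∧
      HRel (PB.at q y s₀ ∘ a') b (bd n) := by
    intro n b a hb ha hab
    let c : I × Cb n → I := fun z => cl ((1 - z.1) * (b z.2).1.1.1 + z.1 * s₀)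
    have hc : Continuous c := by fun_prop
    have c0 : ∀ x, c (0, x) = (b x).1.1.1 := fun x => by simp [c]
    have c1 : ∀ x, c (1, x) = s₀ := fun x => by simp [c]
    have bs : ∀ x ∈ bd n, (b x).1.1.1 = s₀ := fun x hx => by rw [← hab x hx]; rfl
    have cb : ∀ x ∈ bd n, ∀ t, c (t, x) = s₀ := fun x hx t => by
      simp only [c, bs x hx]
      rw [← add_mul, sub_add_cancel, one_mul, cl_coe]
    obtain ⟨H, hH, Hd, Hh⟩ := (goodPair_bd n).relLift hq
      (h := fun z => y (c z, (b z.2).1.1.2)) (d := fun z => (b z.2).1.2) (by fun_prop)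
      (Continuous.continuousOn (by fun_prop)) (by
        rintro ⟨t, x⟩ (hz | hz)
        · obtain rfl : t = 0 := hz
          simp only [c0]; exact (b x).2
        · simp only [cb x hz, ← bs x hz]; exact (b x).2)
    have e1 : ∀ x, q (H (1, x)) = y (s₀, (b x).1.1.2) := fun x => by
      rw [Hh]; simp only [c1]
    refine ⟨fun x => ⟨((b x).1.1.2, H (1, x)), e1 x⟩, Continuous.subtype_mk (by fun_prop) _,
      fun x hx => ?_, HRel.symm ⟨fun z => ⟨((c z, (b z.2).1.1.2), H z), Hh z⟩,
        Continuous.subtype_mk (by fun_prop) _, fun x => ?_, fun x => ?_, fun x hx t => ?_⟩⟩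
    · refine Subtype.ext ?_
      show ((b x).1.1.2, H (1, x)) = (a x).1
      rw [Hd _ (Or.inr hx)]
      show ((b x).1.1.2, (b x).1.2) = (a x).1
      rw [← hab x hx]; rfl
    · refine Subtype.ext ?_
      show ((c (0, x), (b x).1.1.2), H (0, x)) = (b x).1
      rw [Hd _ (Or.inl rfl), c0]
    · refine Subtype.ext ?_
      show ((c (1, x), (b x).1.1.2), H (1, x)) = _
      rw [c1]; rfl
    · refine Subtype.ext ?_
      show ((c (t, x), (b x).1.1.2), H (t, x)) = (b x).1
      rw [Hd _ (Or.inr hx), cb x hx, ← bs x hx]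
  refine ⟨fun ⟨z⟩ => ?_, key⟩
  have : Nonempty (PB q fun x => y (s₀, x)) := by
    obtain ⟨H, hH, Hd, Hh⟩ := (goodPair_bd 0).relLift hq
      (h := fun w => y (cl ((1 - w.1) * z.1.1.1 + w.1 * s₀), z.1.1.2)) (d := fun _ => z.1.2)
      (by fun_prop) continuousOn_const (by
        rintro ⟨t, x⟩ (hz | hz)
        · obtain rfl : t = 0 := hz
          simp [z.2]
        · rw [bd_zero] at hz; exact hz.elim)
    exact ⟨⟨(z.1.1.2, H (1, fun _ => 0)), by rw [Hh]; simp⟩⟩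
  exact this

theorem PB.transport {q : D → B} (hq : Fib q) {y : I × Y → B} (hy : Continuous y) {r : A → Y}
    (hr : Continuous r) {j : I × A → D} (hj : Continuous j)
    (hjy : ∀ s a, q (j (s, a)) = y (s, r a))
    (h1 : WE (fun a => (⟨(r a, j (1, a)), hjy 1 a⟩ : PB q fun x => y (1, x)))) :
    WE (fun a => (⟨(r a, j (0, a)), hjy 0 a⟩ : PB q fun x => y (0, x))) := by
  refine WE.of_comp_left (Continuous.subtype_mk (by fun_prop) _) (PB.continuous_at q y 0) ?_
    (PB.we_at hq hy 0)
  refine WE.congr ?_ ((PB.we_at hq hy 1).comp h1 (PB.continuous_at q y 1)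
    (Continuous.subtype_mk (by fun_prop) _))
  exact ⟨fun z => ⟨((z.1, r z.2), j z), hjy z.1 z.2⟩, Continuous.subtype_mk (by fun_prop) _,
    fun _ => rfl, fun _ => rfl⟩

theorem PSp.he_end {n₀ : A} {S : Set A} {C : I × A → A} (hC : Continuous C)
    (h0 : ∀ z, C (0, z) = n₀) (h1 : ∀ z, C (1, z) = z) (hn : ∀ s, C (s, n₀) = n₀) :
    HE (fun ω : PSp A n₀ S => (⟨ω.1 1, ω.2.2⟩ : S)) := by
  refine ⟨Continuous.subtype_mk (by fun_prop) _, fun z =>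
    ⟨⟨fun s => C (s, z), by fun_prop⟩, h0 _, by
      show C (1, (z : A)) ∈ S
      rw [h1]; exact z.2⟩, ?_, Htpy.symm ?_, ?_⟩
  · refine Continuous.subtype_mk (ContinuousMap.continuous_of_continuous_uncurry _ ?_) _
    show Continuous fun z : S × I => C (z.2, z.1)
    fun_prop
  · refine ⟨fun w => ⟨⟨fun s => C (cl (max s (1 - 2 * w.1)), w.2.1 (cl (max s (2 * w.1 - 1)))),
      by fun_prop⟩, ?_, ?_⟩, ?_, ?_, ?_⟩
    · show C (cl (max (0 : I) (1 - 2 * w.1)), w.2.1 (cl (max (0 : I) (2 * w.1 - 1)))) = n₀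
      rcases le_total (w.1 : ℝ) (1 / 2) with h | h
      · rw [cl_of_le (r := max ((0 : I) : ℝ) (2 * w.1 - 1)) (max_le le_rfl (by linarith)), w.2.2.1,
          hn]
      · rw [cl_of_le (r := max ((0 : I) : ℝ) (1 - 2 * w.1)) (max_le le_rfl (by linarith)), h0]
    · show C (cl (max (1 : I) (1 - 2 * w.1)), w.2.1 (cl (max (1 : I) (2 * w.1 - 1)))) ∈ S
      rw [cl_of_ge (r := max ((1 : I) : ℝ) _) (le_max_left _ _),
        cl_of_ge (r := max ((1 : I) : ℝ) _) (le_max_left _ _), h1]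
      exact w.2.2.2
    · refine Continuous.subtype_mk (ContinuousMap.continuous_of_continuous_uncurry _ ?_) _
      show Continuous fun z : (I × PSp A n₀ S) × I =>
        C (cl (max z.2 (1 - 2 * z.1.1)), z.1.2.1 (cl (max z.2 (2 * z.1.1 - 1))))
      fun_prop
    · refine fun ω => Subtype.ext (ContinuousMap.ext fun s => ?_)
      show C (cl (max (s : ℝ) (1 - 2 * (0 : I))), ω.1 (cl (max (s : ℝ) (2 * (0 : I) - 1)))) = ω.1 s
      have h3 := s.2.1
      have h4 := s.2.2
      rw [cl_of_ge (le_max_of_le_right (by simp)), h1, max_eq_left (by simp; linarith), cl_coe]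
    · refine fun ω => Subtype.ext (ContinuousMap.ext fun s => ?_)
      show C (cl (max (s : ℝ) (1 - 2 * (1 : I))), ω.1 (cl (max (s : ℝ) (2 * (1 : I) - 1)))) =
        C (s, ω.1 1)
      have h3 := s.2.1
      have h4 := s.2.2
      rw [cl_of_ge (r := max (s : ℝ) (2 * (1 : I) - 1)) (le_max_of_le_right (by norm_num)),
        max_eq_left (by norm_num; linarith), cl_coe]
  · have : ((fun ω : PSp A n₀ S => (⟨ω.1 1, ω.2.2⟩ : S)) ∘ fun z : S =>
        ⟨⟨fun s => C (s, z), by fun_prop⟩, h0 _, by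
          show C (1, (z : A)) ∈ S
          rw [h1]; exact z.2⟩) = id := funext fun z => Subtype.ext (h1 _)
    rw [this]
    exact Htpy.refl continuous_id

/-- Points over `V` with a path in `V` to the base point. -/
abbrev NV (p : E → B) (V : Set B) (b₀ : B) : Type _ := {z : NS p V // (z.ev : B) = b₀}

theorem NV.he_fst {p : E → B} (hp : Continuous p) {V : Set B} {b₀ : B} {Γ : I × V → V}
    (hΓ : Continuous Γ) (h0 : ∀ v, Γ (0, v) = v) (h1 : ∀ v, (Γ (1, v) : B) = b₀)
    (hb : ∀ s (v : V), (v : B) = b₀ → (Γ (s, v) : B) = b₀) :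
    HE (fun z : NV p V b₀ => (⟨z.1.1.1, by
      show p z.1.1.1 ∈ V
      rw [← z.1.2.1]; exact z.1.2.2 0⟩ : p ⁻¹' V)) := by
  have hev : Continuous fun z : NV p V b₀ => z.1.1.2 :=
    continuous_snd.comp (NS.continuous_val.comp continuous_subtype_val)
  have hfs : Continuous fun z : NV p V b₀ => z.1.1.1 :=
    continuous_fst.comp (NS.continuous_val.comp continuous_subtype_val)
  have hc0 : ∀ e : p ⁻¹' V, Continuous fun τ : I => (Γ (τ, ⟨p e, e.2⟩) : B) := fun e => by
    have : Continuous fun τ : I => (τ, (⟨p e, e.2⟩ : V)) := by fun_prop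
    exact continuous_subtype_val.comp (hΓ.comp this)
  refine ⟨Continuous.subtype_mk hfs _, fun e =>
    ⟨⟨(e.1, ⟨fun τ => Γ (τ, ⟨p e, e.2⟩), hc0 e⟩), ?_, fun t => (Γ _).2⟩, h1 _⟩, ?_,
    Htpy.symm ?_, Htpy.refl continuous_id⟩
  · show (Γ (0, ⟨p e, e.2⟩) : B) = p e
    rw [h0]
  · refine Continuous.subtype_mk (Continuous.subtype_mk (Continuous.prodMk (by fun_prop)
      (ContinuousMap.continuous_of_continuous_uncurry _ ?_)) _) _
    show Continuous fun z : (p ⁻¹' V) × I => (Γ (z.2, ⟨p z.1, z.1.2⟩) : B)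
    have : Continuous fun z : (p ⁻¹' V) × I => (z.2, (⟨p z.1, z.1.2⟩ : V)) :=
      continuous_snd.prodMk (Continuous.subtype_mk (by fun_prop) _)
    exact continuous_subtype_val.comp (hΓ.comp this)
  · have hcc : Continuous fun w : (I × NV p V b₀) × I =>
        (Γ (cl (min w.2 (2 * w.1.1)), ⟨w.1.2.1.1.2 (cl (min w.2 (2 - 2 * w.1.1))),
          w.1.2.1.2.2 _⟩) : B) := by
      refine continuous_subtype_val.comp (hΓ.comp (Continuous.prodMk (by fun_prop)
        (Continuous.subtype_mk ?_ _)))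
      have h5 : Continuous fun w : (I × NV p V b₀) × I => w.1.2.1.1.2 :=
        hev.comp (by fun_prop : Continuous fun w : (I × NV p V b₀) × I => w.1.2)
      fun_prop
    refine ⟨fun w => ⟨⟨(w.2.1.1.1, ⟨fun τ => Γ (cl (min τ (2 * w.1)),
        ⟨w.2.1.1.2 (cl (min τ (2 - 2 * w.1))), w.2.1.2.2 _⟩),
        hcc.comp (by fun_prop : Continuous fun τ : I => (w, τ))⟩), ?_, fun t => (Γ _).2⟩, ?_⟩,
      ?_, ?_, ?_⟩
    · show (Γ (cl (min (0 : I) (2 * w.1)),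
        ⟨w.2.1.1.2 (cl (min (0 : I) (2 - 2 * w.1))), w.2.1.2.2 _⟩) : B) = p w.2.1.1.1
      have h2 := w.1.2.1
      have h3 := w.1.2.2
      rw [cl_of_le (r := min ((0 : I) : ℝ) (2 * w.1)) (min_le_left _ _), h0]
      show w.2.1.1.2 _ = _
      rw [cl_of_le (r := min ((0 : I) : ℝ) (2 - 2 * w.1)) (min_le_left _ _)]
      exact w.2.1.2.1
    · show (Γ (cl (min (1 : I) (2 * w.1)),
        ⟨w.2.1.1.2 (cl (min (1 : I) (2 - 2 * w.1))), w.2.1.2.2 _⟩) : B) = b₀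
      rcases le_total (w.1 : ℝ) (1 / 2) with h | h
      · refine hb _ _ ?_
        show w.2.1.1.2 _ = b₀
        rw [cl_of_ge (r := min ((1 : I) : ℝ) (2 - 2 * w.1)) (le_min (by simp) (by linarith))]
        exact w.2.2
      · rw [cl_of_ge (r := min ((1 : I) : ℝ) (2 * w.1)) (le_min (by simp) (by linarith)), h1]
    · exact Continuous.subtype_mk (Continuous.subtype_mk (Continuous.prodMk
        (hfs.comp continuous_snd) (ContinuousMap.continuous_of_continuous_uncurry _ hcc)) _) _
    · refine fun z => Subtype.ext (Subtype.ext (Prod.ext rfl (ContinuousMap.ext fun τ => ?_)))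
      show (Γ (cl (min (τ : ℝ) (2 * (0 : I))),
        ⟨z.1.1.2 (cl (min (τ : ℝ) (2 - 2 * (0 : I)))), z.1.2.2 _⟩) : B) = z.1.1.2 τ
      have h2 := τ.2.1
      have h3 := τ.2.2
      rw [cl_of_le (r := min (τ : ℝ) (2 * (0 : I))) (min_le_of_right_le (by simp)), h0]
      show z.1.1.2 _ = _
      rw [min_eq_left (by simp; linarith), cl_coe]
    · refine fun z => Subtype.ext (Subtype.ext (Prod.ext rfl (ContinuousMap.ext fun τ => ?_)))
      have h2 := τ.2.1
      have h3 := τ.2.2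
      have h4 : cl (min (τ : ℝ) (2 * (1 : I))) = τ := by
        rw [min_eq_left (by simp; linarith), cl_coe]
      have h5 : z.1.1.2 (cl (min (τ : ℝ) (2 - 2 * (1 : I)))) = p z.1.1.1 := by
        rw [cl_of_le (min_le_of_right_le (by simp))]; exact z.1.2.1
      show (Γ (cl (min (τ : ℝ) (2 * (1 : I))),
        ⟨z.1.1.2 (cl (min (τ : ℝ) (2 - 2 * (1 : I)))), z.1.2.2 _⟩) : B) = Γ (τ, ⟨p z.1.1.1, _⟩)
      congr 3
      · exact Subtype.ext h5

/-- Evaluating at a variable time is continuous when the path is constant wherever the time may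
jump. -/
theorem continuous_eval_jump {Z : Type*} [TopologicalSpace Z] {g : Z × I → B} (hg : Continuous g)
    {τ : Z → I} {S : Set Z} (hS : IsClosed S) (hτ : ContinuousOn τ Sᶜ)
    (hgS : ∀ z ∈ S, ∀ t t', g (z, t) = g (z, t')) : Continuous fun z => g (z, τ z) := by
  rw [continuous_iff_continuousAt]
  intro z
  by_cases hz : z ∈ S
  · intro O hO
    have h1 : ∀ t ∈ (univ : Set I), ∀ᶠ w : Z × I in 𝓝 (z, t), g w ∈ O := fun t _ =>
      hg.continuousAt (by rw [← hgS z hz (τ z) t]; exact hO)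
    have h2 : ∀ᶠ w in 𝓝 z, ∀ t ∈ (univ : Set I), g (w, t) ∈ O :=
      isCompact_univ.eventually_forall_of_forall_eventually h1
    exact h2.mono fun w hw => hw _ trivial
  · have h3 : ContinuousAt τ z := hτ.continuousAt (hS.isOpen_compl.mem_nhds hz)
    exact hg.continuousAt.comp (continuousAt_id.prodMk h3)

end

end LoopModel

namespace LoopModel

section lists
variable {X Z T : Type*} [TopologicalSpace X] [TopologicalSpace Z] [TopologicalSpace T]

/-- Lists of a given length. -/
abbrev LL (X : Type*) (n : ℕ) : Type _ := {l : List X // l.length = n}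

theorem isOpen_length (n : ℕ) : IsOpen {l : List X | l.length = n} :=
  (isOpen_discrete {n}).preimage (continuous_iff_continuousAt.2 List.continuousAt_length)

theorem LL.continuous_tail (n : ℕ) :
    Continuous fun l : LL X (n + 1) => (⟨l.1.tail, by simp [l.2]⟩ : LL X n) := by
  refine Continuous.subtype_mk
    (Continuous.comp (g := List.tail) ?_ continuous_subtype_val) _
  rw [continuous_iff_continuousAt]
  rintro (_ | ⟨a, l⟩)
  · rw [ContinuousAt, nhds_nil]
    exact tendsto_pure_nhds _ _
  · exact List.tendsto_cons_iff.2 Filter.tendsto_snd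

theorem LL.continuous_head (n : ℕ) :
    Continuous fun l : LL X (n + 1) => l.1.head (by intro h; have := l.2; simp [h] at this) := by
  rw [continuous_iff_continuousAt]
  rintro ⟨_ | ⟨a, l⟩, hl⟩
  · simp at hl
  · have h1 : ContinuousAt (fun m : List X => m.headD a) (a :: l) :=
      List.tendsto_cons_iff.2 Filter.tendsto_fst
    have h2 : ContinuousAt (fun m : LL X (n + 1) => m.1.headD a) ⟨a :: l, hl⟩ :=
      ContinuousAt.comp (f := fun m : LL X (n + 1) => m.1) (g := fun m : List X => m.headD a)
        (x := ⟨a :: l, hl⟩) h1 continuous_subtype_val.continuousAt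
    convert h2 using 1
    funext m
    obtain ⟨_ | ⟨b, m⟩, hm⟩ := m
    · simp at hm
    · rfl

theorem continuous_list {f : List X × Z → T} (h0 : Continuous fun z => f ([], z))
    (h1 : ∀ n, Continuous (fun w : LL X n × Z => f (w.1, w.2)) →
      Continuous fun w : (X × LL X n) × Z => f (w.1.1 :: w.1.2, w.2)) : Continuous f := by
  have key : ∀ n, Continuous fun w : LL X n × Z => f (w.1, w.2) := by
    intro n
    induction n with
    | zero =>
      have : (fun w : LL X 0 × Z => f (w.1, w.2)) = fun w => f ([], w.2) := by
        funext w
        rw [List.length_eq_zero_iff.1 w.1.2]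
      rw [this]
      exact h0.comp continuous_snd
    | succ n ih =>
      have h2 := (h1 n ih).comp ((((LL.continuous_head n).comp continuous_fst).prodMk
        ((LL.continuous_tail n).comp continuous_fst)).prodMk
        (continuous_snd : Continuous fun w : LL X (n + 1) × Z => w.2))
      convert h2 using 1
      funext w
      simp
  rw [continuous_iff_continuousAt]
  rintro ⟨l, z⟩
  have hU : IsOpen ({m : List X | m.length = l.length} ×ˢ (univ : Set Z)) :=
    (isOpen_length _).prod isOpen_univ
  refine ContinuousOn.continuousAt ?_ (hU.mem_nhds ⟨rfl, trivial⟩)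
  rw [continuousOn_iff_continuous_domRestrict]
  have h3 : Continuous fun w : ({m : List X | m.length = l.length} ×ˢ (univ : Set Z) : Set _) =>
      ((⟨w.1.1, w.2.1⟩ : LL X l.length), w.1.2) :=
    (Continuous.subtype_mk (by fun_prop) _).prodMk (by fun_prop)
  exact (key l.length).comp h3

@[fun_prop]
theorem continuous_cons' {f : Z → X} {g : Z → List X} (hf : Continuous f) (hg : Continuous g) :
    Continuous fun z => f z :: g z :=
  continuous_iff_continuousAt.2 fun _ =>
    Filter.Tendsto.cons (hf.tendsto _) (hg.tendsto _)

@[fun_prop]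
theorem continuous_append {f g : Z → List X} (hf : Continuous f) (hg : Continuous g) :
    Continuous fun z => f z ++ g z := by
  have : Continuous fun w : List X × List X => w.1 ++ w.2 := by
    refine continuous_list ?_ fun n ih => ?_
    · exact continuous_id
    · have : Continuous fun w : (X × LL X n) × List X => w.1.2.1 ++ w.2 :=
        ih.comp ((by fun_prop : Continuous fun w : (X × LL X n) × List X => (w.1.2, w.2)))
      exact continuous_cons' (by fun_prop) this
  exact this.comp (hf.prodMk hg)

theorem continuous_map_list {Y : Type*} [TopologicalSpace Y] {k : Z → X → Y}
    (hk : Continuous fun w : Z × X => k w.1 w.2) :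
    Continuous fun w : List X × Z => w.1.map (k w.2) := by
  refine continuous_list continuous_const fun n ih => ?_
  have h1 : Continuous fun w : (X × LL X n) × Z => w.1.2.1.map (k w.2) :=
    ih.comp (by fun_prop : Continuous fun w : (X × LL X n) × Z => (w.1.2, w.2))
  have h2 : Continuous fun w : (X × LL X n) × Z => k w.2 w.1.1 :=
    hk.comp (by fun_prop : Continuous fun w : (X × LL X n) × Z => (w.2, w.1.1))
  exact continuous_cons' h2 h1

end lists

/-- A well behaved base point. -/
structure Nice (X : Type*) [TopologicalSpace X] (x₀ : X) where
  /-- the distance to the base point -/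
  u : X → ℝ
  /-- the deformation swallowing a neighbourhood of the base point -/
  h : I × X → X
  hu : Continuous u
  hh : Continuous h
  nonneg : ∀ x, 0 ≤ u x
  zero_iff : ∀ x, u x = 0 ↔ x = x₀
  h_zero : ∀ x, h (0, x) = x
  h_base : ∀ s, h (s, x₀) = x₀
  u_h : ∀ s x, u (h (s, x)) ≤ u x
  h_one : ∀ x, u x ≤ 1 / 2 → h (1, x) = x₀

attribute [fun_prop] Nice.hu Nice.hh

namespace Nice
variable {X : Type*} [TopologicalSpace X] {x₀ : X} (N : Nice X x₀)

@[simp] theorem u_base : N.u x₀ = 0 := (N.zero_iff x₀).2 rfl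

theorem pos {x : X} (h : x ≠ x₀) : 0 < N.u x :=
  (N.nonneg x).lt_of_ne fun h' => h ((N.zero_iff x).1 h'.symm)

/-- The total weight of a word. -/
def wt (l : List X) : ℝ := (l.map N.u).sum

@[simp] theorem wt_nil : N.wt [] = 0 := rfl
@[simp] theorem wt_cons (x : X) (l : List X) : N.wt (x :: l) = N.u x + N.wt l := by simp [wt]
@[simp] theorem wt_append (l m : List X) : N.wt (l ++ m) = N.wt l + N.wt m := by simp [wt]

theorem wt_nonneg (l : List X) : 0 ≤ N.wt l := by
  induction l with
  | nil => simp
  | cons x l ih => have := N.nonneg x; simp; linarith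

@[fun_prop]
theorem continuous_wt : Continuous N.wt := by
  have : Continuous fun w : List X × Unit => N.wt w.1 := by
    refine continuous_list continuous_const fun n ih => ?_
    have h1 : Continuous fun w : (X × LL X n) × Unit => N.wt w.1.2.1 :=
      ih.comp (by fun_prop : Continuous fun w : (X × LL X n) × Unit => (w.1.2, w.2))
    have h2 := N.hu
    simp only [wt_cons]
    fun_prop
  exact this.comp (by fun_prop : Continuous fun l : List X => (l, ()))

/-- The deformation applied to a word. -/
def hl (s : I) (l : List X) : List X := l.map fun x => N.h (s, x)

@[simp] theorem hl_nil (s : I) : N.hl s [] = [] := rfl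
@[simp] theorem hl_cons (s : I) (x : X) (l : List X) :
    N.hl s (x :: l) = N.h (s, x) :: N.hl s l := rfl
@[simp] theorem hl_append (s : I) (l m : List X) : N.hl s (l ++ m) = N.hl s l ++ N.hl s m := by
  simp [hl]
@[simp] theorem hl_zero (l : List X) : N.hl 0 l = l := by simp [hl, N.h_zero]

theorem continuous_hl : Continuous fun w : I × List X => N.hl w.1 w.2 :=
  (continuous_map_list (k := fun s x => N.h (s, x)) N.hh).comp continuous_swap

end Nice

end LoopModel

namespace LoopModel

section quotients
variable {A Q Z T : Type*} [TopologicalSpace A] [TopologicalSpace Q] [TopologicalSpace Z]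
  [TopologicalSpace T]

theorem quot_id_prod [LocallyCompactSpace Z] {q : A → Q} (hq : Topology.IsQuotientMap q) :
    Topology.IsQuotientMap fun w : Z × A => (w.1, q w.2) := by
  have hc : Continuous fun w : Z × A => (w.1, q w.2) := by
    have := hq.continuous
    fun_prop
  have hs : Function.Surjective fun w : Z × A => (w.1, q w.2) := by
    rintro ⟨z, b⟩
    obtain ⟨a, rfl⟩ := hq.surjective b
    exact ⟨(z, a), rfl⟩
  refine ⟨⟨TopologicalSpace.ext_iff.2 fun s => ⟨fun h => h.preimage hc, fun h => ?_⟩⟩, hs⟩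
  · have : Continuous fun w : Z × Q => w ∈ s :=
      hq.continuous_lift_prod_right (g := fun w : Z × Q => w ∈ s) (continuous_Prop.2 h)
    exact continuous_Prop.1 this

theorem continuousOn_of_quot {q : A → Q} (hq : Topology.IsQuotientMap q) {O : Set Q} (hO : IsOpen O)
    {f : Q → T} (hf : ContinuousOn (f ∘ q) (q ⁻¹' O)) : ContinuousOn f O :=
  (hq.continuousOn_isOpen_iff hO).2 hf

end quotients

section words
variable {X : Type*} [TopologicalSpace X] (x₀ : X)

/-- Deletion of the base point from a word. -/
inductive JRel : List X → List X → Prop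
  | del (l m : List X) : JRel (l ++ x₀ :: m) (l ++ m)

/-- The free monoid on `X` with the base point as unit. -/
def JX : Type _ := Quot (JRel x₀)

instance : TopologicalSpace (JX x₀) := inferInstanceAs (TopologicalSpace (Quot _))

/-- The class of a word. -/
def JX.mk (l : List X) : JX x₀ := Quot.mk _ l

theorem JX.isQuotientMap_mk : Topology.IsQuotientMap (JX.mk x₀) := isQuotientMap_quot_mk

theorem JX.mk_del (l m : List X) : JX.mk x₀ (l ++ x₀ :: m) = JX.mk x₀ (l ++ m) :=
  Quot.sound (.del l m)

theorem JX.mk_cons_base (m : List X) : JX.mk x₀ (x₀ :: m) = JX.mk x₀ m := JX.mk_del x₀ [] m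

variable {x₀} {Z T : Type*} [TopologicalSpace Z] [TopologicalSpace T]

/-- Descend a deletion invariant function. -/
def JX.lift (Φ : List X → T) (h : ∀ l m, Φ (l ++ x₀ :: m) = Φ (l ++ m)) : JX x₀ → T :=
  Quot.lift Φ (by rintro _ _ ⟨l, m⟩; exact h l m)

namespace Nice
variable (N : Nice X x₀)

theorem hl_base (s : I) (l m : List X) : N.hl s (l ++ x₀ :: m) = N.hl s l ++ x₀ :: N.hl s m := by
  simp [N.h_base]

theorem exists_level (l : List X) : ∃ η, 0 < η ∧ η < 1 / 2 ∧ ∀ y ∈ l, N.u y ≠ η := by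
  obtain ⟨η, hη, h⟩ := (Set.Ioo_infinite (show (0 : ℝ) < 1 / 2 by norm_num)).exists_notMem_finset
    (l.map N.u).toFinset
  refine ⟨η, hη.1, hη.2, fun y hy h' => h ?_⟩
  simp only [List.mem_toFinset, List.mem_map]
  exact ⟨y, hy, h'⟩

/-- Keep the letters above a level. -/
def fil (η : ℝ) (l : List X) : List X := l.filter fun y => decide (η < N.u y)

/-- Vanishes exactly when some letter is at the level. -/
def lev (η : ℝ) (l : List X) : ℝ := (l.map fun y => N.u y - η).prod

theorem continuous_lev (η : ℝ) : Continuous (N.lev η) := by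
  have h1 : Continuous fun w : List X × Unit => w.1.map fun y => N.u y - η :=
    continuous_map_list (k := fun _ y => N.u y - η) (by have := N.hu; fun_prop)
  have h2 := List.continuous_prod.comp
    (h1.comp (by fun_prop : Continuous fun l : List X => (l, ())))
  exact h2

theorem continuousAt_fil {η : ℝ} (l : List X) (h : ∀ y ∈ l, N.u y ≠ η) :
    ContinuousAt (N.fil η) l := by
  induction l with
  | nil => rw [ContinuousAt, nhds_nil]; exact tendsto_pure_nhds _ _
  | cons a l ih =>
    have ih := ih fun y hy => h y (List.mem_cons_of_mem _ hy)
    refine List.tendsto_cons_iff.2 ?_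
    rcases (h a List.mem_cons_self).lt_or_gt with ha | ha
    · have h1 : ∀ᶠ p : X × List X in 𝓝 a ×ˢ 𝓝 l, N.fil η p.2 = N.fil η (p.1 :: p.2) := by
        filter_upwards [Filter.tendsto_fst.eventually
          ((isOpen_Iio.preimage N.hu).mem_nhds ha)] with p hp
        have hp : N.u p.1 < η := hp
        simp [fil, hp.le]
      have h2 : N.fil η (a :: l) = N.fil η l := by simp [fil, ha.le]
      rw [h2]
      exact (ih.tendsto.comp Filter.tendsto_snd).congr' h1
    · have h1 : ∀ᶠ p : X × List X in 𝓝 a ×ˢ 𝓝 l,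
          p.1 :: N.fil η p.2 = N.fil η (p.1 :: p.2) := by
        filter_upwards [Filter.tendsto_fst.eventually
          ((isOpen_Ioi.preimage N.hu).mem_nhds ha)] with p hp
        have hp : η < N.u p.1 := hp
        simp [fil, hp]
      have h2 : N.fil η (a :: l) = a :: N.fil η l := by
        have ha : η < N.u a := ha
        simp [fil, ha]
      rw [h2]
      exact (Filter.tendsto_fst.cons (ih.tendsto.comp Filter.tendsto_snd)).congr' h1

theorem fil_hl {η : ℝ} (hη : η ≤ 1 / 2) {T : Type*} (Φ : List X → T)
    (h : ∀ l m, Φ (l ++ x₀ :: m) = Φ (l ++ m)) (l : List X) :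
    Φ (N.hl 1 (N.fil η l)) = Φ (N.hl 1 l) := by
  suffices ∀ pre, Φ (pre ++ N.hl 1 (N.fil η l)) = Φ (pre ++ N.hl 1 l) from this []
  induction l with
  | nil => intro pre; rfl
  | cons a l ih =>
    intro pre
    by_cases ha : η < N.u a
    · have : N.fil η (a :: l) = a :: N.fil η l := by simp [fil, ha]
      rw [this, hl_cons, hl_cons]
      have := ih (pre ++ [N.h (1, a)])
      simpa using this
    · have h1 : N.fil η (a :: l) = N.fil η l := by simp [fil, ha]
      rw [h1, ih, hl_cons, N.h_one a ((not_lt.1 ha).trans hη), h]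

theorem continuous_kill {Φ : List X × Z → T} (hΦ : Continuous Φ)
    (hd : ∀ l m z, Φ (l ++ x₀ :: m, z) = Φ (l ++ m, z)) :
    Continuous fun w : JX x₀ × Z =>
      JX.lift (fun l => Φ (N.hl 1 l, w.2)) (fun l m => by rw [hl_base, hd, hl_append]) w.1 := by
  rw [continuous_iff_continuousAt]
  rintro ⟨⟨l₀⟩, z₀⟩ O hO
  obtain ⟨η, hη0, hη1, hη⟩ := N.exists_level l₀
  have hhl : Continuous fun l : List X => N.hl 1 l :=
    N.continuous_hl.comp (by fun_prop : Continuous fun l : List X => ((1 : I), l))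
  have hΨ : Continuous fun w : List X × Z => Φ (N.hl 1 w.1, w.2) := by fun_prop
  have e1 : ∀ l z, Φ (N.hl 1 (N.fil η l), z) = Φ (N.hl 1 l, z) := fun l z =>
    N.fil_hl hη1.le (fun l => Φ (l, z)) (fun l m => hd l m z) l
  have hO' : (fun w : List X × Z => Φ (N.hl 1 w.1, w.2)) ⁻¹' O ∈ 𝓝 (N.fil η l₀, z₀) :=
    hΨ.continuousAt (by
      show O ∈ 𝓝 (Φ (N.hl 1 (N.fil η l₀), z₀))
      rw [e1]; exact hO)
  obtain ⟨M, hM, N', hN', hMN⟩ := mem_nhds_prod_iff.1 hO'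
  obtain ⟨M', hM'M, hM'o, hM'⟩ := mem_nhds_iff.1 hM
  have lev0 : ∀ l, N.lev η l ≠ 0 ↔ ∀ y ∈ l, N.u y ≠ η := fun l => by
    rw [lev, ne_eq, List.prod_eq_zero_iff]
    constructor
    · intro h y hy h'
      exact h (List.mem_map.2 ⟨y, hy, by rw [h', sub_self]⟩)
    · intro h h'
      obtain ⟨y, hy, h'⟩ := List.mem_map.1 h'
      exact h y hy (sub_eq_zero.1 h')
  let P : List X → Prop := fun l => (∀ y ∈ l, N.u y ≠ η) ∧ N.fil η l ∈ M'
  have hP : IsOpen {l | P l} := by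
    rw [isOpen_iff_mem_nhds]
    rintro l ⟨hl, hlM⟩
    have h1 : {m | N.lev η m ≠ 0} ∈ 𝓝 l :=
      (isOpen_ne.preimage (N.continuous_lev η)).mem_nhds ((lev0 l).2 hl)
    filter_upwards [h1, N.continuousAt_fil l hl (hM'o.mem_nhds hlM)] with m hm hm'
    exact ⟨(lev0 m).1 hm, hm'⟩
  have hPd : ∀ l m, P (l ++ x₀ :: m) = P (l ++ m) := fun l m => by
    have h1 : N.fil η (l ++ x₀ :: m) = N.fil η (l ++ m) := by
      simp [fil, hη0.le]
    have h2 : (∀ y ∈ l ++ x₀ :: m, N.u y ≠ η) ↔ ∀ y ∈ l ++ m, N.u y ≠ η := by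
      constructor
      · intro h y hy
        refine h y ?_
        simp only [List.mem_append, List.mem_cons] at hy ⊢
        tauto
      · intro h y hy
        simp only [List.mem_append, List.mem_cons] at hy
        by_cases hyx : y = x₀
        · rw [hyx, u_base]; exact hη0.ne
        · exact h y (by simp only [List.mem_append]; tauto)
    show (_ ∧ _) = (_ ∧ _)
    rw [h1, h2]
  have hW : IsOpen {w : JX x₀ | JX.lift P hPd w} :=
    (JX.isQuotientMap_mk x₀).isOpen_preimage.1 hP
  have hW0 : {w : JX x₀ | JX.lift P hPd w} ∈ 𝓝 (Quot.mk _ l₀ : JX x₀) :=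
    hW.mem_nhds (show P l₀ from ⟨hη, hM'⟩)
  refine Filter.mem_map.2 (Filter.mem_of_superset (prod_mem_nhds hW0 hN') ?_)
  rintro ⟨⟨l⟩, z⟩ ⟨hw, hz⟩
  show Φ (N.hl 1 l, z) ∈ O
  rw [← e1]
  exact hMN (show (N.fil η l, z) ∈ _ from ⟨hM'M (show P l from hw).2, hz⟩)

end Nice
end words

end LoopModel

namespace LoopModel

section susp
variable {X : Type*} [TopologicalSpace X] {x₀ : X} {T Z : Type*} [TopologicalSpace T]
  [TopologicalSpace Z]

/-- A point of the suspension. -/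
def sp (x₀ : X) (t : I) (x : X) : Susp 1 X x₀ := Quot.mk _ (fun _ => t, x)

/-- Coordinates away from the base point. -/
def Good (x₀ : X) (t : I) (x : X) : Prop := t ≠ 0 ∧ t ≠ 1 ∧ x ≠ x₀

theorem not_good {t : I} {x : X} : ¬ Good x₀ t x ↔ t = 0 ∨ t = 1 ∨ x = x₀ := by
  unfold Good; tauto

theorem mem_collapse {t : NCube 1} {x : X} :
    (t, x) ∈ SuspCollapse 1 X x₀ ↔ ¬ Good x₀ (t 0) x := by
  rw [not_good, ← or_assoc]
  simp [SuspCollapse, NCube.boundary, Fin.exists_fin_one]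

theorem isQuotientMap_sp : Topology.IsQuotientMap fun w : I × X => sp x₀ w.1 w.2 := by
  have h1 : Topology.IsQuotientMap (fun z : NCube 1 × X => (Quot.mk _ z : Susp 1 X x₀)) :=
    isQuotientMap_quot_mk
  have h2 := h1.comp (((Homeomorph.funUnique (Fin 1) I).symm.prodCongr
    (Homeomorph.refl X)).isQuotientMap)
  exact h2

@[fun_prop]
theorem continuous_sp {f : Z → I} {g : Z → X} (hf : Continuous f) (hg : Continuous g) :
    Continuous fun z => sp x₀ (f z) (g z) :=
  isQuotientMap_sp.continuous.comp (hf.prodMk hg)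

theorem sp_bad {t : I} {x : X} (h : ¬ Good x₀ t x) : sp x₀ t x = Susp.base 1 X x₀ :=
  Quot.sound ⟨mem_collapse.2 h, mem_collapse.2 (not_good.2 (Or.inl rfl))⟩

@[simp] theorem sp_zero (x : X) : sp x₀ 0 x = Susp.base 1 X x₀ := sp_bad (by simp [not_good])
@[simp] theorem sp_one (x : X) : sp x₀ 1 x = Susp.base 1 X x₀ := sp_bad (by simp [not_good])
@[simp] theorem sp_base (t : I) : sp x₀ t x₀ = Susp.base 1 X x₀ := sp_bad (by simp [not_good])

/-- Functions on the suspension. -/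
def Susp.lift' {T : Type*} (g : I → X → T) (c : T) (h : ∀ t x, ¬ Good x₀ t x → g t x = c) :
    Susp 1 X x₀ → T :=
  Quot.lift (fun z => g (z.1 0) z.2) (by
    rintro ⟨t, x⟩ ⟨t', x'⟩ ⟨h1, h2⟩
    exact (h _ _ (mem_collapse.1 h1)).trans (h _ _ (mem_collapse.1 h2)).symm)

@[simp] theorem Susp.lift'_sp {T : Type*} (g : I → X → T) (c : T)
    (h : ∀ t x, ¬ Good x₀ t x → g t x = c) (t : I) (x : X) :
    Susp.lift' g c h (sp x₀ t x) = g t x := rfl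

theorem sp_ne_base {t : I} {x : X} : sp x₀ t x ≠ Susp.base 1 X x₀ ↔ Good x₀ t x := by
  refine ⟨fun h => by_contra fun h' => h (sp_bad h'), fun h h' => ?_⟩
  have := congrArg (Susp.lift' (Good x₀) False fun _ _ h => eq_false h) h'
  rw [← sp_base 0] at this
  simp only [Susp.lift'_sp, eq_iff_iff] at this
  exact (this.1 h).2.2 rfl

theorem sp_cases (b : Susp 1 X x₀) : ∃ t x, b = sp x₀ t x := by
  obtain ⟨⟨t, x⟩, h⟩ := isQuotientMap_sp.surjective b
  exact ⟨t, x, h.symm⟩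

open Classical in
/-- Coordinates of a point of the suspension. -/
def coords : Susp 1 X x₀ → I × X :=
  Susp.lift' (fun t x => if Good x₀ t x then (t, x) else (0, x₀)) (0, x₀)
    fun _ _ h => if_neg h

theorem coords_sp {t : I} {x : X} (h : Good x₀ t x) : coords (sp x₀ t x) = (t, x) := if_pos h

theorem sp_coords (b : Susp 1 X x₀) : sp x₀ (coords b).1 (coords b).2 = b := by
  obtain ⟨t, x, rfl⟩ := sp_cases b
  by_cases h : Good x₀ t x
  · rw [coords_sp h]
  · have : coords (sp x₀ 0 x₀) = (0, x₀) := if_neg (by simp [Good])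
    rw [sp_bad h, ← sp_base 0, this]

/-- The complement of the base point. -/
def UU (x₀ : X) : Set (Susp 1 X x₀) := {b | b ≠ Susp.base 1 X x₀}

theorem sp_mem_UU {t : I} {x : X} : sp x₀ t x ∈ UU x₀ ↔ Good x₀ t x := sp_ne_base

/-- Moving the coordinate away from `1/2`. -/
def mv (b t : I) : I := cl (t + b * ((if (t : ℝ) ≤ 1 / 2 then 0 else 1) - t))

@[simp] theorem mv_zero (t : I) : mv 0 t = t := by simp [mv]
@[simp] theorem mv_at_zero (b : I) : mv b 0 = 0 := by simp [mv]
@[simp] theorem mv_at_one (b : I) : mv b 1 = 1 := by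
  have : ¬ (1 : ℝ) ≤ 1 / 2 := by norm_num
  simp only [mv, Set.Icc.coe_one, if_neg this]
  simp

theorem mv_one_le {t : I} (h : (t : ℝ) ≤ 1 / 2) : mv 1 t = 0 := by simp only [mv, if_pos h]; simp
theorem mv_one_gt {t : I} (h : ¬ (t : ℝ) ≤ 1 / 2) : mv 1 t = 1 := by simp only [mv, if_neg h]; simp

theorem mv_ne (b : I) {t : I} (h : (t : ℝ) ≠ 1 / 2) : (mv b t : ℝ) ≠ 1 / 2 := by
  have hb := b.2.1
  have hb1 := b.2.2
  have ht := t.2.1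
  have ht1 := t.2.2
  unfold mv
  rcases le_or_gt (t : ℝ) (1 / 2) with h1 | h1
  · rw [if_pos h1]
    have h2 := lt_of_le_of_ne h1 h
    rw [coe_cl (by nlinarith) (by nlinarith)]
    nlinarith
  · rw [if_neg (not_le.2 h1)]
    rw [coe_cl (by nlinarith) (by nlinarith)]
    nlinarith

theorem continuousAt_mv (b : I) {t : I} (h : (t : ℝ) ≠ 1 / 2) :
    ContinuousAt (fun z : I × I => mv z.1 z.2) (b, t) := by
  have hc : Continuous fun z : I × I => (z.2 : ℝ) := by fun_prop
  rcases h.lt_or_gt with h1 | h1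
  · have : ContinuousAt (fun z : I × I => cl (z.2 + z.1 * (0 - z.2))) (b, t) := by fun_prop
    refine this.congr ?_
    filter_upwards [hc.continuousAt.preimage_mem_nhds (Iio_mem_nhds h1)] with z hz
    have hz : (z.2 : ℝ) < 1 / 2 := hz
    simp only [mv, if_pos hz.le]
  · have : ContinuousAt (fun z : I × I => cl (z.2 + z.1 * (1 - z.2))) (b, t) := by fun_prop
    refine this.congr ?_
    filter_upwards [hc.continuousAt.preimage_mem_nhds (Ioi_mem_nhds h1)] with z hz
    have hz : 1 / 2 < (z.2 : ℝ) := hz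
    simp only [mv, if_neg (not_le.2 hz)]

end susp

section words
variable {X : Type*} [TopologicalSpace X] (x₀ : X)

/-- Append a letter at the end, or drop it. -/
def app (κ : Bool) (l : List X) (y : X) : List X := bif κ then l ++ [y] else l

/-- Triples of a word, a parameter and a letter. -/
abbrev EPre (X : Type*) := List X × I × X

/-- The relations between triples. -/
inductive ERel (κ : Bool) : EPre X → EPre X → Prop
  | del (l m : List X) (t : I) (y : X) : ERel κ (l ++ x₀ :: m, t, y) (l ++ m, t, y)
  | tri (l : List X) (t t' : I) : ERel κ (l, t, x₀) (l, t', x₀)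
  | zero (l : List X) (y : X) : ERel κ (l, 0, y) (y :: l, 0, x₀)
  | one (l : List X) (y : X) : ERel κ (l, 1, y) (app κ l y, 0, x₀)

/-- The total spaces over the suspension: the path fibration (`false`) or the free loop fibration
(`true`). -/
def EE (κ : Bool) : Type _ := Quot (ERel x₀ κ)

instance (κ : Bool) : TopologicalSpace (EE x₀ κ) := inferInstanceAs (TopologicalSpace (Quot _))

variable {x₀} {κ : Bool} {T Z : Type*} [TopologicalSpace T] [TopologicalSpace Z]

@[fun_prop]
theorem continuous_app {f : Z → List X} {g : Z → X} (hf : Continuous f) (hg : Continuous g) :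
    Continuous fun z => app κ (f z) (g z) := by
  cases κ
  · exact hf
  · exact continuous_append hf (by fun_prop)

/-- The class of a triple. -/
def EE.mk (x₀ : X) (κ : Bool) (l : List X) (t : I) (y : X) : EE x₀ κ := Quot.mk _ (l, t, y)

/-- The inclusion of the fibre. -/
abbrev EE.io (x₀ : X) (κ : Bool) (l : List X) : EE x₀ κ := EE.mk x₀ κ l 0 x₀

theorem EE.isQuotientMap_mk :
    Topology.IsQuotientMap fun w : EPre X => EE.mk x₀ κ w.1 w.2.1 w.2.2 :=
  isQuotientMap_quot_mk

@[fun_prop]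
theorem EE.continuous_mk {f : Z → List X} {g : Z → I} {h : Z → X} (hf : Continuous f)
    (hg : Continuous g) (hh : Continuous h) : Continuous fun z => EE.mk x₀ κ (f z) (g z) (h z) :=
  EE.isQuotientMap_mk.continuous.comp (hf.prodMk (hg.prodMk hh))

theorem EE.cases (e : EE x₀ κ) : ∃ l t y, e = EE.mk x₀ κ l t y := by
  obtain ⟨⟨l, t, y⟩⟩ := e
  exact ⟨l, t, y, rfl⟩

theorem EE.mk_del (l m : List X) (t : I) (y : X) :
    EE.mk x₀ κ (l ++ x₀ :: m) t y = EE.mk x₀ κ (l ++ m) t y := Quot.sound (.del l m t y)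
theorem EE.mk_tri (l : List X) (t t' : I) : EE.mk x₀ κ l t x₀ = EE.mk x₀ κ l t' x₀ :=
  Quot.sound (.tri l t t')
theorem EE.mk_zero (l : List X) (y : X) : EE.mk x₀ κ l 0 y = EE.io x₀ κ (y :: l) :=
  Quot.sound (.zero l y)
theorem EE.mk_one (l : List X) (y : X) : EE.mk x₀ κ l 1 y = EE.io x₀ κ (app κ l y) :=
  Quot.sound (.one l y)

/-- Functions compatible with the relations. -/
structure EInv (x₀ : X) (κ : Bool) {T : Type*} (Φ : List X → I → X → T) : Prop where
  del : ∀ l m t y, Φ (l ++ x₀ :: m) t y = Φ (l ++ m) t y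
  tri : ∀ l t t', Φ l t x₀ = Φ l t' x₀
  zero : ∀ l y, Φ l 0 y = Φ (y :: l) 0 x₀
  one : ∀ l y, Φ l 1 y = Φ (app κ l y) 0 x₀

/-- Descend a compatible function. -/
def EE.lift {T : Type*} (Φ : List X → I → X → T) (h : EInv x₀ κ Φ) : EE x₀ κ → T :=
  Quot.lift (fun w => Φ w.1 w.2.1 w.2.2) (by
    rintro _ _ (⟨l, m, t, y⟩ | ⟨l, t, t'⟩ | ⟨l, y⟩ | ⟨l, y⟩)
    exacts [h.del l m t y, h.tri l t t', h.zero l y, h.one l y])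

@[simp] theorem EE.lift_mk {T : Type*} (Φ : List X → I → X → T) (h : EInv x₀ κ Φ) (l : List X)
    (t : I) (y : X) : EE.lift Φ h (EE.mk x₀ κ l t y) = Φ l t y := rfl

theorem EInv.sp : EInv x₀ κ fun _ t y => sp x₀ t y :=
  ⟨fun _ _ _ _ => rfl, fun _ _ _ => by simp, fun _ _ => by simp, fun _ _ => by simp⟩

/-- The projection to the suspension. -/
def EE.p : EE x₀ κ → Susp 1 X x₀ := EE.lift (fun _ t y => sp x₀ t y) EInv.sp

@[simp] theorem EE.p_mk (l : List X) (t : I) (y : X) : EE.p (EE.mk x₀ κ l t y) = sp x₀ t y := rfl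

theorem EE.continuous_lift {Φ : List X → I → X → T} {h : EInv x₀ κ Φ}
    (hΦ : Continuous fun w : EPre X => Φ w.1 w.2.1 w.2.2) : Continuous (EE.lift Φ h) :=
  EE.isQuotientMap_mk.continuous_iff.2 hΦ

@[fun_prop]
theorem EE.continuous_p : Continuous (EE.p : EE x₀ κ → _) := EE.continuous_lift (by fun_prop)

theorem EE.continuous_lift₂ {Φ : I → List X → I → X → T} {h : ∀ s, EInv x₀ κ (Φ s)}
    (hΦ : Continuous fun w : I × EPre X => Φ w.1 w.2.1 w.2.2.1 w.2.2.2) :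
    Continuous fun z : I × EE x₀ κ => EE.lift (Φ z.1) (h z.1) z.2 :=
  (quot_id_prod EE.isQuotientMap_mk).continuous_iff.2 hΦ

theorem EE.continuousOn_lift₂ {Φ : I → List X → I → X → T} {h : ∀ s, EInv x₀ κ (Φ s)}
    {O : Set (Susp 1 X x₀)} (hO : IsOpen O)
    (hΦ : ContinuousOn (fun w : I × EPre X => Φ w.1 w.2.1 w.2.2.1 w.2.2.2)
      {w | sp x₀ w.2.2.1 w.2.2.2 ∈ O}) :
    ContinuousOn (fun z : I × EE x₀ κ => EE.lift (Φ z.1) (h z.1) z.2) {z | EE.p z.2 ∈ O} :=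
  continuousOn_of_quot (quot_id_prod EE.isQuotientMap_mk)
    (hO.preimage (EE.continuous_p.comp continuous_snd)) hΦ

open Classical in
theorem EInv.good {T : Type*} {Φ : List X → I → X → T} (d : T)
    (h : ∀ l m t y, Φ (l ++ x₀ :: m) t y = Φ (l ++ m) t y) :
    EInv x₀ κ fun l t y => if Good x₀ t y then Φ l t y else d :=
  ⟨fun l m t y => by simp [h], fun _ _ _ => by simp [Good], fun _ _ => by simp [Good],
    fun _ _ => by simp [Good]⟩

open Classical in
/-- Functions defined away from the base point. -/
def EE.liftU {T : Type*} (Φ : List X → I → X → T) (d : T)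
    (h : ∀ l m t y, Φ (l ++ x₀ :: m) t y = Φ (l ++ m) t y) : EE x₀ κ → T :=
  EE.lift (fun l t y => if Good x₀ t y then Φ l t y else d) (EInv.good d h)

theorem EE.liftU_mk {T : Type*} (Φ : List X → I → X → T) (d : T)
    (h : ∀ l m t y, Φ (l ++ x₀ :: m) t y = Φ (l ++ m) t y) {l : List X} {t : I} {y : X}
    (hg : Good x₀ t y) : (EE.liftU Φ d h : EE x₀ κ → T) (EE.mk x₀ κ l t y) = Φ l t y := if_pos hg

open Classical in
theorem EE.continuousOn_liftU {Φ : I → List X → I → X → T} {d : T}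
    {h : ∀ s l m t y, Φ s (l ++ x₀ :: m) t y = Φ s (l ++ m) t y} (hU : IsOpen (UU x₀))
    (hΦ : Continuous fun w : I × EPre X => Φ w.1 w.2.1 w.2.2.1 w.2.2.2) :
    ContinuousOn (fun z : I × EE x₀ κ => EE.liftU (Φ z.1) d (h z.1) z.2) {z | EE.p z.2 ∈ UU x₀} :=
  EE.continuousOn_lift₂ (Φ := fun s l t y => if Good x₀ t y then Φ s l t y else d)
    (h := fun s => EInv.good d (h s)) hU
    (hΦ.continuousOn.congr fun _ hw => if_pos (sp_mem_UU.1 hw))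

end words

end LoopModel

namespace LoopModel

namespace Nice
variable {X : Type*} [TopologicalSpace X] {x₀ : X} (N : Nice X x₀) {κ : Bool} {T Z : Type*}
  [TopologicalSpace T] [TopologicalSpace Z]

theorem isOpen_ne_base (N : Nice X x₀) : IsOpen {x : X | x ≠ x₀} := by
  have : {x : X | x ≠ x₀} = N.u ⁻¹' {r | r ≠ 0} := by
    ext x; simp [N.zero_iff]
  rw [this]
  exact isOpen_ne.preimage N.hu

theorem isOpen_UU (N : Nice X x₀) : IsOpen (UU x₀) := by
  refine isQuotientMap_sp.isOpen_preimage.1 ?_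
  have : (fun w : I × X => sp x₀ w.1 w.2) ⁻¹' UU x₀ =
      {w : I × X | w.1 ≠ 0} ∩ ({w | w.1 ≠ 1} ∩ {w | w.2 ≠ x₀}) := by
    ext w
    exact sp_mem_UU
  rw [this]
  exact (isOpen_ne.preimage continuous_fst).inter ((isOpen_ne.preimage continuous_fst).inter
    (N.isOpen_ne_base.preimage continuous_snd))

theorem continuousOn_coords (N : Nice X x₀) : ContinuousOn (coords (x₀ := x₀)) (UU x₀) := by
  refine continuousOn_of_quot isQuotientMap_sp N.isOpen_UU ?_
  exact continuousOn_id.congr fun w hw => coords_sp (sp_mem_UU.1 hw)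

theorem continuous_coords (N : Nice X x₀) : Continuous fun b : UU x₀ => coords b.1 :=
  N.continuousOn_coords.comp_continuous continuous_subtype_val fun b => b.2

theorem VV_aux (t : I) (x : X) (h : ¬ Good x₀ t x) :
    ((t : ℝ) ≠ 1 / 2 ∨ N.u x < 1 / 2) = True := by
  refine eq_true ?_
  rcases not_good.1 h with rfl | rfl | rfl
  · left; norm_num
  · left; norm_num
  · right; simp

/-- A contractible neighbourhood of the base point of the suspension. -/
def VV : Set (Susp 1 X x₀) :=
  {b | Susp.lift' (fun t x => (t : ℝ) ≠ 1 / 2 ∨ N.u x < 1 / 2) True N.VV_aux b}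

theorem sp_mem_VV {t : I} {x : X} : sp x₀ t x ∈ N.VV ↔ (t : ℝ) ≠ 1 / 2 ∨ N.u x < 1 / 2 :=
  Iff.rfl

theorem base_mem_VV : Susp.base 1 X x₀ ∈ N.VV := by
  rw [← sp_base 0]; exact N.sp_mem_VV.2 (Or.inr (by simp))

theorem isOpen_preVV : IsOpen {w : I × X | (w.1 : ℝ) ≠ 1 / 2 ∨ N.u w.2 < 1 / 2} := by
  have h1 : Continuous fun w : I × X => (w.1 : ℝ) := by fun_prop
  have h2 : Continuous fun w : I × X => N.u w.2 := by have := N.hu; fun_prop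
  exact (isOpen_ne.preimage h1).union (isOpen_Iio.preimage h2)

theorem isOpen_VV : IsOpen N.VV := isQuotientMap_sp.isOpen_preimage.1 N.isOpen_preVV

theorem UU_union_VV : UU x₀ ∪ N.VV = univ := by
  refine eq_univ_of_forall fun b => ?_
  by_cases h : b ∈ UU x₀
  · exact Or.inl h
  · right
    have : b = Susp.base 1 X x₀ := not_not.1 h
    rw [this]; exact N.base_mem_VV

/-- first stage parameter -/
def sa (s : I) : I := cl (2 * s)
/-- second stage parameter -/
def sb (s : I) : I := cl (2 * s - 1)

@[fun_prop] theorem continuous_sa : Continuous sa := by unfold sa; fun_prop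
@[fun_prop] theorem continuous_sb : Continuous sb := by unfold sb; fun_prop
@[simp] theorem sa_zero : sa 0 = 0 := by simp [sa]
@[simp] theorem sb_zero : sb 0 = 0 := cl_of_le (by simp)
@[simp] theorem sa_one : sa 1 = 1 := cl_of_ge (by norm_num)
@[simp] theorem sb_one : sb 1 = 1 := cl_of_ge (by norm_num)

/-- Parametrised triples over `VV`. -/
abbrev VPre : Type _ := {w : I × EPre X // sp x₀ w.2.2.1 w.2.2.2 ∈ N.VV}

theorem jump {G : List X → I → X → T} (hG : Continuous fun w : EPre X => G w.1 w.2.1 w.2.2)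
    (htri : ∀ l t t', G l t x₀ = G l t' x₀) :
    ContinuousOn (fun w : I × EPre X => G (N.hl (sa w.1) w.2.1) (mv (sb w.1) w.2.2.1)
      (N.h (sa w.1, w.2.2.2))) {w | sp x₀ w.2.2.1 w.2.2.2 ∈ N.VV} := by
  have hhl : Continuous fun w : I × EPre X => N.hl (sa w.1) w.2.1 :=
    N.continuous_hl.comp (by fun_prop : Continuous fun w : I × EPre X => (sa w.1, w.2.1))
  have hh := N.hh
  rw [continuousOn_iff_continuous_domRestrict]
  have hg : Continuous fun z : N.VPre × I =>
      G (N.hl (sa z.1.1.1) z.1.1.2.1) z.2 (N.h (sa z.1.1.1, z.1.1.2.2.2)) := by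
    have h1 : Continuous fun z : N.VPre × I => N.hl (sa z.1.1.1) z.1.1.2.1 :=
      hhl.comp (by fun_prop : Continuous fun z : N.VPre × I => z.1.1)
    exact hG.comp (h1.prodMk (by fun_prop : Continuous fun z : N.VPre × I =>
      (z.2, N.h (sa z.1.1.1, z.1.1.2.2.2))))
  refine continuous_eval_jump (S := {z : N.VPre | (z.1.2.2.1 : ℝ) = 1 / 2 ∧ (1 / 2 : ℝ) ≤ z.1.1})
    (τ := fun z : N.VPre => mv (sb z.1.1) z.1.2.2.1) hg ?_ ?_ ?_
  · refine IsClosed.inter (s₁ := {z : N.VPre | (z.1.2.2.1 : ℝ) = 1 / 2})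
      (s₂ := {z : N.VPre | (1 / 2 : ℝ) ≤ z.1.1}) ?_ ?_
    · exact isClosed_eq (by fun_prop) continuous_const
    · exact isClosed_le continuous_const (by fun_prop)
  · intro z hz
    refine ContinuousAt.continuousWithinAt ?_
    by_cases ht : (z.1.2.2.1 : ℝ) = 1 / 2
    · have hs : (z.1.1 : ℝ) < 1 / 2 := not_le.1 fun h => hz ⟨ht, h⟩
      have h1 : Continuous fun z : N.VPre => (z.1.1 : ℝ) := by fun_prop
      have h2 : ContinuousAt (fun z : N.VPre => z.1.2.2.1) z := by fun_prop
      refine h2.congr ?_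
      filter_upwards [h1.continuousAt.preimage_mem_nhds (Iio_mem_nhds hs)] with w hw
      have hw : (w.1.1 : ℝ) < 1 / 2 := hw
      have : sb w.1.1 = 0 := cl_of_le (by linarith)
      rw [this, mv_zero]
    · have h2 : ContinuousAt (fun z : N.VPre => (sb z.1.1, z.1.2.2.1)) z := by fun_prop
      exact ContinuousAt.comp (g := fun z : I × I => mv z.1 z.2)
        (f := fun z : N.VPre => (sb z.1.1, z.1.2.2.1)) (x := z) (continuousAt_mv _ ht) h2
  · rintro ⟨⟨s, l, t, y⟩, hz⟩ ⟨ht, hs⟩ τ τ'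
    have h1 : sa s = 1 := cl_of_ge (by
      have hs : (1 / 2 : ℝ) ≤ s := hs
      linarith)
    have h2 : N.u y < 1 / 2 := (N.sp_mem_VV.1 hz).resolve_left fun h => h ht
    show G _ τ (N.h (sa s, y)) = G _ τ' (N.h (sa s, y))
    rw [h1, N.h_one y h2.le]
    exact htri _ _ _

/-- The contraction of `VV`. -/
def Ga (w : I × Susp 1 X x₀) : Susp 1 X x₀ :=
  Susp.lift' (fun t x => sp x₀ (mv (sb w.1) t) (N.h (sa w.1, x))) (Susp.base 1 X x₀)
    (fun t x h => by
      rcases not_good.1 h with rfl | rfl | rfl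
      · simp
      · simp
      · simp [N.h_base]) w.2

@[simp] theorem Ga_sp (s t : I) (x : X) :
    N.Ga (s, sp x₀ t x) = sp x₀ (mv (sb s) t) (N.h (sa s, x)) := rfl

@[simp] theorem Ga_zero (b : Susp 1 X x₀) : N.Ga (0, b) = b := by
  obtain ⟨t, x, rfl⟩ := sp_cases b
  simp [N.h_zero]

@[simp] theorem Ga_one (b : Susp 1 X x₀) : N.Ga (1, b) = Susp.base 1 X x₀ := by
  obtain ⟨t, x, rfl⟩ := sp_cases b
  rw [Ga_sp, sb_one]
  by_cases h : (t : ℝ) ≤ 1 / 2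
  · rw [mv_one_le h]; simp
  · rw [mv_one_gt h]; simp

@[simp] theorem Ga_base (s : I) : N.Ga (s, Susp.base 1 X x₀) = Susp.base 1 X x₀ := by
  rw [← sp_base 0, Ga_sp, N.h_base]; simp

theorem Ga_mem (s : I) {b : Susp 1 X x₀} (hb : b ∈ N.VV) : N.Ga (s, b) ∈ N.VV := by
  obtain ⟨t, x, rfl⟩ := sp_cases b
  rw [Ga_sp, sp_mem_VV]
  rcases hb with h | h
  · exact Or.inl (mv_ne _ h)
  · exact Or.inr ((N.u_h _ _).trans_lt h)

theorem continuousOn_Ga : ContinuousOn N.Ga {w | w.2 ∈ N.VV} := by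
  refine continuousOn_of_quot (quot_id_prod isQuotientMap_sp)
    (N.isOpen_VV.preimage continuous_snd) ?_
  have h1 := N.jump (G := fun _ t x => sp x₀ t x) (by fun_prop) (fun _ _ _ => by simp)
  have h2 : ContinuousOn (fun w : I × I × X => (w.1, (([] : List X), w.2)))
    {w | sp x₀ w.2.1 w.2.2 ∈ N.VV} := by fun_prop
  have h3 := ContinuousOn.comp (t := {w : I × EPre X | sp x₀ w.2.2.1 w.2.2.2 ∈ N.VV}) h1 h2
    (fun w hw => hw)
  exact h3.congr fun w _ => rfl

/-- The contraction of `VV` as a map of `VV`. -/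
def GaV (w : I × N.VV) : N.VV := ⟨N.Ga (w.1, w.2.1), N.Ga_mem _ w.2.2⟩

@[fun_prop]
theorem continuous_GaV : Continuous N.GaV := by
  refine Continuous.subtype_mk (N.continuousOn_Ga.comp_continuous
    (by fun_prop : Continuous fun w : I × N.VV => (w.1, w.2.1)) fun w => w.2.2) _

/-- The deformation of words on classes. -/
def hJ (s : I) : JX x₀ → JX x₀ :=
  JX.lift (fun l => JX.mk x₀ (N.hl s l)) fun l m => by rw [hl_base, JX.mk_del, hl_append]

@[simp] theorem hJ_mk (s : I) (l : List X) : N.hJ s (JX.mk x₀ l) = JX.mk x₀ (N.hl s l) := rfl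

theorem continuous_hJ : Continuous fun w : I × JX x₀ => N.hJ w.1 w.2 :=
  (quot_id_prod (JX.isQuotientMap_mk x₀)).continuous_iff.2
    ((JX.isQuotientMap_mk x₀).continuous.comp N.continuous_hl)

theorem htpy_hJ : Htpy id (N.hJ 1) :=
  ⟨fun w => N.hJ w.1 w.2, N.continuous_hJ, fun w => by
    obtain ⟨l, rfl⟩ := (JX.isQuotientMap_mk x₀).surjective w
    simp, fun _ => rfl⟩

/-- The fibre coordinate over `UU`. -/
def al : EE x₀ κ → JX x₀ := EE.liftU (fun l _ _ => JX.mk x₀ l) (JX.mk x₀ []) fun l m _ _ => by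
  rw [JX.mk_del]

theorem al_mk {l : List X} {t : I} {y : X} (h : Good x₀ t y) :
    al (EE.mk x₀ κ l t y) = JX.mk x₀ l := EE.liftU_mk _ _ _ h

theorem continuousOn_al (N : Nice X x₀) :
    ContinuousOn (al : EE x₀ κ → JX x₀) {e | EE.p e ∈ UU x₀} := by
  have h1 := EE.continuousOn_liftU (κ := κ) (Φ := fun _ l _ _ => JX.mk x₀ l) (d := JX.mk x₀ [])
    (h := fun _ l m _ _ => JX.mk_del x₀ l m) N.isOpen_UU
    ((JX.isQuotientMap_mk x₀).continuous.comp (by fun_prop))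
  exact h1.comp (f := fun e : EE x₀ κ => ((0 : I), e)) (by fun_prop) fun e he => he

/-- The inverse trivialisation over `UU`. -/
def be (κ : Bool) (w : JX x₀ × Susp 1 X x₀) : EE x₀ κ :=
  JX.lift (fun l => EE.mk x₀ κ (N.hl 1 l) (coords w.2).1 (coords w.2).2)
    (fun l m => by rw [hl_base, EE.mk_del, hl_append]) w.1

theorem be_mk (l : List X) (b : Susp 1 X x₀) :
    N.be κ (JX.mk x₀ l, b) = EE.mk x₀ κ (N.hl 1 l) (coords b).1 (coords b).2 := rfl

@[simp] theorem p_be (w : JX x₀ × Susp 1 X x₀) : EE.p (N.be κ w) = w.2 := by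
  obtain ⟨w, b⟩ := w
  obtain ⟨l, rfl⟩ := (JX.isQuotientMap_mk x₀).surjective w
  rw [be_mk, EE.p_mk, sp_coords]

theorem continuous_be : Continuous fun w : JX x₀ × UU x₀ => N.be κ (w.1, w.2) := by
  have h1 := N.continuous_coords
  exact N.continuous_kill (Φ := fun z : List X × UU x₀ => EE.mk x₀ κ z.1 (coords z.2.1).1
    (coords z.2.1).2) (by
      have : Continuous fun z : List X × UU x₀ => coords z.2.1 := h1.comp continuous_snd
      fun_prop) (fun l m z => EE.mk_del _ _ _ _)

theorem al_be (w : JX x₀) {b : Susp 1 X x₀} (hb : b ∈ UU x₀) :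
    al (N.be κ (w, b)) = N.hJ 1 w := by
  obtain ⟨l, rfl⟩ := (JX.isQuotientMap_mk x₀).surjective w
  rw [be_mk, al_mk, hJ_mk]
  rw [← sp_mem_UU, sp_coords]; exact hb

/-- The deformation of the part over `UU`. -/
def eH (w : I × EE x₀ κ) : EE x₀ κ :=
  EE.liftU (fun l t y => EE.mk x₀ κ (N.hl w.1 l) t y) (EE.io x₀ κ [])
    (fun l m t y => by rw [hl_base, EE.mk_del, hl_append]) w.2

theorem eH_mk (s : I) {l : List X} {t : I} {y : X} (h : Good x₀ t y) :
    N.eH (s, EE.mk x₀ κ l t y) = EE.mk x₀ κ (N.hl s l) t y := EE.liftU_mk _ _ _ h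

theorem continuousOn_eH : ContinuousOn (N.eH (κ := κ)) {w | EE.p w.2 ∈ UU x₀} := by
  have hhl : Continuous fun w : I × EPre X => N.hl w.1 w.2.1 :=
    N.continuous_hl.comp (by fun_prop : Continuous fun w : I × EPre X => (w.1, w.2.1))
  exact EE.continuousOn_liftU (Φ := fun s l t y => EE.mk x₀ κ (N.hl s l) t y)
    (h := fun s l m t y => by rw [hl_base, EE.mk_del, hl_append]) N.isOpen_UU (by fun_prop)

theorem eH_zero {e : EE x₀ κ} (he : EE.p e ∈ UU x₀) : N.eH (0, e) = e := by
  obtain ⟨l, t, y, rfl⟩ := EE.cases e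
  rw [N.eH_mk _ (sp_mem_UU.1 he), hl_zero]

theorem eH_one {e : EE x₀ κ} (he : EE.p e ∈ UU x₀) : N.eH (1, e) = N.be κ (al e, EE.p e) := by
  obtain ⟨l, t, y, rfl⟩ := EE.cases e
  have hg : Good x₀ t y := sp_mem_UU.1 he
  rw [N.eH_mk _ hg, al_mk hg, be_mk, EE.p_mk, coords_sp hg]

theorem p_eH (s : I) {e : EE x₀ κ} (he : EE.p e ∈ UU x₀) : EE.p (N.eH (s, e)) = EE.p e := by
  obtain ⟨l, t, y, rfl⟩ := EE.cases e
  rw [N.eH_mk _ (sp_mem_UU.1 he)]; rfl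

theorem he_al (N : Nice X x₀) {Y : Set (Susp 1 X x₀)} (hY : Y ⊆ UU x₀) :
    HE (fun e : (EE.p : EE x₀ κ → _) ⁻¹' Y => ((al e.1, ⟨EE.p e.1, e.2⟩) : JX x₀ × Y)) := by
  have c1 : Continuous fun w : JX x₀ × Y => N.be κ (w.1, w.2) :=
    N.continuous_be.comp (by fun_prop : Continuous fun w : JX x₀ × Y =>
      (w.1, (⟨w.2.1, hY w.2.2⟩ : UU x₀)))
  have c2 : Continuous fun w : I × ((EE.p : EE x₀ κ → _) ⁻¹' Y) => N.eH (w.1, w.2.1) :=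
    N.continuousOn_eH.comp_continuous (by fun_prop) fun w => hY w.2.2
  have m1 : ∀ w : JX x₀ × Y, EE.p (N.be κ (w.1, w.2)) ∈ Y := fun w => by
    rw [p_be]; exact w.2.2
  have m2 : ∀ w : I × ((EE.p : EE x₀ κ → _) ⁻¹' Y), EE.p (N.eH (w.1, w.2.1)) ∈ Y := fun w => by
    rw [N.p_eH _ (hY w.2.2)]; exact w.2.2
  have c0 : Continuous fun e : (EE.p : EE x₀ κ → _) ⁻¹' Y => EE.p e.1 := by fun_prop
  refine ⟨(N.continuousOn_al.comp_continuous continuous_subtype_val fun e => hY e.2).prodMk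
    (c0.subtype_mk fun e => e.2), fun w => ⟨N.be κ (w.1, w.2), m1 w⟩, Continuous.subtype_mk c1 m1,
    Htpy.symm ?_, Htpy.symm ?_⟩
  · refine ⟨fun w => ⟨N.eH (w.1, w.2.1), m2 w⟩, Continuous.subtype_mk c2 m2, fun e => ?_,
      fun e => ?_⟩
    · exact Subtype.ext (N.eH_zero (hY e.2))
    · exact Subtype.ext (N.eH_one (hY e.2))
  · have c3 := N.continuous_hJ
    refine ⟨fun w => (N.hJ w.1 w.2.1, w.2.2), ?_, fun w => ?_, fun w => ?_⟩
    · exact (c3.comp (by fun_prop : Continuous fun w : I × JX x₀ × Y => (w.1, w.2.1))).prodMk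
        (by fun_prop)
    · obtain ⟨l, hl⟩ := (JX.isQuotientMap_mk x₀).surjective w.1
      refine Prod.ext ?_ rfl
      show N.hJ 0 w.1 = w.1
      rw [← hl]; simp
    · refine Prod.ext ?_ (Subtype.ext ?_)
      · exact (N.al_be w.1 (hY w.2.2)).symm
      · show w.2.1 = EE.p (N.be κ (w.1, w.2))
        rw [p_be]

end Nice

end LoopModel

namespace LoopModel

section
variable {X : Type*} [TopologicalSpace X] {x₀ : X} {κ : Bool}

/-- The inclusion of the fibre on classes of words. -/
def ioJ (κ : Bool) : JX x₀ → EE x₀ κ :=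
  JX.lift (fun l => EE.io x₀ κ l) fun _ _ => EE.mk_del _ _ _ _

@[simp] theorem ioJ_mk (l : List X) : ioJ κ (JX.mk x₀ l) = EE.io x₀ κ l := rfl

@[fun_prop]
theorem continuous_ioJ : Continuous (ioJ κ : JX x₀ → _) :=
  (JX.isQuotientMap_mk x₀).continuous_iff.2
    (by fun_prop : Continuous fun l : List X => EE.io x₀ κ l)

@[simp] theorem p_ioJ (w : JX x₀) : EE.p (ioJ κ w) = Susp.base 1 X x₀ := by
  obtain ⟨l, rfl⟩ := (JX.isQuotientMap_mk x₀).surjective w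
  simp
end

namespace Nice
variable {X : Type*} [TopologicalSpace X] {x₀ : X} (N : Nice X x₀) {κ : Bool} {T Z : Type*}
  [TopologicalSpace T] [TopologicalSpace Z]

theorem hl_app (s : I) (l : List X) (y : X) :
    N.hl s (app κ l y) = app κ (N.hl s l) (N.h (s, y)) := by
  cases κ
  · rfl
  · simp [app]

theorem mk_app_base (l : List X) : JX.mk x₀ (app κ l x₀) = JX.mk x₀ l := by
  cases κ
  · rfl
  · exact (JX.mk_del x₀ l []).trans (by simp)

theorem app_append (l m : List X) (y : X) : app κ (l ++ m) y = l ++ app κ m y := by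
  cases κ <;> simp [app]

theorem Dm_inv (s : I) : EInv x₀ κ fun l t y =>
    EE.mk x₀ κ (N.hl (sa s) l) (mv (sb s) t) (N.h (sa s, y)) where
  del l m t y := by rw [hl_base, EE.mk_del, hl_append]
  tri l t t' := by rw [N.h_base]; exact EE.mk_tri _ _ _
  zero l y := by rw [mv_at_zero, EE.mk_zero, N.h_base, hl_cons]
  one l y := by rw [mv_at_one, mv_at_zero, EE.mk_one, N.h_base, hl_app]

/-- The lift of the contraction of `VV`. -/
def Dm (w : I × EE x₀ κ) : EE x₀ κ :=
  EE.lift (fun l t y => EE.mk x₀ κ (N.hl (sa w.1) l) (mv (sb w.1) t) (N.h (sa w.1, y)))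
    (N.Dm_inv w.1) w.2

theorem continuousOn_Dm : ContinuousOn (N.Dm (κ := κ)) {w | EE.p w.2 ∈ N.VV} :=
  EE.continuousOn_lift₂ (h := N.Dm_inv) N.isOpen_VV
    (N.jump (G := EE.mk x₀ κ) (by fun_prop) fun _ _ _ => EE.mk_tri _ _ _)

theorem Dm_zero (e : EE x₀ κ) : N.Dm (0, e) = e := by
  obtain ⟨l, t, y, rfl⟩ := EE.cases e
  simp [Dm, N.h_zero]

theorem p_Dm (s : I) (e : EE x₀ κ) : EE.p (N.Dm (s, e)) = N.Ga (s, EE.p e) := by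
  obtain ⟨l, t, y, rfl⟩ := EE.cases e
  rfl

theorem W_inv : EInv x₀ κ fun l t y => if (t : ℝ) ≤ 1 / 2 then JX.mk x₀ (N.h (1, y) :: N.hl 1 l)
    else JX.mk x₀ (N.hl 1 (app κ l y)) where
  del l m t y := by
    rw [hl_base, ← List.cons_append, JX.mk_del, app_append, app_append, hl_append, hl_append]
    have : app κ (x₀ :: m) y = x₀ :: app κ m y := app_append [x₀] m y
    rw [this, hl_cons, N.h_base, JX.mk_del]
    simp
  tri l t t' := by
    have : ∀ t : I, (if (t : ℝ) ≤ 1 / 2 then JX.mk x₀ (N.h (1, x₀) :: N.hl 1 l)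
        else JX.mk x₀ (N.hl 1 (app κ l x₀))) = JX.mk x₀ (N.hl 1 l) := fun t => by
      rw [hl_app, N.h_base, mk_app_base, JX.mk_cons_base, ite_self]
    rw [this, this]
  zero l y := by
    have h : (((0 : I) : ℝ) ≤ 1 / 2) := by norm_num
    rw [if_pos h, if_pos h, N.h_base, JX.mk_cons_base, hl_cons]
  one l y := by
    have h : (((0 : I) : ℝ) ≤ 1 / 2) := by norm_num
    have h' : ¬ (((1 : I) : ℝ) ≤ 1 / 2) := by norm_num
    rw [if_neg h', if_pos h, N.h_base, JX.mk_cons_base]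

/-- The fibre coordinate over `VV`. -/
def W : EE x₀ κ → JX x₀ := EE.lift _ N.W_inv

theorem W_le {l : List X} {t : I} {y : X} (h : (t : ℝ) ≤ 1 / 2) :
    N.W (EE.mk x₀ κ l t y) = JX.mk x₀ (N.h (1, y) :: N.hl 1 l) := if_pos h

theorem W_gt {l : List X} {t : I} {y : X} (h : ¬ (t : ℝ) ≤ 1 / 2) :
    N.W (EE.mk x₀ κ l t y) = JX.mk x₀ (N.hl 1 (app κ l y)) := if_neg h

theorem W_io (w : JX x₀) : N.W (ioJ κ w) = N.hJ 1 w := by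
  obtain ⟨l, rfl⟩ := (JX.isQuotientMap_mk x₀).surjective w
  rw [ioJ_mk, W_le _ (by norm_num), N.h_base, JX.mk_cons_base, hJ_mk]

theorem continuousOn_W : ContinuousOn (N.W (κ := κ)) {e | EE.p e ∈ N.VV} := by
  refine continuousOn_of_quot EE.isQuotientMap_mk (N.isOpen_VV.preimage EE.continuous_p) ?_
  rw [continuousOn_iff_continuous_domRestrict]
  have hmk := (JX.isQuotientMap_mk x₀).continuous
  have hh := N.hh
  have hhl : Continuous fun l : List X => N.hl 1 l :=
    N.continuous_hl.comp (by fun_prop : Continuous fun l : List X => ((1 : I), l))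
  have c1 : Continuous fun w : EPre X => JX.mk x₀ (N.h (1, w.2.2) :: N.hl 1 w.1) :=
    hmk.comp (continuous_cons' (by fun_prop) (hhl.comp continuous_fst))
  have c2 : Continuous fun w : EPre X => JX.mk x₀ (N.hl 1 (app κ w.1 w.2.2)) :=
    hmk.comp (hhl.comp (by fun_prop))
  refine Continuous.if_le (f := fun w : {w : EPre X // EE.p (EE.mk x₀ κ w.1 w.2.1 w.2.2) ∈ N.VV} =>
    (w.1.2.1 : ℝ)) (g := fun _ => 1 / 2) (f' := fun w =>
      JX.mk x₀ (N.h (1, w.1.2.2) :: N.hl 1 w.1.1))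
    (g' := fun w => JX.mk x₀ (N.hl 1 (app κ w.1.1 w.1.2.2)))
    (c1.comp continuous_subtype_val) (c2.comp continuous_subtype_val)
    (by fun_prop) continuous_const ?_
  rintro ⟨⟨l, t, y⟩, hw⟩ ht
  have h2 : N.u y < 1 / 2 := (N.sp_mem_VV.1 hw).resolve_left fun h => h ht
  show JX.mk x₀ (N.h (1, y) :: N.hl 1 l) = JX.mk x₀ (N.hl 1 (app κ l y))
  rw [hl_app, N.h_one y h2.le, mk_app_base, JX.mk_cons_base]

theorem Dm_one (e : EE x₀ κ) : N.Dm (1, e) = ioJ κ (N.W e) := by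
  obtain ⟨l, t, y, rfl⟩ := EE.cases e
  show EE.mk x₀ κ (N.hl (sa 1) l) (mv (sb 1) t) (N.h (sa 1, y)) = _
  rw [sa_one, sb_one]
  by_cases h : (t : ℝ) ≤ 1 / 2
  · rw [W_le _ h, mv_one_le h, EE.mk_zero]; rfl
  · rw [W_gt _ h, mv_one_gt h, EE.mk_one, hl_app]; rfl

/-- The fibre inclusion is a homotopy equivalence onto the part over `VV`. -/
theorem he_io : HE (fun w : JX x₀ => (⟨ioJ κ w, by
    show EE.p _ ∈ N.VV
    rw [p_ioJ]; exact N.base_mem_VV⟩ : (EE.p : EE x₀ κ → _) ⁻¹' N.VV)) := by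
  have c1 : Continuous fun e : (EE.p : EE x₀ κ → _) ⁻¹' N.VV => N.W e.1 :=
    N.continuousOn_W.comp_continuous continuous_subtype_val fun e => e.2
  have c2 : Continuous fun w : I × ((EE.p : EE x₀ κ → _) ⁻¹' N.VV) => N.Dm (w.1, w.2.1) :=
    N.continuousOn_Dm.comp_continuous (by fun_prop) fun w => w.2.2
  have m2 : ∀ w : I × ((EE.p : EE x₀ κ → _) ⁻¹' N.VV), EE.p (N.Dm (w.1, w.2.1)) ∈ N.VV :=
    fun w => by rw [p_Dm]; exact N.Ga_mem _ w.2.2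
  refine ⟨continuous_ioJ.subtype_mk _, fun e => N.W e.1, c1, ?_, Htpy.symm ?_⟩
  · have := N.htpy_hJ.symm
    have e : (fun e : (EE.p : EE x₀ κ → _) ⁻¹' N.VV => N.W e.1) ∘ (fun w : JX x₀ =>
        (⟨ioJ κ w, by
          show EE.p _ ∈ N.VV
          rw [p_ioJ]; exact N.base_mem_VV⟩ : (EE.p : EE x₀ κ → _) ⁻¹' N.VV)) = N.hJ 1 :=
      funext fun w => N.W_io w
    rw [e]; exact this
  · exact ⟨fun w => ⟨N.Dm (w.1, w.2.1), m2 w⟩, c2.subtype_mk m2,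
      fun e => Subtype.ext (N.Dm_zero e.1), fun e => Subtype.ext (N.Dm_one e.1)⟩

end Nice

end LoopModel

namespace LoopModel

section
variable {X : Type*} {x₀ : X} {T T' : Type*}

/-- Functions of a passed word, a word ahead, and a position in a letter, which are compatible
with passing from letter to letter and with the deletion of base points. -/
structure SInv (x₀ : X) (F : List X → List X → I → X → T) : Prop where
  tri : ∀ a l t t', F a l t x₀ = F a l t' x₀
  zero : ∀ a l y, F a l 0 y = F a (y :: l) 0 x₀
  one : ∀ a l y, F a l 1 y = F (a ++ [y]) l 0 x₀
  del : ∀ a l m t y, F a (l ++ x₀ :: m) t y = F a (l ++ m) t y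
  pdel : ∀ a b l t y, F (a ++ x₀ :: b) l t y = F (a ++ b) l t y
end

namespace Nice
variable {X : Type*} [TopologicalSpace X] {x₀ : X} (N : Nice X x₀) {κ : Bool} {T T' Z : Type*}
  [TopologicalSpace T] [TopologicalSpace Z]

/-- Read a word at a given position. -/
def scn (F : List X → List X → I → X → T) : List X → List X → ℝ → T
  | a, [], _ => F a [] 0 x₀
  | a, y :: l, r => if r ≤ N.u y then F a l (cl (r / N.u y)) y else scn F (a ++ [y]) l (r - N.u y)

variable {F : List X → List X → I → X → T}

theorem scn_cons_le {a l : List X} {y : X} {r : ℝ} (h : r ≤ N.u y) :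
    N.scn F a (y :: l) r = F a l (cl (r / N.u y)) y := if_pos h

theorem scn_cons_gt {a l : List X} {y : X} {r : ℝ} (h : N.u y < r) :
    N.scn F a (y :: l) r = N.scn F (a ++ [y]) l (r - N.u y) := if_neg (not_le.2 h)

theorem scn_nonpos (hF : SInv x₀ F) (a l : List X) {r : ℝ} (hr : r ≤ 0) :
    N.scn F a l r = F a l 0 x₀ := by
  cases l with
  | nil => rfl
  | cons y l =>
    rw [N.scn_cons_le (hr.trans (N.nonneg y)),
      cl_of_le (div_nonpos_of_nonpos_of_nonneg hr (N.nonneg y)),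
      hF.zero]

theorem scn_cons (hF : SInv x₀ F) (a l : List X) (y : X) {r : ℝ} (hr : 0 ≤ r) :
    N.scn F a (y :: l) (N.u y + r) = N.scn F (a ++ [y]) l r := by
  rcases hr.eq_or_lt with rfl | hr
  · rw [add_zero, N.scn_cons_le le_rfl, N.scn_nonpos hF _ _ le_rfl, ← hF.one]
    by_cases h : y = x₀
    · subst h; exact hF.tri _ _ _ _
    · rw [div_self (N.pos h).ne', cl_one]
  · rw [N.scn_cons_gt (by linarith), add_sub_cancel_left]

theorem scn_append (hF : SInv x₀ F) (a l m : List X) {r : ℝ} (hr : 0 ≤ r) :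
    N.scn F a (l ++ m) (N.wt l + r) = N.scn F (a ++ l) m r := by
  induction l generalizing a with
  | nil => simp
  | cons y l ih =>
    rw [List.cons_append, wt_cons, add_assoc,
      N.scn_cons hF _ _ _ (by have := N.wt_nonneg l; linarith),
      ih, List.append_assoc]; rfl

theorem scn_append_left (hF : SInv x₀ F) (a l m : List X) {r : ℝ} (hr : r ≤ N.wt l) :
    N.scn F a (l ++ m) r = N.scn (fun a l t y => F a (l ++ m) t y) a l r := by
  induction l generalizing a r with
  | nil => exact N.scn_nonpos hF _ _ hr
  | cons y l ih =>
    rcases le_or_gt r (N.u y) with h | h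
    · rw [List.cons_append, N.scn_cons_le h, N.scn_cons_le h]
    · rw [List.cons_append, N.scn_cons_gt h, N.scn_cons_gt h, ih]
      rw [wt_cons] at hr; linarith

theorem scn_ge (hF : SInv x₀ F) (a l : List X) {r : ℝ} (hr : N.wt l ≤ r) :
    N.scn F a l r = F (a ++ l) [] 0 x₀ := by
  have := N.scn_append hF a l [] (r := r - N.wt l) (by linarith)
  rw [List.append_nil, add_sub_cancel] at this
  exact this

theorem scn_congr {a b : List X} (l : List X) (r : ℝ)
    (h : ∀ m l t y, F (a ++ m) l t y = F (b ++ m) l t y) : N.scn F a l r = N.scn F b l r := by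
  induction l generalizing a b r with
  | nil =>
    show F a [] 0 x₀ = F b [] 0 x₀
    simpa using h [] [] 0 x₀
  | cons y l ih =>
    have h0 := h [] l (cl (r / N.u y)) y
    rw [List.append_nil, List.append_nil] at h0
    rw [scn, scn, h0, ih]
    intro m l t y'
    rw [List.append_assoc, List.append_assoc]; exact h _ _ _ _

theorem scn_base (hF : SInv x₀ F) (a l : List X) (r : ℝ) :
    N.scn F a (x₀ :: l) r = N.scn F a l r := by
  rcases le_or_gt r 0 with h | h
  · rw [N.scn_nonpos hF _ _ h, N.scn_nonpos hF _ _ h]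
    exact hF.del a [] l 0 x₀
  · have h1 : N.u x₀ < r := by simpa using h
    rw [N.scn_cons_gt h1, u_base, sub_zero]
    refine N.scn_congr l r fun m l t y => ?_
    rw [List.append_assoc]
    exact hF.pdel a m l t y

theorem scn_del (hF : SInv x₀ F) (a l m : List X) (r : ℝ) :
    N.scn F a (l ++ x₀ :: m) r = N.scn F a (l ++ m) r := by
  induction l generalizing a r with
  | nil => exact N.scn_base hF _ _ _
  | cons y l ih =>
    rw [List.cons_append, List.cons_append, scn, scn, ih, hF.del]

theorem scn_map (g : T → T') (a l : List X) (r : ℝ) :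
    g (N.scn F a l r) = N.scn (fun a l t y => g (F a l t y)) a l r := by
  induction l generalizing a r with
  | nil => rfl
  | cons y l ih => rw [scn, scn, apply_ite g, ih]

theorem continuous_scn (hF : SInv x₀ F)
    (hc : Continuous fun w : List X × List X × I × X => F w.1 w.2.1 w.2.2.1 w.2.2.2) :
    Continuous fun w : List X × List X × ℝ => N.scn F w.1 w.2.1 w.2.2 := by
  have key : Continuous fun w : List X × (List X × ℝ) => N.scn F w.2.1 w.1 w.2.2 := by
    refine continuous_list (hc.comp (by fun_prop : Continuous fun z : List X × ℝ =>
      (z.1, ([] : List X), (0 : I), x₀))) fun n ih => ?_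
    have hu := N.hu
    have cu : Continuous fun w : (X × LL X n) × List X × ℝ => N.u w.1.1 := by fun_prop
    have c1 : Continuous fun w : (X × LL X n) × List X × ℝ =>
      F w.2.1 w.1.2.1 (cl (w.2.2 / N.u w.1.1)) w.1.1 := by
      have hg : Continuous fun z : ((X × LL X n) × List X × ℝ) × I =>
        F z.1.2.1 z.1.1.2.1 z.2 z.1.1.1 :=
        hc.comp (by fun_prop :
          Continuous fun z : ((X × LL X n) × List X × ℝ) × I => (z.1.2.1, z.1.1.2.1, z.2, z.1.1.1))
      refine continuous_eval_jump (S := {w : (X × LL X n) × List X × ℝ | N.u w.1.1 = 0})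
        (τ := fun w : (X × LL X n) × List X × ℝ => cl (w.2.2 / N.u w.1.1)) hg ?_ ?_ ?_
      · exact isClosed_eq cu continuous_const
      · intro w hw
        refine ContinuousAt.continuousWithinAt ?_
        refine continuous_cl.continuousAt.comp (ContinuousAt.div ?_ ?_ hw)
        · fun_prop
        · fun_prop
      · rintro ⟨⟨y, l⟩, a, r⟩ hw τ τ'
        have : y = x₀ := (N.zero_iff y).1 hw
        subst this
        exact hF.tri _ _ _ _
    have c2 : Continuous fun w : (X × LL X n) × List X × ℝ =>
      N.scn F (w.2.1 ++ [w.1.1]) w.1.2.1 (w.2.2 - N.u w.1.1) :=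
      ih.comp (by fun_prop :
        Continuous fun w : (X × LL X n) × List X × ℝ => (w.1.2, (w.2.1 ++ [w.1.1],
          w.2.2 - N.u w.1.1)))
    refine Continuous.if_le c1 c2 (by fun_prop) cu ?_
    rintro ⟨⟨y, l⟩, a, r⟩ hr
    have hr : r = N.u y := hr
    subst hr
    have h1 := N.scn_cons hF a l.1 y le_rfl
    rw [add_zero, N.scn_cons_le le_rfl] at h1
    show F a l.1 (cl (N.u y / N.u y)) y = N.scn F (a ++ [y]) l.1 (N.u y - N.u y)
    rw [h1, sub_self]
  exact key.comp (by fun_prop : Continuous fun w : List X × List X × ℝ => (w.2.1, (w.1, w.2.2)))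

/-- Read a word in the suspension. -/
def rd (l : List X) (r : ℝ) : Susp 1 X x₀ := N.scn (fun _ _ t y => sp x₀ t y) [] l r

theorem SInv.sp : SInv x₀ fun _ _ t y => sp x₀ t y :=
  ⟨by simp, by simp, by simp, by simp, by simp⟩

theorem continuous_rd : Continuous fun w : List X × ℝ => N.rd w.1 w.2 :=
  (N.continuous_scn SInv.sp (by fun_prop)).comp
    (by fun_prop : Continuous fun w : List X × ℝ => (([] : List X), w.1, w.2))

theorem rd_nonpos (l : List X) {r : ℝ} (h : r ≤ 0) : N.rd l r = Susp.base 1 X x₀ :=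
  (N.scn_nonpos SInv.sp _ _ h).trans (by simp)
theorem rd_ge (l : List X) {r : ℝ} (h : N.wt l ≤ r) : N.rd l r = Susp.base 1 X x₀ :=
  (N.scn_ge SInv.sp _ _ h).trans (by simp)
theorem rd_append (l m : List X) {r : ℝ} (h : 0 ≤ r) : N.rd (l ++ m) (N.wt l + r) = N.rd m r :=
  (N.scn_append SInv.sp _ _ _ h).trans (N.scn_congr _ _ fun _ _ _ _ => rfl)
theorem rd_cons (y : X) (m : List X) {r : ℝ} (h : 0 ≤ r) : N.rd (y :: m) (N.u y + r) = N.rd m r :=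
  (N.scn_cons SInv.sp _ _ _ h).trans (N.scn_congr _ _ fun _ _ _ _ => rfl)
theorem rd_append_left (l m : List X) {r : ℝ} (h : r ≤ N.wt l) : N.rd (l ++ m) r = N.rd l r :=
  N.scn_append_left SInv.sp _ _ _ h
theorem rd_del (l m : List X) (r : ℝ) : N.rd (l ++ x₀ :: m) r = N.rd (l ++ m) r :=
  N.scn_del SInv.sp _ _ _ _
@[simp] theorem rd_base (l : List X) (r : ℝ) : N.rd (x₀ :: l) r = N.rd l r := N.rd_del [] l r

theorem rd_cons_le (y : X) (l : List X) {t : I} : N.rd (y :: l) (t * N.u y) = sp x₀ t y := by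
  have h1 : (t : ℝ) * N.u y ≤ N.u y := by nlinarith [N.nonneg y, t.2.2]
  rw [rd, N.scn_cons_le h1]
  by_cases h : y = x₀
  · subst h; simp
  · rw [mul_div_cancel_right₀ _ (N.pos h).ne', cl_coe]

/-- Read a word in the total space. -/
def Rd (κ : Bool) (a l : List X) (r : ℝ) : EE x₀ κ :=
  N.scn (fun a l t y => EE.mk x₀ κ (bif κ then l ++ a else l) t y) a l r

theorem SInv.mk : SInv x₀ fun a l t y => EE.mk x₀ κ (bif κ then l ++ a else l) t y where
  tri _ _ _ _ := EE.mk_tri _ _ _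
  zero a l y := by cases κ <;> exact EE.mk_zero _ _
  one a l y := by
    rw [EE.mk_one]
    cases κ <;> simp [app]
  del a l m t y := by
    cases κ
    · exact EE.mk_del _ _ _ _
    · simpa using EE.mk_del l (m ++ a) t y
  pdel a b l t y := by
    cases κ
    · rfl
    · simpa using EE.mk_del (l ++ a) b t y

theorem continuous_Rd : Continuous fun w : List X × List X × ℝ => N.Rd κ w.1 w.2.1 w.2.2 := by
  refine N.continuous_scn SInv.mk ?_
  cases κ
  · show Continuous fun w : List X × List X × I × X => EE.mk x₀ false w.2.1 w.2.2.1 w.2.2.2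
    fun_prop
  · show Continuous fun w : List X × List X × I × X => EE.mk x₀ true (w.2.1 ++ w.1) w.2.2.1 w.2.2.2
    fun_prop

theorem p_Rd (a l : List X) (r : ℝ) : EE.p (N.Rd κ a l r) = N.rd l r :=
  (N.scn_map EE.p a l r).trans (N.scn_congr l r fun _ _ _ _ => rfl)

theorem Rd_cons_le (a l : List X) (y : X) {t : I} :
    N.Rd κ a (y :: l) (t * N.u y) = EE.mk x₀ κ (bif κ then l ++ a else l) t y := by
  have h1 : (t : ℝ) * N.u y ≤ N.u y := by nlinarith [N.nonneg y, t.2.2]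
  rw [Rd, N.scn_cons_le h1]
  by_cases h : y = x₀
  · subst h; exact EE.mk_tri _ _ _
  · rw [mul_div_cancel_right₀ _ (N.pos h).ne', cl_coe]

end Nice

end LoopModel

namespace LoopModel

section
variable {A B Y : Type*} [TopologicalSpace A] [TopologicalSpace B] [TopologicalSpace Y]

/-- A map over `Y` is a weak equivalence if all its pullbacks along cubes are. -/
theorem WE.over {f : A → Y → B} (hne : Nonempty (B × Y) → Nonempty A)
    (h : ∀ (n : ℕ) (y : Cb n → Y), Continuous y →
      WE (fun z : A × Cb n => ((f z.1 (y z.2), z.2) : B × Cb n))) :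
    WE (fun z : A × Y => ((f z.1 z.2, z.2) : B × Y)) := by
  refine ⟨fun hB => ⟨((hne hB).some, hB.some.2)⟩, fun n b a hb ha hab => ?_⟩
  obtain ⟨a', ha', haa, hr⟩ := (h n (fun x => (b x).2) (by fun_prop)).2 n (fun x => ((b x).1, x))
    (fun x => ((a x).1, x)) (by fun_prop) (by fun_prop) (fun x hx => by
      have h1 : f (a x).1 (a x).2 = (b x).1 := congrArg Prod.fst (hab x hx)
      have h2 : (a x).2 = (b x).2 := congrArg Prod.snd (hab x hx)
      rw [h2] at h1
      exact Prod.ext h1 rfl)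
  refine ⟨fun x => ((a' x).1, (b (a' x).2).2), by fun_prop, fun x hx => ?_, ?_⟩
  · show ((a' x).1, (b (a' x).2).2) = a x
    rw [haa x hx]
    exact Prod.ext rfl (congrArg Prod.snd (hab x hx)).symm
  · exact hr.comp (g := fun z : B × Cb n => (z.1, (b z.2).2)) (by fun_prop)

theorem PSp.ext_iff {n₀ : A} {S : Set A} {ω ω' : PSp A n₀ S} : ω = ω' ↔ ∀ s, ω.1 s = ω'.1 s :=
  ⟨fun h _ => by rw [h], fun h => Subtype.ext (ContinuousMap.ext h)⟩

/-- Any map from a cube to a path connected space contracts to a given point. -/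
theorem Cb.contract [PathConnectedSpace A] {n : ℕ} {g : Cb n → A} (hg : Continuous g) (a : A) :
    Htpy g fun _ => a := by
  refine Htpy.trans (g := fun _ => g 0)
    ⟨fun w => g fun i => σ w.1 * w.2 i, by fun_prop, fun x => ?_,
    fun x => ?_⟩ ?_
  · simp
  · simp; rfl
  · have γ := PathConnectedSpace.somePath (g 0) a
    exact ⟨fun w => γ w.1, by fun_prop, fun _ => γ.source, fun _ => γ.target⟩
end

namespace Nice
variable {X : Type*} [TopologicalSpace X] {x₀ : X} (N : Nice X x₀) {κ : Bool} {T Z : Type*}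
  [TopologicalSpace T] [TopologicalSpace Z]

theorem we_const_UU (N : Nice X x₀) {Y : Set (Susp 1 X x₀)} (hY : Y ⊆ UU x₀) :
    WE (MS.const (EE.p : EE x₀ κ → _) hY) := by
  have hin : ∀ z : MS (EE.p : EE x₀ κ → _) (UU x₀) Y, EE.p z.1.1.1 ∈ UU x₀ := fun z => by
    rw [← z.1.2.1]; exact z.1.2.2 0
  have cv : Continuous fun z : MS (EE.p : EE x₀ κ → _) (UU x₀) Y => z.1.1 :=
    NS.continuous_val.comp continuous_subtype_val
  have ce : Continuous fun z : MS (EE.p : EE x₀ κ → _) (UU x₀) Y => z.1.1.1 :=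
    continuous_fst.comp cv
  have cγ : Continuous fun z : MS (EE.p : EE x₀ κ → _) (UU x₀) Y => z.1.1.2 :=
    continuous_snd.comp cv
  have cal : Continuous fun z : MS (EE.p : EE x₀ κ → _) (UU x₀) Y => al z.1.1.1 :=
    N.continuousOn_al.comp_continuous ce hin
  have cbe : Continuous fun w : JX x₀ × Y => N.be κ (w.1, w.2) :=
    N.continuous_be.comp (by fun_prop : Continuous fun w : JX x₀ × Y =>
      (w.1, (⟨w.2.1, hY w.2.2⟩ : UU x₀)))
  have mbe : ∀ w : JX x₀ × Y, EE.p (N.be κ (w.1, w.2)) ∈ Y := fun w => by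
    rw [p_be]; exact w.2.2
  let F : MS (EE.p : EE x₀ κ → _) (UU x₀) Y → JX x₀ × Y := fun z => (al z.1.1.1, z.ev)
  let R : JX x₀ × Y → MS (EE.p : EE x₀ κ → _) (UU x₀) Y := fun w =>
    MS.const _ hY ⟨N.be κ (w.1, w.2), mbe w⟩
  have hF : Continuous F := cal.prodMk MS.continuous_ev
  have hR : Continuous R := ((MS.isInducing_incl hY).continuous.comp
    (NS.he_const EE.continuous_p).1).comp (cbe.subtype_mk mbe)
  have hFR : Htpy (F ∘ R) id := by
    refine Htpy.symm ⟨fun w => (N.hJ w.1 w.2.1, w.2.2), ?_, fun w => ?_, fun w => ?_⟩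
    · exact (N.continuous_hJ.comp (by fun_prop : Continuous fun w : I × JX x₀ × Y =>
        (w.1, w.2.1))).prodMk (by fun_prop)
    · obtain ⟨l, hl⟩ := (JX.isQuotientMap_mk x₀).surjective w.1
      refine Prod.ext ?_ rfl
      show N.hJ 0 w.1 = w.1
      rw [← hl]; simp
    · refine Prod.ext ?_ (Subtype.ext ?_)
      · exact (N.al_be w.1 (hY w.2.2)).symm
      · show w.2.1 = EE.p (N.be κ (w.1, w.2))
        rw [p_be]
  have hRF : Htpy (R ∘ F) id := by
    refine Htpy.symm (Htpy.trans (g := fun z =>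
      (⟨⟨(N.be κ (al z.1.1.1, EE.p z.1.1.1), z.1.1.2), by rw [p_be]; exact z.1.2.1, z.1.2.2⟩, z.2⟩ :
        MS (EE.p : EE x₀ κ → _) (UU x₀) Y)) ?_ ?_)
    · refine ⟨fun w => ⟨⟨(N.eH (w.1, w.2.1.1.1), w.2.1.1.2), ?_, w.2.1.2.2⟩, w.2.2⟩, ?_,
        fun z => ?_,
        fun z => ?_⟩
      · rw [N.p_eH _ (hin w.2)]; exact w.2.1.2.1
      · refine Continuous.subtype_mk (Continuous.subtype_mk (Continuous.prodMk ?_ ?_) _) _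
        · exact N.continuousOn_eH.comp_continuous (by fun_prop) fun w => hin w.2
        · exact cγ.comp continuous_snd
      · exact Subtype.ext (Subtype.ext (Prod.ext (N.eH_zero (hin z)) rfl))
      · exact Subtype.ext (Subtype.ext (Prod.ext (N.eH_one (hin z)) rfl))
    · refine ⟨fun w => ⟨⟨(N.be κ (al w.2.1.1.1, w.2.1.1.2 w.1),
        ⟨fun τ => w.2.1.1.2 (max τ w.1), by fun_prop⟩), ?_, fun t => w.2.1.2.2 _⟩, ?_⟩, ?_,
          fun z => ?_,
        fun z => ?_⟩
      · rw [p_be]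
        exact congrArg w.2.1.1.2 (max_eq_right (show (0 : I) ≤ w.1 from w.1.2.1))
      · have h1 : w.2.1.1.2 (max 1 w.1) = w.2.1.1.2 1 :=
          congrArg w.2.1.1.2 (max_eq_left (show w.1 ≤ 1 from w.1.2.2))
        show w.2.1.1.2 (max 1 w.1) ∈ Y
        exact h1 ▸ w.2.2
      · refine Continuous.subtype_mk (Continuous.subtype_mk (Continuous.prodMk ?_ ?_) _) _
        · have c1 : Continuous fun w : I × MS (EE.p : EE x₀ κ → _) (UU x₀) Y =>
              (⟨w.2.1.1.2 w.1, w.2.1.2.2 _⟩ : UU x₀) :=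
            Continuous.subtype_mk (by fun_prop) _
          exact N.continuous_be.comp ((cal.comp continuous_snd).prodMk c1)
        · refine ContinuousMap.continuous_of_continuous_uncurry _ ?_
          show Continuous fun y : (I × MS (EE.p : EE x₀ κ → _) (UU x₀) Y) × I =>
            y.1.2.1.1.2 (max y.2 y.1.1)
          fun_prop
      · refine Subtype.ext (Subtype.ext (Prod.ext ?_ (ContinuousMap.ext fun τ => ?_)))
        · show N.be κ (al z.1.1.1, z.1.1.2 0) = _
          rw [z.1.2.1]
        · exact congrArg z.1.1.2 (max_eq_left (show (0 : I) ≤ τ from τ.2.1))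
      · refine Subtype.ext (Subtype.ext (Prod.ext rfl (ContinuousMap.ext fun τ => ?_)))
        show z.1.1.2 (max τ 1) = EE.p (N.be κ (al z.1.1.1, z.1.1.2 1))
        exact (congrArg z.1.1.2 (max_eq_right (show τ ≤ 1 from τ.2.2))).trans
          (N.p_be (al z.1.1.1, z.1.1.2 1)).symm
  have hc : Continuous (MS.const (EE.p : EE x₀ κ → _) hY) :=
    (MS.isInducing_incl hY).continuous.comp (NS.he_const EE.continuous_p).1
  exact WE.of_comp_left hc hF (N.he_al hY).we (HE.we ⟨hF, R, hR, hRF, hFR⟩)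

end Nice

end LoopModel

namespace LoopModel

namespace Nice
variable {X : Type*} [TopologicalSpace X] {x₀ : X} (N : Nice X x₀) {κ : Bool} {T Z : Type*}
  [TopologicalSpace T] [TopologicalSpace Z]

theorem continuous_WV : Continuous fun e : (EE.p : EE x₀ κ → _) ⁻¹' N.VV => N.W e.1 :=
  N.continuousOn_W.comp_continuous continuous_subtype_val fun e => e.2

theorem we_id_hJ : WE (N.hJ 1) := WE.congr N.htpy_hJ.symm WE.id

theorem we_W : WE fun e : (EE.p : EE x₀ κ → _) ⁻¹' N.VV => N.W e.1 := by
  refine WE.of_comp_right N.continuous_WV N.he_io ?_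
  have e : (fun e : (EE.p : EE x₀ κ → _) ⁻¹' N.VV => N.W e.1) ∘ (fun w : JX x₀ =>
      (⟨ioJ κ w, by
        show EE.p _ ∈ N.VV
        rw [p_ioJ]; exact N.base_mem_VV⟩ : (EE.p : EE x₀ κ → _) ⁻¹' N.VV)) = N.hJ 1 :=
    funext fun w => N.W_io w
  rw [e]
  exact N.we_id_hJ

/-- Multiplication by a letter after the deformation. -/
def shear (x : X) (w : JX x₀) : JX x₀ :=
  JX.lift (fun l => JX.mk x₀ (x :: N.hl 1 l)) (fun l m => by
    rw [hl_base, ← List.cons_append, JX.mk_del, hl_append, List.cons_append]) w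

@[simp] theorem shear_mk (x : X) (l : List X) :
    N.shear x (JX.mk x₀ l) = JX.mk x₀ (x :: N.hl 1 l) := rfl

theorem continuous_shear : Continuous fun w : JX x₀ × X => N.shear w.2 w.1 := by
  have hmk := (JX.isQuotientMap_mk x₀).continuous
  refine N.continuous_kill (Φ := fun z : List X × X => JX.mk x₀ (z.2 :: z.1))
    (hmk.comp (by fun_prop)) fun l m z => ?_
  rw [← List.cons_append, JX.mk_del, List.cons_append]

theorem shear_base (w : JX x₀) : N.shear x₀ w = N.hJ 1 w := by
  obtain ⟨l, rfl⟩ := (JX.isQuotientMap_mk x₀).surjective w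
  rw [shear_mk, JX.mk_cons_base, hJ_mk]

theorem we_shear [PathConnectedSpace X] {Y : Type*} [TopologicalSpace Y] {g : Y → X}
    (hg : Continuous g) :
    WE fun z : JX x₀ × Y => ((N.shear (g z.2) z.1, z.2) : JX x₀ × Y) := by
  have hs := N.continuous_shear
  refine WE.over (f := fun w b => N.shear (g b) w) (fun _ => ⟨JX.mk x₀ []⟩) fun n y hy => ?_
  obtain ⟨F, hF, h0, h1⟩ := Cb.contract (hg.comp hy) x₀
  refine WE.congr (g := fun z : JX x₀ × Cb n => (N.hJ 1 z.1, z.2)) ?_ N.we_id_hJ.prod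
  refine ⟨fun w => (N.shear (F (w.1, w.2.2)) w.2.1, w.2.2), ?_, fun z => ?_, fun z => ?_⟩
  · exact (hs.comp (by fun_prop : Continuous fun w : I × JX x₀ × Cb n =>
      (w.2.1, F (w.1, w.2.2)))).prodMk (by fun_prop)
  · exact Prod.ext (congrArg (fun x => N.shear x z.1) (h0 z.2)) rfl
  · exact Prod.ext ((congrArg (fun x => N.shear x z.1) (h1 z.2)).trans (N.shear_base z.1)) rfl

/-- The overlap of the two pieces. -/
abbrev YY : Set (Susp 1 X x₀) := UU x₀ ∩ N.VV

open Classical in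
/-- The letter multiplied on the overlap. -/
def gY (b : N.YY) : X := if ((coords b.1).1 : ℝ) ≤ 1 / 2 then N.h (1, (coords b.1).2) else x₀

theorem continuous_gY : Continuous N.gY := by
  have hc : Continuous fun b : N.YY => coords b.1 :=
    N.continuousOn_coords.comp_continuous continuous_subtype_val fun b => b.2.1
  have hh := N.hh
  refine Continuous.if_le (f := fun b : N.YY => ((coords b.1).1 : ℝ)) (g := fun _ => 1 / 2)
    (f' := fun b => N.h (1, (coords b.1).2)) (g' := fun _ => x₀) (by fun_prop) continuous_const
    (by fun_prop) continuous_const ?_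
  rintro ⟨b, hb⟩ h
  have h : ((coords b).1 : ℝ) = 1 / 2 := h
  have h1 := hb.2
  rw [← sp_coords b, sp_mem_VV] at h1
  exact N.h_one _ (h1.resolve_left fun h' => h' h).le

theorem W_eq_shear (e : (EE.p : EE x₀ false → _) ⁻¹' N.YY) :
    N.W e.1 = N.shear (N.gY ⟨EE.p e.1, e.2⟩) (al e.1) := by
  obtain ⟨e, he⟩ := e
  obtain ⟨l, t, y, rfl⟩ := EE.cases e
  have hg : Good x₀ t y := sp_mem_UU.1 he.1
  have hc : coords (EE.p (EE.mk x₀ false l t y)) = (t, y) := coords_sp hg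
  show N.W (EE.mk x₀ false l t y) = N.shear (N.gY _) (al (EE.mk x₀ false l t y))
  unfold gY
  rw [al_mk hg, shear_mk]
  simp only [hc]
  by_cases h : (t : ℝ) ≤ 1 / 2
  · rw [if_pos h, W_le _ h]
  · rw [if_neg h, W_gt _ h, JX.mk_cons_base]; rfl

theorem we_pW [PathConnectedSpace X] :
    WE fun e : (EE.p : EE x₀ false → _) ⁻¹' N.YY =>
      ((N.W e.1, ⟨EE.p e.1, e.2⟩) : JX x₀ × N.YY) := by
  have h1 := N.he_al (κ := false) (Y := N.YY) inter_subset_left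
  have hs := N.continuous_shear
  have hg := N.continuous_gY
  have h2 := (N.we_shear hg).comp h1.we ((hs.comp (by fun_prop :
    Continuous fun z : JX x₀ × N.YY => (z.1, N.gY z.2))).prodMk continuous_snd) h1.1
  have e : (fun e : (EE.p : EE x₀ false → _) ⁻¹' N.YY =>
      ((N.W e.1, ⟨EE.p e.1, e.2⟩) : JX x₀ × N.YY)) =
      (fun z : JX x₀ × N.YY => ((N.shear (N.gY z.2) z.1, z.2) : JX x₀ × N.YY)) ∘
        (fun e : (EE.p : EE x₀ false → _) ⁻¹' N.YY => ((al e.1, ⟨EE.p e.1, e.2⟩) : JX x₀ × N.YY)) :=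
    funext fun e => Prod.ext (N.W_eq_shear e) rfl
  rw [e]; exact h2

/-- The deformation of the overlap inside the base-point piece. -/
def yG (w : I × N.YY) : N.VV := N.GaV (w.1, ⟨w.2.1, w.2.2.2⟩)

theorem continuous_yG : Continuous N.yG :=
  N.continuous_GaV.comp (by fun_prop : Continuous fun w : I × N.YY =>
    ((w.1, ⟨w.2.1, w.2.2.2⟩) : I × N.VV))

theorem continuous_jG_aux : Continuous fun z : (I × (EE.p : EE x₀ false → _) ⁻¹' N.YY) × I =>
    (N.yG (z.1.1 * z.2, ⟨EE.p z.1.2.1, z.1.2.2⟩) : Susp 1 X x₀) := by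
  have hp : Continuous (EE.p : EE x₀ false → _) := EE.continuous_p
  exact continuous_subtype_val.comp (N.continuous_yG.comp (by fun_prop :
    Continuous fun z : (I × (EE.p : EE x₀ false → _) ⁻¹' N.YY) × I =>
      ((z.1.1 * z.2, ⟨EE.p z.1.2.1, z.1.2.2⟩) : I × N.YY)))

/-- The track of the deformation, truncated. -/
def jP (w : I × (EE.p : EE x₀ false → _) ⁻¹' N.YY) : C(I, Susp 1 X x₀) :=
  ⟨fun τ => (N.yG (w.1 * τ, ⟨EE.p w.2.1, w.2.2⟩) : Susp 1 X x₀),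
    (N.continuous_jG_aux.comp (by fun_prop : Continuous fun τ : I => (w, τ)) :)⟩

theorem jP_apply (w : I × (EE.p : EE x₀ false → _) ⁻¹' N.YY) (τ : I) :
    N.jP w τ = N.Ga (w.1 * τ, EE.p w.2.1) := rfl

theorem jP_zero (w : I × (EE.p : EE x₀ false → _) ⁻¹' N.YY) : N.jP w 0 = EE.p w.2.1 := by
  rw [jP_apply, mul_zero, Ga_zero]

theorem jP_mem (w : I × (EE.p : EE x₀ false → _) ⁻¹' N.YY) (τ : I) : N.jP w τ ∈ N.VV :=
  (N.yG (w.1 * τ, ⟨EE.p w.2.1, w.2.2⟩)).2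

/-- A point of the overlap with the truncated track. -/
def jG (w : I × (EE.p : EE x₀ false → _) ⁻¹' N.YY) : NS (EE.p : EE x₀ false → _) N.VV :=
  ⟨(w.2.1, N.jP w), N.jP_zero w, N.jP_mem w⟩

theorem continuous_jG : Continuous N.jG :=
  Continuous.subtype_mk (Continuous.prodMk (by fun_prop)
    (ContinuousMap.continuous_of_continuous_uncurry _ N.continuous_jG_aux)) _

theorem jG_ev (s : I) (a : (EE.p : EE x₀ false → _) ⁻¹' N.YY) :
    (N.jG (s, a)).ev = N.yG (s, ⟨EE.p a.1, a.2⟩) := Subtype.ext (by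
  show N.Ga (s * 1, EE.p a.1) = N.Ga (s, EE.p a.1)
  rw [mul_one])

theorem we_const_VV [PathConnectedSpace X] :
    WE (MS.const (EE.p : EE x₀ false → _) (inter_subset_right : N.YY ⊆ N.VV)) := by
  let p : EE x₀ false → Susp 1 X x₀ := EE.p
  have hp : Continuous p := EE.continuous_p
  have cG := N.continuous_GaV
  let r : p ⁻¹' N.YY → N.YY := fun e => ⟨p e.1, e.2⟩
  have hr : Continuous r := (hp.comp continuous_subtype_val).subtype_mk _
  have key := PB.transport NS.fib_ev N.continuous_yG hr N.continuous_jG N.jG_ev ?_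
  · let k : (PB (NS.ev : NS p N.VV → N.VV) fun b => N.yG (0, b)) → MS p N.VV N.YY := fun z =>
      ⟨z.1.2, by
        rw [z.2]
        show N.Ga (0, z.1.1.1) ∈ N.YY
        rw [Ga_zero]; exact z.1.1.2⟩
    have hk : HE k := by
      refine ⟨(by fun_prop :
        Continuous fun z : PB (NS.ev : NS p N.VV → N.VV) fun b => N.yG (0, b) =>
        z.1.2).subtype_mk _, fun z => ⟨(z.ev, z.1), Subtype.ext ?_⟩, ?_, ?_, ?_⟩
      · show (z.1.ev : Susp 1 X x₀) = N.Ga (0, z.1.ev)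
        rw [Ga_zero]
      · exact Continuous.subtype_mk (MS.continuous_ev.prodMk continuous_subtype_val) _
      · refine Htpy.trans (g := id) ⟨fun w => w.2, continuous_snd, fun z => ?_, fun z => rfl⟩
          (Htpy.refl continuous_id)
        refine Subtype.ext (Prod.ext (Subtype.ext ?_) rfl)
        have := congrArg Subtype.val z.2
        show z.1.1.1 = (z.1.2.ev : Susp 1 X x₀)
        rw [this]
        exact (N.Ga_zero _).symm
      · exact Htpy.refl continuous_id
    have e : MS.const (EE.p : EE x₀ false → _) (inter_subset_right : N.YY ⊆ N.VV) =
        k ∘ fun a => ⟨(r a, N.jG (0, a)), N.jG_ev 0 a⟩ := by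
      refine funext fun e =>
        Subtype.ext (Subtype.ext (Prod.ext rfl (ContinuousMap.ext fun τ => ?_)))
      show p e.1 = N.Ga (0 * τ, p e.1)
      rw [zero_mul, Ga_zero]
    have c0 : Continuous fun a : p ⁻¹' N.YY =>
        (⟨(r a, N.jG (0, a)), N.jG_ev 0 a⟩ : PB (NS.ev : NS p N.VV → N.VV) fun b => N.yG (0, b)) :=
      Continuous.subtype_mk (hr.prodMk (N.continuous_jG.comp
        (continuous_const.prodMk continuous_id))) _
    have w0 := hk.we.comp key hk.1 c0
    rw [e]
    exact w0
  · let b₀ := Susp.base 1 X x₀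
    have nv := NV.he_fst hp (Γ := N.GaV) (b₀ := b₀) cG (fun v => Subtype.ext (N.Ga_zero v))
      (fun v => N.Ga_one v) (fun s v hv => by
        show N.Ga (s, v.1) = b₀
        rw [hv]; exact N.Ga_base s)
    have w1 := (N.we_W (κ := false)).comp nv.we N.continuous_WV nv.1
    have w2 := w1.prod (C := N.YY)
    let k : (PB (NS.ev : NS p N.VV → N.VV) fun b => N.yG (1, b)) → NV p N.VV b₀ × N.YY := fun z =>
      (⟨z.1.2, by rw [z.2]; exact N.Ga_one _⟩, z.1.1)
    have hk : HE k := by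
      refine ⟨Continuous.prodMk (Continuous.subtype_mk (by fun_prop) _) (by fun_prop),
        fun z => ⟨(z.2, z.1.1), Subtype.ext ?_⟩, ?_, ?_, ?_⟩
      · show (z.1.1.ev : Susp 1 X x₀) = N.Ga (1, z.2.1)
        rw [Ga_one, z.1.2]
      · exact Continuous.subtype_mk (by fun_prop) _
      · exact Htpy.refl continuous_id
      · exact Htpy.refl continuous_id
    have cw : Continuous fun z : NV p N.VV b₀ × N.YY =>
      ((((fun e : (EE.p : EE x₀ false → _) ⁻¹' N.VV => N.W e.1) ∘ fun z : NV p N.VV b₀ =>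
        (⟨z.1.1.1, by
          show p z.1.1.1 ∈ N.VV
          rw [← z.1.2.1]; exact z.1.2.2 0⟩ : p ⁻¹' N.VV)) z.1, z.2) : JX x₀ × N.YY) :=
      ((N.continuous_WV.comp nv.1).comp continuous_fst).prodMk continuous_snd
    refine WE.of_comp_left ((hr.prodMk (N.continuous_jG.comp
      (continuous_const.prodMk continuous_id))).subtype_mk _) (cw.comp hk.1) ?_
      (w2.comp hk.we cw hk.1)
    exact N.we_pW

theorem glue [PathConnectedSpace X] : Glue (EE.p : EE x₀ false → _) (UU x₀) N.VV :=
  ⟨N.we_const_UU _, N.we_const_VV⟩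

end Nice

end LoopModel

namespace LoopModel

section
variable {E B J : Type*} [TopologicalSpace E] [TopologicalSpace B] [TopologicalSpace J]
  {p : E → B} {U V : Set B}

/-- Points with constant paths. -/
def Sh.unit (hUV : ∀ b, b ∈ U ∨ b ∈ V) (e : E) : Sh p U V :=
  ⟨⟨(e, .const I (p e)), rfl, fun _ => trivial⟩,
    (hUV (p e)).imp (fun h _ => h) (fun h _ => h)⟩

theorem Sh.continuous_unit (hp : Continuous p) (hUV : ∀ b, b ∈ U ∨ b ∈ V) :
    Continuous (Sh.unit hUV : E → Sh p U V) := by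
  refine Continuous.subtype_mk (Continuous.subtype_mk (Continuous.prodMk continuous_id ?_) _) _
  exact ContinuousMap.continuous_of_continuous_uncurry _
    (show Continuous fun y : E × I => p y.1 by fun_prop)

/-- Truncation of the paths. -/
def Sh.trunc (s : I) (z : Sh p U V) : Sh p U V :=
  ⟨⟨(z.1.1.1, z.1.1.2.comp ⟨fun τ => s * τ, by fun_prop⟩), by
    show z.1.1.2 (s * 0) = _
    rw [mul_zero]; exact z.1.2.1, fun _ => trivial⟩,
    z.2.imp (fun h t => h (s * t)) (fun h t => h (s * t))⟩

theorem Sh.continuous_trunc : Continuous fun w : I × Sh p U V => Sh.trunc w.1 w.2 := by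
  have hv : Continuous fun z : Sh p U V => z.1.1 :=
    NS.continuous_val.comp continuous_subtype_val
  refine Continuous.subtype_mk (Continuous.subtype_mk (Continuous.prodMk
    (continuous_fst.comp (hv.comp continuous_snd)) ?_) _) _
  have h2 : Continuous fun y : (I × Sh p U V) × I => y.1.2.1.1.2 :=
    continuous_snd.comp (hv.comp (by fun_prop))
  exact ContinuousMap.continuous_of_continuous_uncurry _
    (show Continuous fun y : (I × Sh p U V) × I => y.1.2.1.1.2 (y.1.1 * y.2) by fun_prop)

theorem Sh.ext' {z z' : Sh p U V} (h : z.1.1.1 = z'.1.1.1) (h2 : ∀ τ, z.1.1.2 τ = z'.1.1.2 τ) :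
    z = z' := Subtype.ext (Subtype.ext (Prod.ext h (ContinuousMap.ext h2)))

open Classical in
/-- Contraction of a space of short paths obtained from a contraction of the total space. -/
def Sh.ctr (hUV : ∀ b, b ∈ U ∨ b ∈ V) (C : I × E → E) (w : I × Sh p U V) : Sh p U V :=
  if (w.1 : ℝ) ≤ 1 / 2 then Sh.unit hUV (C (cl (1 - 2 * w.1), w.2.1.1.1))
  else Sh.trunc (cl (2 * w.1 - 1)) w.2

theorem Sh.continuous_ctr (hp : Continuous p) (hUV : ∀ b, b ∈ U ∨ b ∈ V) {C : I × E → E}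
    (hC : Continuous C) (h0 : ∀ e, C (0, e) = e) :
    Continuous (Sh.ctr hUV C : I × Sh p U V → Sh p U V) := by
  have hv : Continuous fun w : I × Sh p U V => w.2.1.1.1 :=
    continuous_fst.comp (NS.continuous_val.comp (continuous_subtype_val.comp continuous_snd))
  have hu := Sh.continuous_unit (U := U) (V := V) hp hUV
  have hcl := continuous_cl
  refine Continuous.if_le (f := fun w : I × Sh p U V => (w.1 : ℝ)) (g := fun _ => 1 / 2)
    (f' := fun w => Sh.unit hUV (C (cl (1 - 2 * w.1), w.2.1.1.1)))
    (g' := fun w => Sh.trunc (cl (2 * w.1 - 1)) w.2)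
    (by fun_prop) (Sh.continuous_trunc.comp (by fun_prop : Continuous fun w : I × Sh p U V =>
      (cl (2 * (w.1 : ℝ) - 1), w.2))) (by fun_prop) continuous_const ?_
  rintro ⟨s, z⟩ hs
  have hs : (s : ℝ) = 1 / 2 := hs
  have e1 : cl (1 - 2 * (s : ℝ)) = 0 := cl_of_le (by rw [hs]; norm_num)
  have e2 : cl (2 * (s : ℝ) - 1) = 0 := cl_of_le (by rw [hs]; norm_num)
  simp only [e1, e2, h0]
  refine Sh.ext' rfl fun τ => ?_
  show p z.1.1.1 = z.1.1.2 (0 * τ)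
  rw [zero_mul]; exact z.1.2.1.symm

theorem Sh.ctr_zero (hUV : ∀ b, b ∈ U ∨ b ∈ V) {C : I × E → E} {e₀ : E}
    (h1 : ∀ e, C (1, e) = e₀) (z : Sh p U V) : Sh.ctr hUV C (0, z) = Sh.unit hUV e₀ := by
  have : ((0 : I) : ℝ) ≤ 1 / 2 := by norm_num
  unfold Sh.ctr
  rw [if_pos this]
  show Sh.unit hUV (C (cl (1 - 2 * ((0 : I) : ℝ)), _)) = _
  rw [show cl (1 - 2 * ((0 : I) : ℝ)) = 1 from cl_of_ge (by norm_num), h1]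

theorem Sh.ctr_one (hUV : ∀ b, b ∈ U ∨ b ∈ V) {C : I × E → E} (z : Sh p U V) :
    Sh.ctr hUV C (1, z) = z := by
  have : ¬ ((1 : I) : ℝ) ≤ 1 / 2 := by norm_num
  unfold Sh.ctr
  rw [if_neg this]
  show Sh.trunc (cl (2 * ((1 : I) : ℝ) - 1)) z = _
  rw [show cl (2 * ((1 : I) : ℝ) - 1) = 1 from cl_of_ge (by norm_num)]
  refine Sh.ext' rfl fun τ => ?_
  show z.1.1.2 (1 * τ) = _
  rw [one_mul]

theorem Sh.ctr_unit (hUV : ∀ b, b ∈ U ∨ b ∈ V) {C : I × E → E} {e₀ : E}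
    (hn : ∀ s, C (s, e₀) = e₀) (s : I) :
    Sh.ctr hUV C (s, Sh.unit hUV e₀) = (Sh.unit hUV e₀ : Sh p U V) := by
  unfold Sh.ctr
  split_ifs
  · show Sh.unit hUV (C (_, e₀)) = _
    rw [hn]
  · rfl

theorem Glue.we_scan (hp : Continuous p) (hU : IsOpen U) (hV : IsOpen V)
    (hUV : ∀ b, b ∈ U ∨ b ∈ V) (hG : Glue p U V) {b₀ : B} (hb₀ : b₀ ∉ U)
    {C : I × E → E} (hC : Continuous C) {e₀ : E} (h0 : ∀ e, C (0, e) = e)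
    (h1 : ∀ e, C (1, e) = e₀) (hn : ∀ s, C (s, e₀) = e₀) (he₀ : p e₀ = b₀)
    {Γ : I × V → V} (hΓ : Continuous Γ) (hΓ0 : ∀ v, Γ (0, v) = v) (hΓ1 : ∀ v, (Γ (1, v) : B) = b₀)
    (hΓb : ∀ s (v : V), (v : B) = b₀ → (Γ (s, v) : B) = b₀)
    {io : J → E} (hio : Continuous io) (hpio : ∀ w, p (io w) = b₀)
    (hbV : ∀ w, p (io w) ∈ V) (he : HE fun w => (⟨io w, hbV w⟩ : p ⁻¹' V))
    {f : J → PSp B b₀ {b₀}} (hf : ∀ w s, (f w).1 s = p (C (σ s, io w))) : WE f := by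
  have hb : b₀ ∈ V := (hUV b₀).resolve_left hb₀
  let n₀ : Sh p U V := Sh.unit hUV e₀
  have ht := Glue.tf hp hU hV hUV hG hb₀ (n₀ := n₀) he₀
  let S : Set (Sh p U V) := {z | z.1.In V ∧ z.ev = b₀}
  have hu := Sh.continuous_unit (p := p) hp hUV
  have q1 := PSp.he_end (S := S) (Sh.continuous_ctr (U := U) (V := V) hp hUV hC h0)
    (Sh.ctr_zero hUV h1) (Sh.ctr_one hUV) (Sh.ctr_unit hUV hn)
  let k : S → NV p V b₀ := fun z => ⟨⟨z.1.1.1, z.1.1.2.1, z.2.1⟩, z.2.2⟩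
  have hk : HE k := by
    refine ⟨?_, fun z => ⟨⟨⟨z.1.1, z.1.2.1, fun _ => trivial⟩, Or.inr z.1.2.2⟩, z.1.2.2, z.2⟩,
      ?_, ?_, ?_⟩
    · exact Continuous.subtype_mk (Continuous.subtype_mk (NS.continuous_val.comp
        (continuous_subtype_val.comp continuous_subtype_val)) _) _
    · have c1 : Continuous fun z : NV p V b₀ =>
          (⟨z.1.1, z.1.2.1, fun _ => trivial⟩ : NS p (univ : Set B)) :=
        Continuous.subtype_mk (NS.continuous_val.comp continuous_subtype_val) _
      have c2 : Continuous fun z : NV p V b₀ => (⟨⟨z.1.1, z.1.2.1, fun _ => trivial⟩,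
          Or.inr z.1.2.2⟩ : Sh p U V) := c1.subtype_mk _
      exact c2.subtype_mk _
    · exact Htpy.refl continuous_id
    · exact Htpy.refl continuous_id
  have q3 := NV.he_fst hp hΓ hΓ0 hΓ1 hΓb
  have q := q3.comp (hk.comp q1)
  let ω : J → PSp (Sh p U V) n₀ S := fun w =>
    ⟨⟨fun s => Sh.unit hUV (C (σ s, io w)), by fun_prop⟩, by
      show Sh.unit hUV (C (σ 0, io w)) = _
      rw [unitInterval.symm_zero, h1], by
      show Sh.unit hUV (C (σ 1, io w)) ∈ S
      rw [unitInterval.symm_one, h0]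
      exact ⟨fun _ => hbV w, hpio w⟩⟩
  have hω : Continuous ω := Continuous.subtype_mk
    (ContinuousMap.continuous_of_continuous_uncurry _
      (show Continuous fun y : J × I => (Sh.unit hUV (C (σ y.2, io y.1)) : Sh p U V) by
        fun_prop)) _
  have wω : WE ω := by
    refine WE.of_comp_left hω q.1 ?_ q.we
    refine cast (congrArg WE (funext fun w => Subtype.ext ?_)) he.we
    show io w = C (σ 1, io w)
    rw [unitInterval.symm_one, h0]
  have r := ht.we.comp wω (PSp.continuous_map _ _ _) hω
  refine cast (congrArg WE (funext fun w => PSp.ext_iff.2 fun s => ?_)) r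
  exact (hf w s).symm

end

namespace Nice
variable {X : Type*} [TopologicalSpace X] {x₀ : X} (N : Nice X x₀) {κ : Bool} {T Z : Type*}
  [TopologicalSpace T] [TopologicalSpace Z]

/-- The position at time `s` of a scan which moves to the end of a word. -/
def pos' (s : I) (l : List X) (r : ℝ) : ℝ := r + s * (N.wt l - r)

theorem cA_inv (s : I) : EInv x₀ false fun l t y =>
    N.Rd false [] (y :: l) (N.pos' s (y :: l) (t * N.u y)) where
  del l m t y := by
    have := N.scn_del (SInv.mk (κ := false)) [] (y :: l) m
      (N.pos' s (y :: (l ++ x₀ :: m)) (t * N.u y))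
    simp only [Rd, pos', wt_cons, wt_append, N.u_base, zero_add] at this ⊢
    exact this
  tri l t t' := by simp [N.u_base]
  zero l y := by
    simp only [Set.Icc.coe_zero, zero_mul]
    have := N.scn_base (SInv.mk (κ := false)) [] (y :: l) (N.pos' s (y :: l) 0)
    simp only [Rd, pos', wt_cons, wt_append, N.u_base, zero_add] at this ⊢
    exact this.symm
  one l y := by
    have hp : 0 ≤ N.pos' s l 0 := by
      have := N.wt_nonneg l
      simp only [pos']; nlinarith [s.2.1]
    have h1 := N.scn_base (SInv.mk (κ := false)) [] l (N.pos' s l 0)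
    have h2 := N.scn_cons (SInv.mk (κ := false)) [] l y hp
    have h3 : N.Rd false [y] l (N.pos' s l 0) = N.Rd false [] l (N.pos' s l 0) :=
      N.scn_congr _ _ fun _ _ _ _ => rfl
    have e : N.pos' s (y :: l) (((1 : I) : ℝ) * N.u y) = N.u y + N.pos' s l 0 := by
      simp only [pos', wt_cons, Set.Icc.coe_one]; ring
    have e' : N.pos' s (x₀ :: l) (((0 : I) : ℝ) * N.u x₀) = N.pos' s l 0 := by
      simp only [pos', wt_cons, Set.Icc.coe_zero, N.u_base]; ring
    show _ = N.Rd false [] (x₀ :: l) (N.pos' s (x₀ :: l) (((0 : I) : ℝ) * N.u x₀))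
    rw [e, e']
    exact h2.trans (h3.trans h1.symm)

/-- The contraction of the total space over words. -/
def cA (w : I × EE x₀ false) : EE x₀ false :=
  EE.lift (fun l t y => N.Rd false [] (y :: l) (N.pos' w.1 (y :: l) (t * N.u y))) (N.cA_inv w.1) w.2

theorem cA_mk (s : I) (l : List X) (t : I) (y : X) : N.cA (s, EE.mk x₀ false l t y) =
    N.Rd false [] (y :: l) (N.pos' s (y :: l) (t * N.u y)) := rfl

theorem continuous_cA : Continuous N.cA := by
  have hu := N.hu
  have hw := N.continuous_wt
  refine EE.continuous_lift₂ (h := N.cA_inv) ?_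
  exact N.continuous_Rd.comp (by
    unfold pos'
    fun_prop : Continuous fun w : I × EPre X => (([] : List X), w.2.2.2 :: w.2.1,
      N.pos' w.1 (w.2.2.2 :: w.2.1) (w.2.2.1 * N.u w.2.2.2)))

theorem cA_zero (e : EE x₀ false) : N.cA (0, e) = e := by
  obtain ⟨l, t, y, rfl⟩ := EE.cases e
  rw [cA_mk]
  have : N.pos' 0 (y :: l) (t * N.u y) = t * N.u y := by simp [pos']
  rw [this, Rd_cons_le]; rfl

theorem cA_one (e : EE x₀ false) : N.cA (1, e) = EE.io x₀ false [] := by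
  obtain ⟨l, t, y, rfl⟩ := EE.cases e
  rw [cA_mk]
  have : N.pos' 1 (y :: l) (t * N.u y) = N.wt (y :: l) := by simp [pos']
  rw [this]
  exact N.scn_ge SInv.mk _ _ le_rfl

theorem cA_io (s : I) (l : List X) : N.cA (s, EE.io x₀ false l) =
    N.Rd false [] l (s * N.wt l) := by
  show N.Rd false [] (x₀ :: l) (N.pos' s (x₀ :: l) (((0 : I) : ℝ) * N.u x₀)) = _
  have : N.pos' s (x₀ :: l) (((0 : I) : ℝ) * N.u x₀) = s * N.wt l := by
    simp [pos', N.u_base]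
  rw [this]
  exact N.scn_base SInv.mk _ _ _

/-- The loop which reads a word. -/
def scan (w : JX x₀) : PSp (Susp 1 X x₀) (Susp.base 1 X x₀) {Susp.base 1 X x₀} :=
  JX.lift (fun l => ⟨⟨fun τ => N.rd l (σ τ * N.wt l), N.continuous_rd.comp (by fun_prop :
      Continuous fun τ : I => (l, (σ τ : ℝ) * N.wt l))⟩, by
    show N.rd l ((σ 0 : I) * N.wt l) = _
    rw [unitInterval.symm_zero]; exact N.rd_ge _ (by simp), by
    show N.rd l ((σ 1 : I) * N.wt l) = _
    rw [unitInterval.symm_one]; exact N.rd_nonpos _ (by simp)⟩) (fun l m => by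
      refine PSp.ext_iff.2 fun τ => ?_
      show N.rd (l ++ x₀ :: m) (σ τ * N.wt (l ++ x₀ :: m)) = N.rd (l ++ m) (σ τ * N.wt (l ++ m))
      rw [rd_del]; simp [N.u_base]) w

theorem scan_mk (l : List X) (τ : I) : (N.scan (JX.mk x₀ l)).1 τ = N.rd l (σ τ * N.wt l) := rfl

@[fun_prop]
theorem continuous_scan : Continuous N.scan := by
  have hw := N.continuous_wt
  refine (JX.isQuotientMap_mk x₀).continuous_iff.2 (Continuous.subtype_mk
    (ContinuousMap.continuous_of_continuous_uncurry _ ?_) _)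
  exact (N.continuous_rd.comp (by fun_prop : Continuous fun y : List X × I =>
    (y.1, (σ y.2 : ℝ) * N.wt y.1)) :)

theorem we_scan [PathConnectedSpace X] : WE N.scan := by
  refine Glue.we_scan EE.continuous_p N.isOpen_UU N.isOpen_VV
    (fun b => (N.UU_union_VV ▸ mem_univ b : b ∈ UU x₀ ∪ N.VV)) N.glue ?_ N.continuous_cA N.cA_zero
    N.cA_one (fun s => ?_) ?_ N.continuous_GaV (fun v => Subtype.ext (N.Ga_zero v))
    (fun v => N.Ga_one v) (fun s v hv => ?_) (continuous_ioJ (κ := false)) p_ioJ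
    (fun w => by rw [p_ioJ]; exact N.base_mem_VV) N.he_io fun w s => ?_
  · exact fun h => h rfl
  · rw [cA_io]
    exact N.scn_nonpos SInv.mk _ _ (by simp)
  · exact p_ioJ (JX.mk x₀ [])
  · show N.Ga (s, v.1) = _
    rw [hv]; exact N.Ga_base s
  · obtain ⟨l, rfl⟩ := (JX.isQuotientMap_mk x₀).surjective w
    rw [scan_mk, ioJ_mk, cA_io, p_Rd]

end Nice

end LoopModel

namespace LoopModel

section
variable {A B E L : Type*} [TopologicalSpace A] [TopologicalSpace B] [TopologicalSpace E]
  [TopologicalSpace L]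

/-- Free loops, parametrized by the interval. -/
abbrev LP (B : Type*) [TopologicalSpace B] : Type _ := {β : C(I, B) // β 0 = β 1}

/-- The starting point of a free loop. -/
def LP.ev (β : LP B) : B := β.1 0

@[fun_prop]
theorem LP.continuous_ev : Continuous (LP.ev : LP B → B) := by
  unfold LP.ev; fun_prop

theorem WE.restrictPreimage_of {f : E → L} {ev : L → B} {p : E → B} (h : ∀ e, ev (f e) = p e)
    {Y : Set B} (hw : WE (fun e : p ⁻¹' Y => (⟨f e.1, by
      show ev (f e) ∈ Y
      rw [h]; exact e.2⟩ : ev ⁻¹' Y))) : WE ((ev ⁻¹' Y).restrictPreimage f) := by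
  obtain rfl : p = ev ∘ f := funext fun e => (h e).symm
  exact hw

theorem LP.transport {Y : Set B} {b₀ : B} {y : I × Y → B × B} (hy : Continuous y)
    (y0 : ∀ b, y (0, b) = (b.1, b.1)) (y1 : ∀ b, y (1, b) = (b₀, b₀)) {r : A → Y}
    (hr : Continuous r) {j : I × A → C(I, B)} (hj : Continuous j)
    (hjy : ∀ s a, (j (s, a) 0, j (s, a) 1) = y (s, r a))
    {g : A → PSp B b₀ {b₀} × Y} (hg : WE g) (hg1 : ∀ a, (g a).1.1 = j (1, a))
    (hg2 : ∀ a, (g a).2 = r a)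
    {f : A → (LP.ev : LP B → B) ⁻¹' Y} (hf : ∀ a, (f a).1.1 = j (0, a)) : WE f := by
  have key := PB.transport fib_ends hy hr hj hjy ?_
  · let k : (PB (fun γ : C(I, B) => (γ 0, γ 1)) fun b => y (0, b)) → (LP.ev : LP B → B) ⁻¹' Y :=
      fun z => ⟨⟨z.1.2, by
        have h := z.2.trans (y0 z.1.1)
        exact (congrArg Prod.fst h).trans (congrArg Prod.snd h).symm⟩, by
        have h := congrArg Prod.fst (z.2.trans (y0 z.1.1))
        show z.1.2 0 ∈ Y
        rw [show z.1.2 0 = z.1.1 from h]; exact z.1.1.2⟩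
    have hk : HE k := by
      refine ⟨Continuous.subtype_mk (Continuous.subtype_mk (by fun_prop) _) _,
        fun β => ⟨(⟨β.1.1 0, β.2⟩, β.1.1), ?_⟩, ?_, ?_, ?_⟩
      · exact (Prod.ext rfl β.1.2.symm : (β.1.1 0, β.1.1 1) = (β.1.1 0, β.1.1 0)).trans
          (y0 ⟨β.1.1 0, β.2⟩).symm
      · exact Continuous.subtype_mk (Continuous.prodMk
          (LP.continuous_ev.comp continuous_subtype_val |>.subtype_mk _)
          (continuous_subtype_val.comp continuous_subtype_val)) _
      · refine Htpy.trans (g := id) ⟨fun w => w.2, continuous_snd, fun z => ?_, fun z => rfl⟩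
          (Htpy.refl continuous_id)
        refine Subtype.ext (Prod.ext (Subtype.ext ?_) rfl)
        exact (congrArg Prod.fst (z.2.trans (y0 z.1.1))).symm
      · exact Htpy.refl continuous_id
    have w0 := hk.we.comp key hk.1 (Continuous.subtype_mk (by fun_prop) _)
    refine cast (congrArg WE (funext fun a => ?_)) w0
    exact Subtype.ext (Subtype.ext (hf a).symm)
  · let k : (PB (fun γ : C(I, B) => (γ 0, γ 1)) fun b => y (1, b)) → PSp B b₀ {b₀} × Y :=
      fun z => (⟨z.1.2, congrArg Prod.fst (z.2.trans (y1 z.1.1)),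
        congrArg Prod.snd (z.2.trans (y1 z.1.1))⟩, z.1.1)
    have hk : HE k := by
      refine ⟨Continuous.prodMk (Continuous.subtype_mk (by fun_prop) _) (by fun_prop),
        fun z => ⟨(z.2, z.1.1), ?_⟩, ?_, ?_, ?_⟩
      · exact (Prod.ext z.1.2.1 z.1.2.2 : (z.1.1 0, z.1.1 1) = (b₀, b₀)).trans (y1 _).symm
      · exact Continuous.subtype_mk (by fun_prop) _
      · exact Htpy.refl continuous_id
      · exact Htpy.refl continuous_id
    refine WE.of_comp_left (Continuous.subtype_mk (by fun_prop) _) hk.1 ?_ hk.we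
    refine cast (congrArg WE (funext fun a => ?_)) hg
    exact Prod.ext (Subtype.ext (hg1 a)) (hg2 a)

end

namespace Nice
variable {X : Type*} [TopologicalSpace X] {x₀ : X} (N : Nice X x₀) {κ : Bool} {T Z : Type*}
  [TopologicalSpace T] [TopologicalSpace Z]

/-- The position on a cyclic word in the family of paths which starts at the loop and ends
with the scan. -/
def cpos (s t : ℝ) (l : List X) (y : X) (τ : ℝ) : ℝ :=
  N.u y * (t + s * (1 - t)) + (1 - τ) *
    ((N.wt (y :: l) + (1 - s) * t * N.u y) - N.u y * (t + s * (1 - t)))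

/-- Reading a cyclic word. -/
def crd (s : ℝ) (l : List X) (t : I) (y : X) : C(I, Susp 1 X x₀) :=
  ⟨fun τ => N.rd (y :: (l ++ [y])) (N.cpos s t l y τ), N.continuous_rd.comp (by
    unfold cpos
    fun_prop : Continuous fun τ : I => (y :: (l ++ [y]), N.cpos s t l y τ))⟩

theorem crd_apply (s : ℝ) (l : List X) (t : I) (y : X) (τ : I) :
    N.crd s l t y τ = N.rd (y :: (l ++ [y])) (N.cpos s t l y τ) := rfl

theorem crd_del (s : ℝ) (l m : List X) (t : I) (y : X) :
    N.crd s (l ++ x₀ :: m) t y = N.crd s (l ++ m) t y := by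
  ext τ
  simp only [crd_apply, cpos, wt_cons, wt_append, N.u_base, zero_add]
  have := N.rd_del (y :: l) (m ++ [y])
  simp only [List.cons_append, List.append_assoc] at this ⊢
  exact this _

theorem continuous_crd : Continuous fun w : I × EPre X => N.crd w.1 w.2.1 w.2.2.1 w.2.2.2 := by
  have hu := N.hu
  have hw := N.continuous_wt
  refine ContinuousMap.continuous_of_continuous_uncurry _ ?_
  exact (N.continuous_rd.comp (by
    unfold cpos
    fun_prop : Continuous fun v : (I × EPre X) × I => (v.1.2.2.2 :: (v.1.2.1 ++ [v.1.2.2.2]),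
      N.cpos v.1.1 v.1.2.2.1 v.1.2.1 v.1.2.2.2 v.2)) :)

theorem crd_left (s : I) (l : List X) (t : I) (y : X) :
    N.crd s l t y 0 = sp x₀ (t * σ s) y := by
  have h := N.nonneg y
  have e : N.cpos s t l y 0 = N.wt (y :: l) + (t * σ s : I) * N.u y := by
    simp only [cpos, Set.Icc.coe_zero, Set.Icc.coe_mul, unitInterval.coe_symm_eq]; ring
  have := N.rd_append (y :: l) [y] (r := (t * σ s : I) * N.u y) (mul_nonneg (t * σ s).2.1 h)
  rw [rd_cons_le] at this
  rw [crd_apply, ← this]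
  exact congrArg _ e

theorem crd_right (s : I) (l : List X) (t : I) (y : X) :
    N.crd s l t y 1 = sp x₀ (σ (σ t * σ s)) y := by
  have e : N.cpos s t l y 1 = (σ (σ t * σ s) : I) * N.u y := by
    simp [cpos]; ring
  rw [crd_apply, ← N.rd_cons_le y (l ++ [y])]
  exact congrArg _ e

theorem crd_zero_apply (l : List X) (t : I) (y : X) (τ : I) : N.crd 0 l t y τ =
    N.rd (y :: (l ++ [y])) (t * N.u y + σ τ * N.wt (y :: l)) := by
  rw [crd_apply]
  congr 1
  simp [cpos]; ring

theorem crd_one (l : List X) (t : I) (y : X) : N.crd 1 l t y = (N.scan (JX.mk x₀ l)).1 := by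
  ext τ
  rw [scan_mk, crd_apply]
  have e : N.cpos 1 t l y τ = N.u y + σ τ * N.wt l := by
    simp [cpos]
  have h1 := N.wt_nonneg l
  rw [e, rd_cons _ _ _ (mul_nonneg (σ τ).2.1 h1), rd_append_left]
  nlinarith [(σ τ).2.2]

theorem fcl_inv : EInv x₀ true fun l t y => N.crd 0 l t y where
  del l m t y := N.crd_del 0 l m t y
  tri l t t' := by ext τ; simp [crd_apply, cpos, N.u_base]
  zero l y := by
    ext τ
    rw [crd_zero_apply, crd_zero_apply, rd_base]
    have h := N.wt_nonneg (y :: l)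
    have h2 : ((σ τ : I) : ℝ) * N.wt (y :: l) ≤ N.wt (y :: l) := by nlinarith [(σ τ).2.2]
    have e1 := N.rd_append_left (y :: l) [y] h2
    have e2 := N.rd_append_left (y :: l) [x₀] h2
    simp only [Set.Icc.coe_zero, zero_mul, zero_add, wt_cons _ x₀, N.u_base, wt_cons,
      List.cons_append] at e1 e2 ⊢
    rw [e1, e2]
  one l y := by
    ext τ
    rw [crd_zero_apply, crd_zero_apply, rd_base]
    have h := N.wt_nonneg (y :: l)
    have h2 : ((σ τ : I) : ℝ) * N.wt (y :: l) ≤ N.wt (l ++ [y]) := by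
      rw [wt_append, wt_cons, wt_cons, wt_nil]; rw [wt_cons] at h; nlinarith [(σ τ).2.2]
    have e1 := N.rd_cons y (l ++ [y]) (mul_nonneg (σ τ).2.1 h)
    have e2 := N.rd_append_left (l ++ [y]) [x₀] h2
    show N.rd (y :: (l ++ [y])) ((1 : I) * N.u y + _) = N.rd ((l ++ [y]) ++ [x₀]) _
    rw [Set.Icc.coe_one, one_mul, e1, ← e2]
    congr 1
    simp only [app, cond_true, wt_cons, wt_append, N.u_base, wt_nil, Set.Icc.coe_zero]
    ring

/-- The map from the cyclic model to free loops. -/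
def fcl (e : EE x₀ true) : LP (Susp 1 X x₀) :=
  ⟨EE.lift (fun l t y => N.crd 0 l t y) N.fcl_inv e, by
    obtain ⟨l, t, y, rfl⟩ := EE.cases e
    show N.crd (0 : I) l t y 0 = N.crd (0 : I) l t y 1
    rw [crd_left, crd_right]
    simp⟩

theorem continuous_fcl : Continuous N.fcl :=
  Continuous.subtype_mk (EE.continuous_lift (N.continuous_crd.comp
    (by fun_prop : Continuous fun w : EPre X => ((0 : I), w)))) _

theorem ev_fcl (e : EE x₀ true) : (N.fcl e).ev = EE.p e := by
  obtain ⟨l, t, y, rfl⟩ := EE.cases e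
  show N.crd (0 : I) l t y 0 = sp x₀ t y
  rw [crd_left]
  simp

theorem fcl_io (w : JX x₀) : (N.fcl (ioJ true w)).1 = (N.scan w).1 := by
  obtain ⟨l, rfl⟩ := (JX.isQuotientMap_mk x₀).surjective w
  rw [ioJ_mk]
  show N.crd 0 l 0 x₀ = _
  rw [← N.crd_one l 0 x₀]
  ext τ
  simp [crd_apply, cpos, N.u_base]

end Nice

end LoopModel

namespace LoopModel

namespace Nice
variable {X : Type*} [TopologicalSpace X] {x₀ : X} (N : Nice X x₀) {κ : Bool} {T Z : Type*}
  [TopologicalSpace T] [TopologicalSpace Z]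

theorem we_fcl_UU [PathConnectedSpace X] {Y : Set (Susp 1 X x₀)} (hY : Y ⊆ UU x₀) :
    WE ((LP.ev ⁻¹' Y).restrictPreimage N.fcl) := by
  refine WE.restrictPreimage_of N.ev_fcl ?_
  have hc : Continuous fun b : Y => coords b.1 :=
    N.continuousOn_coords.comp_continuous continuous_subtype_val fun b => hY b.2
  have hal : Continuous fun a : (EE.p : EE x₀ true → _) ⁻¹' Y => al a.1 :=
    N.continuousOn_al.comp_continuous continuous_subtype_val fun a => hY a.2
  have hp : Continuous (EE.p : EE x₀ true → _) := EE.continuous_p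
  have hr : Continuous fun a : (EE.p : EE x₀ true → _) ⁻¹' Y => (⟨EE.p a.1, a.2⟩ : Y) :=
    (hp.comp continuous_subtype_val).subtype_mk _
  have hj := EE.continuousOn_liftU (κ := true) (Φ := fun s l t y => N.crd s l t y)
    (d := .const I (Susp.base 1 X x₀)) (h := fun s l m t y => N.crd_del s l m t y) N.isOpen_UU
    N.continuous_crd
  have hc' : Continuous fun w : I × Y => coords w.2.1 := hc.comp continuous_snd
  have hy : Continuous fun w : I × Y => (sp x₀ ((coords w.2.1).1 * σ w.1) (coords w.2.1).2,
      sp x₀ (σ (σ (coords w.2.1).1 * σ w.1)) (coords w.2.1).2) := by fun_prop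
  refine LP.transport (b₀ := Susp.base 1 X x₀)
    (y := fun w : I × Y => (sp x₀ ((coords w.2.1).1 * σ w.1) (coords w.2.1).2,
      sp x₀ (σ (σ (coords w.2.1).1 * σ w.1)) (coords w.2.1).2))
    (r := fun a : (EE.p : EE x₀ true → _) ⁻¹' Y => (⟨EE.p a.1, a.2⟩ : Y))
    (j := fun w : I × (EE.p : EE x₀ true → _) ⁻¹' Y => EE.liftU (fun l t y => N.crd w.1 l t y)
      (.const I (Susp.base 1 X x₀)) (N.crd_del w.1) w.2.1)
    (g := fun a => (N.scan (al a.1), ⟨EE.p a.1, a.2⟩)) hy (fun b => ?_) (fun b => ?_) hr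
    (hj.comp_continuous (by fun_prop : Continuous fun w : I × (EE.p : EE x₀ true → _) ⁻¹' Y =>
      (w.1, w.2.1)) fun w => hY w.2.2) (fun s a => ?_) ?_ (fun a => ?_) (fun a => rfl) fun a => ?_
  · simp [sp_coords]
  · simp
  · obtain ⟨e, he⟩ := a
    obtain ⟨l, t, y, rfl⟩ := EE.cases e
    have hg : Good x₀ t y := sp_mem_UU.1 (hY he)
    have hco : coords (EE.p (EE.mk x₀ true l t y)) = (t, y) := coords_sp hg
    simp only [EE.liftU_mk _ _ _ hg, crd_left, crd_right, hco]
  · have h1 := (N.we_scan.prod (C := Y)).comp (N.he_al (κ := true) hY).we (by fun_prop)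
      (N.he_al (κ := true) hY).1
    exact h1
  · obtain ⟨e, he⟩ := a
    obtain ⟨l, t, y, rfl⟩ := EE.cases e
    have hg : Good x₀ t y := sp_mem_UU.1 (hY he)
    simp only [EE.liftU_mk _ _ _ hg, al_mk hg]
    exact (N.crd_one l t y).symm
  · obtain ⟨e, he⟩ := a
    obtain ⟨l, t, y, rfl⟩ := EE.cases e
    have hg : Good x₀ t y := sp_mem_UU.1 (hY he)
    simp only [EE.liftU_mk _ _ _ hg]
    rfl

theorem we_fcl_VV [PathConnectedSpace X] :
    WE ((LP.ev ⁻¹' N.VV).restrictPreimage N.fcl) := by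
  refine WE.restrictPreimage_of N.ev_fcl ?_
  have hf := N.continuous_fcl
  have cG := N.continuous_GaV
  refine WE.of_comp_right (Continuous.subtype_mk (by fun_prop) _) N.he_io ?_
  have hgv : Continuous fun w : I × N.VV => (N.GaV w : Susp 1 X x₀) :=
    continuous_subtype_val.comp cG
  refine LP.transport (b₀ := Susp.base 1 X x₀)
    (y := fun w : I × N.VV => ((N.GaV w : Susp 1 X x₀), (N.GaV w : Susp 1 X x₀)))
    (r := fun _ => ⟨Susp.base 1 X x₀, N.base_mem_VV⟩)
    (j := fun w : I × JX x₀ => (N.scan w.2).1)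
    (g := fun w => (N.scan w, ⟨Susp.base 1 X x₀, N.base_mem_VV⟩))
    (hgv.prodMk hgv) (fun b => ?_) (fun b => ?_) continuous_const (by fun_prop) (fun s a => ?_) ?_
    (fun a => rfl) (fun a => rfl) fun a => ?_
  · show (N.Ga _, N.Ga _) = _
    rw [N.Ga_zero]
  · show (N.Ga _, N.Ga _) = _
    rw [N.Ga_one]
  · have e : (N.GaV (s, ⟨Susp.base 1 X x₀, N.base_mem_VV⟩) : Susp 1 X x₀) = Susp.base 1 X x₀ :=
      N.Ga_base s
    show ((N.scan a).1 0, (N.scan a).1 1) = _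
    simp only [e]
    exact Prod.ext (N.scan a).2.1 (N.scan a).2.2
  · have hh : HE fun ω : PSp (Susp 1 X x₀) (Susp.base 1 X x₀) {Susp.base 1 X x₀} =>
        ((ω, ⟨Susp.base 1 X x₀, N.base_mem_VV⟩) :
          PSp (Susp 1 X x₀) (Susp.base 1 X x₀) {Susp.base 1 X x₀} × N.VV) := by
      refine ⟨by fun_prop, Prod.fst, continuous_fst, Htpy.refl continuous_id, Htpy.symm ?_⟩
      exact ⟨fun w => (w.2.1, N.GaV (w.1, w.2.2)), by fun_prop,
        fun z => Prod.ext rfl (Subtype.ext (N.Ga_zero _)),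
        fun z => Prod.ext rfl (Subtype.ext (N.Ga_one _))⟩
    exact hh.we.comp N.we_scan hh.1 N.continuous_scan
  · exact N.fcl_io a

theorem we_fcl [PathConnectedSpace X] : WE N.fcl :=
  WE.local N.continuous_fcl (N.isOpen_UU.preimage LP.continuous_ev)
    (N.isOpen_VV.preimage LP.continuous_ev)
    (fun b => (N.UU_union_VV ▸ mem_univ b.ev : b.ev ∈ UU x₀ ∪ N.VV))
    (N.we_fcl_UU subset_rfl) N.we_fcl_VV (N.we_fcl_UU inter_subset_left)

end Nice

end LoopModel

namespace LoopModel

/-- Continuity of an evaluation at a parameter which may jump where it does not matter. -/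
theorem continuous_eval_any {Z B : Type*} [TopologicalSpace Z] [TopologicalSpace B] {g : Z × I → B}
    (hg : Continuous g) {τ : Z → I} {S : Set Z} (hS : IsClosed S)
    (hτ : ContinuousOn (fun z => g (z, τ z)) Sᶜ)
    (hgS : ∀ z ∈ S, ∀ t t', g (z, t) = g (z, t')) : Continuous fun z => g (z, τ z) := by
  rw [continuous_iff_continuousAt]
  intro z
  by_cases hz : z ∈ S
  · intro O hO
    have h1 : ∀ t ∈ (univ : Set I), ∀ᶠ w : Z × I in 𝓝 (z, t), g w ∈ O := fun t _ =>
      hg.continuousAt (by rw [← hgS z hz (τ z) t]; exact hO)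
    have h2 : ∀ᶠ w in 𝓝 z, ∀ t ∈ (univ : Set I), g (w, t) ∈ O :=
      isCompact_univ.eventually_forall_of_forall_eventually h1
    exact h2.mono fun w hw => hw _ trivial
  · exact hτ.continuousAt (hS.isOpen_compl.mem_nhds hz)

namespace Nice
variable {X : Type*} [TopologicalSpace X] {x₀ : X} (N : Nice X x₀) {κ : Bool} {T Z : Type*}
  [TopologicalSpace T] [TopologicalSpace Z]

theorem scn_shift (F : List X → List X → I → X → T) (b a l : List X) (r : ℝ) :
    N.scn F (b ++ a) l r = N.scn (fun a l t y => F (b ++ a) l t y) a l r := by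
  induction l generalizing a r with
  | nil => rfl
  | cons y l ih => rw [scn, scn, ← ih, List.append_assoc]

theorem wt_eq_zero {l : List X} (h : N.wt l = 0) : ∀ x ∈ l, x = x₀ := by
  induction l with
  | nil => simp
  | cons y l ih =>
    have h1 := N.nonneg y
    have h2 := N.wt_nonneg l
    rw [wt_cons] at h
    intro x hx
    rcases List.mem_cons.1 hx with rfl | hx
    · exact (N.zero_iff x).1 (by linarith)
    · exact ih (by linarith) x hx

/-- Rotation of a cyclic word. -/
def Rot (l : List X) (r : ℝ) : EE x₀ true := N.Rd true [] l (N.wt l * Int.fract (r / N.wt l))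

theorem Rd_zero (l : List X) : N.Rd true [] l 0 = EE.io x₀ true l :=
  (N.scn_nonpos SInv.mk _ _ le_rfl).trans (by
    show EE.mk x₀ true (l ++ []) 0 x₀ = _
    rw [List.append_nil])

theorem Rd_wt (l : List X) : N.Rd true [] l (N.wt l) = EE.io x₀ true l :=
  (N.scn_ge SInv.mk _ _ le_rfl).trans rfl

theorem Rot_of_mem {l : List X} {r : ℝ} (h0 : 0 ≤ r) (h1 : r ≤ N.wt l) :
    N.Rot l r = N.Rd true [] l r := by
  unfold Rot
  rcases (N.wt_nonneg l).eq_or_lt with h | h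
  · rw [← h, zero_mul, show r = 0 by linarith]
  · rcases h1.eq_or_lt with h1 | h1
    · rw [h1, div_self h.ne', Int.fract_one, mul_zero, Rd_wt, Rd_zero]
    · rw [Int.fract_eq_self.2 ⟨div_nonneg h0 h.le, (div_lt_one h).2 h1⟩, mul_div_cancel₀ _ h.ne']

theorem Rot_add_int (l : List X) (r : ℝ) (n : ℤ) : N.Rot l (r + n * N.wt l) = N.Rot l r := by
  unfold Rot
  rcases (N.wt_nonneg l).eq_or_lt with h | h
  · rw [← h, zero_mul, zero_mul]
  · rw [add_div, mul_div_cancel_right₀ _ h.ne', Int.fract_add_intCast]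

theorem Rot_del (l m : List X) (r : ℝ) : N.Rot (l ++ x₀ :: m) r = N.Rot (l ++ m) r := by
  have : N.wt (l ++ x₀ :: m) = N.wt (l ++ m) := by simp
  unfold Rot
  rw [this]
  exact N.scn_del SInv.mk _ _ _ _

theorem Rot_rot_aux (y : X) (l : List X) {ρ : ℝ} (h0 : 0 ≤ ρ) (h1 : ρ < N.u y + N.wt l) :
    N.Rot (y :: l) (N.u y + ρ) = N.Rot (l ++ [y]) ρ := by
  have hy := N.nonneg y
  have hl := N.wt_nonneg l
  rw [N.Rot_of_mem (l := l ++ [y]) h0 (by simp; linarith)]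
  rcases le_or_gt ρ (N.wt l) with h | h
  · rw [N.Rot_of_mem (by linarith) (by simp; linarith)]
    refine (N.scn_cons SInv.mk _ _ _ h0).trans
      (Eq.trans ?_ (N.scn_append_left SInv.mk _ _ _ h).symm)
    refine (N.scn_shift _ [y] [] _ _).trans ?_
    congr 1
    funext a l t z
    simp
  · have e : N.u y + ρ = (ρ - N.wt l) + ((1 : ℤ) : ℝ) * N.wt (y :: l) := by
      simp; ring
    have hle : ρ - N.wt l ≤ N.u y := by linarith
    have e2 := N.scn_append (SInv.mk (κ := true)) [] l [y] (r := ρ - N.wt l) (by linarith)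
    rw [add_sub_cancel, N.scn_cons_le hle] at e2
    rw [e, Rot_add_int, N.Rot_of_mem (by linarith) (by simp; linarith)]
    refine (N.scn_cons_le hle).trans (Eq.trans ?_ e2.symm)
    simp

theorem Rot_rot (y : X) (l : List X) (r : ℝ) : N.Rot (y :: l) r = N.Rot (l ++ [y]) (r - N.u y) := by
  have e : N.wt (l ++ [y]) = N.wt (y :: l) := by simp [add_comm]
  rcases (N.wt_nonneg (y :: l)).eq_or_lt with h | h
  · have hy := N.wt_eq_zero h.symm y (by simp)
    subst hy
    unfold Rot
    rw [e, ← h, zero_mul, zero_mul, Rd_zero, Rd_zero]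
    exact (EE.mk_del [] l _ _).trans (Eq.trans (by simp) (EE.mk_del l [] _ _).symm)
  · set U := N.wt (y :: l) with hU
    have h1 := Int.fract_add_floor ((r - N.u y) / U)
    have h2 := Int.fract_nonneg ((r - N.u y) / U)
    have h3 := Int.fract_lt_one ((r - N.u y) / U)
    set f := Int.fract ((r - N.u y) / U)
    set n := ⌊(r - N.u y) / U⌋
    have h4 : r - N.u y = f * U + n * U := by
      rw [← add_mul, h1, div_mul_cancel₀ _ h.ne']
    have a := N.Rot_rot_aux y l (ρ := f * U) (by positivity) (by
      rw [← wt_cons, ← hU]; nlinarith)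
    have b := N.Rot_add_int (y :: l) (N.u y + f * U) n
    have c := N.Rot_add_int (l ++ [y]) (f * U) n
    rw [← hU] at b
    rw [e] at c
    rw [h4, c, ← a, ← b]
    congr 1; linarith

/-- Normalized reading. -/
def Rn (w : List X × I) : EE x₀ true := N.Rd true [] w.1 (N.wt w.1 * w.2)

theorem continuous_Rn : Continuous N.Rn :=
  N.continuous_Rd.comp (by fun_prop : Continuous fun w : List X × I =>
    (([] : List X), w.1, N.wt w.1 * (w.2 : ℝ)))

theorem Rot_eq_Rn (l : List X) (r : ℝ) : N.Rot l r =
    N.Rn (l, ⟨Int.fract (r / N.wt l), Int.fract_nonneg _, (Int.fract_lt_one _).le⟩) := rfl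

theorem Rn_of_wt {l : List X} (h : N.wt l = 0) (t t' : I) : N.Rn (l, t) = N.Rn (l, t') := by
  simp [Rn, h]

theorem continuous_Rot : Continuous fun w : List X × ℝ => N.Rot w.1 w.2 := by
  have hw := N.continuous_wt
  have hF : Continuous fun w : List X × ℝ => N.Rd true [] w.1 (N.wt w.1 * Int.fract w.2) := by
    refine ContinuousOn.comp_fract (f := fun w : List X × ℝ => fun t : ℝ =>
      N.Rd true [] w.1 (N.wt w.1 * t)) (s := fun w => w.2) ?_ continuous_snd fun w => ?_
    · exact (N.continuous_Rd.comp (by fun_prop : Continuous fun w : (List X × ℝ) × ℝ =>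
        (([] : List X), w.1.1, N.wt w.1.1 * w.2))).continuousOn
    · rw [mul_zero, mul_one, Rd_zero, Rd_wt]
  refine continuous_eval_any (g := fun z : (List X × ℝ) × I => N.Rn (z.1.1, z.2))
    (τ := fun w => ⟨Int.fract (w.2 / N.wt w.1), Int.fract_nonneg _, (Int.fract_lt_one _).le⟩)
    (S := {w | N.wt w.1 = 0}) (N.continuous_Rn.comp (by fun_prop))
    (isClosed_eq (by fun_prop) continuous_const) ?_ fun z hz t t' => N.Rn_of_wt hz t t'
  refine hF.comp_continuousOn (f := fun w : List X × ℝ => (w.1, w.2 / N.wt w.1)) ?_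
  exact continuousOn_fst.prodMk (continuousOn_snd.div (by fun_prop) fun w hw => hw)

end Nice

end LoopModel

namespace LoopModel

/-- Functions of lists of labelled real numbers which only depend on the labelled configuration
modulo `1`, up to order. -/
structure CInv {X T : Type*} (x₀ : X) (Φ : List (ℝ × X) → T) : Prop where
  del : ∀ w z w', Φ (w ++ (z, x₀) :: w') = Φ (w ++ w')
  rot : ∀ z y w, Φ ((z, y) :: w) = Φ (w ++ [(z + 1, y)])

/-- The points with non-trivial labels lie, in increasing order, in an interval of length
less than `1`. -/
def Win {X : Type*} (x₀ : X) (w : List (ℝ × X)) : Prop :=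
  w.Pairwise fun a b => a.2 ≠ x₀ → b.2 ≠ x₀ → a.1 < b.1 ∧ b.1 < a.1 + 1

section
variable {X T : Type*} {x₀ : X}

open Classical in
theorem CInv.filter_aux {Φ : List (ℝ × X) → T} (h : CInv x₀ Φ) (w p : List (ℝ × X)) :
    Φ (p ++ w) = Φ (p ++ w.filter fun b => b.2 ≠ x₀) := by
  induction w generalizing p with
  | nil => rfl
  | cons b w ih =>
    obtain ⟨z, y⟩ := b
    by_cases hy : y = x₀
    · subst hy
      rw [h.del, ih]
      simp
    · have := ih (p ++ [(z, y)])
      simpa [hy] using this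

open Classical in
theorem CInv.filter {Φ : List (ℝ × X) → T} (h : CInv x₀ Φ) (w : List (ℝ × X)) :
    Φ w = Φ (w.filter fun b => b.2 ≠ x₀) := h.filter_aux w []

theorem CInv.of_base {Φ : List (ℝ × X) → T} (h : CInv x₀ Φ) {w : List (ℝ × X)}
    (hw : ∀ b ∈ w, b.2 = x₀) : Φ w = Φ [] := by
  classical
  rw [h.filter w]
  congr 1
  simpa using hw

theorem CInv.comp_map {Φ : List (ℝ × X) → T} (h : CInv x₀ Φ) {k : X → X} (hk : k x₀ = x₀) :
    CInv x₀ fun w => Φ (w.map fun b => (b.1, k b.2)) where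
  del w z w' := by
    rw [List.map_append, List.map_append, List.map_cons]
    show Φ (_ ++ (z, k x₀) :: _) = _
    rw [hk, h.del]
  rot z y w := by
    rw [List.map_append, List.map_cons, List.map_cons, List.map_nil]
    exact h.rot _ _ _

end

namespace Nice
variable {X : Type*} [TopologicalSpace X] {x₀ : X} (N : Nice X x₀) {κ : Bool} {T Z : Type*}
  [TopologicalSpace T] [TopologicalSpace Z]

/-- The first moment of a labelled configuration. -/
def mom (w : List (ℝ × X)) : ℝ := (w.map fun b => N.u b.2 * (b.1 - 1 / 2)).sum

@[simp] theorem mom_nil : N.mom [] = 0 := rfl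
@[simp] theorem mom_cons (b : ℝ × X) (w : List (ℝ × X)) :
    N.mom (b :: w) = N.u b.2 * (b.1 - 1 / 2) + N.mom w := by simp [mom]
@[simp] theorem mom_append (v w : List (ℝ × X)) : N.mom (v ++ w) = N.mom v + N.mom w := by
  simp [mom]

theorem continuous_mom : Continuous N.mom := by
  have hu := N.hu
  refine (continuous_list (f := fun w : List (ℝ × X) × Unit => N.mom w.1) continuous_const
    fun n hn => ?_).comp (by fun_prop : Continuous fun w : List (ℝ × X) => (w, ()))
  have h2 : Continuous fun w : ((ℝ × X) × LL (ℝ × X) n) × Unit => N.mom w.1.2.1 :=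
    hn.comp (by fun_prop : Continuous fun w : ((ℝ × X) × LL (ℝ × X) n) × Unit => (w.1.2, ()))
  refine ((by fun_prop : Continuous fun w : ((ℝ × X) × LL (ℝ × X) n) × Unit =>
    N.u w.1.1.2 * (w.1.1.1 - 1 / 2)).add h2).congr fun w => ?_
  simp

/-- The cyclic word of a configuration. -/
def ph (w : List (ℝ × X)) : EE x₀ true := N.Rot (w.map Prod.snd) (-N.mom w)

theorem ph_inv : CInv x₀ N.ph where
  del w z w' := by
    have e : N.mom (w ++ (z, x₀) :: w') = N.mom (w ++ w') := by simp
    unfold ph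
    rw [e, List.map_append, List.map_append, List.map_cons]
    exact N.Rot_del _ _ _
  rot z y w := by
    unfold ph
    rw [List.map_append, List.map_cons, List.map_cons, List.map_nil]
    refine (N.Rot_rot y _ _).trans ?_
    congr 1
    simp
    ring

theorem continuous_ph : Continuous N.ph := by
  have h1 := N.continuous_mom
  have h2 : Continuous fun w : List (ℝ × X) => w.map Prod.snd :=
    (continuous_map_list (k := fun (_ : Unit) (b : ℝ × X) => b.2) (by fun_prop)).comp
      (by fun_prop : Continuous fun w : List (ℝ × X) => (w, ()))
  exact N.continuous_Rot.comp (h2.prodMk h1.neg)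

/-- Interpolation between the given positions and the positions spaced by weight. -/
def itp (s U : ℝ) : ℝ → List (ℝ × X) → List (ℝ × X)
  | _, [] => []
  | a, b :: w => ((1 - s) * b.1 + s * ((a + N.u b.2 / 2) / U), b.2) :: itp s U (a + N.u b.2) w

theorem itp_append (s U a : ℝ) (v w : List (ℝ × X)) :
    N.itp s U a (v ++ w) = N.itp s U a v ++ N.itp s U (a + N.wt (v.map Prod.snd)) w := by
  induction v generalizing a with
  | nil => simp [itp]
  | cons b v ih => simp [itp, ih, add_assoc]

@[simp] theorem itp_snd (s U a : ℝ) (w : List (ℝ × X)) :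
    (N.itp s U a w).map Prod.snd = w.map Prod.snd := by
  induction w generalizing a with
  | nil => rfl
  | cons b w ih => simp [itp, ih]

theorem itp_zero (U a : ℝ) (w : List (ℝ × X)) : N.itp 0 U a w = w := by
  induction w generalizing a with
  | nil => rfl
  | cons b w ih => simp [itp, ih]

theorem itp_one (U a : ℝ) {v w : List (ℝ × X)} (h : v.map Prod.snd = w.map Prod.snd) :
    N.itp 1 U a v = N.itp 1 U a w := by
  induction v generalizing a w with
  | nil => cases w <;> simp_all
  | cons b v ih =>
    cases w with
    | nil => simp at h
    | cons c w =>
      simp only [List.map_cons, List.cons.injEq] at h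
      simp [itp, h.1, ih _ h.2]

theorem mem_itp {s U a : ℝ} {w : List (ℝ × X)} {b : ℝ × X} (hb : b ∈ N.itp s U a w) :
    ∃ c ∈ w, b.2 = c.2 ∧ ∃ m, b.1 = (1 - s) * c.1 + s * (m / U) ∧ a + N.u b.2 / 2 ≤ m ∧
      m ≤ a + N.wt (w.map Prod.snd) - N.u b.2 / 2 := by
  induction w generalizing a with
  | nil => simp [itp] at hb
  | cons d w ih =>
    rcases List.mem_cons.1 hb with rfl | hb
    · refine ⟨d, by simp, rfl, a + N.u d.2 / 2, rfl, le_rfl, ?_⟩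
      have := N.wt_nonneg (w.map Prod.snd)
      simp only [List.map_cons, wt_cons]
      linarith
    · obtain ⟨c, hc, h1, m, h2, h3, h4⟩ := ih hb
      have := N.nonneg d.2
      refine ⟨c, by simp [hc], h1, m, h2, by linarith, ?_⟩
      simp only [List.map_cons, wt_cons]
      linarith

theorem itp_win {s U a : ℝ} {w : List (ℝ × X)} (hs0 : 0 ≤ s) (hs1 : s ≤ 1)
    (hU : N.wt (w.map Prod.snd) ≤ U) (hU0 : 0 < U)
    (h : s < 1 → Win x₀ w) : Win x₀ (N.itp s U a w) := by
  induction w generalizing a with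
  | nil => exact List.Pairwise.nil
  | cons d w ih =>
    simp only [List.map_cons, wt_cons] at hU
    have hd := N.nonneg d.2
    refine List.pairwise_cons.2 ⟨fun b hb hd0 hb0 => ?_, ih (by linarith)
      fun hs => (List.pairwise_cons.1 (h hs)).2⟩
    obtain ⟨c, hc, h1, m, h2, h3, h4⟩ := N.mem_itp hb
    have p1 := N.pos hd0
    have p2 := N.pos hb0
    simp only at p1 hd0 ⊢
    have q1 : 0 < m / U - (a + N.u d.2 / 2) / U := by
      rw [← sub_div]; exact div_pos (by linarith) hU0
    have q2 : m / U - (a + N.u d.2 / 2) / U < 1 := by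
      rw [← sub_div, div_lt_one hU0]; linarith
    rcases hs1.eq_or_lt with rfl | hs
    · rw [h2]
      constructor <;> linarith
    · obtain ⟨r1, r2⟩ := (List.pairwise_cons.1 (h hs)).1 c hc hd0 (h1 ▸ hb0)
      rw [h2]
      constructor <;> nlinarith

theorem continuous_itp : Continuous fun z : List (ℝ × X) × ℝ × ℝ × ℝ =>
    N.itp z.2.1 z.2.2.1⁻¹ z.2.2.2 z.1 := by
  have hu := N.hu
  refine continuous_list continuous_const fun n ih => ?_
  have h1 : Continuous fun w : ((ℝ × X) × LL (ℝ × X) n) × ℝ × ℝ × ℝ =>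
      N.itp w.2.1 w.2.2.1⁻¹ (w.2.2.2 + N.u w.1.1.2) w.1.2.1 :=
    (ih.comp (by fun_prop : Continuous fun w : ((ℝ × X) × LL (ℝ × X) n) × ℝ × ℝ × ℝ =>
      (w.1.2, w.2.1, w.2.2.1, w.2.2.2 + N.u w.1.1.2)) :)
  have h2 : Continuous fun w : ((ℝ × X) × LL (ℝ × X) n) × ℝ × ℝ × ℝ =>
      ((1 - w.2.1) * w.1.1.1 + w.2.1 * ((w.2.2.2 + N.u w.1.1.2 / 2) / w.2.2.1⁻¹), w.1.1.2) := by
    simp only [div_inv_eq_mul]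
    fun_prop
  exact continuous_cons' h2 h1

/-- Evaluate an invariant function on the configuration of a cyclic word rotated by `r`. -/
def Psi {T : Type*} (Φ : List (ℝ × X) → T) (L : List X) (r : ℝ) : T :=
  Φ (N.itp 1 (N.wt L) (-r) (L.map fun x => ((0 : ℝ), x)))

theorem map_snd_zero (L : List X) : (L.map fun x => ((0 : ℝ), x)).map Prod.snd = L := by
  simp [Function.comp_def]

section Psi
variable {Φ : List (ℝ × X) → T}

theorem Psi_of_wt (h : CInv x₀ Φ) {L : List X} (hL : N.wt L = 0) (r : ℝ) : N.Psi Φ L r = Φ [] := by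
  refine h.of_base fun b hb => N.wt_eq_zero hL _ ?_
  have : b.2 ∈ (N.itp 1 (N.wt L) (-r) (L.map fun x => ((0 : ℝ), x))).map Prod.snd :=
    List.mem_map_of_mem hb
  rwa [itp_snd, map_snd_zero] at this

theorem Psi_del (h : CInv x₀ Φ) (l m : List X) (r : ℝ) :
    N.Psi Φ (l ++ x₀ :: m) r = N.Psi Φ (l ++ m) r := by
  have e : N.wt (l ++ x₀ :: m) = N.wt (l ++ m) := by simp
  unfold Psi
  rw [e, List.map_append, List.map_append, itp_append, itp_append, List.map_cons]
  refine (h.del _ _ _).trans ?_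
  simp [u_base]

theorem Psi_rot (h : CInv x₀ Φ) (y : X) (l : List X) (r : ℝ) :
    N.Psi Φ (y :: l) r = N.Psi Φ (l ++ [y]) (r - N.u y) := by
  have e : N.wt (l ++ [y]) = N.wt (y :: l) := by simp [add_comm]
  rcases (N.wt_nonneg (y :: l)).eq_or_lt with h0 | h0
  · rw [N.Psi_of_wt h h0.symm, N.Psi_of_wt h (e.trans h0.symm)]
  · unfold Psi
    rw [e, List.map_append, itp_append, map_snd_zero]
    refine (h.rot _ _ _).trans ?_
    congr 1
    have h1 : N.wt (y :: l) = N.u y + N.wt l := by simp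
    have e1 : -(r - N.u y) = -r + N.u y := by ring
    rw [e1]
    congr 1
    simp only [itp, List.map_cons, List.map_nil, List.cons.injEq, Prod.mk.injEq, and_true]
    field_simp
    rw [h1]; ring

theorem Psi_rots (h : CInv x₀ Φ) (l m : List X) (r : ℝ) :
    N.Psi Φ (l ++ m) r = N.Psi Φ (m ++ l) (r - N.wt l) := by
  induction l generalizing m r with
  | nil => simp
  | cons y l ih =>
    rw [List.cons_append, N.Psi_rot h, List.append_assoc, ih, wt_cons, List.append_assoc, sub_sub]
    rfl

theorem Psi_period (h : CInv x₀ Φ) (l : List X) (r : ℝ) (n : ℤ) :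
    N.Psi Φ l (r + n * N.wt l) = N.Psi Φ l r := by
  have h1 : ∀ r, N.Psi Φ l r = N.Psi Φ l (r - N.wt l) := fun r => by
    simpa using N.Psi_rots h l [] r
  induction n using Int.induction_on with
  | zero => simp
  | succ i ih =>
    rw [← ih, h1 (r + _)]; congr 1; push_cast; ring
  | pred i ih =>
    rw [← ih, h1 (r + ((-(i : ℤ) : ℤ) : ℝ) * _)]; congr 1; push_cast; ring

theorem Psi_einv (h : CInv x₀ Φ) : EInv x₀ true fun l t y => N.Psi Φ (y :: l) (t * N.u y) where
  del l m t y := N.Psi_del h (y :: l) m _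
  tri l t t' := by simp
  zero l y := by
    simp only [u_base, mul_zero]
    refine Eq.trans ?_ (N.Psi_del h [] (y :: l) _).symm
    simp
  one l y := by
    simp only [u_base, mul_zero, app]
    refine Eq.trans ?_ (N.Psi_del h [] (l ++ [y]) _).symm
    rw [N.Psi_rot h]
    simp

/-- The map out of cyclic words defined by an invariant function. -/
def ps (h : CInv x₀ Φ) : EE x₀ true → T :=
  EE.lift (fun l t y => N.Psi Φ (y :: l) (t * N.u y)) (N.Psi_einv h)

theorem Psi_scn (h : CInv x₀ Φ) (a l : List X) {r : ℝ} (h0 : 0 ≤ r) (h1 : r ≤ N.wt l) :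
    N.scn (fun a l t y => N.Psi Φ (y :: (l ++ a)) (t * N.u y)) a l r = N.Psi Φ (l ++ a) r := by
  induction l generalizing a r with
  | nil =>
    have : r = 0 := le_antisymm h1 h0
    subst this
    show N.Psi Φ (x₀ :: a) _ = _
    refine (N.Psi_del h [] a _).trans ?_
    simp
  | cons y l ih =>
    rw [wt_cons] at h1
    rcases le_or_gt r (N.u y) with hr | hr
    · rw [scn_cons_le _ hr]
      show N.Psi Φ (y :: (l ++ a)) _ = _
      have hy := N.nonneg y
      rw [coe_cl (div_nonneg h0 hy) (div_le_one_of_le₀ hr hy)]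
      rcases hy.eq_or_lt with hy | hy
      · have : r = 0 := by linarith
        rw [← hy, this]; simp
      · rw [div_mul_cancel₀ _ hy.ne']; rfl
    · rw [scn_cons_gt _ hr, ih _ (by linarith) (by linarith), List.cons_append, N.Psi_rot h,
        List.append_assoc]

theorem ps_Rot (h : CInv x₀ Φ) (l : List X) (r : ℝ) : N.ps h (N.Rot l r) = N.Psi Φ l r := by
  have h1 := Int.fract_nonneg (r / N.wt l)
  have h2 := (Int.fract_lt_one (r / N.wt l)).le
  have h3 := N.wt_nonneg l
  refine (N.scn_map (N.ps h) [] l _).trans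
    ((N.Psi_scn h [] l (by positivity) (by nlinarith)).trans ?_)
  rw [List.append_nil]
  rcases h3.eq_or_lt with h3 | h3
  · rw [N.Psi_of_wt h h3.symm, N.Psi_of_wt h h3.symm]
  · rw [← N.Psi_period h l _ ⌊r / N.wt l⌋]
    congr 1
    have := Int.fract_add_floor (r / N.wt l)
    rw [mul_comm, ← add_mul, this, div_mul_cancel₀ _ h3.ne']

end Psi

theorem mom_itp (U a : ℝ) (hU : U ≠ 0) (w : List (ℝ × X)) : N.mom (N.itp 1 U a w) =
    (a * N.wt (w.map Prod.snd) + N.wt (w.map Prod.snd) ^ 2 / 2) / U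
      - N.wt (w.map Prod.snd) / 2 := by
  induction w generalizing a with
  | nil => simp [itp]
  | cons b w ih =>
    simp only [itp, mom_cons, ih, List.map_cons, wt_cons]
    field_simp
    ring

theorem Psi_ph (l : List X) (r : ℝ) : N.Psi N.ph l r = N.Rot l r := by
  rcases (N.wt_nonneg l).eq_or_lt with h | h
  · rw [N.Psi_of_wt N.ph_inv h.symm]
    unfold ph Rot
    rw [← h]
    simp only [zero_mul, Rd_zero, List.map_nil, wt_nil]
    clear r
    have h' := h.symm
    clear h
    induction l with
    | nil => rfl
    | cons y l ih =>
      have hy := N.wt_eq_zero h' y (by simp)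
      subst hy
      rw [ih (by simpa using h')]
      exact (EE.mk_del [] l _ _).symm
  · unfold Psi ph
    rw [mom_itp _ _ _ h.ne', itp_snd, map_snd_zero]
    congr 1
    field_simp
    ring

end Nice

end LoopModel

namespace LoopModel

section cfg
variable {M X : Type*} [TopologicalSpace M] [TopologicalSpace X] (x₀ : X)

/-- The labelled points of a pre-configuration. -/
def mset (p : LabelPre M X) : Multiset (M × X) :=
  Finset.univ.val.map fun i => (p.2.1.1 i, p.2.2 i)

open Classical in
/-- Discard the points with trivial label. -/
def nb {A : Type*} (m : Multiset (A × X)) : Multiset (A × X) := m.filter fun b => b.2 ≠ x₀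

theorem nb_cons_base {A : Type*} (a : A) (m : Multiset (A × X)) :
    nb x₀ ((a, x₀) ::ₘ m) = nb x₀ m := by simp [nb]

theorem nb_eq_self {A : Type*} {m : Multiset (A × X)} (h : ∀ b ∈ m, b.2 ≠ x₀) : nb x₀ m = m := by
  simpa [nb, Multiset.filter_eq_self] using fun a b hb => h (a, b) hb

/-- The class of a pre-configuration. -/
def lc (p : LabelPre M X) : LabeledConfig M X x₀ := Quot.mk _ p

variable {x₀}

theorem mem_mset {p : LabelPre M X} {b : M × X} :
    b ∈ mset p ↔ ∃ i, (p.2.1.1 i, p.2.2 i) = b := by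
  simp [mset]

theorem lc_eq_of_mset {p p' : LabelPre M X} (h : mset p = mset p') : lc x₀ p = lc x₀ p' := by
  obtain ⟨k, c, l⟩ := p
  obtain ⟨k', c', l'⟩ := p'
  have hk : k = k' := by simpa [mset] using congrArg Multiset.card h
  subst hk
  have h1 : ∀ i, ∃ j, (c'.1 j, l' j) = (c.1 i, l i) := fun i =>
    (mem_mset (p := ⟨k, c', l'⟩)).1 (h ▸ mem_mset.2 ⟨i, rfl⟩)
  choose f hf using h1
  have hinj : Function.Injective f := fun i j hij => c.2 <| by
    have h2 := congrArg Prod.fst (hf i)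
    have h3 := congrArg Prod.fst (hf j)
    simp only at h2 h3
    rw [← h2, ← h3, hij]
  have := Quot.sound (LabelRel.perm (x₀ := x₀) c' l'
    (Equiv.ofBijective f (Finite.injective_iff_bijective.1 hinj)))
  refine Eq.trans ?_ this.symm
  show Quot.mk _ _ = Quot.mk _ _
  congr 3
  · exact Subtype.ext (funext fun i => (congrArg Prod.fst (hf i)).symm)
  · exact funext fun i => (congrArg Prod.snd (hf i)).symm

/-- Delete a point. -/
def delPt {k : ℕ} (c : OrdConfig M (k + 1)) (l : Fin (k + 1) → X) (i : Fin (k + 1)) :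
    LabelPre M X :=
  ⟨k, ⟨c.1 ∘ i.succAbove, c.2.comp Fin.succAbove_right_injective⟩, l ∘ i.succAbove⟩

theorem mset_delPt {k : ℕ} (c : OrdConfig M (k + 1)) (l : Fin (k + 1) → X) (i : Fin (k + 1)) :
    mset ⟨k + 1, c, l⟩ = (c.1 i, l i) ::ₘ mset (delPt c l i) := by
  unfold mset
  rw [Fin.univ_succAbove k i]
  simp only [Finset.cons_val, Finset.map_val, Multiset.map_cons, Multiset.map_map]
  rfl

theorem nb_delPt {k : ℕ} (c : OrdConfig M (k + 1)) (l : Fin (k + 1) → X) (i : Fin (k + 1))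
    (h : l i = x₀) : nb x₀ (mset (⟨k + 1, c, l⟩ : LabelPre M X)) = nb x₀ (mset (delPt c l i)) := by
  rw [mset_delPt c l i, h, nb_cons_base]

theorem exists_reduced (p : LabelPre M X) :
    ∃ p', mset p' = nb x₀ (mset p) ∧ lc x₀ p' = lc x₀ p := by
  obtain ⟨k, c, l⟩ := p
  induction k with
  | zero => exact ⟨⟨0, c, l⟩, by simp [mset, nb], rfl⟩
  | succ k ih =>
    by_cases h : ∃ i, l i = x₀
    · obtain ⟨i, hi⟩ := h
      obtain ⟨p', h1, h2⟩ := ih (delPt c l i).2.1 (delPt c l i).2.2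
      exact ⟨p', h1.trans (nb_delPt c l i hi).symm,
        h2.trans (Quot.sound (LabelRel.delete c l i hi)).symm⟩
    · push Not at h
      refine ⟨⟨k + 1, c, l⟩, (nb_eq_self x₀ fun b hb => ?_).symm, rfl⟩
      obtain ⟨i, rfl⟩ := mem_mset.1 hb
      exact h i

theorem nb_mset_eq {p p' : LabelPre M X} (h : LabelRel M X x₀ p p') :
    nb x₀ (mset p) = nb x₀ (mset p') := by
  cases h with
  | perm c l e =>
    congr 1
    unfold mset
    conv_lhs => rw [← Multiset.map_univ_val_equiv e, Multiset.map_map]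
    rfl
  | delete c l i h => exact nb_delPt c l i h

variable (x₀)

open Classical in
/-- The configuration given by a multiset of labelled points. -/
def cfg (m : Multiset (M × X)) : LabeledConfig M X x₀ :=
  if h : ∃ p : LabelPre M X, mset p = nb x₀ m then lc x₀ h.choose else LabeledConfig.empty M X x₀

variable {x₀}

theorem mem_nb {A : Type*} {m : Multiset (A × X)} {b : A × X} :
    b ∈ nb x₀ m ↔ b ∈ m ∧ b.2 ≠ x₀ := by simp [nb]

theorem nb_nb {A : Type*} (m : Multiset (A × X)) : nb x₀ (nb x₀ m) = nb x₀ m :=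
  nb_eq_self x₀ fun _ hb => (mem_nb.1 hb).2

theorem cfg_nb (m : Multiset (M × X)) : cfg x₀ (nb x₀ m) = cfg x₀ m := by
  unfold cfg
  rw [nb_nb]

theorem cfg_congr {m m' : Multiset (M × X)} (h : nb x₀ m = nb x₀ m') : cfg x₀ m = cfg x₀ m' := by
  rw [← cfg_nb m, h, cfg_nb]

theorem cfg_eq {p : LabelPre M X} {m : Multiset (M × X)} (h : nb x₀ (mset p) = nb x₀ m) :
    cfg x₀ m = lc x₀ p := by
  obtain ⟨p', h1, h2⟩ := exists_reduced (x₀ := x₀) p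
  have hm : ∃ p : LabelPre M X, mset p = nb x₀ m := ⟨p', h1.trans h⟩
  unfold cfg
  rw [dif_pos hm, ← h2]
  exact lc_eq_of_mset (hm.choose_spec.trans (h1.trans h).symm)

theorem cfg_mset (p : LabelPre M X) : cfg x₀ (mset p) = lc x₀ p := cfg_eq rfl

/-- The pre-configuration given by a list. -/
def ofL (w : List (M × X)) (h : (w.map Prod.fst).Nodup) : LabelPre M X :=
  ⟨w.length, ⟨fun i => (w.get i).1, fun i j hij => by
    have := (List.nodup_iff_injective_get.1 h) (a₁ := i.cast (by simp)) (a₂ := j.cast (by simp))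
      (by simpa using hij)
    exact Fin.ext (by simpa [Fin.ext_iff] using this)⟩, fun i => (w.get i).2⟩

theorem mset_ofL (w : List (M × X)) (h : (w.map Prod.fst).Nodup) : mset (ofL w h) = ↑w := by
  have : (List.ofFn fun i => w.get i) = w := List.ofFn_get w
  conv_rhs => rw [← this]
  unfold mset
  exact Fin.univ_val_map (n := w.length) (fun i => w.get i)

theorem nb_coe {A : Type*} (w : List (A × X)) : nb x₀ (w : Multiset (A × X)) =
    (haveI := Classical.decEq X; (w.filter fun b => b.2 ≠ x₀ : List (A × X))) := by
  unfold nb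
  rw [Multiset.filter_coe]

end cfg

end LoopModel

namespace LoopModel

section circle
variable {M X : Type*} [TopologicalSpace M] [TopologicalSpace X] {x₀ : X}
  (c : M ≃ₜ AddCircle (1 : ℝ))

/-- The point of the circle with a given coordinate. -/
def pt (z : ℝ) : M := c.symm (z : AddCircle (1 : ℝ))

/-- The coordinate of a point in the interval `[a, a + 1)`. -/
def rep (a : ℝ) (m : M) : ℝ := AddCircle.equivIco 1 a (c m)

theorem continuous_pt : Continuous (pt c) :=
  c.symm.continuous.comp (AddCircle.continuous_mk' 1)

theorem rep_mem (a : ℝ) (m : M) : rep c a m ∈ Ico a (a + 1) := (AddCircle.equivIco 1 a (c m)).2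

@[simp] theorem pt_rep (a : ℝ) (m : M) : pt c (rep c a m) = m := by
  unfold pt rep
  rw [AddCircle.coe_equivIco]
  simp

theorem rep_pt {a z : ℝ} (h : z ∈ Ico a (a + 1)) : rep c a (pt c z) = z := by
  unfold pt rep
  rw [Homeomorph.apply_symm_apply]
  exact AddCircle.equivIco_coe_of_mem h

@[simp] theorem pt_add_one (z : ℝ) : pt c (z + 1) = pt c z := by
  unfold pt
  rw [AddCircle.coe_add_period]

theorem pt_ne {z z' : ℝ} (h : z < z') (h' : z' < z + 1) : pt c z ≠ pt c z' := fun e => by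
  have h1 := rep_pt c (a := z) (z := z) ⟨le_rfl, by linarith⟩
  rw [e, rep_pt c ⟨h.le, h'⟩] at h1
  exact h.ne' h1

theorem continuousAt_rep {a : ℝ} {m : M} (h : m ≠ pt c a) : ContinuousAt (rep c a) m := by
  have h1 : c m ≠ (a : AddCircle (1 : ℝ)) := fun e => h (by rw [pt, ← e]; simp)
  exact continuous_subtype_val.continuousAt.comp
    ((AddCircle.continuousAt_equivIco 1 a h1).comp c.continuous.continuousAt)

/-- The labelled points of `M` given by labelled real numbers. -/
def toM (w : List (ℝ × X)) : Multiset (M × X) :=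
  (w.map fun b => (pt c b.1, b.2) : List (M × X))

@[simp] theorem toM_nil : toM c ([] : List (ℝ × X)) = 0 := rfl
@[simp] theorem toM_cons (b : ℝ × X) (w : List (ℝ × X)) :
    toM c (b :: w) = (pt c b.1, b.2) ::ₘ toM c w := rfl
@[simp] theorem toM_append (v w : List (ℝ × X)) : toM c (v ++ w) = toM c v + toM c w := by
  simp [toM]

/-- A list is in normal form if its positions are increasing in `[0, 1)`. -/
def NF (w : List (ℝ × X)) : Prop := w.Pairwise (fun a b => a.1 < b.1) ∧ ∀ b ∈ w, b.1 ∈ Ico (0 : ℝ) 1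

theorem NF.eq {v w : List (ℝ × X)} (hv : NF v) (hw : NF w)
    (h : toM c v = toM c w) : v = w := by
  have key : ∀ w : List (ℝ × X), NF w → (toM c w).map (fun b => (rep c 0 b.1, b.2)) = w := by
    intro w hw
    unfold toM
    rw [Multiset.map_coe, List.map_map]
    refine congrArg _ ?_
    refine (List.map_congr_left fun b hb => ?_).trans (List.map_id w)
    have := hw.2 b hb
    simp only [Function.comp]
    rw [rep_pt c (by simpa using this)]
    rfl
  have hp : v.Perm w := by
    rw [← Multiset.coe_eq_coe, ← key v hv, ← key w hw, h]
  exact hp.eq_of_pairwise (fun a b _ _ h1 h2 => absurd h1 h2.not_gt) hv.1 hw.1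

theorem exists_NF (p : LabelPre M X) : ∃ w, NF w ∧ toM c w = mset p := by
  classical
  set v : List (ℝ × X) := List.ofFn fun i => (rep c 0 (p.2.1.1 i), p.2.2 i) with hv
  set r : ℝ × X → ℝ × X → Prop := fun a b => a.1 ≤ b.1
  have : Std.Total r := ⟨fun a b => le_total _ _⟩
  have : IsTrans _ r := ⟨fun a b c h h' => le_trans h h'⟩
  have hperm := List.perm_insertionSort r v
  refine ⟨v.insertionSort r, ⟨?_, fun b hb => ?_⟩, ?_⟩
  · have h1 := List.pairwise_insertionSort r v
    have h2 : v.Pairwise fun a b => a.1 ≠ b.1 := by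
      rw [hv, List.pairwise_ofFn]
      intro i j hij e
      refine hij.ne (p.2.1.2 ?_)
      rw [← pt_rep c 0 (p.2.1.1 i), ← pt_rep c 0 (p.2.1.1 j)]
      exact congrArg _ e
    have h3 := (hperm.symm.pairwise_iff fun h => h.symm).1 h2
    exact (h1.and h3).imp fun h => lt_of_le_of_ne h.1 h.2
  · have := hperm.mem_iff.1 hb
    rw [hv, List.mem_ofFn] at this
    obtain ⟨i, rfl⟩ := this
    simpa using rep_mem c 0 (p.2.1.1 i)
  · refine (Multiset.coe_eq_coe.2 (hperm.map _)).trans ?_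
    rw [hv, List.map_ofFn]
    unfold mset
    rw [Fin.univ_val_map]
    simp [Function.comp_def]

/-- Normal form of a multiset of labelled points. -/
def canon (m : Multiset (M × X)) : List (ℝ × X) :=
  haveI := Classical.propDecidable (∃ w, NF w ∧ toM c w = m)
  if h : ∃ w, NF w ∧ toM c w = m then h.choose else []

theorem canon_eq {w : List (ℝ × X)} (h : NF w) : canon c (toM c w) = w := by
  have hm : ∃ v, NF v ∧ toM c v = toM c w := ⟨w, h, rfl⟩
  unfold canon
  rw [dif_pos hm]
  exact hm.choose_spec.1.eq c h hm.choose_spec.2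

/-- The map on labelled configurations induced by an invariant function. -/
def clift {T : Type*} (Φ : List (ℝ × X) → T) : LabeledConfig M X x₀ → T :=
  Quot.lift (fun p => Φ (canon c (nb x₀ (mset p)))) fun _ _ h => by
    show Φ _ = Φ _
    rw [nb_mset_eq h]

/-- The measure of how far a list is from the interval `[0, 1)`. -/
def far (w : List (ℝ × X)) : ℕ := (w.map fun b => ⌊b.1⌋.natAbs).sum

theorem canon_eq_of_inv {T : Type*} {Φ : List (ℝ × X) → T} (h : CInv x₀ Φ) (w : List (ℝ × X))
    (hw : w.Pairwise fun a b => a.1 < b.1 ∧ b.1 < a.1 + 1) :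
    Φ (canon c (toM c w)) = Φ w := by
  induction hn : far w using Nat.strong_induction_on generalizing w with
  | _ n ih =>
  subst hn
  by_cases hNF : NF w
  · rw [canon_eq c hNF]
  have h1 : ∃ b ∈ w, b.1 ∉ Ico (0 : ℝ) 1 := by
    by_contra! h1
    exact hNF ⟨hw.imp fun h => h.1, h1⟩
  obtain ⟨b, hb, hb1⟩ := h1
  by_cases hneg : b.1 < 0
  · obtain ⟨⟨z, y⟩, v, rfl⟩ : ∃ a v, w = a :: v := by
      cases w with
      | nil => simp at hb
      | cons a v => exact ⟨a, v, rfl⟩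
    have hz : z < 0 := by
      rcases List.mem_cons.1 hb with rfl | hb
      · exact hneg
      · exact ((List.pairwise_cons.1 hw).1 b hb).1.trans hneg
    have hf : ⌊z⌋ < 0 := Int.floor_lt_zero.2 hz
    have e : far (v ++ [(z + 1, y)]) < far ((z, y) :: v) := by
      simp only [far, List.map_append, List.sum_append, List.map_cons, List.sum_cons, List.map_nil,
        List.sum_nil, Int.floor_add_one]
      omega
    have hP : (v ++ [(z + 1, y)]).Pairwise fun a b => a.1 < b.1 ∧ b.1 < a.1 + 1 := by
      refine List.pairwise_append.2 ⟨(List.pairwise_cons.1 hw).2, by simp, fun a ha b hb => ?_⟩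
      obtain rfl : b = (z + 1, y) := by simpa using hb
      obtain ⟨p, q⟩ := (List.pairwise_cons.1 hw).1 a ha
      exact ⟨q, by linarith⟩
    rw [h.rot, ← ih _ e _ hP rfl]
    congr 2
    simp only [toM_cons, toM_append, toM_nil, pt_add_one]
    rw [add_comm, Multiset.cons_add, zero_add]
  · have hb2 : 1 ≤ b.1 := by
      by_contra! h2
      exact hb1 ⟨not_lt.1 hneg, h2⟩
    obtain ⟨v, ⟨z, y⟩, rfl⟩ : ∃ v a, w = v ++ [a] := by
      rcases List.eq_nil_or_concat' w with rfl | ⟨v, a, rfl⟩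
      · simp at hb
      · exact ⟨v, a, rfl⟩
    obtain ⟨hp1, -, hp2⟩ := List.pairwise_append.1 hw
    have hz : 1 ≤ z := by
      rcases List.mem_append.1 hb with hb | hb
      · have := (hp2 b hb (z, y) (by simp)).1
        simp only at this
        linarith
      · obtain rfl : b = (z, y) := by simpa using hb
        exact hb2
    have hf : 1 ≤ ⌊z⌋ := Int.le_floor.2 (by simpa using hz)
    have e : far ((z - 1, y) :: v) < far (v ++ [(z, y)]) := by
      simp only [far, List.map_append, List.sum_append, List.map_cons, List.sum_cons, List.map_nil,
        List.sum_nil, Int.floor_sub_one]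
      omega
    have hr := h.rot (z - 1) y v
    rw [sub_add_cancel] at hr
    have hP : ((z - 1, y) :: v).Pairwise fun a b => a.1 < b.1 ∧ b.1 < a.1 + 1 := by
      refine List.pairwise_cons.2 ⟨fun a ha => ?_, hp1⟩
      obtain ⟨p, q⟩ := hp2 a ha (z, y) (by simp)
      simp only at p q ⊢
      constructor <;> linarith
    rw [← hr, ← ih _ e _ hP rfl]
    congr 2
    have := pt_add_one c (z - 1)
    rw [sub_add_cancel] at this
    simp only [toM_cons, toM_append, toM_nil, this]
    rw [add_comm, Multiset.cons_add, zero_add]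

theorem nb_toM (w : List (ℝ × X)) : nb x₀ (toM c w) =
    toM c (haveI := Classical.decEq X; w.filter fun b => b.2 ≠ x₀) := by
  unfold toM
  rw [nb_coe, List.filter_map]
  rfl

theorem nodup_toM {w : List (ℝ × X)} (hw : w.Pairwise fun a b => a.1 < b.1 ∧ b.1 < a.1 + 1) :
    ((w.map fun b => (pt c b.1, b.2)).map Prod.fst).Nodup := by
  rw [List.map_map, List.Nodup, List.pairwise_map]
  exact hw.imp fun h => pt_ne c h.1 h.2

theorem Win.filter {w : List (ℝ × X)} (hw : Win x₀ w) :
    (haveI := Classical.decEq X; w.filter fun b => b.2 ≠ x₀).Pairwise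
      fun a b => a.1 < b.1 ∧ b.1 < a.1 + 1 := by
  rw [List.pairwise_filter]
  exact hw.imp fun h ha hb => h (by simpa using ha) (by simpa using hb)

/-- The configuration of a list of labelled real numbers. -/
def cf (w : List (ℝ × X)) : LabeledConfig M X x₀ := cfg x₀ (toM c w)

theorem clift_cf {T : Type*} {Φ : List (ℝ × X) → T} (h : CInv x₀ Φ) {w : List (ℝ × X)}
    (hw : Win x₀ w) : clift c Φ (cf c w : LabeledConfig M X x₀) = Φ w := by
  have hn := nodup_toM c hw.filter
  have e : nb x₀ (mset (ofL _ hn)) = nb x₀ (toM c w) := by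
    rw [mset_ofL, ← nb_nb (toM c w), nb_toM]
    rfl
  unfold cf
  rw [cfg_eq e]
  show Φ (canon c (nb x₀ (mset (ofL _ hn)))) = _
  rw [e, nb_toM, canon_eq_of_inv c h _ hw.filter]
  classical
  rw [h.filter w]

theorem clift_lc {T : Type*} {Φ : List (ℝ × X) → T} (h : CInv x₀ Φ) {w : List (ℝ × X)}
    (hw : Win x₀ w) {p : LabelPre M X} (hp : mset p = toM c w) : clift c Φ (lc x₀ p) = Φ w := by
  rw [← clift_cf c h hw, cf, ← hp, cfg_mset]

theorem cf_inv : CInv x₀ (cf c : List (ℝ × X) → LabeledConfig M X x₀) where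
  del w z w' := by
    refine cfg_congr ?_
    rw [toM_append, toM_append, toM_cons, Multiset.add_cons, nb_cons_base]
  rot z y w := by
    unfold cf
    congr 1
    simp only [toM_cons, toM_append, toM_nil, pt_add_one]
    rw [add_comm (toM c w), Multiset.cons_add, zero_add]

theorem clift_self (C : LabeledConfig M X x₀) : clift c (cf c) C = C := by
  induction C using Quot.ind with
  | _ p =>
  obtain ⟨w, hw, e⟩ := exists_NF c p
  have : Win x₀ w := by
    refine (List.Pairwise.imp_of_mem ?_ hw.1)
    intro a b ha hb h _ _
    exact ⟨h, by have := (hw.2 a ha).1; have := (hw.2 b hb).2; linarith⟩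
  refine (clift_lc c (cf_inv c) this e.symm).trans ?_
  unfold cf
  rw [e, cfg_mset]; rfl

end circle

end LoopModel

namespace LoopModel

theorem continuous_ofFn {Y : Type*} [TopologicalSpace Y] (k : ℕ) :
    Continuous (List.ofFn : (Fin k → Y) → List Y) := by
  induction k with
  | zero => exact continuous_const.congr fun v => (List.ofFn_zero (f := v)).symm
  | succ k ih =>
    have h : Continuous fun v : Fin (k + 1) → Y => List.ofFn fun i : Fin k => v i.succ :=
      ih.comp (by fun_prop : Continuous fun (v : Fin (k + 1) → Y) (i : Fin k) => v i.succ)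
    exact (continuous_cons' (by fun_prop : Continuous fun v : Fin (k + 1) → Y => v 0) h).congr
      fun v => (List.ofFn_succ (f := v)).symm

/-- The tuple of entries of a list. -/
def toS {Y : Type*} (w : List Y) : Σ n, Fin n → Y := ⟨w.length, w.get⟩

theorem continuous_toS {Y : Type*} [TopologicalSpace Y] : Continuous (toS : List Y → _) := by
  have hG : Continuous fun w : Y × (Σ n, Fin n → Y) =>
      (⟨w.2.1 + 1, Fin.cons w.1 w.2.2⟩ : Σ n, Fin n → Y) := by
    rw [continuous_iff_continuousAt]
    rintro ⟨y, n, v⟩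
    have he : Topology.IsOpenEmbedding (@Sigma.mk ℕ (fun n => Fin n → Y) n) :=
      Topology.IsOpenEmbedding.sigmaMk
    refine (((Topology.IsOpenEmbedding.id (X := Y)).prodMap he).continuousAt_iff
      (x := (y, v))).1 ?_
    have h : Continuous fun w : Y × (Fin n → Y) => (Fin.cons w.1 w.2 : Fin (n + 1) → Y) :=
      continuous_pi fun i => by
        refine Fin.cases ?_ (fun j => ?_) i
        · simpa using continuous_fst
        · show Continuous fun a : Y × (Fin n → Y) => a.2 j
          fun_prop
    exact (Continuous.comp (g := @Sigma.mk ℕ (fun n => Fin n → Y) (n + 1))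
      continuous_sigmaMk h).continuousAt
  refine (continuous_list (f := fun w : List Y × Unit => toS w.1)
    (continuous_const (y := (toS [] : Σ n, Fin n → Y)))
    fun n hn => ?_).comp (by fun_prop : Continuous fun w : List Y => (w, ()))
  have h2 : Continuous fun w : (Y × LL Y n) × Unit => toS w.1.2.1 :=
    (hn.comp (by fun_prop : Continuous fun w : (Y × LL Y n) × Unit => (w.1.2, ())) :)
  refine (hG.comp ((by fun_prop : Continuous fun w : (Y × LL Y n) × Unit => w.1.1).prodMk h2)).congr
    fun w => ?_
  show (⟨_, _⟩ : Σ n, Fin n → Y) = ⟨_, _⟩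
  congr 1
  funext i
  exact Fin.cases rfl (fun j => rfl) i

theorem continuousAt_filter_gt {Y : Type*} [TopologicalSpace Y] {u : Y → ℝ} (hu : Continuous u)
    {η : ℝ} (l : List Y) (h : ∀ y ∈ l, u y ≠ η) :
    ContinuousAt (fun l : List Y => l.filter fun y => decide (η < u y)) l := by
  induction l with
  | nil => rw [ContinuousAt, nhds_nil]; exact tendsto_pure_nhds _ _
  | cons a l ih =>
    have ih := ih fun y hy => h y (List.mem_cons_of_mem _ hy)
    refine List.tendsto_cons_iff.2 ?_
    rcases (h a List.mem_cons_self).lt_or_gt with ha | ha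
    · have h1 : ∀ᶠ p : Y × List Y in 𝓝 a ×ˢ 𝓝 l, p.2.filter (fun y => decide (η < u y)) =
          (p.1 :: p.2).filter fun y => decide (η < u y) := by
        filter_upwards [Filter.tendsto_fst.eventually
          ((isOpen_Iio.preimage hu).mem_nhds ha)] with p hp
        have hp : u p.1 < η := hp
        simp [hp.le]
      have h2 : (a :: l).filter (fun y => decide (η < u y)) =
        l.filter fun y => decide (η < u y) := by simp [ha.le]
      beta_reduce
      rw [h2]
      exact (ih.tendsto.comp Filter.tendsto_snd).congr' h1
    · have h1 : ∀ᶠ p : Y × List Y in 𝓝 a ×ˢ 𝓝 l,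
          p.1 :: p.2.filter (fun y => decide (η < u y)) =
          (p.1 :: p.2).filter fun y => decide (η < u y) := by
        filter_upwards [Filter.tendsto_fst.eventually
          ((isOpen_Ioi.preimage hu).mem_nhds ha)] with p hp
        have hp : η < u p.1 := hp
        simp [hp]
      have h2 : (a :: l).filter (fun y => decide (η < u y)) =
          a :: l.filter fun y => decide (η < u y) := by
        have ha : η < u a := ha
        simp [ha]
      beta_reduce
      rw [h2]
      exact (Filter.tendsto_fst.cons (ih.tendsto.comp Filter.tendsto_snd)).congr' h1

section circle
variable {M X : Type*} [TopologicalSpace M] [TopologicalSpace X] {x₀ : X}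
  (c : M ≃ₜ AddCircle (1 : ℝ))

theorem isQuotientMap_lc : Topology.IsQuotientMap (lc x₀ : LabelPre M X → _) :=
  isQuotientMap_quot_mk

theorem continuous_clift {S T : Type*} [TopologicalSpace S] [LocallyCompactSpace S]
    [TopologicalSpace T] {Φ : S → List (ℝ × X) → T} (h : ∀ s, CInv x₀ (Φ s))
    (hc : ∀ s w, (w.Pairwise fun a b => a.1 < b.1 ∧ b.1 < a.1 + 1) →
      ContinuousAt (fun z : S × List (ℝ × X) => Φ z.1 z.2) (s, w)) :
    Continuous fun z : S × LabeledConfig M X x₀ => clift c (Φ z.1) z.2 := by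
  refine (quot_id_prod isQuotientMap_lc).continuous_iff.2 (continuous_iff_continuousAt.2 ?_)
  rintro ⟨s, k, c₀, l₀⟩
  have he : Topology.IsOpenEmbedding
      (@Sigma.mk ℕ (fun k => OrdConfig M k × (Fin k → X)) k) :=
    Topology.IsOpenEmbedding.sigmaMk
  refine (((Topology.IsOpenEmbedding.id (X := S)).prodMap he).continuousAt_iff
    (x := (s, c₀, l₀))).1 ?_
  obtain ⟨a, ha, ha'⟩ : ∃ a ∈ Ico (0 : ℝ) 1, a ∉ Set.range fun i => rep c 0 (c₀.1 i) :=
    (Ico_infinite zero_lt_one).exists_notMem_finite (finite_range _)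
  have hne : ∀ i, c₀.1 i ≠ pt c a := fun i e => ha' ⟨i, by
    show rep c 0 (c₀.1 i) = a
    rw [e, rep_pt c (by simpa using ha)]⟩
  have hcz : ∀ i, ContinuousAt (fun z : S × OrdConfig M k × (Fin k → X) => rep c a (z.2.1.1 i))
      (s, c₀, l₀) := fun i => by
    have h1 : Continuous fun z : S × OrdConfig M k × (Fin k → X) => z.2.1.1 i :=
      (continuous_apply i).comp (continuous_subtype_val.comp (continuous_fst.comp continuous_snd))
    exact ContinuousAt.comp (f := fun z : S × OrdConfig M k × (Fin k → X) => z.2.1.1 i)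
      (continuousAt_rep c (hne i)) h1.continuousAt
  set q := Tuple.sort fun i => rep c a (c₀.1 i)
  have hqm : StrictMono fun i => rep c a (c₀.1 (q i)) := by
    refine Monotone.strictMono_of_injective
      (Tuple.monotone_sort fun i => rep c a (c₀.1 i)) fun i j hij => ?_
    refine q.injective (c₀.2 ?_)
    rw [← pt_rep c a (c₀.1 (q i)), ← pt_rep c a (c₀.1 (q j))]
    exact congrArg _ hij
  set W : S × OrdConfig M k × (Fin k → X) → List (ℝ × X) := fun z =>
    List.ofFn fun i => (rep c a (z.2.1.1 (q i)), z.2.2 (q i)) with hW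
  have hmono : ∀ᶠ z in 𝓝 (s, c₀, l₀), ∀ i j : Fin k, i < j →
      rep c a (z.2.1.1 (q i)) < rep c a (z.2.1.1 (q j)) := by
    refine Filter.eventually_all.2 fun i => Filter.eventually_all.2 fun j =>
      Filter.eventually_imp_distrib_left.2 fun hij => ?_
    exact (hcz (q i)).eventually_lt (hcz (q j)) (hqm hij)
  have hwin : ∀ z : S × OrdConfig M k × (Fin k → X), (∀ i j : Fin k, i < j →
      rep c a (z.2.1.1 (q i)) < rep c a (z.2.1.1 (q j))) →
      (W z).Pairwise fun a b => a.1 < b.1 ∧ b.1 < a.1 + 1 := fun z hz => by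
    rw [hW, List.pairwise_ofFn]
    refine fun i j hij => ⟨hz i j hij, ?_⟩
    have h1 := (rep_mem c a (z.2.1.1 (q i))).1
    have h2 := (rep_mem c a (z.2.1.1 (q j))).2
    show rep c a (z.2.1.1 (q j)) < rep c a (z.2.1.1 (q i)) + 1
    linarith
  have hWc : ContinuousAt W (s, c₀, l₀) := by
    refine ContinuousAt.comp (f := fun z : S × OrdConfig M k × (Fin k → X) =>
      fun i : Fin k => (rep c a (z.2.1.1 (q i)), z.2.2 (q i))) (continuous_ofFn k).continuousAt ?_
    exact continuousAt_pi.2 fun i => (hcz (q i)).prodMk (by fun_prop)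
  have hlim : ContinuousAt (fun z => Φ z.1 (W z)) (s, c₀, l₀) :=
    ContinuousAt.comp (g := fun z : S × List (ℝ × X) => Φ z.1 z.2)
      (f := fun z : S × OrdConfig M k × (Fin k → X) => (z.1, W z))
      (hc s (W (s, c₀, l₀)) (hwin _ fun i j hij => hqm hij))
      (continuousAt_fst.prodMk hWc)
  refine hlim.congr (hmono.mono fun z hz => ?_)
  refine (clift_lc (x₀ := x₀) c (h z.1) ((hwin z hz).imp fun h _ _ => h) ?_).symm
  unfold toM
  rw [List.map_ofFn, ← Fin.univ_val_map]
  conv_lhs => rw [mset, ← Multiset.map_univ_val_equiv q, Multiset.map_map]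
  refine Multiset.map_congr rfl fun i _ => ?_
  simp

theorem continuousAt_cf {w : List (ℝ × X)} (h : (w.map fun b => pt c b.1).Nodup) :
    ContinuousAt (cf c : List (ℝ × X) → LabeledConfig M X x₀) w := by
  have : T2Space M := c.symm.t2Space
  have e : (cf c : List (ℝ × X) → LabeledConfig M X x₀) =
      (fun v : Σ n, Fin n → ℝ × X => cf c (List.ofFn v.2)) ∘ toS := by
    funext w
    simp [toS]
  rw [e]
  refine ContinuousAt.comp ?_ continuous_toS.continuousAt
  have he : Topology.IsOpenEmbedding
      (@Sigma.mk ℕ (fun n => Fin n → ℝ × X) w.length) :=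
    Topology.IsOpenEmbedding.sigmaMk
  refine (he.continuousAt_iff (x := w.get)).1 ?_
  have hpt := continuous_pt c
  set O : Set (Fin w.length → ℝ × X) := {v | Function.Injective fun i => pt c (v i).1}
  have hO : IsOpen O := by
    have : O = ⋂ i, ⋂ j, {v | i ≠ j → pt c (v i).1 ≠ pt c (v j).1} := by
      ext v
      simp only [mem_iInter, mem_ofPred_eq, O, Function.Injective]
      exact forall₂_congr fun i j => not_imp_not.symm
    rw [this]
    refine isOpen_iInter_of_finite fun i => isOpen_iInter_of_finite fun j => ?_
    by_cases hij : i = j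
    · simp [hij]
    · simp only [ne_eq, hij, not_false_eq_true, forall_const]
      exact isOpen_ne_fun (by fun_prop) (by fun_prop)
  have hw : w.get ∈ O := by
    intro i j hij
    have := (List.nodup_iff_injective_get.1 h) (a₁ := i.cast (by simp)) (a₂ := j.cast (by simp))
      (by simpa using hij)
    exact Fin.ext (by simpa [Fin.ext_iff] using this)
  refine ContinuousOn.continuousAt ?_ (hO.mem_nhds hw)
  rw [continuousOn_iff_continuous_domRestrict]
  have h1 : Continuous fun v : O => (⟨fun i => pt c (v.1 i).1, v.2⟩ : OrdConfig M w.length) :=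
    Continuous.subtype_mk (continuous_pi fun i => hpt.comp (continuous_fst.comp
      ((continuous_apply i).comp continuous_subtype_val))) _
  have h2 : Continuous fun v : O => (⟨w.length, ⟨fun i => pt c (v.1 i).1, v.2⟩,
      fun i => (v.1 i).2⟩ : LabelPre M X) :=
    continuous_sigmaMk.comp (h1.prodMk (continuous_pi fun i => continuous_snd.comp
      ((continuous_apply i).comp continuous_subtype_val)))
  refine (isQuotientMap_lc.continuous.comp h2).congr fun v => ?_
  refine (cfg_mset (x₀ := x₀) _).symm.trans ?_
  show _ = cfg x₀ _
  congr 1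
  unfold toM
  rw [List.map_ofFn, ← Fin.univ_val_map]
  rfl

end circle

end LoopModel

namespace LoopModel

section circle
variable {M X : Type*} [TopologicalSpace M] [TopologicalSpace X] {x₀ : X}
  (c : M ≃ₜ AddCircle (1 : ℝ))

theorem exists_win (C : LabeledConfig M X x₀) : ∃ w, Win x₀ w ∧ cf c w = C := by
  induction C using Quot.ind with
  | _ p =>
  obtain ⟨w, hw, e⟩ := exists_NF c p
  refine ⟨w, List.Pairwise.imp_of_mem ?_ hw.1, ?_⟩
  · intro a b ha hb h _ _
    exact ⟨h, by have := (hw.2 a ha).1; have := (hw.2 b hb).2; linarith⟩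
  · unfold cf
    rw [e, cfg_mset]; rfl

theorem clift_congr {T : Type*} {Φ Ψ : List (ℝ × X) → T} (h : CInv x₀ Φ) (h' : CInv x₀ Ψ)
    (e : ∀ w, Win x₀ w → Φ w = Ψ w) (C : LabeledConfig M X x₀) : clift c Φ C = clift c Ψ C := by
  obtain ⟨w, hw, rfl⟩ := exists_win c C
  rw [clift_cf c h hw, clift_cf c h' hw, e w hw]

namespace Nice
variable (N : Nice X x₀)

/-- The deformation applied to the labels of a list. -/
def hm (s : I) (w : List (ℝ × X)) : List (ℝ × X) := w.map fun b => (b.1, N.h (s, b.2))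

@[simp] theorem hm_nil (s : I) : N.hm s [] = [] := rfl
@[simp] theorem hm_cons (s : I) (b : ℝ × X) (w : List (ℝ × X)) :
    N.hm s (b :: w) = (b.1, N.h (s, b.2)) :: N.hm s w := rfl
@[simp] theorem hm_zero (w : List (ℝ × X)) : N.hm 0 w = w := by simp [hm, N.h_zero]
@[simp] theorem hm_snd (s : I) (w : List (ℝ × X)) :
    (N.hm s w).map Prod.snd = N.hl s (w.map Prod.snd) := by simp [hm, hl]

theorem hm_win {s : I} {w : List (ℝ × X)} (h : Win x₀ w) : Win x₀ (N.hm s w) := by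
  refine List.pairwise_map.2 (h.imp fun h ha hb => h ?_ ?_)
  · rintro e; exact ha (by rw [e, N.h_base])
  · rintro e; exact hb (by rw [e, N.h_base])

theorem continuous_hm : Continuous fun z : I × List (ℝ × X) => N.hm z.1 z.2 := by
  have hh := N.hh
  exact (continuous_map_list (k := fun (s : I) (b : ℝ × X) => (b.1, N.h (s, b.2)))
    (by fun_prop)).comp continuous_swap

/-- The total weight of the labels of a list. -/
def wts (w : List (ℝ × X)) : ℝ := N.wt (w.map Prod.snd)

theorem continuous_wts : Continuous N.wts := by
  have h2 : Continuous fun w : List (ℝ × X) => w.map Prod.snd :=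
    (continuous_map_list (k := fun (_ : Unit) (b : ℝ × X) => b.2) (by fun_prop)).comp
      (by fun_prop : Continuous fun w : List (ℝ × X) => (w, ()))
  exact N.continuous_wt.comp h2

theorem win_of_wts {w : List (ℝ × X)} (h : N.wts w = 0) : Win x₀ w :=
  List.Pairwise.imp_of_mem (R := fun _ _ => True)
    (fun ha _ _ h' => (h' (N.wt_eq_zero h _ (List.mem_map_of_mem ha))).elim)
    (List.pairwise_of_forall fun _ _ => trivial)

theorem hm_inv {T : Type*} {Φ : List (ℝ × X) → T} (h : CInv x₀ Φ) (s : I) :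
    CInv x₀ fun w => Φ (N.hm s w) :=
  h.comp_map (k := fun x => N.h (s, x)) (N.h_base s)

theorem le_wt {l : List X} {y : X} (h : y ∈ l) : N.u y ≤ N.wt l := by
  induction l with
  | nil => simp at h
  | cons z l ih =>
    have h1 := N.nonneg z
    have h2 := N.wt_nonneg l
    rw [wt_cons]
    rcases List.mem_cons.1 h with rfl | h
    · linarith
    · linarith [ih h]

theorem wt_hl_le (s : I) (l : List X) : N.wt (N.hl s l) ≤ N.wt l := by
  induction l with
  | nil => simp
  | cons y l ih =>
    rw [hl_cons, wt_cons, wt_cons]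
    exact add_le_add (N.u_h s y) ih

/-- The configuration of a list, after removing the points with labels near the base point. -/
def cK (w : List (ℝ × X)) : LabeledConfig M X x₀ := cf c (N.hm 1 w)

theorem cK_inv : CInv x₀ (N.cK c : _ → LabeledConfig M X x₀) := N.hm_inv (cf_inv c) 1

theorem cK_filter_aux {η : ℝ} (hη : η ≤ 1 / 2) (w p : List (ℝ × X)) :
    (cf c (p ++ N.hm 1 w) : LabeledConfig M X x₀) =
      cf c (p ++ N.hm 1 (w.filter fun b => decide (η < N.u b.2))) := by
  induction w generalizing p with
  | nil => rfl
  | cons b w ih =>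
    by_cases hb : η < N.u b.2
    · have := ih (p ++ [(b.1, N.h (1, b.2))])
      simpa [hb] using this
    · have h1 : N.h (1, b.2) = x₀ := N.h_one _ (by linarith)
      rw [hm_cons, h1, (cf_inv c).del, ih]
      simp [hb]

theorem cK_filter {η : ℝ} (hη : η ≤ 1 / 2) (w : List (ℝ × X)) :
    (N.cK c w : LabeledConfig M X x₀) = N.cK c (w.filter fun b => decide (η < N.u b.2)) :=
  N.cK_filter_aux c hη w []

theorem cK_small {w : List (ℝ × X)} (h : N.wts w ≤ 1 / 2) :
    (N.cK c w : LabeledConfig M X x₀) = cf c [] := by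
  rw [N.cK_filter c le_rfl]
  have : (w.filter fun b => decide (1 / 2 < N.u b.2)) = [] := by
    rw [List.filter_eq_nil_iff]
    intro b hb
    have := N.le_wt (List.mem_map_of_mem hb : b.2 ∈ w.map Prod.snd)
    unfold wts at h
    simp only [decide_eq_true_eq, not_lt]
    linarith
  rw [this]; rfl

theorem continuousAt_cf_hm {w : List (ℝ × X)} (s : I)
    (hw : w.Pairwise fun a b => a.1 < b.1 ∧ b.1 < a.1 + 1) :
    ContinuousAt (fun z : I × List (ℝ × X) => (cf c (N.hm z.1 z.2) : LabeledConfig M X x₀))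
      (s, w) := by
  refine ContinuousAt.comp (g := (cf c : List (ℝ × X) → LabeledConfig M X x₀))
    (f := fun z : I × List (ℝ × X) => N.hm z.1 z.2) (continuousAt_cf c ?_)
    N.continuous_hm.continuousAt
  show ((N.hm s w).map fun b => pt c b.1).Nodup
  unfold hm
  rw [List.map_map, List.Nodup, List.pairwise_map]
  exact hw.imp fun h => pt_ne c h.1 h.2

theorem continuousAt_cK {w : List (ℝ × X)} (hw : Win x₀ w) :
    ContinuousAt (N.cK c : _ → LabeledConfig M X x₀) w := by
  obtain ⟨η, h0, h1, h⟩ := N.exists_level (w.map Prod.snd)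
  have hf := continuousAt_filter_gt (N.hu.comp (continuous_snd (X := ℝ))) (η := η) w
    fun b hb => h b.2 (List.mem_map_of_mem hb)
  have e : (N.cK c : _ → LabeledConfig M X x₀) = (fun z : I × List (ℝ × X) => cf c (N.hm z.1 z.2)) ∘
      fun w => ((1 : I), w.filter fun b => decide (η < N.u b.2)) :=
    funext fun w => N.cK_filter c h1.le w
  rw [e]
  refine ContinuousAt.comp (N.continuousAt_cf_hm c _ ?_) (continuousAt_const.prodMk hf)
  rw [List.pairwise_filter]
  have aux : ∀ y, η < N.u y → y ≠ x₀ := by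
    rintro _ h rfl
    rw [N.u_base] at h
    exact h0.not_gt h
  exact hw.imp fun h ha hb => h (aux _ (by simpa using ha)) (aux _ (by simpa using hb))

theorem continuousAt_cK_itp {Z : Type*} [TopologicalSpace Z] {f : Z → List (ℝ × X)} {s a : Z → ℝ}
    {z : Z} (hf : ContinuousAt f z) (hs : ContinuousAt s z) (ha : ContinuousAt a z)
    (h0 : 0 ≤ s z) (h1 : s z ≤ 1) (hw : s z < 1 → Win x₀ (f z)) :
    ContinuousAt (fun z => (N.cK c (N.itp (s z) (N.wts (f z)) (a z) (f z)) :
      LabeledConfig M X x₀)) z := by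
  have hW : ContinuousAt (fun z => N.wts (f z)) z :=
    ContinuousAt.comp (g := N.wts) N.continuous_wts.continuousAt hf
  have hpos : 0 ≤ N.wts (f z) := N.wt_nonneg _
  rcases hpos.eq_or_lt with h | h
  · refine (continuousAt_const (y := (cf c [] : LabeledConfig M X x₀))).congr ?_
    filter_upwards [hW.eventually (gt_mem_nhds (show N.wts (f z) < 1 / 2 by rw [← h]; norm_num))]
      with z hz
    refine (N.cK_small c ?_).symm
    unfold wts at hz ⊢
    rw [itp_snd]
    exact le_of_lt hz
  · have hi : ContinuousAt (fun z => N.itp (s z) (N.wts (f z)) (a z) (f z)) z := by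
      have h2 := ContinuousAt.comp (f := fun z => (f z, s z, (N.wts (f z))⁻¹, a z))
        N.continuous_itp.continuousAt (hf.prodMk (hs.prodMk ((hW.inv₀ h.ne').prodMk ha)))
      refine h2.congr (Filter.Eventually.of_forall fun z => ?_)
      simp
    exact ContinuousAt.comp (f := fun z => N.itp (s z) (N.wts (f z)) (a z) (f z))
      (N.continuousAt_cK c (N.itp_win h0 h1 le_rfl h hw)) hi

theorem continuous_Psi_cK : Continuous fun z : List X × ℝ =>
    (N.Psi (N.cK c) z.1 z.2 : LabeledConfig M X x₀) := by
  have h : Continuous fun z : List X × ℝ => z.1.map fun x => ((0 : ℝ), x) :=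
    (continuous_map_list (k := fun (_ : Unit) (x : X) => ((0 : ℝ), x)) (by fun_prop)).comp
      (by fun_prop : Continuous fun z : List X × ℝ => (z.1, ()))
  refine continuous_iff_continuousAt.2 fun z => ?_
  refine (N.continuousAt_cK_itp c h.continuousAt (continuousAt_const (y := (1 : ℝ)))
    (continuous_snd.neg).continuousAt zero_le_one le_rfl fun h => (lt_irrefl _ h).elim).congr
    (Filter.Eventually.of_forall fun z => ?_)
  show N.cK c (N.itp 1 (N.wts _) _ _) = N.cK c (N.itp 1 (N.wt z.1) _ _)
  unfold wts
  rw [map_snd_zero]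
  rfl

/-- The configuration of a cyclic word. -/
def cw : EE x₀ true → LabeledConfig M X x₀ := N.ps (N.cK_inv c)

theorem continuous_cw : Continuous (N.cw c : EE x₀ true → LabeledConfig M X x₀) := by
  have hu := N.hu
  refine EE.continuous_lift (h := N.Psi_einv (N.cK_inv c)) ?_
  have h1 : Continuous fun w : EPre X => w.2.2 :: w.1 := by fun_prop
  exact (N.continuous_Psi_cK c).comp (h1.prodMk
    (by fun_prop : Continuous fun w : EPre X => (w.2.1 : ℝ) * N.u w.2.2))

/-- The cyclic word of a configuration. -/
def wc : LabeledConfig M X x₀ → EE x₀ true := clift c N.ph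

theorem continuous_wc : Continuous (N.wc c : LabeledConfig M X x₀ → _) :=
  (continuous_clift (S := Unit) c (fun _ => N.ph_inv) fun _ _ _ =>
    (N.continuous_ph.comp continuous_snd).continuousAt).comp
    (by fun_prop : Continuous fun C : LabeledConfig M X x₀ => ((), C))

/-- The interpolation from the identity of configurations to equidistributed ones. -/
theorem itp_inv {T : Type*} {Φ : List (ℝ × X) → T} (h : CInv x₀ Φ) (s : ℝ) :
    CInv x₀ fun w => Φ (N.itp s (N.wts w) (N.mom w) w) where
  del w z w' := by
    have e : N.wts (w ++ (z, x₀) :: w') = N.wts (w ++ w') := by simp [wts]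
    have e' : N.mom (w ++ (z, x₀) :: w') = N.mom (w ++ w') := by simp
    rw [e, e', itp_append, itp_append]
    refine (h.del _ _ _).trans ?_
    simp [u_base]
  rot z y w := by
    have e : N.wts (w ++ [(z + 1, y)]) = N.wts ((z, y) :: w) := by simp [wts, add_comm]
    have e' : N.mom (w ++ [(z + 1, y)]) = N.mom ((z, y) :: w) + N.u y := by simp; ring
    have h0 : 0 ≤ N.wts ((z, y) :: w) := N.wt_nonneg _
    rcases h0.eq_or_lt with h0 | h0
    · have hb : ∀ v, N.wts v = 0 → ∀ U a, Φ (N.itp s U a v) = Φ [] := fun v hv U a =>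
        h.of_base fun b hb => N.wt_eq_zero hv _ (by
          have : b.2 ∈ (N.itp s U a v).map Prod.snd := List.mem_map_of_mem hb
          rwa [itp_snd] at this)
      rw [hb _ h0.symm, hb _ (e.trans h0.symm)]
    · rw [e, e', itp_append]
      refine (h.rot _ _ _).trans ?_
      congr 2
      have h1 : N.wts ((z, y) :: w) = N.u y + N.wt (w.map Prod.snd) := by simp [wts]
      simp only [itp, List.cons.injEq, Prod.mk.injEq, and_true]
      field_simp
      rw [h1]; ring

theorem htpy_cw_wc : Htpy (fun C => N.cw c (N.wc c C)) (id : LabeledConfig M X x₀ → _) := by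
  have hΦ1 : ∀ s : I, CInv x₀ fun w => (N.cK c (N.itp s (N.wts w) (N.mom w) w) :
    LabeledConfig M X x₀) := fun s => N.itp_inv (N.cK_inv c) s
  have hΦ2 : ∀ s : I, CInv x₀ fun w => (cf c (N.hm s w) : LabeledConfig M X x₀) :=
    fun s => N.hm_inv (cf_inv c) s
  have h1 : Htpy (clift c (N.cK c) : LabeledConfig M X x₀ → LabeledConfig M X x₀)
      (fun C => N.cw c (N.wc c C)) := by
    refine ⟨_, continuous_clift c hΦ1 fun s w hw => ?_, ?_, ?_⟩
    · exact N.continuousAt_cK_itp c continuousAt_snd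
        (continuous_subtype_val.comp continuous_fst).continuousAt
        (N.continuous_mom.comp continuous_snd).continuousAt s.2.1 s.2.2
        fun _ => hw.imp fun h _ _ => h
    · refine fun C => clift_congr c (hΦ1 0) (N.cK_inv c) (fun w _ => ?_) C
      show N.cK c (N.itp ((0 : I) : ℝ) _ _ w) = _
      exact congrArg _ (N.itp_zero _ _ w)
    · intro C
      obtain ⟨w, hw, rfl⟩ := exists_win c C
      refine (clift_cf c (hΦ1 1) hw).trans ?_
      show _ = N.cw c (clift c N.ph (cf c w))
      rw [clift_cf c N.ph_inv hw]
      refine Eq.trans ?_ (N.ps_Rot (N.cK_inv c) _ _).symm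
      unfold Psi
      rw [neg_neg]
      exact congrArg _ (N.itp_one _ _ (map_snd_zero _).symm)
  have h2 : Htpy (id : LabeledConfig M X x₀ → LabeledConfig M X x₀) (clift c (N.cK c)) := by
    refine ⟨_, continuous_clift c hΦ2 fun s w hw => N.continuousAt_cf_hm c s hw, ?_, ?_⟩
    · intro C
      refine (clift_congr c (hΦ2 0) (cf_inv c) (fun w _ => ?_) C).trans (clift_self c C)
      show cf c (N.hm 0 w) = _
      rw [hm_zero]
    · exact fun C => rfl
  exact (h2.trans h1).symm

theorem htpy_wc_cw :
    Htpy (fun e => N.wc c (N.cw c e : LabeledConfig M X x₀)) (id : EE x₀ true → _) := by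
  have hu := N.hu
  have hΦ : ∀ s : I, CInv x₀ fun w => N.ph (N.hm s w) := fun s => N.hm_inv N.ph_inv s
  refine Htpy.symm ⟨_, EE.continuous_lift₂ (h := fun s => N.Psi_einv (hΦ s)) ?_, ?_, ?_⟩
  · have key : Continuous fun z : I × List X × ℝ =>
      N.Psi (fun w => N.ph (N.hm z.1 w)) z.2.1 z.2.2 := by
      set f : I × List X × ℝ → List (ℝ × X) := fun z =>
        N.hm z.1 (N.itp 1 (N.wt z.2.1) (-z.2.2) (z.2.1.map fun x => ((0 : ℝ), x))) with hf
      have hfs : ∀ z, (f z).map Prod.snd = N.hl z.1 z.2.1 := fun z => by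
        rw [hf]
        show (N.hm _ _).map Prod.snd = _
        rw [hm_snd, itp_snd, map_snd_zero]
      have hg : Continuous fun w : (I × List X × ℝ) × I => N.Rn (N.hl w.1.1 w.1.2.1, w.2) :=
        N.continuous_Rn.comp ((N.continuous_hl.comp (by fun_prop :
          Continuous fun w : (I × List X × ℝ) × I => (w.1.1, w.1.2.1))).prodMk continuous_snd)
      have e : ∀ z, N.Psi (fun w => N.ph (N.hm z.1 w)) z.2.1 z.2.2 = N.Rn (N.hl z.1 z.2.1,
          ⟨Int.fract (-N.mom (f z) / N.wt (N.hl z.1 z.2.1)), Int.fract_nonneg _,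
            (Int.fract_lt_one _).le⟩) := fun z => by
        rw [← N.Rot_eq_Rn, ← hfs]
        rfl
      have hc : IsClosed {z : I × List X × ℝ | N.wt z.2.1 = 0} :=
        isClosed_eq (N.continuous_wt.comp (by fun_prop)) continuous_const
      refine (continuous_eval_any hg hc ?_ ?_ (τ := fun z => ⟨Int.fract (-N.mom (f z) /
        N.wt (N.hl z.1 z.2.1)), Int.fract_nonneg _, (Int.fract_lt_one _).le⟩)).congr
        fun z => (e z).symm
      · refine ContinuousOn.congr (f := fun z => N.ph (f z)) ?_ fun z _ => (e z).symm
        refine N.continuous_ph.comp_continuousOn fun z hz => ContinuousAt.continuousWithinAt ?_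
        have hz : N.wt z.2.1 ≠ 0 := hz
        have hW : ContinuousAt (fun z : I × List X × ℝ => N.wt z.2.1) z :=
          (N.continuous_wt.comp
            (by fun_prop : Continuous fun z : I × List X × ℝ => z.2.1)).continuousAt
        have hl : Continuous fun z : I × List X × ℝ => z.2.1.map fun x => ((0 : ℝ), x) :=
          (continuous_map_list (k := fun (_ : Unit) (x : X) => ((0 : ℝ), x)) (by fun_prop)).comp
            (by fun_prop : Continuous fun z : I × List X × ℝ => (z.2.1, ()))
        have h2 := ContinuousAt.comp (f := fun z : I × List X × ℝ =>
            (z.2.1.map fun x => ((0 : ℝ), x), (1 : ℝ), (N.wt z.2.1)⁻¹, -z.2.2))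
          N.continuous_itp.continuousAt (hl.continuousAt.prodMk (continuousAt_const.prodMk
            ((hW.inv₀ hz).prodMk (by fun_prop : Continuous fun z : I × List X × ℝ =>
              -z.2.2).continuousAt)))
        have h3 := ContinuousAt.comp (g := fun z : I × List (ℝ × X) => N.hm z.1 z.2)
          N.continuous_hm.continuousAt (continuousAt_fst.prodMk h2)
        refine h3.congr (Filter.Eventually.of_forall fun z => ?_)
        simp [hf]
      · intro z hz t t'
        refine N.Rn_of_wt ?_ t t'
        have hz : N.wt z.2.1 = 0 := hz
        refine le_antisymm ?_ (N.wt_nonneg _)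
        rw [← hz]
        exact N.wt_hl_le _ _
    have h1 : Continuous fun w : I × EPre X => w.2.2.2 :: w.2.1 := by fun_prop
    exact (key.comp (continuous_fst.prodMk (h1.prodMk (by fun_prop :
      Continuous fun w : I × EPre X => (w.2.2.1 : ℝ) * N.u w.2.2.2))) :)
  · intro e
    obtain ⟨l, t, y, rfl⟩ := EE.cases e
    refine (EE.lift_mk _ _ l t y).trans ?_
    have e0 : (fun w => N.ph (N.hm 0 w)) = N.ph := funext fun w => by rw [hm_zero]
    have hy := N.nonneg y
    have hl := N.wt_nonneg l
    rw [e0, Psi_ph, N.Rot_of_mem (mul_nonneg t.2.1 hy) (by rw [wt_cons]; nlinarith [t.2.2]),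
      Rd_cons_le]
    simp
  · intro e
    obtain ⟨l, t, y, rfl⟩ := EE.cases e
    refine (EE.lift_mk _ _ l t y).trans ?_
    show _ = clift c N.ph (cf c (N.hm 1 (N.itp 1 _ _ _)))
    refine (clift_cf c N.ph_inv (N.hm_win ?_)).symm
    have h0 := N.wt_nonneg (y :: l)
    rcases h0.eq_or_lt with h0 | h0
    · refine N.win_of_wts ?_
      unfold wts
      rw [itp_snd, map_snd_zero, h0]
    · refine N.itp_win zero_le_one le_rfl ?_ h0 fun h => (lt_irrefl _ h).elim
      rw [map_snd_zero]

theorem he_wc : HE (N.wc c : LabeledConfig M X x₀ → _) :=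
  ⟨N.continuous_wc c, N.cw c, N.continuous_cw c, N.htpy_cw_wc c, N.htpy_wc_cw c⟩

end Nice

end circle

end LoopModel

namespace LoopModel

section functoriality
variable {M X Y Z : Type*} [TopologicalSpace M] [TopologicalSpace X] [TopologicalSpace Y]
  [TopologicalSpace Z] {x₀ : X} {y₀ : Y} {z₀ : Z}

/-- Pointed homotopy between pointed maps. -/
def PHtpy (x₀ : X) (y₀ : Y) (f g : X → Y) : Prop :=
  ∃ F : I × X → Y, Continuous F ∧ (∀ x, F (0, x) = f x) ∧ (∀ x, F (1, x) = g x) ∧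
    ∀ t, F (t, x₀) = y₀

/-- Apply a map to all labels of a pre-configuration. -/
def lpmap (k : X → Y) (p : LabelPre M X) : LabelPre M Y := ⟨p.1, p.2.1, k ∘ p.2.2⟩

theorem continuous_lpmap {S : Type*} [TopologicalSpace S] {k : S → X → Y}
    (hk : Continuous fun z : S × X => k z.1 z.2) :
    Continuous fun z : S × LabelPre M X => lpmap (k z.1) z.2 := by
  refine continuous_iff_continuousAt.2 ?_
  rintro ⟨s, n, c, l⟩
  have he : Topology.IsOpenEmbedding (@Sigma.mk ℕ (fun k => OrdConfig M k × (Fin k → X)) n) :=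
    Topology.IsOpenEmbedding.sigmaMk
  refine (((Topology.IsOpenEmbedding.id (X := S)).prodMap he).continuousAt_iff
    (x := (s, c, l))).1 ?_
  have h : Continuous fun z : S × OrdConfig M n × (Fin n → X) =>
      (z.2.1, fun i => k z.1 (z.2.2 i)) := by
    refine (by fun_prop : Continuous fun z : S × OrdConfig M n × (Fin n → X) => z.2.1).prodMk
      (continuous_pi fun i => hk.comp (by fun_prop :
        Continuous fun z : S × OrdConfig M n × (Fin n → X) => (z.1, z.2.2 i)))
  exact (Continuous.comp (g := @Sigma.mk ℕ (fun k => OrdConfig M k × (Fin k → Y)) n)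
    continuous_sigmaMk h).continuousAt

/-- The map of labelled configuration spaces induced by a pointed map. -/
def lcmap (k : X → Y) (hk : k x₀ = y₀) : LabeledConfig M X x₀ → LabeledConfig M Y y₀ :=
  Quot.map (lpmap k) (by
    rintro _ _ (⟨c, l, e⟩ | ⟨c, l, i, h⟩)
    · exact LabelRel.perm c (k ∘ l) e
    · exact LabelRel.delete c (k ∘ l) i ((congrArg k h).trans hk))

theorem continuous_lcmap₂ {S : Type*} [TopologicalSpace S] [LocallyCompactSpace S]
    {k : S → X → Y} (hk : Continuous fun z : S × X => k z.1 z.2) (h : ∀ s, k s x₀ = y₀) :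
    Continuous fun z : S × LabeledConfig M X x₀ => lcmap (k z.1) (h z.1) z.2 :=
  (quot_id_prod isQuotientMap_lc).continuous_iff.2
    (isQuotientMap_lc.continuous.comp (continuous_lpmap hk))

theorem continuous_lcmap {k : X → Y} (hc : Continuous k) (hk : k x₀ = y₀) :
    Continuous (lcmap k hk : LabeledConfig M X x₀ → LabeledConfig M Y y₀) :=
  (continuous_lcmap₂ (S := Unit) (hc.comp continuous_snd) fun _ => hk).comp
    (by fun_prop : Continuous fun C : LabeledConfig M X x₀ => ((), C))

theorem PHtpy.lcmap {k : X → X} (hk : k x₀ = x₀) (h : PHtpy x₀ x₀ k id) :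
    Htpy (lcmap k hk : LabeledConfig M X x₀ → _) id := by
  obtain ⟨F, hF, h0, h1, hb⟩ := h
  refine ⟨_, continuous_lcmap₂ (k := fun s x => F (s, x)) hF hb, ?_, ?_⟩
  · rintro ⟨p⟩
    exact congrArg (Quot.mk _) (congrArg (fun k => lpmap k p) (funext h0))
  · rintro ⟨p⟩
    exact congrArg (Quot.mk _) (congrArg (fun k => lpmap k p) (funext h1))

theorem he_lcmap {f : X → Y} {g : Y → X} (hf : Continuous f) (hg : Continuous g) (f₀ : f x₀ = y₀)
    (g₀ : g y₀ = x₀) (h : PHtpy x₀ x₀ (g ∘ f) id) (h' : PHtpy y₀ y₀ (f ∘ g) id) :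
    HE (lcmap f f₀ : LabeledConfig M X x₀ → LabeledConfig M Y y₀) := by
  refine ⟨continuous_lcmap hf f₀, LoopModel.lcmap g g₀, continuous_lcmap hg g₀, ?_, ?_⟩
  · refine cast (congrArg (Htpy · id) (funext ?_)) (h.lcmap (by simp [f₀, g₀]))
    rintro ⟨p⟩; rfl
  · refine cast (congrArg (Htpy · id) (funext ?_)) (h'.lcmap (by simp [f₀, g₀]))
    rintro ⟨p⟩; rfl

/-- The map of suspensions induced by a pointed map. -/
def smap (k : X → Y) (hk : k x₀ = y₀) : Susp 1 X x₀ → Susp 1 Y y₀ :=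
  Quot.map (fun w => (w.1, k w.2)) (by
    have : ∀ w, w ∈ SuspCollapse 1 X x₀ → ((w.1, k w.2) : NCube 1 × Y) ∈ SuspCollapse 1 Y y₀ := by
      rintro w (h | h)
      · exact Or.inl ⟨h.1, trivial⟩
      · exact Or.inr ⟨trivial, (congrArg k h.2).trans hk⟩
    exact fun a b h => ⟨this a h.1, this b h.2⟩)

theorem continuous_smap₂ {S : Type*} [TopologicalSpace S] [LocallyCompactSpace S]
    {k : S → X → Y} (hk : Continuous fun z : S × X => k z.1 z.2) (h : ∀ s, k s x₀ = y₀) :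
    Continuous fun z : S × Susp 1 X x₀ => smap (k z.1) (h z.1) z.2 := by
  have hq : Topology.IsQuotientMap (Quot.mk _ : NCube 1 × X → Susp 1 X x₀) := isQuotientMap_quot_mk
  have hq' : Topology.IsQuotientMap (Quot.mk _ : NCube 1 × Y → Susp 1 Y y₀) := isQuotientMap_quot_mk
  refine (quot_id_prod hq).continuous_iff.2 (hq'.continuous.comp ?_)
  exact (by fun_prop : Continuous fun z : S × NCube 1 × X => z.2.1).prodMk
    (hk.comp (by fun_prop : Continuous fun z : S × NCube 1 × X => (z.1, z.2.2)))

theorem continuous_smap {k : X → Y} (hc : Continuous k) (hk : k x₀ = y₀) :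
    Continuous (smap k hk : Susp 1 X x₀ → Susp 1 Y y₀) :=
  (continuous_smap₂ (S := Unit) (hc.comp continuous_snd) fun _ => hk).comp
    (by fun_prop : Continuous fun C : Susp 1 X x₀ => ((), C))

theorem PHtpy.smap {k : X → X} (hk : k x₀ = x₀) (h : PHtpy x₀ x₀ k id) :
    Htpy (smap k hk) (id : Susp 1 X x₀ → _) := by
  obtain ⟨F, hF, h0, h1, hb⟩ := h
  refine ⟨_, continuous_smap₂ (k := fun s x => F (s, x)) hF hb, ?_, ?_⟩
  · rintro ⟨p⟩
    exact congrArg (Quot.mk _) (congrArg (Prod.mk p.1) (h0 p.2))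
  · rintro ⟨p⟩
    exact congrArg (Quot.mk _) (congrArg (Prod.mk p.1) (h1 p.2))

theorem he_smap {f : X → Y} {g : Y → X} (hf : Continuous f) (hg : Continuous g) (f₀ : f x₀ = y₀)
    (g₀ : g y₀ = x₀) (h : PHtpy x₀ x₀ (g ∘ f) id) (h' : PHtpy y₀ y₀ (f ∘ g) id) :
    HE (smap f f₀) := by
  refine ⟨continuous_smap hf f₀, LoopModel.smap g g₀, continuous_smap hg g₀, ?_, ?_⟩
  · refine cast (congrArg (Htpy · id) (funext ?_)) (h.smap (by simp [f₀, g₀]))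
    rintro ⟨p⟩; rfl
  · refine cast (congrArg (Htpy · id) (funext ?_)) (h'.smap (by simp [f₀, g₀]))
    rintro ⟨p⟩; rfl

theorem he_comp_left [LocallyCompactSpace M] {f : C(X, Y)} (hf : HE f) :
    HE fun β : C(M, X) => f.comp β := by
  obtain ⟨-, g, hg, ⟨F, hF, h0, h1⟩, ⟨G, hG, h2, h3⟩⟩ := hf
  refine ⟨by fun_prop, fun β => (⟨g, hg⟩ : C(Y, X)).comp β, by fun_prop, ?_, ?_⟩
  · refine ⟨fun z => (⟨F, hF⟩ : C(I × X, X)).comp ((ContinuousMap.const _ z.1).prodMk z.2), ?_,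
      fun β => ?_, fun β => ?_⟩
    · refine ContinuousMap.continuous_of_continuous_uncurry _ ?_
      show Continuous fun w : (I × C(M, X)) × M => F (w.1.1, w.1.2 w.2)
      fun_prop
    · ext m; exact h0 _
    · ext m; exact h1 _
  · refine ⟨fun z => (⟨G, hG⟩ : C(I × Y, Y)).comp ((ContinuousMap.const _ z.1).prodMk z.2), ?_,
      fun β => ?_, fun β => ?_⟩
    · refine ContinuousMap.continuous_of_continuous_uncurry _ ?_
      show Continuous fun w : (I × C(M, Y)) × M => G (w.1.1, w.1.2 w.2)
      fun_prop
    · ext m; exact h2 _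
    · ext m; exact h3 _

end functoriality

section loops
variable {M B : Type*} [TopologicalSpace M] [TopologicalSpace B] (c : M ≃ₜ AddCircle (1 : ℝ))

theorem isQuotientMap_pt (L : Type*) [TopologicalSpace L] :
    Topology.IsQuotientMap fun w : L × I => (w.1, pt c (w.2 : ℝ)) := by
  have : T2Space M := c.symm.t2Space
  have hc : Continuous fun t : I => pt c (t : ℝ) := (continuous_pt c).comp continuous_subtype_val
  have hp := isProperMap_id (X := L) |>.prodMap hc.isProperMap
  refine hp.isClosedMap.isQuotientMap hp.continuous ?_
  rintro ⟨l, m⟩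
  have h := rep_mem c 0 m
  exact ⟨(l, ⟨rep c 0 m, h.1, by have := h.2; linarith⟩), Prod.ext rfl (pt_rep c 0 m)⟩

/-- The map of the circle defined by a free loop. -/
def ofLP (β : LP B) (m : M) : B :=
  β.1 ⟨rep c 0 m, (rep_mem c 0 m).1, by have := (rep_mem c 0 m).2; linarith⟩

theorem ofLP_pt (β : LP B) (t : I) : ofLP c β (pt c t) = β.1 t := by
  unfold ofLP
  rcases t.2.2.eq_or_lt with h | h
  · have e : rep c 0 (pt c t) = 0 := by
      rw [h, ← zero_add (1 : ℝ), pt_add_one]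
      exact rep_pt c (by simp)
    have e0 :
      (⟨rep c 0 (pt c t), (rep_mem c 0 (pt c t)).1, by rw [e]; exact zero_le_one⟩ : I) = 0 :=
      Subtype.ext e
    have e1 : t = 1 := Subtype.ext h
    exact (congrArg β.1 e0).trans (β.2.trans (congrArg β.1 e1.symm))
  · have h' : (t : ℝ) < 0 + 1 := by simpa using h
    exact congrArg β.1 (Subtype.ext (rep_pt c ⟨t.2.1, h'⟩))

theorem continuous_ofLP : Continuous fun w : LP B × M => ofLP c w.1 w.2 := by
  refine (isQuotientMap_pt c (LP B)).continuous_iff.2 ?_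
  refine (by fun_prop : Continuous fun w : LP B × I => w.1.1 w.2).congr fun w => ?_
  exact (ofLP_pt c w.1 w.2).symm

/-- The parametrization of the circle by the interval. -/
def ptI : C(I, M) := ⟨fun t => pt c (t : ℝ), (continuous_pt c).comp continuous_subtype_val⟩

theorem ptI_zero : ptI c 0 = ptI c 1 := by
  show pt c 0 = pt c 1
  rw [← pt_add_one c 0, zero_add]

/-- The map of the circle defined by a free loop, as a continuous map. -/
def ofLPc (β : LP B) : C(M, B) :=
  ⟨ofLP c β, (continuous_ofLP c).comp (by fun_prop : Continuous fun m : M => (β, m))⟩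

/-- Free loops are maps of the circle. -/
def lpHomeo : LP B ≃ₜ C(M, B) where
  toFun := ofLPc c
  invFun γ := ⟨γ.comp (ptI c), congrArg γ (ptI_zero c)⟩
  left_inv β := Subtype.ext (ContinuousMap.ext fun t => ofLP_pt c β t)
  right_inv γ := ContinuousMap.ext fun m => congrArg γ (pt_rep c 0 m)
  continuous_toFun := ContinuousMap.continuous_of_continuous_uncurry _ (continuous_ofLP c)
  continuous_invFun := Continuous.subtype_mk (ContinuousMap.continuous_precomp (ptI c)) _

end loops

/-- The unit circle in the plane is the quotient of the real line by the integers. -/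
def circleHomeo : Metric.sphere (0 : EuclideanSpace ℝ (Fin 2)) 1 ≃ₜ AddCircle (1 : ℝ) :=
  (Complex.orthonormalBasisOneI.repr.toHomeomorph.symm.subtype (p := (· ∈ sphere 0 1))
    (q := (· ∈ Submonoid.unitSphere ℂ)) fun z => by
      rw [mem_sphere_zero_iff_norm]
      show _ ↔ _ ∈ sphere (0 : ℂ) 1
      rw [mem_sphere_zero_iff_norm]
      exact (Complex.orthonormalBasisOneI.repr.symm.norm_map z).symm ▸ Iff.rfl).trans
    (AddCircle.homeomorphCircle one_ne_zero).symm

end LoopModel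

namespace LoopModel

section whisker
variable {X : Type*} [TopologicalSpace X] (x₀ : X)

/-- The relation attaching a whisker at the base point. -/
inductive WhRel : X ⊕ I → X ⊕ I → Prop
  | glue : WhRel (Sum.inl x₀) (Sum.inr 0)

/-- The space with a whisker attached at the base point. -/
def Wh : Type _ := Quot (WhRel x₀)

instance : TopologicalSpace (Wh x₀) := inferInstanceAs (TopologicalSpace (Quot _))

/-- The inclusion of the space. -/
def Wh.inl (x : X) : Wh x₀ := Quot.mk _ (Sum.inl x)

/-- The inclusion of the whisker. -/
def Wh.inr (t : I) : Wh x₀ := Quot.mk _ (Sum.inr t)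

theorem Wh.glue : Wh.inl x₀ x₀ = Wh.inr x₀ 0 := Quot.sound WhRel.glue

theorem Wh.isQuotientMap : Topology.IsQuotientMap (Quot.mk (WhRel x₀) : _ → Wh x₀) :=
  isQuotientMap_quot_mk

@[fun_prop]
theorem Wh.continuous_inl : Continuous (Wh.inl x₀) :=
  (Wh.isQuotientMap x₀).continuous.comp _root_.continuous_inl

@[fun_prop]
theorem Wh.continuous_inr : Continuous (Wh.inr x₀) :=
  (Wh.isQuotientMap x₀).continuous.comp _root_.continuous_inr

theorem Wh.cases (w : Wh x₀) : (∃ x, w = Wh.inl x₀ x) ∨ ∃ t, w = Wh.inr x₀ t := by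
  obtain ⟨x | t⟩ := w
  exacts [Or.inl ⟨x, rfl⟩, Or.inr ⟨t, rfl⟩]

variable {T S : Type*} [TopologicalSpace T] [TopologicalSpace S]

/-- The map defined on the space with a whisker by maps on both parts. -/
def Wh.lift (f : X → T) (g : I → T) (h : f x₀ = g 0) : Wh x₀ → T :=
  Quot.lift (Sum.elim f g) (by rintro _ _ ⟨⟩; exact h)

theorem Wh.continuous_lift₂ [LocallyCompactSpace S] {f : S → X → T} {g : S → I → T}
    {h : ∀ s, f s x₀ = g s 0} (hf : Continuous fun z : S × X => f z.1 z.2)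
    (hg : Continuous fun z : S × I => g z.1 z.2) :
    Continuous fun z : S × Wh x₀ => Wh.lift x₀ (f z.1) (g z.1) (h z.1) z.2 := by
  refine (quot_id_prod (Wh.isQuotientMap x₀)).continuous_iff.2 ?_
  refine (Homeomorph.prodSumDistrib (X := S) (Y := X) (Z := I)).symm.isQuotientMap.continuous_iff.2
    ?_
  exact continuous_sum_dom.2 ⟨hf, hg⟩

theorem Wh.continuous_lift {f : X → T} {g : I → T} {h : f x₀ = g 0} (hf : Continuous f)
    (hg : Continuous g) : Continuous (Wh.lift x₀ f g h) :=
  (Wh.continuous_lift₂ (S := Unit) x₀ (h := fun _ => h) (hf.comp continuous_snd)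
    (hg.comp continuous_snd)).comp (by fun_prop : Continuous fun w : Wh x₀ => ((), w))

/-- The deformation of the whisker. -/
def whd (s r : I) : I := cl (r * (1 + s))

theorem continuous_whd : Continuous fun z : I × I => whd z.1 z.2 := by
  have := continuous_cl
  unfold whd
  fun_prop

theorem whd_zero (s : I) : whd s 0 = 0 := by
  refine Subtype.ext ?_
  simp [whd, cl]

theorem le_whd (s r : I) : (r : ℝ) ≤ whd s r := by
  simp only [whd, cl]
  have := s.2.1
  have := r.2.1
  have := r.2.2
  simp only [coe_projIcc]
  refine le_max_of_le_right (le_min r.2.2 ?_)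
  nlinarith

theorem whd_eq_one {r : I} (s : I) (h : 1 ≤ (r : ℝ) * (1 + s)) : whd s r = 1 :=
  projIcc_of_right_le zero_le_one h

/-- The deformation data of the space with a whisker. -/
def whNice : Nice (Wh x₀) (Wh.inr x₀ 1) where
  u := Wh.lift x₀ (fun _ => 1) (fun t => 1 - t) (by simp)
  h z := Wh.lift x₀ (Wh.inl x₀) (fun r => Wh.inr x₀ (whd z.1 r))
    ((Wh.glue x₀).trans (congrArg _ (whd_zero z.1).symm)) z.2
  hu := Wh.continuous_lift x₀ continuous_const (by fun_prop)
  hh := Wh.continuous_lift₂ (f := fun (_ : I) => Wh.inl x₀)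
    (g := fun s r => Wh.inr x₀ (whd s r))
    (h := fun s => (Wh.glue x₀).trans (congrArg _ (whd_zero s).symm)) x₀ (by fun_prop)
    ((Wh.continuous_inr x₀).comp continuous_whd)
  nonneg w := by
    obtain ⟨x, rfl⟩ | ⟨t, rfl⟩ := Wh.cases x₀ w
    · exact zero_le_one
    · exact sub_nonneg.2 t.2.2
  zero_iff w := by
    constructor
    · obtain ⟨x, rfl⟩ | ⟨t, rfl⟩ := Wh.cases x₀ w
      · exact fun h => (one_ne_zero h).elim
      · intro h
        exact congrArg _ (Subtype.ext (sub_eq_zero.1 h).symm)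
    · rintro rfl
      exact sub_self (1 : ℝ)
  h_zero w := by
    obtain ⟨x, rfl⟩ | ⟨t, rfl⟩ := Wh.cases x₀ w
    · rfl
    · refine congrArg (Wh.inr x₀) ?_
      show cl (t * (1 + (0 : ℝ))) = t
      rw [add_zero, mul_one]
      exact projIcc_val _ _
  h_base s := congrArg (Wh.inr x₀) (whd_eq_one s (by have := s.2.1; simpa using this))
  u_h s w := by
    obtain ⟨x, rfl⟩ | ⟨t, rfl⟩ := Wh.cases x₀ w
    · exact le_rfl
    · exact sub_le_sub_left (le_whd s t) 1
  h_one w := by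
    obtain ⟨x, rfl⟩ | ⟨t, rfl⟩ := Wh.cases x₀ w
    · intro h
      have h : (1 : ℝ) ≤ 1 / 2 := h
      norm_num at h
    · intro h
      have h : 1 - (t : ℝ) ≤ 1 / 2 := h
      refine congrArg (Wh.inr x₀) (whd_eq_one 1 ?_)
      show 1 ≤ (t : ℝ) * (1 + 1)
      linarith

instance [PathConnectedSpace X] : PathConnectedSpace (Wh x₀) := by
  refine ⟨⟨Wh.inl x₀ x₀⟩, ?_⟩
  have key : ∀ w, Joined (Wh.inl x₀ x₀) w := by
    intro w
    obtain ⟨x, rfl⟩ | ⟨t, rfl⟩ := Wh.cases x₀ w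
    · exact (PathConnectedSpace.joined x₀ x).map (Wh.continuous_inl x₀)
    · rw [Wh.glue]
      have : PathConnectedSpace I := isPathConnected_iff_pathConnectedSpace.1
        ((convex_Icc (0 : ℝ) 1).isPathConnected ⟨0, by simp⟩)
      exact (PathConnectedSpace.joined 0 t).map (Wh.continuous_inr x₀)
  exact fun v w => (key v).symm.trans (key w)

/-- The projection collapsing the whisker. -/
def Wh.proj : Wh x₀ → X := Wh.lift x₀ id (fun _ => x₀) rfl

theorem Wh.continuous_proj : Continuous (Wh.proj x₀) :=
  Wh.continuous_lift x₀ continuous_id continuous_const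

theorem exists_whisker_equiv {x₀ : X} (h : IsWellPointed X x₀) :
    ∃ g : X → Wh x₀, Continuous g ∧ g x₀ = Wh.inr x₀ 1 ∧
      PHtpy x₀ x₀ (Wh.proj x₀ ∘ g) id ∧
      PHtpy (Wh.inr x₀ 1) (Wh.inr x₀ 1) (g ∘ Wh.proj x₀) id := by
  obtain ⟨G, hG, hp⟩ := h (Wh x₀) inferInstance ⟨Wh.inl x₀, Wh.continuous_inl x₀⟩
    ⟨Wh.inr x₀, Wh.continuous_inr x₀⟩ (Wh.glue x₀).symm
  refine ⟨fun x => G (1, x), by fun_prop, hp 1, ?_, ?_⟩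
  · have hc := Wh.continuous_proj x₀
    refine ⟨fun z => Wh.proj x₀ (G (unitInterval.symm z.1, z.2)), by fun_prop, fun x => ?_,
      fun x => ?_, fun t => ?_⟩
    · simp
    · show Wh.proj x₀ (G (unitInterval.symm 1, x)) = x
      rw [unitInterval.symm_one, hG]
      rfl
    · show Wh.proj x₀ (G (unitInterval.symm t, x₀)) = x₀
      rw [hp]
      rfl
  · have hg : ∀ s : I, G (s, x₀) = Wh.inr x₀ (max s 0) := fun s => by
      rw [hp, max_eq_left (show (0 : I) ≤ s from s.2.1)]
      rfl
    have hc : Continuous fun z : I × Wh x₀ => Wh.lift x₀ (fun x => G (z.1, x))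
        (fun r => Wh.inr x₀ (max z.1 r)) (hg z.1) z.2 :=
      Wh.continuous_lift₂ (f := fun s x => G (s, x)) (g := fun s r => Wh.inr x₀ (max s r)) x₀
        G.continuous ((Wh.continuous_inr x₀).comp (continuous_fst.max continuous_snd))
    refine ⟨fun z => Wh.lift x₀ (fun x => G (unitInterval.symm z.1, x))
      (fun r => Wh.inr x₀ (max (unitInterval.symm z.1) r)) (hg _) z.2, hc.comp (by fun_prop :
        Continuous fun z : I × Wh x₀ => (unitInterval.symm z.1, z.2)), fun w => ?_, fun w => ?_,
      fun t => ?_⟩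
    · obtain ⟨x, rfl⟩ | ⟨t, rfl⟩ := Wh.cases x₀ w
      · show G (unitInterval.symm 0, x) = G (1, x)
        rw [unitInterval.symm_zero]
      · show Wh.inr x₀ (max (unitInterval.symm 0) t) = G (1, x₀)
        rw [unitInterval.symm_zero, max_eq_left (show t ≤ (1 : I) from t.2.2), hp]
        rfl
    · obtain ⟨x, rfl⟩ | ⟨t, rfl⟩ := Wh.cases x₀ w
      · show G (unitInterval.symm 1, x) = _
        rw [unitInterval.symm_one, hG]
        rfl
      · show Wh.inr x₀ (max (unitInterval.symm 1) t) = _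
        rw [unitInterval.symm_one, max_eq_right (show (0 : I) ≤ t from t.2.1)]
        rfl
    · show Wh.inr x₀ (max (unitInterval.symm t) 1) = _
      rw [max_eq_right (show unitInterval.symm t ≤ (1 : I) from (unitInterval.symm t).2.2)]

end whisker

theorem exists_we_labeledConfig {M X : Type*} [TopologicalSpace M] [TopologicalSpace X]
    (c : M ≃ₜ AddCircle (1 : ℝ)) {x₀ : X} (h : IsWellPointed X x₀) [PathConnectedSpace X] :
    ∃ f : C(LabeledConfig M X x₀, C(M, Susp 1 X x₀)), WE f := by
  obtain ⟨g, hg, g₀, h1, h2⟩ := exists_whisker_equiv h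
  have hp := Wh.continuous_proj x₀
  have : LocallyCompactSpace M := c.isClosedEmbedding.locallyCompactSpace
  set N := whNice x₀
  have ha : HE (lcmap g g₀ : LabeledConfig M X x₀ → LabeledConfig M (Wh x₀) (Wh.inr x₀ 1)) :=
    he_lcmap hg hp g₀ rfl h1 h2
  have hb := N.he_wc c
  have hd := HE.homeo (lpHomeo c (B := Susp 1 (Wh x₀) (Wh.inr x₀ 1)))
  have hs : HE (smap (Wh.proj x₀) rfl : Susp 1 (Wh x₀) (Wh.inr x₀ 1) → Susp 1 X x₀) :=
    he_smap hp hg rfl g₀ h2 h1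
  have he := he_comp_left (M := M) (f := ⟨_, hs.1⟩) hs
  have h3 := he.comp hd
  have h4 := hb.comp ha
  have c5 := h3.1.comp N.continuous_fcl
  have h5 := h3.we.comp N.we_fcl h3.1 N.continuous_fcl
  exact ⟨⟨_, c5.comp h4.1⟩, h5.comp h4.we c5 h4.1⟩

end LoopModel

/-- Let `(X,x₀)` be a well-pointed path-connected space and `S¹` the unit
circle in `ℝ²`. Then there is a weak homotopy equivalence from the labelled configuration
space `C⁰(S¹;X)` to the free loop space `Map(S¹, ΣX)`. -/
theorem labeledConfig_circle_weakEquiv_freeLoopSpace (X : Type*) [TopologicalSpace X]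
    (x₀ : X) (hwp : IsWellPointed X x₀) [PathConnectedSpace X] :
    ∃ f : C(LabeledConfig ↥(Metric.sphere (0 : EuclideanSpace ℝ (Fin 2)) 1) X x₀,
        C(↥(Metric.sphere (0 : EuclideanSpace ℝ (Fin 2)) 1), Susp 1 X x₀)),
      IsWeakHomotopyEquiv f := by
  obtain ⟨f, hf⟩ := LoopModel.exists_we_labeledConfig LoopModel.circleHomeo hwp
  exact ⟨f, hf.isWeakHomotopyEquiv⟩

end
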